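/- In the reduced real K-theory of spheres, K̃O⁰(Sⁿ) ≅ ℤ for n ≡ 0, 4 mod 8, K̃O⁰(Sⁿ) ≅ ℤ/2 for n ≡ 1, 2 mod 8, and K̃O⁰(Sⁿ) = 0 otherwise (for n ≥ 1). -/

import Mathlib

/-- A locally trivial, finite-rank topological `𝕜`-vector bundle over `X`, presented
through its total space `T`, projection `π`, fibrewise vector space structures and
local trivializations. -/
structure VB (𝕜 : Type) [NormedField 𝕜] (X : Type) [TopologicalSpace X] : Type 1 where
  T : Type
  [topT : TopologicalSpace T]
  π : T → X
  contπ : Continuous π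
  [fibAdd : ∀ x : X, AddCommGroup {t : T // π t = x}]
  [fibMod : ∀ x : X, Module 𝕜 {t : T // π t = x}]
  locTriv : ∀ x : X, ∃ (U : Set X) (_ : IsOpen U) (_ : x ∈ U) (m : ℕ)
    (φ : {t : T // π t ∈ U} ≃ₜ ↥U × (Fin m → 𝕜)),
      (∀ t : {t : T // π t ∈ U}, ((φ t).1 : X) = π t.1) ∧
      ∀ (y : X) (hy : y ∈ U), IsLinearMap 𝕜
        fun v : {t : T // π t = y} => (φ ⟨v.1, by rw [v.2]; exact hy⟩).2

attribute [instance] VB.topT VB.fibAdd VB.fibMod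

namespace VB

variable {𝕜 : Type} [NormedField 𝕜] {X : Type} [TopologicalSpace X]

/-- Isomorphism of vector bundles: a fibrewise-linear homeomorphism over `X`. -/
def Iso (V W : VB 𝕜 X) : Prop :=
  ∃ (φ : V.T ≃ₜ W.T) (hπ : ∀ t, W.π (φ t) = V.π t),
    ∀ x : X, IsLinearMap 𝕜 fun v : {t : V.T // V.π t = x} =>
      (⟨φ v.1, (hπ v.1).trans v.2⟩ : {t : W.T // W.π t = x})

/-- `S` is (isomorphic to) the Whitney direct sum `V ⊕ W`. -/
def IsSumOf (S V W : VB 𝕜 X) : Prop :=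
  ∃ (φ : S.T ≃ₜ {p : V.T × W.T // V.π p.1 = W.π p.2})
    (hπ : ∀ t, V.π (φ t).1.1 = S.π t),
    ∀ x : X, IsLinearMap 𝕜 fun v : {t : S.T // S.π t = x} =>
      ((⟨(φ v.1).1.1, (hπ v.1).trans v.2⟩ : {t : V.T // V.π t = x}),
       (⟨(φ v.1).1.2, ((φ v.1).2.symm.trans (hπ v.1)).trans v.2⟩ :
          {t : W.T // W.π t = x}))

/-- `V` is (isomorphic to) the trivial bundle `θ_m = X × 𝕜^m` of rank `m`. -/
def IsTrivialOfRank (V : VB 𝕜 X) (m : ℕ) : Prop :=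
  ∃ (φ : V.T ≃ₜ X × (Fin m → 𝕜)) (_ : ∀ t, (φ t).1 = V.π t),
    ∀ x : X, IsLinearMap 𝕜 fun v : {t : V.T // V.π t = x} => (φ v.1).2

/-- `W` is (isomorphic to) the pullback `f* V` of `V` along a continuous map `f`. -/
def IsPullbackAlong {Y : Type} [TopologicalSpace Y] (f : Y → X)
    (W : VB 𝕜 Y) (V : VB 𝕜 X) : Prop :=
  ∃ (φ : W.T ≃ₜ {q : Y × V.T // V.π q.2 = f q.1})
    (hπ : ∀ t, (φ t).1.1 = W.π t),
    ∀ y : Y, IsLinearMap 𝕜 fun v : {t : W.T // W.π t = y} =>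
      (⟨(φ v.1).1.2, (φ v.1).2.trans (congrArg f ((hπ v.1).trans v.2))⟩ :
        {t : V.T // V.π t = f y})

end VB

/-- `(K, cls)` is a model for the topological K-theory group `K⁰(X)`: the Grothendieck
group of the monoid of isomorphism classes of `𝕜`-vector bundles on `X` under Whitney
sum, characterized by its universal property. -/
def IsKTheory (𝕜 : Type) [NormedField 𝕜] (X : Type) [TopologicalSpace X]
    (K : Type 1) [AddCommGroup K] (cls : VB 𝕜 X → K) : Prop :=
  (∀ V W, VB.Iso V W → cls V = cls W) ∧
  (∀ S V W, VB.IsSumOf S V W → cls S = cls V + cls W) ∧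
  ∀ (H : Type 1) [AddCommGroup H] (f : VB 𝕜 X → H),
    (∀ V W, VB.Iso V W → f V = f W) →
    (∀ S V W, VB.IsSumOf S V W → f S = f V + f W) →
    ∃! φ : K →+ H, ∀ V, φ (cls V) = f V

/-- The standard `n`-sphere, realized as the unit sphere in `ℝ^{n+1}`. -/
abbrev Sph (n : ℕ) : Set (EuclideanSpace ℝ (Fin (n + 1))) :=
  Metric.sphere (0 : EuclideanSpace ℝ (Fin (n + 1))) 1

open scoped Matrix Kronecker
set_option linter.unusedSectionVars false

section Sqrt
variable {𝔸 : Type} [NormedRing 𝔸] [NormedAlgebra ℝ 𝔸] [CompleteSpace 𝔸]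
  {X : Type} [TopologicalSpace X]

theorem commute_ringInverse {M : Type} [MonoidWithZero M] {a b : M} (h : Commute a b)
    (hb : IsUnit b) : Commute a (Ring.inverse b) := by
  obtain ⟨u, rfl⟩ := hb
  rw [Ring.inverse_unit]
  exact h.units_inv_right

theorem ringInverse_eq {M : Type} [MonoidWithZero M] {a b : M} (h₁ : a * b = 1)
    (h₂ : b * a = 1) : Ring.inverse a = b :=
  Ring.inverse_unit ⟨a, b, h₁, h₂⟩

/-- The integrand whose integral is the logarithm of the segment from `1` to `S`. -/
noncomputable def logIntegrand (S : 𝔸) (v : ℝ) : 𝔸 :=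
  (S - 1) * Ring.inverse (1 + (max 0 (min 1 v)) • (S - 1))

noncomputable def logSeg (S : 𝔸) (u : ℝ) : 𝔸 :=
  ∫ v in (0 : ℝ)..u, logIntegrand S v

/-- A square root of `1 + u (S - 1)` when the segment from `1` to `S` is invertible. -/
noncomputable def sqrtSeg (S : 𝔸) (u : ℝ) : 𝔸 :=
  NormedSpace.exp ((1 / 2 : ℝ) • logSeg S u)

def SegUnit (S : 𝔸) : Prop := ∀ u ∈ Set.Icc (0 : ℝ) 1, IsUnit (1 + u • (S - 1))

theorem clamp_mem (v : ℝ) : max 0 (min 1 v) ∈ Set.Icc (0 : ℝ) 1 :=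
  ⟨le_max_left _ _, max_le zero_le_one (min_le_left _ _)⟩

omit [NormedAlgebra ℝ 𝔸] in
theorem continuous_ringInverse {f : X → 𝔸} (hf : Continuous f)
    (hu : ∀ x, IsUnit (f x)) : Continuous fun x => Ring.inverse (f x) := by
  rw [continuous_iff_continuousAt]
  intro x
  have h := NormedRing.inverse_continuousAt (hu x).unit
  exact ContinuousAt.comp (f := f) (g := Ring.inverse) h hf.continuousAt

theorem continuous_logIntegrand {S : X → 𝔸} (hS : Continuous S)
    (hu : ∀ x, SegUnit (S x)) : Continuous fun q : X × ℝ => logIntegrand (S q.1) q.2 := by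
  unfold logIntegrand
  refine Continuous.mul (by fun_prop) (continuous_ringInverse (by fun_prop) ?_)
  exact fun q => hu _ _ (clamp_mem _)

theorem continuous_sqrtSeg {S : X → 𝔸} (hS : Continuous S)
    (hu : ∀ x, SegUnit (S x)) : Continuous fun q : X × ℝ => sqrtSeg (S q.1) q.2 := by
  unfold sqrtSeg logSeg
  let _ : NormedAlgebra ℚ 𝔸 := NormedAlgebra.restrictScalars ℚ ℝ 𝔸
  refine (NormedSpace.exp_continuous (𝔸 := 𝔸)).comp (Continuous.const_smul ?_ _)
  have h : Continuous (Function.uncurry fun (q : X × ℝ) (v : ℝ) => logIntegrand (S q.1) v) :=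
    (continuous_logIntegrand hS hu).comp (f := fun r : (X × ℝ) × ℝ => (r.1.1, r.2)) (by fun_prop)
  exact intervalIntegral.continuous_parametric_intervalIntegral_of_continuous h (by fun_prop)

omit [CompleteSpace 𝔸] in
theorem sqrtSeg_zero (S : 𝔸) : sqrtSeg S 0 = 1 := by
  simp [sqrtSeg, logSeg]

omit [CompleteSpace 𝔸] in
theorem sqrtSeg_one (u : ℝ) : sqrtSeg (1 : 𝔸) u = 1 := by
  simp [sqrtSeg, logSeg, logIntegrand]

theorem continuous_logIntegrand_right {S : 𝔸} (hu : SegUnit S) :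
    Continuous (logIntegrand S) :=
  (continuous_logIntegrand (X := Unit) (S := fun _ => S) (by fun_prop) (fun _ => hu)).comp
    (f := fun v : ℝ => ((), v)) (by fun_prop)

theorem commute_logSeg {S A : 𝔸} (hu : SegUnit S) (h : Commute A S) (u : ℝ) :
    Commute A (logSeg S u) := by
  have hA : ∀ v, A * logIntegrand S v = logIntegrand S v * A := fun v => by
    have h1 : Commute A (1 + (max 0 (min 1 v)) • (S - 1)) :=
      (Commute.one_right A).add_right ((h.sub_right (Commute.one_right A)).smul_right _)
    have h2 : Commute A (Ring.inverse (1 + (max 0 (min 1 v)) • (S - 1))) :=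
      commute_ringInverse h1 (hu _ (clamp_mem v))
    exact (h.sub_right (Commute.one_right A)).mul_right h2
  have hi : IntervalIntegrable (logIntegrand S) MeasureTheory.volume 0 u :=
    (continuous_logIntegrand_right hu).intervalIntegrable _ _
  have e1 := (ContinuousLinearMap.mul ℝ 𝔸 A).intervalIntegral_comp_comm hi
  have e2 := ((ContinuousLinearMap.mul ℝ 𝔸).flip A).intervalIntegral_comp_comm hi
  simp only [ContinuousLinearMap.mul_apply', ContinuousLinearMap.flip_apply] at e1 e2
  change A * (∫ v in (0 : ℝ)..u, logIntegrand S v) = (∫ v in (0 : ℝ)..u, logIntegrand S v) * A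
  rw [← e1, ← e2]
  simp only [hA]

theorem commute_sqrtSeg {S A : 𝔸} (hu : SegUnit S) (h : Commute A S) (u : ℝ) :
    Commute A (sqrtSeg S u) :=
  Commute.exp_right ((commute_logSeg hu h u).smul_right _)

theorem map_ringInverse_anti {S : 𝔸} (φ : 𝔸 →L[ℝ] 𝔸) (h1 : φ 1 = 1)
    (hmul : ∀ a b, φ (a * b) = φ b * φ a) (hu : IsUnit S) :
    φ (Ring.inverse S) = Ring.inverse (φ S) := by
  have a := congrArg φ (Ring.mul_inverse_cancel S hu)
  have b := congrArg φ (Ring.inverse_mul_cancel S hu)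
  rw [hmul, h1] at a b
  exact (ringInverse_eq b a).symm

theorem map_logSeg_anti {S : 𝔸} (hu : SegUnit S) (φ : 𝔸 →L[ℝ] 𝔸) (h1 : φ 1 = 1)
    (hmul : ∀ a b, φ (a * b) = φ b * φ a) (h : φ S = S) (u : ℝ) :
    φ (logSeg S u) = logSeg S u := by
  have key : ∀ v, φ (logIntegrand S v) = logIntegrand S v := fun v => by
    unfold logIntegrand
    rw [hmul, map_ringInverse_anti φ h1 hmul (hu _ (clamp_mem v))]
    simp only [map_add, map_sub, map_smul, h1, h]
    exact (commute_ringInverse ((Commute.one_right _).add_right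
      ((Commute.refl (S - 1)).smul_right _)) (hu _ (clamp_mem v))).symm
  have hi : IntervalIntegrable (logIntegrand S) MeasureTheory.volume 0 u :=
    (continuous_logIntegrand_right hu).intervalIntegrable _ _
  unfold logSeg
  rw [← φ.intervalIntegral_comp_comm hi]
  simp only [key]

theorem map_sqrtSeg_anti {S : 𝔸} (hu : SegUnit S) (φ : 𝔸 →L[ℝ] 𝔸) (h1 : φ 1 = 1)
    (hmul : ∀ a b, φ (a * b) = φ b * φ a) (h : φ S = S) (u : ℝ) :
    φ (sqrtSeg S u) = sqrtSeg S u := by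
  let _ : NormedAlgebra ℚ 𝔸 := NormedAlgebra.restrictScalars ℚ ℝ 𝔸
  let ψ : 𝔸 →+* 𝔸ᵐᵒᵖ :=
    { toFun := fun a => MulOpposite.op (φ a)
      map_one' := by simp [h1]
      map_mul' := fun a b => by simp [hmul]
      map_zero' := by simp
      map_add' := fun a b => by simp }
  have hψ : Continuous ψ := MulOpposite.continuous_op.comp φ.continuous
  have := NormedSpace.map_exp ψ hψ ((1 / 2 : ℝ) • logSeg S u)
  have h2 : ψ ((1 / 2 : ℝ) • logSeg S u) = MulOpposite.op ((1 / 2 : ℝ) • logSeg S u) := by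
    change MulOpposite.op (φ _) = _
    rw [map_smul, map_logSeg_anti hu φ h1 hmul h]
  rw [h2, NormedSpace.exp_op] at this
  exact MulOpposite.op_injective this

theorem sqrtSeg_sq {S : 𝔸} (hu : SegUnit S) {u : ℝ} (h : u ∈ Set.Icc (0 : ℝ) 1) :
    sqrtSeg S u * sqrtSeg S u = 1 + u • (S - 1) := by
  let _ : NormedAlgebra ℚ 𝔸 := NormedAlgebra.restrictScalars ℚ ℝ 𝔸
  have hL : ∀ t, HasDerivAt (logSeg S) (logIntegrand S t) t := fun t =>
    ((continuous_logIntegrand_right hu).integral_hasStrictDerivAt 0 t).hasDerivAt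
  have hcL : ∀ s t, Commute (logSeg S s) (logSeg S t) := fun s t =>
    commute_logSeg hu (commute_logSeg hu (Commute.refl S) s).symm t
  have hE : ∀ t, HasDerivAt (fun u => NormedSpace.exp (-logSeg S u))
      (NormedSpace.exp (-logSeg S t) * (-logIntegrand S t)) t := fun t => by
    have h0 : HasDerivAt (fun u => -(logSeg S u - logSeg S t)) (-logIntegrand S t) t :=
      ((hL t).sub_const _).neg
    have h1 : HasFDerivAt (𝕜 := ℝ) (NormedSpace.exp : 𝔸 → 𝔸)
        (1 : 𝔸 →L[ℝ] 𝔸) ((fun u => -(logSeg S u - logSeg S t)) t) := by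
      simpa using (hasFDerivAt_exp_zero (𝕂 := ℝ) (𝔸 := 𝔸))
    have h2 := (h1.comp_hasDerivAt t h0).const_mul (NormedSpace.exp (-logSeg S t))
    refine h2.congr_of_eventuallyEq (Filter.Eventually.of_forall fun u => ?_)
    simp only [Function.comp]
    rw [← NormedSpace.exp_add_of_commute]
    · congr 1; abel
    · exact ((hcL t u).sub_right (Commute.refl _)).neg_left.neg_right
  have hder : ∀ t ∈ Set.Icc (0 : ℝ) 1, HasDerivAt
      (fun u => NormedSpace.exp (-logSeg S u) * (1 + u • (S - 1))) 0 t := fun t ht => by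
    have h3 : HasDerivAt (fun u : ℝ => 1 + u • (S - 1)) (S - 1) t := by
      simpa using ((hasDerivAt_id t).smul_const (S - 1)).const_add 1
    have h7 := (hE t).mul h3
    have : (max 0 (min 1 t)) = t := by
      rw [min_eq_right ht.2, max_eq_right ht.1]
    have h4 : logIntegrand S t * (1 + t • (S - 1)) = S - 1 := by
      unfold logIntegrand
      rw [this, mul_assoc, Ring.inverse_mul_cancel _ (hu t ht), mul_one]
    rw [mul_assoc, neg_mul, h4, mul_neg, neg_add_cancel] at h7
    exact h7
  have hconst := constant_of_has_deriv_right_zero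
    (f := fun u => NormedSpace.exp (-logSeg S u) * (1 + u • (S - 1))) (a := 0) (b := 1)
    (fun t ht => (hder t ht).continuousAt.continuousWithinAt)
    (fun t ht => (hder t ⟨ht.1, ht.2.le⟩).hasDerivWithinAt) u h
  have h00 : logSeg S 0 = 0 := by simp [logSeg]
  simp only [h00, neg_zero, NormedSpace.exp_zero, zero_smul, add_zero, mul_one] at hconst
  have h5 : sqrtSeg S u * sqrtSeg S u = NormedSpace.exp (logSeg S u) := by
    unfold sqrtSeg
    rw [← NormedSpace.exp_add_of_commute (Commute.refl _), ← add_smul]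
    norm_num
  have h6 : NormedSpace.exp (logSeg S u) * NormedSpace.exp (-logSeg S u) = 1 := by
    rw [← NormedSpace.exp_add_of_commute (Commute.refl _).neg_right]; simp
  rw [h5]
  calc NormedSpace.exp (logSeg S u)
      = NormedSpace.exp (logSeg S u) * (NormedSpace.exp (-logSeg S u) * (1 + u • (S - 1))) := by
        rw [hconst, mul_one]
    _ = _ := by rw [← mul_assoc, h6, one_mul]

theorem isUnit_sqrtSeg (S : 𝔸) (u : ℝ) : IsUnit (sqrtSeg S u) := by
  let _ : NormedAlgebra ℚ 𝔸 := NormedAlgebra.restrictScalars ℚ ℝ 𝔸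
  exact NormedSpace.isUnit_exp _

end Sqrt

section TrigApprox
variable {V : Type} [NormedAddCommGroup V] [NormedSpace ℝ V] {X : Type} [TopologicalSpace X]

/-- `Σ_{j ≤ d} sin^{2j} θ (cos θ A_j + sin θ B_j)`. -/
noncomputable def trigSum {V X : Type} [AddCommGroup V] [Module ℝ V] (d : ℕ) (A B : ℕ → X → V)
    (θ : ℝ) (x : X) : V :=
  ∑ j ∈ Finset.range (d + 1),
    Real.sin θ ^ (2 * j) • (Real.cos θ • A j x + Real.sin θ • B j x)

/-- Polynomials in `cos θ`, `sin θ` with only odd degree terms and coefficients in `W`. -/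
def IsTrig (W : Submodule ℝ V) (f : ℝ → X → V) : Prop :=
  ∃ (d : ℕ) (A B : ℕ → X → V), (∀ j, Continuous (A j)) ∧ (∀ j, Continuous (B j)) ∧
    (∀ j x, A j x ∈ W) ∧ (∀ j x, B j x ∈ W) ∧ (∀ j, d < j → A j = 0 ∧ B j = 0) ∧
    ∀ θ x, f θ x = trigSum d A B θ x

variable {W : Submodule ℝ V}

omit [TopologicalSpace X] in
theorem trigSum_of_le {d d' : ℕ} {A B : ℕ → X → V} (h : d ≤ d')
    (hd : ∀ j, d < j → A j = 0 ∧ B j = 0) (θ : ℝ) (x : X) :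
    trigSum d A B θ x = trigSum d' A B θ x := by
  refine Finset.sum_subset (Finset.range_mono (by omega)) fun j _ hj => ?_
  have := hd j (by simpa using hj)
  simp [this.1, this.2]

theorem IsTrig.add {f g : ℝ → X → V} (hf : IsTrig W f) (hg : IsTrig W g) :
    IsTrig W (fun θ x => f θ x + g θ x) := by
  obtain ⟨d, A, B, hA, hB, hAW, hBW, hd, hf⟩ := hf
  obtain ⟨d', A', B', hA', hB', hAW', hBW', hd', hg⟩ := hg
  refine ⟨max d d', fun j x => A j x + A' j x, fun j x => B j x + B' j x,
    fun j => (hA j).add (hA' j), fun j => (hB j).add (hB' j),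
    fun j x => W.add_mem (hAW j x) (hAW' j x), fun j x => W.add_mem (hBW j x) (hBW' j x),
    fun j hj => ?_, fun θ x => ?_⟩
  · have h1 := hd j (lt_of_le_of_lt (le_max_left _ _) hj)
    have h2 := hd' j (lt_of_le_of_lt (le_max_right _ _) hj)
    constructor <;> funext x <;> simp [h1.1, h1.2, h2.1, h2.2]
  · beta_reduce
    rw [hf, hg, trigSum_of_le (le_max_left d d') hd, trigSum_of_le (le_max_right d d') hd']
    simp only [trigSum]
    rw [← Finset.sum_add_distrib]
    refine Finset.sum_congr rfl fun j _ => ?_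
    rw [← smul_add]; congr 1
    simp only [smul_add]; abel

theorem IsTrig.smul {f : ℝ → X → V} (hf : IsTrig W f) (c : ℝ) :
    IsTrig W (fun θ x => c • f θ x) := by
  obtain ⟨d, A, B, hA, hB, hAW, hBW, hd, hf⟩ := hf
  refine ⟨d, fun j x => c • A j x, fun j x => c • B j x,
    fun j => (hA j).const_smul c, fun j => (hB j).const_smul c,
    fun j x => W.smul_mem _ (hAW j x), fun j x => W.smul_mem _ (hBW j x),
    fun j hj => ?_, fun θ x => ?_⟩
  · have h1 := hd j hj
    constructor <;> funext x <;> simp [h1.1, h1.2]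
  · beta_reduce
    rw [hf]
    simp only [trigSum, Finset.smul_sum]
    refine Finset.sum_congr rfl fun j _ => ?_
    rw [smul_comm]; congr 1
    rw [smul_add, smul_comm c, smul_comm c]

theorem IsTrig.sinSq {f : ℝ → X → V} (hf : IsTrig W f) :
    IsTrig W (fun θ x => (Real.sin θ ^ 2) • f θ x) := by
  obtain ⟨d, A, B, hA, hB, hAW, hBW, hd, hf⟩ := hf
  refine ⟨d + 1, fun j x => if j = 0 then 0 else A (j - 1) x,
    fun j x => if j = 0 then 0 else B (j - 1) x, fun j => ?_, fun j => ?_, fun j x => ?_,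
    fun j x => ?_, fun j hj => ?_, fun θ x => ?_⟩
  · by_cases h : j = 0
    · simpa [h] using continuous_const
    · simpa [h] using hA _
  · by_cases h : j = 0
    · simpa [h] using continuous_const
    · simpa [h] using hB _
  · dsimp only; split_ifs; exacts [W.zero_mem, hAW _ _]
  · dsimp only; split_ifs; exacts [W.zero_mem, hBW _ _]
  · have h1 := hd (j - 1) (by omega)
    have : j ≠ 0 := by omega
    constructor <;> funext x <;> simp [h1.1, h1.2]
  · beta_reduce
    rw [hf]
    unfold trigSum
    rw [Finset.sum_range_succ' _ (d + 1), Finset.smul_sum]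
    simp only [Nat.add_eq_zero_iff, one_ne_zero, and_false, if_false, if_true, add_tsub_cancel_right,
      smul_zero, add_zero]
    refine Finset.sum_congr rfl fun j _ => ?_
    rw [smul_smul, ← pow_add]; congr 2; ring

theorem IsTrig.congr {f g : ℝ → X → V} (hf : IsTrig W f) (h : ∀ θ x, g θ x = f θ x) :
    IsTrig W g := by
  have : g = f := by funext θ x; exact h θ x
  rwa [this]

theorem IsTrig.cosSq {f : ℝ → X → V} (hf : IsTrig W f) :
    IsTrig W (fun θ x => (Real.cos θ ^ 2) • f θ x) :=
  (hf.add (hf.sinSq.smul (-1))).congr fun θ x => by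
    rw [Real.cos_sq', sub_smul, one_smul, neg_one_smul, sub_eq_add_neg]

theorem isTrig_base {c c' : X → V} (hc : Continuous c) (hc' : Continuous c') (hW : ∀ x, c x ∈ W)
    (hW' : ∀ x, c' x ∈ W) :
    IsTrig W (fun θ x => Real.cos θ • c x + Real.sin θ • c' x) := by
  refine ⟨0, fun j x => if j = 0 then c x else 0, fun j x => if j = 0 then c' x else 0,
    fun j => ?_, fun j => ?_, fun j x => ?_, fun j x => ?_, fun j hj => ?_, fun θ x => ?_⟩
  · by_cases h : j = 0
    · simpa [h] using hc
    · simpa [h] using continuous_const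
  · by_cases h : j = 0
    · simpa [h] using hc'
    · simpa [h] using continuous_const
  · dsimp only; split_ifs; exacts [hW x, W.zero_mem]
  · dsimp only; split_ifs; exacts [hW' x, W.zero_mem]
  · have : j ≠ 0 := by omega
    constructor <;> funext x <;> simp [this]
  · simp [trigSum]

theorem isTrig_zero : IsTrig W (fun _ _ => 0 : ℝ → X → V) :=
  (isTrig_base (c := fun _ : X => (0 : V)) (c' := fun _ => 0) continuous_const continuous_const
    (fun _ => W.zero_mem) (fun _ => W.zero_mem)).congr fun θ x => by simp

theorem IsTrig.sum {m : ℕ} {f : Fin m → ℝ → X → V} (hf : ∀ k, IsTrig W (f k)) :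
    IsTrig W (fun θ x => ∑ k, f k θ x) := by
  induction m with
  | zero => exact isTrig_zero.congr fun θ x => by simp
  | succ m ih =>
    exact ((hf 0).add (ih fun k => hf k.succ)).congr fun θ x => by rw [Fin.sum_univ_succ]

theorem isTrig_oddPoly {c : X → V} (P : Polynomial ℝ)
    (u : ℝ → ℝ) (hu : IsTrig W (fun θ x => u θ • c x))
    (hsq : ∀ f : ℝ → X → V, IsTrig W f → IsTrig W (fun θ x => (u θ ^ 2) • f θ x)) :
    IsTrig W (fun θ x => (P.eval (u θ) - P.eval (-u θ)) • c x) := by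
  have hpow : ∀ j : ℕ, IsTrig W (fun θ x => (u θ ^ (2 * j + 1)) • c x) := fun j => by
    induction j with
    | zero => simpa using hu
    | succ j ih =>
      refine (hsq _ ih).congr fun θ x => ?_
      rw [smul_smul, ← pow_add]; congr 2; ring
  induction P using Polynomial.induction_on' with
  | add p q hp hq =>
    refine (hp.add hq).congr fun θ x => ?_
    rw [← add_smul, Polynomial.eval_add, Polynomial.eval_add]; congr 1; ring
  | monomial n a =>
    rcases Nat.even_or_odd' n with ⟨j, rfl | rfl⟩
    · refine isTrig_zero.congr fun θ x => ?_
      simp [Polynomial.eval_monomial, pow_mul]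
    · refine ((hpow j).smul (2 * a)).congr fun θ x => ?_
      rw [smul_smul, Polynomial.eval_monomial, Polynomial.eval_monomial, Odd.neg_pow ⟨j, rfl⟩]
      congr 1; ring

theorem odd_poly_approx [CompactSpace X] {g : ℝ × X → V} (hg : Continuous g)
    (hodd : ∀ t x, g (-t, x) = -g (t, x)) (hW : ∀ t x, g (t, x) ∈ W) {δ : ℝ} (hδ : 0 < δ) :
    ∃ (m : ℕ) (P : Fin m → Polynomial ℝ) (c : Fin m → X → V), (∀ k, Continuous (c k)) ∧
      (∀ k x, c k x ∈ W) ∧ ∀ t ∈ Set.Icc (-1 : ℝ) 1, ∀ x,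
        ‖g (t, x) - ∑ k, ((P k).eval t - (P k).eval (-t)) • c k x‖ < δ := by
  let G : C(unitInterval, C(X, V)) := ContinuousMap.curry
    ⟨fun q : unitInterval × X => g (2 * (q.1 : ℝ) - 1, q.2), by fun_prop⟩
  have hG : ∀ s x, G s x = g (2 * (s : ℝ) - 1, x) := fun s x => rfl
  have := (Metric.tendsto_nhds.1 (bernsteinApproximation_uniform G)) δ hδ
  obtain ⟨n, hn⟩ := this.exists
  rw [dist_eq_norm] at hn
  refine ⟨n + 1, fun k => Polynomial.C (1 / 2) * (bernsteinPolynomial ℝ n k).comp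
    (Polynomial.C (1 / 2) * (1 + Polynomial.X)), fun k x => G (bernstein.z k) x,
    fun k => (G _).continuous, fun k x => hW _ _, fun t ht x => ?_⟩
  have key : ∀ t ∈ Set.Icc (-1 : ℝ) 1,
      ‖g (t, x) - ∑ k : Fin (n + 1), (bernsteinPolynomial ℝ n k).eval (1 / 2 * (1 + t)) •
        G (bernstein.z k) x‖ < δ := fun t ht => by
    let s : unitInterval := ⟨1 / 2 * (1 + t), by constructor <;> linarith [ht.1, ht.2]⟩
    have h1 : ‖(bernsteinApproximation n G - G) s x‖ < δ :=
      lt_of_le_of_lt ((ContinuousMap.norm_coe_le_norm ((bernsteinApproximation n G - G) s) x).trans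
        (ContinuousMap.norm_coe_le_norm _ s)) hn
    rw [norm_sub_rev]
    have h2 : (bernsteinApproximation n G - G) s x = ∑ k : Fin (n + 1),
        (bernsteinPolynomial ℝ n k).eval (1 / 2 * (1 + t)) • G (bernstein.z k) x - g (t, x) := by
      rw [ContinuousMap.sub_apply, ContinuousMap.sub_apply, bernsteinApproximation.apply, hG,
        ContinuousMap.sum_apply]
      congr 3
      simp only [s]; ring
    rwa [← h2]
  have h1 := key t ht
  have h2 := key (-t) ⟨by linarith [ht.2], by linarith [ht.1]⟩
  rw [hodd] at h2
  have e : g (t, x) - ∑ k : Fin (n + 1), ((Polynomial.C (1 / 2) * (bernsteinPolynomial ℝ n k).comp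
      (Polynomial.C (1 / 2) * (1 + Polynomial.X))).eval t - (Polynomial.C (1 / 2) *
      (bernsteinPolynomial ℝ n k).comp (Polynomial.C (1 / 2) * (1 + Polynomial.X))).eval (-t)) •
        G (bernstein.z k) x = (1 / 2 : ℝ) • (g (t, x) - ∑ k : Fin (n + 1),
        (bernsteinPolynomial ℝ n k).eval (1 / 2 * (1 + t)) • G (bernstein.z k) x) -
        (1 / 2 : ℝ) • (-g (t, x) - ∑ k : Fin (n + 1),
        (bernsteinPolynomial ℝ n k).eval (1 / 2 * (1 + -t)) • G (bernstein.z k) x) := by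
    simp only [Polynomial.eval_mul, Polynomial.eval_comp, Polynomial.eval_C, Polynomial.eval_add,
      Polynomial.eval_one, Polynomial.eval_X, sub_smul, Finset.sum_sub_distrib, ← smul_smul,
      ← Finset.smul_sum, smul_sub, smul_neg]
    have : g (t, x) = (1 / 2 : ℝ) • g (t, x) + (1 / 2 : ℝ) • g (t, x) := by
      rw [← add_smul]; norm_num
    nth_rewrite 1 [this]
    abel
  rw [e]
  refine (norm_sub_le _ _).trans_lt ?_
  rw [norm_smul, norm_smul]
  norm_num
  linarith

theorem trig_approx [CompactSpace X] {F : ℝ × X → V} (hF : Continuous F)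
    (h0 : ∀ x, F (Real.pi, x) = -F (0, x)) (hW : ∀ t x, F (t, x) ∈ W) {δ : ℝ} (hδ : 0 < δ) :
    ∃ P : ℝ → X → V, IsTrig W P ∧ ∀ θ ∈ Set.Icc 0 Real.pi, ∀ x, ‖F (θ, x) - P θ x‖ < δ := by
  let fa : ℝ × X → V := fun q => (1 / 2 : ℝ) •
    (F (Real.arccos q.1, q.2) - F (Real.pi - Real.arccos q.1, q.2))
  let h : ℝ × X → V := fun q => (1 / 2 : ℝ) •
    (F (Real.arcsin q.1, q.2) + F (Real.pi - Real.arcsin q.1, q.2))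
  let fs : ℝ × X → V := fun q => if 0 ≤ q.1 then h q else -h (-q.1, q.2)
  have hfa : Continuous fa := by
    have := Real.continuous_arccos
    fun_prop
  have hh : Continuous h := by
    have := Real.continuous_arcsin
    fun_prop
  have hz : ∀ x, h (0, x) = 0 := fun x => by simp [h, h0]
  have hfs : Continuous fs := by
    refine Continuous.if_le hh (by fun_prop) continuous_const continuous_fst ?_
    rintro ⟨t, x⟩ (ht : 0 = t)
    subst ht; simp [hz]
  obtain ⟨m, P, c, hc, hcW, hP⟩ := odd_poly_approx (W := W) hfa (fun t x => by
    simp only [fa, Real.arccos_neg, sub_sub_cancel]; rw [← smul_neg]; congr 1; abel)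
    (fun t x => W.smul_mem _ (W.sub_mem (hW _ _) (hW _ _))) (half_pos hδ)
  obtain ⟨m', P', c', hc', hcW', hP'⟩ := odd_poly_approx (W := W) hfs (fun t x => by
    rcases lt_trichotomy t 0 with ht | rfl | ht
    · simp [fs, ht.le, not_le.2 ht]
    · simp [fs, hz]
    · simp [fs, ht.le, not_le.2 ht]) (fun t x => by
      dsimp only [fs]
      split_ifs
      · exact W.smul_mem _ (W.add_mem (hW _ _) (hW _ _))
      · exact W.neg_mem (W.smul_mem _ (W.add_mem (hW _ _) (hW _ _)))) (half_pos hδ)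
  refine ⟨fun θ x => (∑ k, ((P k).eval (Real.cos θ) - (P k).eval (-Real.cos θ)) • c k x) +
    ∑ k, ((P' k).eval (Real.sin θ) - (P' k).eval (-Real.sin θ)) • c' k x, IsTrig.add
      (IsTrig.sum fun k => isTrig_oddPoly (P k) _
        ((isTrig_base (hc k) continuous_const (hcW k) (fun _ => W.zero_mem)).congr fun θ x => by simp)
        fun f hf => hf.cosSq)
      (IsTrig.sum fun k => isTrig_oddPoly (P' k) _
        ((isTrig_base continuous_const (hc' k) (fun _ => W.zero_mem) (hcW' k)).congr fun θ x => by simp)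
        fun f hf => hf.sinSq), fun θ hθ x => ?_⟩
  have e1 : fa (Real.cos θ, x) = (1 / 2 : ℝ) • (F (θ, x) - F (Real.pi - θ, x)) := by
    simp only [fa]; rw [Real.arccos_cos hθ.1 hθ.2]
  have e2 : fs (Real.sin θ, x) = (1 / 2 : ℝ) • (F (θ, x) + F (Real.pi - θ, x)) := by
    have : 0 ≤ Real.sin θ := Real.sin_nonneg_of_mem_Icc hθ
    simp only [fs, this, if_true, h]
    rcases le_total θ (Real.pi / 2) with hl | hl
    · rw [Real.arcsin_sin (by linarith [hθ.1]) hl]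
    · have : Real.arcsin (Real.sin θ) = Real.pi - θ := by
        rw [← Real.sin_pi_sub, Real.arcsin_sin] <;> linarith [hθ.2]
      rw [this, sub_sub_cancel, add_comm]
  have e3 : F (θ, x) = fa (Real.cos θ, x) + fs (Real.sin θ, x) := by
    rw [e1, e2, ← smul_add]
    have : F (θ, x) - F (Real.pi - θ, x) + (F (θ, x) + F (Real.pi - θ, x)) = (2 : ℝ) • F (θ, x) := by
      rw [two_smul]; abel
    rw [this, smul_smul]; norm_num
  have h1 := hP _ ⟨Real.neg_one_le_cos θ, Real.cos_le_one θ⟩ x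
  have h2 := hP' _ ⟨Real.neg_one_le_sin θ, Real.sin_le_one θ⟩ x
  rw [e3, add_sub_add_comm]
  exact (norm_add_le _ _).trans_lt (by linarith)

end TrigApprox

section TrigCut
variable {V : Type} [NormedAddCommGroup V] [NormedSpace ℝ V] {X : Type} [TopologicalSpace X]
  {W : Submodule ℝ V}

theorem trigSum_succ {V X : Type} [AddCommGroup V] [Module ℝ V] (d : ℕ) (A B : ℕ → X → V)
    (θ : ℝ) (x : X) : trigSum d A B θ x = (Real.cos θ • A 0 x + Real.sin θ • B 0 x) +
    ∑ j ∈ Finset.range d, Real.sin θ ^ (2 * (j + 1)) •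
      (Real.cos θ • A (j + 1) x + Real.sin θ • B (j + 1) x) := by
  unfold trigSum
  rw [Finset.sum_range_succ', add_comm]; simp

theorem trig_cut [CompactSpace X] {F : ℝ × X → V} (hF : Continuous F) {e : V}
    (h0 : ∀ x, F (0, x) = e) (hπ : ∀ x, F (Real.pi, x) = -e) (hW : ∀ t x, F (t, x) ∈ W)
    (he : e ∈ W) {δ : ℝ} (hδ : 0 < δ) :
    ∃ (d : ℕ) (A B : ℕ → X → V) (χ : X → ℝ), (∀ j, Continuous (A j)) ∧ (∀ j, Continuous (B j)) ∧
      Continuous χ ∧ (∀ j x, A j x ∈ W) ∧ (∀ j x, B j x ∈ W) ∧ (∀ x, A 0 x = e) ∧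
      (∀ j x, χ x • A (j + 1) x = A (j + 1) x ∧ χ x • B (j + 1) x = B (j + 1) x) ∧
      (∀ x, (∀ θ ∈ Set.Icc 0 Real.pi, F (θ, x) = Real.cos θ • e + Real.sin θ • F (Real.pi / 2, x)) →
        χ x = 0 ∧ B 0 x = F (Real.pi / 2, x)) ∧
      ∀ θ ∈ Set.Icc 0 Real.pi, ∀ x, ‖trigSum d A B θ x - F (θ, x)‖ < δ := by
  obtain ⟨P, ⟨d, A, B, hA, hB, hAW, hBW, -, hP⟩, hPF⟩ := trig_approx (W := W) hF
    (fun x => by rw [h0, hπ]) hW (half_pos hδ)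
  let G : C(X, C(Set.Icc (0 : ℝ) Real.pi, V)) := ContinuousMap.curry
    ⟨fun q : X × Set.Icc (0 : ℝ) Real.pi => (Real.cos q.2 • e + Real.sin q.2 • F (Real.pi / 2, q.1)) -
      F ((q.2 : ℝ), q.1), by fun_prop⟩
  have hG : ∀ θ (hθ : θ ∈ Set.Icc 0 Real.pi) x,
    ‖(Real.cos θ • e + Real.sin θ • F (Real.pi / 2, x)) - F (θ, x)‖ ≤ ‖G x‖ := fun θ hθ x =>
      ContinuousMap.norm_coe_le_norm (G x) ⟨θ, hθ⟩
  let ρ : X → ℝ := fun x => min 1 (‖G x‖ / δ)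
  let χ' : X → ℝ := fun x => max 0 (2 * ρ x - 1)
  let χ : X → ℝ := fun x => min 1 (2 * ρ x)
  have hρ : Continuous ρ := by fun_prop
  have hχ' : Continuous χ' := by fun_prop
  have hχ : Continuous χ := by fun_prop
  have hχχ : ∀ x, χ x * χ' x = χ' x := fun x => by
    simp only [χ, χ']
    rcases le_total (2 * ρ x) 1 with h | h
    · rw [max_eq_left (by linarith)]; simp
    · rw [min_eq_left h, one_mul]
  have hχ1 : ∀ x, χ' x ∈ Set.Icc (0 : ℝ) 1 := fun x =>
    ⟨le_max_left _ _, max_le zero_le_one (by have : ρ x ≤ 1 := min_le_left _ _; linarith)⟩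
  refine ⟨d, fun j x => if j = 0 then e else χ' x • A j x,
    fun j x => if j = 0 then (1 - χ' x) • F (Real.pi / 2, x) + χ' x • B 0 x else χ' x • B j x, χ,
    fun j => ?_, fun j => ?_, hχ, fun j x => ?_, fun j x => ?_, fun x => by simp,
    fun j x => ?_, fun x hx => ?_, fun θ hθ x => ?_⟩
  · by_cases h : j = 0
    · simpa [h] using continuous_const
    · have := hA j
      simp only [h, if_false]; fun_prop
  · have := hB j
    by_cases h : j = 0
    · subst h
      simp only [if_true]; fun_prop
    · simp only [h, if_false]; fun_prop
  · dsimp only; split_ifs; exacts [he, W.smul_mem _ (hAW _ _)]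
  · dsimp only; split_ifs
    exacts [W.add_mem (W.smul_mem _ (hW _ _)) (W.smul_mem _ (hBW _ _)), W.smul_mem _ (hBW _ _)]
  · simp [smul_smul, hχχ]
  · have hGx : G x = 0 := by
      ext θ
      change (Real.cos θ • e + Real.sin θ • F (Real.pi / 2, x)) - F ((θ : ℝ), x) = 0
      rw [hx θ θ.2, sub_self]
    have hρx : ρ x = 0 := by simp [ρ, hGx]
    simp [χ, χ', hρx]
  · have hA0 : ‖e - A 0 x‖ < δ / 2 := by
      have := hPF 0 ⟨le_rfl, Real.pi_pos.le⟩ x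
      rw [h0, hP, trigSum_succ] at this
      simpa using this
    have e1 : trigSum d (fun j x => if j = 0 then e else χ' x • A j x)
        (fun j x => if j = 0 then (1 - χ' x) • F (Real.pi / 2, x) + χ' x • B 0 x else χ' x • B j x) θ x
        - F (θ, x) = (1 - χ' x) • ((Real.cos θ • e + Real.sin θ • F (Real.pi / 2, x)) - F (θ, x)) +
        χ' x • (Real.cos θ • (e - A 0 x) + (P θ x - F (θ, x))) := by
      rw [hP, trigSum_succ, trigSum_succ]
      simp only [if_true, Nat.add_eq_zero_iff, one_ne_zero, and_false, if_false]
      have : ∑ j ∈ Finset.range d, Real.sin θ ^ (2 * (j + 1)) •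
          (Real.cos θ • χ' x • A (j + 1) x + Real.sin θ • χ' x • B (j + 1) x) = χ' x •
          ∑ j ∈ Finset.range d, Real.sin θ ^ (2 * (j + 1)) •
          (Real.cos θ • A (j + 1) x + Real.sin θ • B (j + 1) x) := by
        rw [Finset.smul_sum]
        refine Finset.sum_congr rfl fun j _ => ?_
        module
      rw [this]
      module
    rw [e1]
    have hb : ‖Real.cos θ • (e - A 0 x) + (P θ x - F (θ, x))‖ < δ := by
      refine (norm_add_le _ _).trans_lt ?_
      have h1 : ‖Real.cos θ • (e - A 0 x)‖ ≤ ‖e - A 0 x‖ := by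
        rw [norm_smul]
        exact mul_le_of_le_one_left (norm_nonneg _) (Real.abs_cos_le_one θ)
      have h2 := hPF θ hθ x
      rw [norm_sub_rev] at h2
      linarith
    refine (norm_add_le _ _).trans_lt ?_
    rw [norm_smul, norm_smul, Real.norm_of_nonneg (hχ1 x).1,
      Real.norm_of_nonneg (by linarith [(hχ1 x).2])]
    rcases (hχ1 x).2.eq_or_lt with h1 | h1
    · rw [h1]; simpa using hb
    · have hlt : ‖G x‖ < δ := by
        by_contra hge
        have : 1 ≤ ‖G x‖ / δ := (one_le_div hδ).2 (not_lt.1 hge)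
        have hρ1 : ρ x = 1 := min_eq_left this
        have : χ' x = 1 := by simp only [χ', hρ1]; norm_num
        linarith
      have h3 := (hG θ hθ x).trans_lt hlt
      nlinarith [(hχ1 x).1]

end TrigCut

section Complexify
variable {𝔸 : Type} [NormedRing 𝔸] [NormedAlgebra ℝ 𝔸] [CompleteSpace 𝔸]
  {X : Type} [TopologicalSpace X]

theorem segUnit_neg_sq {T : 𝔸} (hu : ∀ θ : ℝ, IsUnit (Real.cos θ • (1 : 𝔸) + Real.sin θ • T)) :
    SegUnit (-(T * T)) := by
  intro u hu01
  have hs : Real.sin (Real.arccos √(1 - u)) = √u := by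
    rw [Real.sin_arccos, Real.sq_sqrt (by linarith [hu01.2])]; congr 1; ring
  have hc : Real.cos (Real.arccos √(1 - u)) = √(1 - u) :=
    Real.cos_arccos (by linarith [Real.sqrt_nonneg (1 - u)])
      (Real.sqrt_le_one.2 (by linarith [hu01.1]))
  have h1 := hu (Real.arccos √(1 - u))
  have h2 := hu (-(Real.arccos √(1 - u)))
  rw [Real.cos_neg, Real.sin_neg] at h2
  rw [hs, hc] at h1 h2
  convert h1.mul h2 using 1
  have e1 : √(1 - u) * √(1 - u) = 1 - u := Real.mul_self_sqrt (by linarith [hu01.2])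
  have e2 : √u * √u = u := Real.mul_self_sqrt hu01.1
  simp only [add_mul, mul_add, smul_mul_smul_comm, mul_one, one_mul, e1, neg_mul, mul_neg, e2,
    mul_comm √u]
  module

theorem exists_complexify {T : X → 𝔸} (hT : Continuous T)
    (hu : ∀ x, ∀ θ : ℝ, IsUnit (Real.cos θ • (1 : 𝔸) + Real.sin θ • T x)) :
    ∃ R : ℝ × X → 𝔸, Continuous R ∧ (∀ x, R (0, x) = T x) ∧ (∀ x, R (1, x) * R (1, x) = -1) ∧
      (∀ t ∈ Set.Icc (0 : ℝ) 1, ∀ x, ∀ θ : ℝ,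
        IsUnit (Real.cos θ • (1 : 𝔸) + Real.sin θ • R (t, x))) ∧
      (∀ t x A, Commute A (T x) → Commute A (R (t, x))) ∧
      (∀ t x, ∀ φ : 𝔸 →ₗ[ℝ] 𝔸, Continuous φ → φ 1 = 1 → (∀ a b, φ (a * b) = φ b * φ a) →
        φ (T x) = T x → φ (R (t, x)) = R (t, x)) ∧
      (∀ x, T x * T x = -1 → ∀ t, R (t, x) = T x) := by
  let S : X → 𝔸 := fun x => -(T x * T x)
  have hS : Continuous S := by fun_prop
  have hSu : ∀ x, SegUnit (S x) := fun x => segUnit_neg_sq (hu x)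
  have hcS : ∀ x A, Commute A (T x) → Commute A (S x) := fun x A h => (h.mul_right h).neg_right
  have hH1 : ∀ x, sqrtSeg (S x) 1 * sqrtSeg (S x) 1 = S x := fun x => by
    rw [sqrtSeg_sq (hSu x) (by simp)]; simp
  let I : X → 𝔸 := fun x => Ring.inverse (sqrtSeg (S x) 1)
  have hIH : ∀ x, I x * sqrtSeg (S x) 1 = 1 := fun x =>
    Ring.inverse_mul_cancel _ (isUnit_sqrtSeg _ _)
  have hHI : ∀ x, sqrtSeg (S x) 1 * I x = 1 := fun x =>
    Ring.mul_inverse_cancel _ (isUnit_sqrtSeg _ _)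
  have hH : Continuous fun q : X × ℝ => sqrtSeg (S q.1) q.2 := continuous_sqrtSeg hS hSu
  have hI : Continuous I := continuous_ringInverse
    (hH.comp (f := fun x : X => (x, (1 : ℝ))) (by fun_prop)) fun x => isUnit_sqrtSeg _ _
  have hcI : ∀ x A, Commute A (T x) → Commute A (I x) := fun x A h =>
    commute_ringInverse (commute_sqrtSeg (hSu x) (hcS x A h) 1) (isUnit_sqrtSeg _ _)
  have hcT : ∀ x u, Commute (T x) (sqrtSeg (S x) u) := fun x u =>
    commute_sqrtSeg (hSu x) (hcS x _ (Commute.refl _)) u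
  have hcTI : ∀ x, Commute (T x) (I x) := fun x => hcI x _ (Commute.refl _)
  have hcHI : ∀ x u, Commute (sqrtSeg (S x) u) (I x) := fun x u =>
    hcI x _ (hcT x u).symm
  let R : ℝ × X → 𝔸 := fun q => T q.2 * I q.2 * sqrtSeg (S q.2) (1 - q.1)
  have hJ : ∀ x, (T x * I x) * (T x * I x) = -1 := fun x => by
    have : T x * I x * (T x * I x) = (T x * T x) * (I x * I x) := by
      rw [mul_assoc, ← mul_assoc (I x), ← (hcTI x).eq, mul_assoc (T x), ← mul_assoc (T x)]
    have h2 : T x * T x = -(sqrtSeg (S x) 1 * sqrtSeg (S x) 1) := by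
      rw [hH1]; simp [S]
    rw [this, h2, neg_mul, mul_assoc, ← mul_assoc _ (I x), hHI, one_mul, hHI]
  have hcJ : ∀ x u, Commute (T x * I x) (sqrtSeg (S x) u) := fun x u =>
    (hcT x u).mul_left (hcHI x u).symm
  have hRR : ∀ t ∈ Set.Icc (0 : ℝ) 1, ∀ x, R (t, x) * R (t, x) = -(1 + (1 - t) • (S x - 1)) := by
    intro t ht x
    change T x * I x * _ * (T x * I x * _) = _
    rw [mul_assoc (T x * I x), ← mul_assoc _ (T x * I x), ← (hcJ x _).eq, mul_assoc (T x * I x),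
      sqrtSeg_sq (hSu x) ⟨by linarith [ht.2], by linarith [ht.1]⟩, ← mul_assoc, hJ, neg_one_mul]
  refine ⟨R, ?_, fun x => ?_, fun x => ?_, fun t ht x θ => ?_, fun t x A h => ?_,
    fun t x φ hφ h1 hmul hT => ?_, fun x hx t => ?_⟩
  · refine ((hT.comp continuous_snd).mul (hI.comp continuous_snd)).mul
      (hH.comp (f := fun q : ℝ × X => (q.2, 1 - q.1)) (by fun_prop))
  · simp only [R, sub_zero]
    rw [mul_assoc, hIH, mul_one]
  · rw [hRR 1 (by simp)]; simp
  · have hc : Commute (Real.cos θ • (1 : 𝔸) + Real.sin θ • R (t, x))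
        (Real.cos θ • (1 : 𝔸) - Real.sin θ • R (t, x)) := by
      have h0 : Commute (Real.cos θ • (1 : 𝔸)) (Real.sin θ • R (t, x)) :=
        ((Commute.one_left _).smul_left _).smul_right _
      exact ((Commute.refl _).sub_right h0).add_left (h0.symm.sub_right (Commute.refl _))
    refine (hc.isUnit_mul_iff.1 ?_).1
    have : (Real.cos θ • (1 : 𝔸) + Real.sin θ • R (t, x)) *
        (Real.cos θ • (1 : 𝔸) - Real.sin θ • R (t, x)) =
        1 + (Real.sin θ ^ 2 * (1 - t)) • (S x - 1) := by
      have hcs : Real.cos θ * Real.cos θ = 1 - Real.sin θ ^ 2 := by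
        nlinarith [Real.sin_sq_add_cos_sq θ]
      simp only [add_mul, mul_sub, smul_mul_smul_comm, mul_one, one_mul, hRR t ht, hcs,
        mul_comm (Real.sin θ) (Real.cos θ)]
      module
    rw [this]
    refine hSu x _ ⟨mul_nonneg (sq_nonneg _) (by linarith [ht.2]), ?_⟩
    exact mul_le_one₀ (Real.sin_sq_le_one θ) (by linarith [ht.2]) (by linarith [ht.1])
  · exact (h.mul_right (hcI x A h)).mul_right (commute_sqrtSeg (hSu x) (hcS x A h) _)
  · let φ' : 𝔸 →L[ℝ] 𝔸 := ⟨φ, hφ⟩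
    have hS : φ (S x) = S x := by simp [S, hmul, hT]
    have h2 : ∀ u, φ (sqrtSeg (S x) u) = sqrtSeg (S x) u := fun u =>
      map_sqrtSeg_anti (hSu x) φ' h1 hmul hS u
    have h3 : φ (I x) = I x := by
      refine (map_ringInverse_anti φ' h1 hmul (isUnit_sqrtSeg _ _)).trans ?_
      change Ring.inverse (φ (sqrtSeg (S x) 1)) = _
      rw [h2]
    simp only [R, hmul, h2, h3, hT]
    rw [(hcTI x).eq.symm, (hcJ x _).eq]
  · have h1 : S x = 1 := by simp [S, hx]
    simp [R, I, h1, sqrtSeg_one]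

end Complexify

section Htpy
variable {X Y Z X' Y' : Type} [TopologicalSpace X] [TopologicalSpace Y] [TopologicalSpace Z]
  [TopologicalSpace X'] [TopologicalSpace Y']

/-- `f` and `g` are joined by a homotopy all of whose stages satisfy `P` pointwise. -/
def Htpy (P : X → Y → Prop) (f g : X → Y) : Prop :=
  ∃ H : ℝ × X → Y, Continuous H ∧ (∀ x, H (0, x) = f x) ∧ (∀ x, H (1, x) = g x) ∧
    ∀ t ∈ Set.Icc (0 : ℝ) 1, ∀ x, P x (H (t, x))

variable {P : X → Y → Prop} {f g h : X → Y}

theorem Htpy.refl (hf : Continuous f) (hP : ∀ x, P x (f x)) : Htpy P f f :=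
  ⟨fun q => f q.2, by fun_prop, fun _ => rfl, fun _ => rfl, fun _ _ x => hP x⟩

theorem Htpy.symm (H : Htpy P f g) : Htpy P g f := by
  obtain ⟨H, hc, h0, h1, hP⟩ := H
  refine ⟨fun q => H (1 - q.1, q.2), by fun_prop, fun x => by simp [h1], fun x => by simp [h0],
    fun t ht x => hP _ ⟨by linarith [ht.2], by linarith [ht.1]⟩ _⟩

theorem Htpy.trans (H : Htpy P f g) (K : Htpy P g h) : Htpy P f h := by
  obtain ⟨H, hc, h0, h1, hP⟩ := H
  obtain ⟨K, kc, k0, k1, kP⟩ := K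
  refine ⟨fun q => if q.1 ≤ 1 / 2 then H (2 * q.1, q.2) else K (2 * q.1 - 1, q.2), ?_,
    fun x => ?_, fun x => ?_, fun t ht x => ?_⟩
  · refine Continuous.if_le (by fun_prop) (by fun_prop) (by fun_prop) (by fun_prop) fun q hq => ?_
    rw [hq]; norm_num [h1, k0]
  · norm_num [h0]
  · norm_num [k1]
  · dsimp only
    split_ifs with h
    · exact hP _ ⟨by linarith [ht.1], by linarith⟩ _
    · exact kP _ ⟨by linarith, by linarith [ht.2]⟩ _

theorem Htpy.left (H : Htpy P f g) (x : X) : P x (f x) := by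
  obtain ⟨H, hc, h0, h1, hP⟩ := H
  rw [← h0]; exact hP 0 (by simp) x

theorem Htpy.right (H : Htpy P f g) (x : X) : P x (g x) := H.symm.left x

theorem Htpy.map {P' : X' → Y' → Prop} (H : Htpy P f g) {w : X' → X} (hw : Continuous w)
    {Φ : X' × Y → Y'} (hΦ : Continuous Φ) (hP : ∀ x y, P (w x) y → P' x (Φ (x, y))) :
    Htpy P' (fun x => Φ (x, f (w x))) (fun x => Φ (x, g (w x))) := by
  obtain ⟨H, hc, h0, h1, hH⟩ := H
  exact ⟨fun q => Φ (q.2, H (q.1, w q.2)), by fun_prop, fun x => by simp [h0],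
    fun x => by simp [h1], fun t ht x => hP _ _ (hH t ht _)⟩

theorem Htpy.mono {P' : X → Y → Prop} (H : Htpy P f g) (hP : ∀ x y, P x y → P' x y) :
    Htpy P' f g :=
  H.map (w := id) continuous_id (Φ := fun q => q.2) continuous_snd hP

end Htpy

section Cliff
variable {ι κ : Type} [Fintype ι] [DecidableEq ι] [Fintype κ] [DecidableEq κ]
  {X : Type} [TopologicalSpace X]

/-- `e 0, …, e (N - 1)` are anticommuting symmetric involutions. -/
structure IsCliff (N : ℕ) (e : ℕ → Matrix ι ι ℝ) : Prop where
  symm : ∀ i < N, (e i)ᵀ = e i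
  sq : ∀ i < N, e i * e i = 1
  anti : ∀ i < N, ∀ j < N, i ≠ j → e i * e j = -(e j * e i)

/-- Symmetric matrices anticommuting with `e 0, …, e (k - 1)`. -/
def SA (k : ℕ) (e : ℕ → Matrix ι ι ℝ) (A : Matrix ι ι ℝ) : Prop :=
  Aᵀ = A ∧ ∀ i < k, e i * A = -(A * e i)

variable {k N : ℕ} {e : ℕ → Matrix ι ι ℝ} {A B : Matrix ι ι ℝ}

omit [DecidableEq ι] in
theorem SA.add (hA : SA k e A) (hB : SA k e B) : SA k e (A + B) :=
  ⟨by rw [Matrix.transpose_add, hA.1, hB.1], fun i hi => by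
    rw [mul_add, add_mul, hA.2 i hi, hB.2 i hi, neg_add]⟩

omit [DecidableEq ι] in
theorem SA.smul (hA : SA k e A) (c : ℝ) : SA k e (c • A) :=
  ⟨by rw [Matrix.transpose_smul, hA.1], fun i hi => by
    rw [mul_smul_comm, smul_mul_assoc, hA.2 i hi, smul_neg]⟩

omit [DecidableEq ι] in
theorem SA.zero : SA k e 0 := ⟨by simp, by simp⟩

omit [DecidableEq ι] in
theorem SA.sum {α : Type} {s : Finset α} {f : α → Matrix ι ι ℝ} (h : ∀ a ∈ s, SA k e (f a)) :
    SA k e (∑ a ∈ s, f a) :=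
  Finset.sum_induction _ _ (fun _ _ => SA.add) SA.zero h

theorem IsCliff.sa (h : IsCliff N e) {i : ℕ} (hi : i < N) (hk : k ≤ i) : SA k e (e i) :=
  ⟨h.symm i hi, fun j hj => h.anti j (by omega) i hi (by omega)⟩

omit [DecidableEq ι] in
theorem SA.mono {l : ℕ} (hA : SA k e A) (h : l ≤ k) : SA l e A :=
  ⟨hA.1, fun i hi => hA.2 i (by omega)⟩

theorem IsCliff.mono {M : ℕ} (h : IsCliff N e) (hM : M ≤ N) : IsCliff M e :=
  ⟨fun i hi => h.symm i (by omega), fun i hi => h.sq i (by omega),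
    fun i hi j hj => h.anti i (by omega) j (by omega)⟩

/-- The submodule of matrices satisfying `SA`. -/
def saSubmodule (k : ℕ) (e : ℕ → Matrix ι ι ℝ) : Submodule ℝ (Matrix ι ι ℝ) where
  carrier := {A | SA k e A}
  add_mem' := SA.add
  zero_mem' := SA.zero
  smul_mem' := fun c _ h => h.smul c

theorem isUnit_smul_one_add_psd {c : ℝ} (hc : 0 < c) (hA : A.PosSemidef) :
    IsUnit (c • (1 : Matrix ι ι ℝ) + A) :=
  ((Matrix.PosDef.one.smul hc).add_posSemidef hA).isUnit

omit [DecidableEq ι] in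
theorem psd_self_mul_transpose (A : Matrix ι ι ℝ) : (A * Aᵀ).PosSemidef := by
  simpa using Matrix.posSemidef_self_mul_conjTranspose A

theorem isUnit_skewify {J : Matrix ι ι ℝ} (hJ : J * J = -1) {t : ℝ}
    (ht : t ∈ Set.Icc (0 : ℝ) 1) (θ : ℝ) :
    IsUnit (Real.cos θ • (1 : Matrix ι ι ℝ) + Real.sin θ • ((1 - t / 2) • J - (t / 2) • Jᵀ)) := by
  set K := (1 - t / 2) • J - (t / 2) • Jᵀ with hK
  have hJT : Jᵀ * Jᵀ = -1 := by rw [← Matrix.transpose_mul, hJ]; simp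
  have hc : Commute (Real.cos θ • (1 : Matrix ι ι ℝ) + Real.sin θ • K)
      (Real.cos θ • (1 : Matrix ι ι ℝ) - Real.sin θ • K) := by
    have h0 : Commute (Real.cos θ • (1 : Matrix ι ι ℝ)) (Real.sin θ • K) :=
      ((Commute.one_left _).smul_left _).smul_right _
    exact ((Commute.refl _).sub_right h0).add_left (h0.symm.sub_right (Commute.refl _))
  refine (hc.isUnit_mul_iff.1 ?_).1
  have : (Real.cos θ • (1 : Matrix ι ι ℝ) + Real.sin θ • K) *
      (Real.cos θ • (1 : Matrix ι ι ℝ) - Real.sin θ • K) =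
      (Real.cos θ ^ 2 + Real.sin θ ^ 2 * ((1 - t / 2) ^ 2 + (t / 2) ^ 2)) • (1 : Matrix ι ι ℝ) +
      (Real.sin θ ^ 2 * ((1 - t / 2) * (t / 2))) • (J * Jᵀ + Jᵀ * Jᵀᵀ) := by
    rw [Matrix.transpose_transpose, hK]
    simp only [add_mul, mul_sub, sub_mul, smul_mul_smul_comm, mul_one, one_mul, hJ, hJT, smul_sub,
      smul_smul, mul_comm (Real.sin θ) (Real.cos θ)]
    module
  rw [this]
  refine isUnit_smul_one_add_psd ?_ (Matrix.PosSemidef.smul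
    ((psd_self_mul_transpose _).add (psd_self_mul_transpose _)) ?_)
  · rcases eq_or_ne (Real.cos θ) 0 with h | h
    · have : Real.sin θ ^ 2 = 1 := by nlinarith [Real.sin_sq_add_cos_sq θ]
      rw [this, h]; nlinarith [sq_nonneg (1 - t)]
    · have := sq_pos_of_ne_zero h
      positivity
  · have := ht.1; have := ht.2
    exact mul_nonneg (sq_nonneg _) (mul_nonneg (by linarith) (by linarith))

open scoped Matrix.Norms.Operator in
/-- Invertible linear pencils `cos θ • e k + sin θ • B` deform to ones with `B` anticommuting
with `e k`. -/
theorem linear_pencil (he : IsCliff (k + 1) e) {B : X → Matrix ι ι ℝ} (hB : Continuous B)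
    (hSA : ∀ x, SA k e (B x))
    (hu : ∀ x, ∀ θ ∈ Set.Icc 0 Real.pi, IsUnit (Real.cos θ • e k + Real.sin θ • B x)) :
    ∃ R : ℝ × X → Matrix ι ι ℝ, Continuous R ∧ (∀ x, R (0, x) = B x) ∧
      (∀ x, SA (k + 1) e (R (1, x))) ∧ (∀ t x, SA k e (R (t, x))) ∧
      (∀ t ∈ Set.Icc (0 : ℝ) 1, ∀ x θ, IsUnit (Real.cos θ • e k + Real.sin θ • R (t, x))) ∧
      ∀ x, SA (k + 1) e (B x) → B x * B x = 1 → ∀ t, R (t, x) = B x := by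
  have hek := he.sq k (by omega)
  have heT := he.symm k (by omega)
  have hu' : ∀ x, ∀ θ : ℝ, IsUnit (Real.cos θ • (1 : Matrix ι ι ℝ) + Real.sin θ • (e k * B x)) := by
    intro x θ
    have hue : IsUnit (e k) := ⟨⟨e k, e k, hek, hek⟩, rfl⟩
    have key : ∀ θ : ℝ, IsUnit (Real.cos θ • e k + Real.sin θ • B x) := by
      have h2 : ∀ θ, |θ| ≤ Real.pi → IsUnit (Real.cos θ • e k + Real.sin θ • B x) := by
        intro θ hθ
        rcases le_total 0 θ with h | h
        · exact hu x θ ⟨h, (le_abs_self _).trans hθ⟩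
        · have := (hu x (θ + Real.pi) ⟨by linarith [neg_abs_le θ], by linarith⟩).neg
          rw [Real.cos_add_pi, Real.sin_add_pi] at this
          convert this using 1
          module
      intro θ
      have := h2 (toIocMod Real.two_pi_pos (-Real.pi) θ) (abs_le.2
        ⟨(toIocMod_mem_Ioc Real.two_pi_pos (-Real.pi) θ).1.le, by
          linarith [(toIocMod_mem_Ioc Real.two_pi_pos (-Real.pi) θ).2]⟩)
      have h3 := toIocMod_add_toIocDiv_zsmul Real.two_pi_pos (-Real.pi) θ
      rw [zsmul_eq_mul] at h3
      rw [← h3, Real.cos_add_int_mul_two_pi, Real.sin_add_int_mul_two_pi]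
      exact this
    convert hue.mul (key θ) using 1
    rw [mul_add, mul_smul_comm, mul_smul_comm, hek]
  obtain ⟨R₁, hR₁, h0, hsq, hun, hcomm, hanti, hconst⟩ := exists_complexify
    (T := fun x => e k * B x) (by fun_prop) hu'
  let φ : Matrix ι ι ℝ →ₗ[ℝ] Matrix ι ι ℝ :=
    { toFun := fun A => e k * Aᵀ * e k
      map_add' := fun A B => by simp [mul_add, add_mul]
      map_smul' := fun c A => by simp }
  have hR1T : ∀ t x, (R₁ (t, x))ᵀ = e k * R₁ (t, x) * e k := fun t x => by
    have := hanti t x φ (by change Continuous fun A => e k * Aᵀ * e k; fun_prop)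
      (by simp [φ, hek]) (fun a b => by
        change e k * (a * b)ᵀ * e k = e k * bᵀ * e k * (e k * aᵀ * e k)
        rw [Matrix.transpose_mul]
        simp only [mul_assoc]
        rw [← mul_assoc (e k) (e k), hek, one_mul]) (by
        change e k * (e k * B x)ᵀ * e k = e k * B x
        rw [Matrix.transpose_mul, heT, (hSA x).1, mul_assoc, mul_assoc, hek, mul_one])
    change e k * (R₁ (t, x))ᵀ * e k = _ at this
    calc (R₁ (t, x))ᵀ = e k * (e k * (R₁ (t, x))ᵀ * e k) * e k := by
          simp only [mul_assoc, hek, mul_one]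
          rw [← mul_assoc, hek, one_mul]
      _ = _ := by rw [this]
  have hc1 : ∀ t x, ∀ i < k, Commute (e i) (R₁ (t, x)) := fun t x i hi =>
    hcomm t x _ (by
      change _ * _ = _ * _
      rw [← mul_assoc, he.anti i (by omega) k (by omega) (by omega), neg_mul, mul_assoc,
        (hSA x).2 i hi]
      simp [mul_assoc])
  have hc1T : ∀ t x, ∀ i < k, Commute (e i) (R₁ (t, x))ᵀ := fun t x i hi => by
    have := congrArg Matrix.transpose (hc1 t x i hi).eq
    rw [Matrix.transpose_mul, Matrix.transpose_mul, he.symm i (by omega)] at this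
    exact this.symm
  -- skewification
  let K : ℝ × X → Matrix ι ι ℝ := fun q =>
    (1 - q.1 / 2) • R₁ (1, q.2) - (q.1 / 2) • (R₁ (1, q.2))ᵀ
  have hKc : Continuous K := by fun_prop
  have hcK : ∀ t x, ∀ i < k, Commute (e i) (K (t, x)) := fun t x i hi =>
    ((hc1 1 x i hi).smul_right _).sub_right ((hc1T 1 x i hi).smul_right _)
  have heeT : ∀ A : Matrix ι ι ℝ, e k * (e k * A) = A := fun A => by rw [← mul_assoc, hek, one_mul]
  have hKT : ∀ t x, (K (t, x))ᵀ = e k * K (t, x) * e k := fun t x => by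
    have h2 : R₁ (1, x) = e k * (R₁ (1, x))ᵀ * e k := by
      rw [hR1T]; simp only [mul_assoc, hek, mul_one]; rw [heeT]
    simp only [K, Matrix.transpose_sub, Matrix.transpose_smul, Matrix.transpose_transpose]
    rw [mul_sub, sub_mul, mul_smul_comm, mul_smul_comm, smul_mul_assoc, smul_mul_assoc, ← hR1T, ← h2]
  have sa_of : ∀ A : Matrix ι ι ℝ, Aᵀ = e k * A * e k → (∀ i < k, Commute (e i) A) →
      SA k e (e k * A) := fun A h1 h2 => ⟨by
        rw [Matrix.transpose_mul, heT, h1, mul_assoc, hek, mul_one], fun i hi => by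
        rw [← mul_assoc, he.anti i (by omega) k (by omega) (by omega), neg_mul, mul_assoc,
          (h2 i hi).eq, mul_assoc]⟩
  have unit_of : ∀ A : Matrix ι ι ℝ, ∀ θ : ℝ,
      IsUnit (Real.cos θ • (1 : Matrix ι ι ℝ) + Real.sin θ • A) →
      IsUnit (Real.cos θ • e k + Real.sin θ • (e k * A)) := fun A θ h => by
    have hue : IsUnit (e k) := ⟨⟨e k, e k, hek, hek⟩, rfl⟩
    convert hue.mul h using 1
    rw [mul_add, mul_smul_comm, mul_smul_comm, mul_one]
  have h01 : ∀ x, K (0, x) = R₁ (1, x) := fun x => by simp [K]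
  refine ⟨fun q => e k * if q.1 ≤ 1 / 2 then R₁ (2 * q.1, q.2) else K (2 * q.1 - 1, q.2), ?_,
    fun x => ?_, fun x => ?_, fun t x => ?_, fun t ht x θ => ?_, fun x hx hx2 t => ?_⟩
  · refine continuous_const.mul (Continuous.if_le (by fun_prop) (by fun_prop) (by fun_prop)
      (by fun_prop) fun q hq => ?_)
    rw [hq]; norm_num [h01]
  · norm_num [h0]; rw [heeT]
  · have h1 : (if (1 : ℝ) ≤ 1 / 2 then R₁ (2 * 1, x) else K (2 * 1 - 1, x)) = K (1, x) := by
      norm_num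
    change SA (k + 1) e (e k * (if (1 : ℝ) ≤ 1 / 2 then R₁ (2 * 1, x) else K (2 * 1 - 1, x)))
    rw [h1]
    have h2 := sa_of _ (hKT 1 x) (hcK 1 x)
    refine ⟨h2.1, fun i hi => ?_⟩
    rcases Nat.lt_succ_iff_lt_or_eq.1 hi with hi | rfl
    · exact h2.2 i hi
    · have h3 : (K (1, x))ᵀ = -K (1, x) := by
        simp only [K, Matrix.transpose_sub, Matrix.transpose_smul, Matrix.transpose_transpose]
        module
      rw [heeT, ← hKT, h3, neg_neg]
  · dsimp only
    split_ifs
    · exact sa_of _ (hR1T _ x) (hc1 _ x)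
    · exact sa_of _ (hKT _ x) (hcK _ x)
  · dsimp only
    split_ifs with h
    · exact unit_of _ _ (hun _ ⟨by linarith [ht.1], by linarith⟩ x θ)
    · exact unit_of _ _ (isUnit_skewify (hsq x) ⟨by linarith, by linarith [ht.2]⟩ θ)
  · have hT2 : (e k * B x) * (e k * B x) = -1 := by
      have := hx.2 k (by omega)
      calc _ = e k * (B x * e k) * B x := by simp only [mul_assoc]
        _ = -1 := by
          rw [← neg_neg (B x * e k), ← this, mul_neg, heeT, neg_mul, hx2]
    have hR : ∀ t, R₁ (t, x) = e k * B x := hconst x hT2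
    have hK : ∀ t, K (t, x) = e k * B x := fun t => by
      have : (e k * B x)ᵀ = -(e k * B x) := by
        rw [Matrix.transpose_mul, heT, hx.1, hx.2 k (by omega), neg_neg]
      simp only [K, hR, this]
      module
    dsimp only
    rw [hR, hK, ite_self, heeT]

end Cliff

section Dsum
variable {ι κ : Type} {A A' : Matrix ι ι ℝ} {B B' : Matrix κ κ ℝ}

/-- Block sum of square matrices. -/
def dsum (A : Matrix ι ι ℝ) (B : Matrix κ κ ℝ) : Matrix (ι ⊕ κ) (ι ⊕ κ) ℝ :=
  Matrix.fromBlocks A 0 0 B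

theorem dsum_transpose (A : Matrix ι ι ℝ) (B : Matrix κ κ ℝ) : (dsum A B)ᵀ = dsum Aᵀ Bᵀ := by
  simp [dsum, Matrix.fromBlocks_transpose]

theorem dsum_mul [Fintype ι] [Fintype κ] (A A' : Matrix ι ι ℝ) (B B' : Matrix κ κ ℝ) :
    dsum A B * dsum A' B' = dsum (A * A') (B * B') := by
  simp [dsum, Matrix.fromBlocks_multiply]

theorem dsum_add (A A' : Matrix ι ι ℝ) (B B' : Matrix κ κ ℝ) :
    dsum A B + dsum A' B' = dsum (A + A') (B + B') := by
  simp [dsum, Matrix.fromBlocks_add]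

theorem dsum_smul (c : ℝ) (A : Matrix ι ι ℝ) (B : Matrix κ κ ℝ) :
    c • dsum A B = dsum (c • A) (c • B) := by
  simp [dsum, Matrix.fromBlocks_smul]

theorem dsum_neg (A : Matrix ι ι ℝ) (B : Matrix κ κ ℝ) : -dsum A B = dsum (-A) (-B) := by
  simp [dsum, Matrix.fromBlocks_neg]

theorem dsum_sub (A A' : Matrix ι ι ℝ) (B B' : Matrix κ κ ℝ) :
    dsum A B - dsum A' B' = dsum (A - A') (B - B') := by
  rw [sub_eq_add_neg, dsum_neg, dsum_add, ← sub_eq_add_neg, ← sub_eq_add_neg]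

theorem dsum_sum {α : Type} (s : Finset α) (f : α → Matrix ι ι ℝ) (g : α → Matrix κ κ ℝ) :
    ∑ a ∈ s, dsum (f a) (g a) = dsum (∑ a ∈ s, f a) (∑ a ∈ s, g a) := by
  classical
  induction s using Finset.induction_on with
  | empty => simp [dsum]
  | insert a s ha ih => rw [Finset.sum_insert ha, ih, dsum_add, Finset.sum_insert ha,
      Finset.sum_insert ha]

theorem dsum_one [DecidableEq ι] [DecidableEq κ] :
    dsum (1 : Matrix ι ι ℝ) (1 : Matrix κ κ ℝ) = 1 := by
  simp [dsum]

variable [Fintype ι] [Fintype κ] [DecidableEq ι] [DecidableEq κ]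

theorem isUnit_dsum (hA : IsUnit A) (hB : IsUnit B) : IsUnit (dsum A B) :=
  (Matrix.isUnit_fromBlocks_zero₂₁ (A := A) (B := 0) (D := B)).2 ⟨hA, hB⟩

omit [Fintype ι] [Fintype κ] [DecidableEq ι] [DecidableEq κ] in
theorem Continuous.blockSum {X : Type} [TopologicalSpace X] {f : X → Matrix ι ι ℝ}
    {g : X → Matrix κ κ ℝ} (hf : Continuous f) (hg : Continuous g) :
    Continuous fun x => dsum (f x) (g x) :=
  hf.matrix_fromBlocks continuous_const continuous_const hg

theorem IsCliff.blockSum {N : ℕ} {e : ℕ → Matrix ι ι ℝ} {e' : ℕ → Matrix κ κ ℝ} (h : IsCliff N e)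
    (h' : IsCliff N e') : IsCliff N fun i => dsum (e i) (e' i) where
  symm i hi := by rw [dsum_transpose, h.symm i hi, h'.symm i hi]
  sq i hi := by rw [dsum_mul, h.sq i hi, h'.sq i hi, dsum_one]
  anti i hi j hj hij := by rw [dsum_mul, dsum_mul, h.anti i hi j hj hij, h'.anti i hi j hj hij,
    dsum_neg]

omit [DecidableEq ι] [DecidableEq κ] in
theorem SA.blockSum {k : ℕ} {e : ℕ → Matrix ι ι ℝ} {e' : ℕ → Matrix κ κ ℝ} (hA : SA k e A)
    (hB : SA k e' B) : SA k (fun i => dsum (e i) (e' i)) (dsum A B) :=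
  ⟨by rw [dsum_transpose, hA.1, hB.1], fun i hi => by
    rw [dsum_mul, dsum_mul, hA.2 i hi, hB.2 i hi, dsum_neg]⟩

end Dsum

section CliffModules
variable {ι μ : Type} [Fintype ι] [DecidableEq ι] [Fintype μ] [DecidableEq μ]

theorem IsCliff.double {M : ℕ} {g : ℕ → Matrix μ μ ℝ} (h : IsCliff M g) :
    IsCliff (M + 1) fun i => match i with
      | 0 => dsum (1 : Matrix μ μ ℝ) (-1 : Matrix μ μ ℝ)
      | i + 1 => Matrix.fromBlocks 0 (g i) (g i) 0 where
  symm i hi := by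
    cases i with
    | zero => simp [dsum_transpose]
    | succ i => simp [Matrix.fromBlocks_transpose, h.symm i (by omega)]
  sq i hi := by
    cases i with
    | zero => simp [dsum_mul, dsum_one]
    | succ i => simp [Matrix.fromBlocks_multiply, h.sq i (by omega)]
  anti i hi j hj hij := by
    cases i with
    | zero =>
      cases j with
      | zero => omega
      | succ j => simp [dsum, Matrix.fromBlocks_multiply, Matrix.fromBlocks_neg]
    | succ i =>
      cases j with
      | zero => simp [dsum, Matrix.fromBlocks_multiply, Matrix.fromBlocks_neg]
      | succ j => simp [Matrix.fromBlocks_multiply, Matrix.fromBlocks_neg,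
          h.anti i (by omega) j (by omega) (by omega)]

theorem exists_cliff (M : ℕ) : ∃ (μ : Type) (_ : Fintype μ) (_ : DecidableEq μ)
    (g : ℕ → Matrix μ μ ℝ), Nonempty μ ∧ IsCliff M g := by
  induction M with
  | zero => exact ⟨Unit, inferInstance, inferInstance, 0, ⟨()⟩, ⟨by simp, by simp, by simp⟩⟩
  | succ M ih =>
    obtain ⟨μ, _, _, g, ⟨m⟩, h⟩ := ih
    exact ⟨μ ⊕ μ, inferInstance, inferInstance, _, ⟨Sum.inl m⟩, h.double⟩

theorem exists_cliff_vec (M : ℕ) : ∃ (μ : Type) (_ : Fintype μ) (_ : DecidableEq μ)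
    (g : ℕ → Matrix μ μ ℝ) (v : μ → ℝ), IsCliff (M + 1) g ∧ g 0 *ᵥ v = v ∧ v ⬝ᵥ v = 1 := by
  obtain ⟨μ, _, _, g, ⟨m⟩, h⟩ := exists_cliff M
  refine ⟨μ ⊕ μ, inferInstance, inferInstance, _, Pi.single (Sum.inl m) 1, h.double, ?_, ?_⟩
  · ext i
    rw [Matrix.mulVec_single_one]
    rcases i with i | i <;> simp [dsum, Matrix.col, Pi.single_apply, Matrix.one_apply]
  · simp

theorem IsCliff.tensor {k L : ℕ} {e : ℕ → Matrix ι ι ℝ} {g : ℕ → Matrix μ μ ℝ} (he : IsCliff k e)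
    (hg : IsCliff (L + 1) g) : IsCliff (k + L) fun i =>
      if i < k then -(e i ⊗ₖ g 0) else (1 : Matrix ι ι ℝ) ⊗ₖ g (i - k + 1) where
  symm i hi := by
    split_ifs with h
    · rw [Matrix.transpose_neg, ← Matrix.kroneckerMap_transpose, he.symm i h, hg.symm 0 (by omega)]
    · rw [← Matrix.kroneckerMap_transpose, hg.symm _ (by omega), Matrix.transpose_one]
  sq i hi := by
    split_ifs with h
    · rw [neg_mul_neg, ← Matrix.mul_kronecker_mul, he.sq i h, hg.sq 0 (by omega),
        Matrix.one_kronecker_one]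
    · rw [← Matrix.mul_kronecker_mul, hg.sq _ (by omega), one_mul, Matrix.one_kronecker_one]
  anti i hi j hj hij := by
    have neg_r : ∀ (A : Matrix ι ι ℝ) (B : Matrix μ μ ℝ), A ⊗ₖ (-B) = -(A ⊗ₖ B) := fun A B => by
      ext; simp
    have neg_l : ∀ (A : Matrix ι ι ℝ) (B : Matrix μ μ ℝ), (-A) ⊗ₖ B = -(A ⊗ₖ B) := fun A B => by
      ext; simp
    split_ifs with h h' h'
    · rw [neg_mul_neg, neg_mul_neg, ← Matrix.mul_kronecker_mul, ← Matrix.mul_kronecker_mul,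
        he.anti i h j h' hij, neg_l]
    · rw [neg_mul, mul_neg, ← Matrix.mul_kronecker_mul, ← Matrix.mul_kronecker_mul, one_mul, mul_one,
        hg.anti 0 (by omega) (j - k + 1) (by omega) (by omega), neg_r]
    · rw [neg_mul, mul_neg, ← Matrix.mul_kronecker_mul, ← Matrix.mul_kronecker_mul, one_mul, mul_one,
        hg.anti 0 (by omega) (i - k + 1) (by omega) (by omega), neg_r, neg_neg]
    · rw [← Matrix.mul_kronecker_mul, ← Matrix.mul_kronecker_mul,
        hg.anti (i - k + 1) (by omega) (j - k + 1) (by omega) (by omega), neg_r]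

/-- The block row whose blocks are `A` scaled by the entries of `v`. -/
def blockRow (A : Matrix ι ι ℝ) (v : μ → ℝ) : Matrix ι (ι × μ) ℝ :=
  Matrix.of fun i p => A i p.1 * v p.2

omit [Fintype ι] [DecidableEq ι] [Fintype μ] [DecidableEq μ] in
theorem blockRow_smul (c : ℝ) (A : Matrix ι ι ℝ) (v : μ → ℝ) :
    blockRow (c • A) v = c • blockRow A v := by
  ext; simp [blockRow, mul_assoc]

omit [DecidableEq ι] [Fintype μ] [DecidableEq μ] in
theorem mul_blockRow (C A : Matrix ι ι ℝ) (v : μ → ℝ) : C * blockRow A v = blockRow (C * A) v := by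
  ext i p
  simp [blockRow, Matrix.mul_apply, Finset.sum_mul, mul_assoc]

omit [DecidableEq ι] [DecidableEq μ] in
theorem blockRow_mul_kronecker (A C : Matrix ι ι ℝ) (v : μ → ℝ) (G : Matrix μ μ ℝ) :
    blockRow A v * (C ⊗ₖ G) = blockRow (A * C) (v ᵥ* G) := by
  ext i p
  simp only [blockRow, Matrix.mul_apply, Matrix.of_apply, Fintype.sum_prod_type,
    Matrix.kroneckerMap_apply, Matrix.vecMul, dotProduct, Finset.sum_mul_sum]
  refine Finset.sum_congr rfl fun a _ => Finset.sum_congr rfl fun b _ => by ring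

omit [DecidableEq ι] [DecidableEq μ] in
theorem blockRow_mul_transpose (A C : Matrix ι ι ℝ) (v w : μ → ℝ) :
    blockRow A v * (blockRow C w)ᵀ = (v ⬝ᵥ w) • (A * Cᵀ) := by
  ext i j
  simp only [blockRow, Matrix.mul_apply, Matrix.of_apply, Fintype.sum_prod_type,
    Matrix.transpose_apply, Matrix.smul_apply, dotProduct, smul_eq_mul, Finset.sum_mul_sum]
  rw [Finset.sum_comm]
  refine Finset.sum_congr rfl fun a _ => Finset.sum_congr rfl fun b _ => by ring

end CliffModules

section CliffCombination
variable {ι κ : Type} [Fintype ι] [DecidableEq ι] [Fintype κ] [DecidableEq κ]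
  {k N p : ℕ} {e : ℕ → Matrix ι ι ℝ} {X : Type} [TopologicalSpace X]

/-- Linear combination of `e l, …, e (l + p - 1)`. -/
def cliffSum (e : ℕ → Matrix ι ι ℝ) (l p : ℕ) (s : ℕ → ℝ) : Matrix ι ι ℝ :=
  ∑ j ∈ Finset.range p, s j • e (l + j)

theorem sq_add_of_anti {A B : Matrix ι ι ℝ} (a b : ℝ) (h : A * B = -(B * A)) (hA : A * A = 1)
    (hB : B * B = 1) : (a • A + b • B) * (a • A + b • B) = (a ^ 2 + b ^ 2) • (1 : Matrix ι ι ℝ) := by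
  simp only [add_mul, mul_add, smul_mul_smul_comm, hA, hB, h]
  module

theorem IsCliff.cliffSum_sa (he : IsCliff N e) {l : ℕ} (h : l + p ≤ N) (s : ℕ → ℝ) :
    SA l e (cliffSum e l p s) :=
  SA.sum fun j hj => (he.sa (by have := Finset.mem_range.1 hj; omega) (by omega)).smul _

theorem IsCliff.cliffSum_sq (he : IsCliff N e) {l : ℕ} (h : l + p ≤ N) (s : ℕ → ℝ) :
    cliffSum e l p s * cliffSum e l p s =
      (∑ j ∈ Finset.range p, s j ^ 2) • (1 : Matrix ι ι ℝ) := by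
  induction p with
  | zero => simp [cliffSum]
  | succ p ih =>
    have ih := ih (by omega)
    have hs : cliffSum e l (p + 1) s = cliffSum e l p s + s p • e (l + p) :=
      Finset.sum_range_succ _ _
    have ha : cliffSum e l p s * e (l + p) = -(e (l + p) * cliffSum e l p s) := by
      rw [cliffSum, Finset.sum_mul, Finset.mul_sum, ← Finset.sum_neg_distrib]
      refine Finset.sum_congr rfl fun j hj => ?_
      have := Finset.mem_range.1 hj
      rw [smul_mul_assoc, mul_smul_comm, he.anti _ (by omega) _ (by omega) (by omega), smul_neg]
    rw [hs, Finset.sum_range_succ, add_mul, mul_add, mul_add, ih, mul_smul_comm, ha,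
      smul_mul_assoc, smul_mul_smul_comm, he.sq _ (by omega)]
    module

theorem cliffSum_dsum (e : ℕ → Matrix ι ι ℝ) (e' : ℕ → Matrix κ κ ℝ) (l p : ℕ) (s : ℕ → ℝ) :
    cliffSum (fun i => dsum (e i) (e' i)) l p s = dsum (cliffSum e l p s) (cliffSum e' l p s) := by
  simp only [cliffSum, dsum_smul, dsum_sum]

theorem continuous_cliffSum (e : ℕ → Matrix ι ι ℝ) (l p : ℕ) {σ : ℕ → X → ℝ}
    (hσ : ∀ j, Continuous (σ j)) : Continuous fun x => cliffSum e l p fun j => σ j x := by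
  unfold cliffSum
  fun_prop

end CliffCombination

section Parity
variable {μ ι : Type} [Fintype μ] [DecidableEq μ] [Fintype ι] [DecidableEq ι]
  {γ f q : Matrix μ μ ℝ} {m : μ → ℝ}

omit [DecidableEq μ] in
theorem vecMul_dot_eq_zero {G : Matrix μ μ ℝ} (hγ : γᵀ = γ) (h : γ * G = -(G * γ)) {u w : μ → ℝ}
    {s : ℝ} (hs : s * s = 1) (hu : γ *ᵥ u = s • u) (hw : γ *ᵥ w = s • w) :
    (u ᵥ* G) ⬝ᵥ w = 0 := by
  have h1 : w = s • (γ *ᵥ w) := by rw [hw, smul_smul, hs, one_smul]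
  have h2 : u ᵥ* γ = s • u := by rw [← Matrix.mulVec_transpose, hγ, hu]
  have h3 : (u ᵥ* G) ⬝ᵥ w = -((u ᵥ* G) ⬝ᵥ w) := by
    conv_lhs => rw [h1]
    rw [dotProduct_smul, Matrix.dotProduct_mulVec, Matrix.vecMul_vecMul, ← neg_neg (G * γ), ← h,
      Matrix.vecMul_neg, ← Matrix.vecMul_vecMul, h2, neg_dotProduct, Matrix.smul_vecMul,
      smul_dotProduct, smul_neg, smul_smul, hs, one_smul]
  linarith

theorem blockRow_conj (hγ : γᵀ = γ) (hf : fᵀ = f) (hq : qᵀ = q) (hff : f * f = 1) (hqq : q * q = 1)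
    (hγf : γ * f = -(f * γ)) (hγq : γ * q = -(q * γ)) (hfq : f * q = -(q * f)) (hm : γ *ᵥ m = m)
    (hmm : m ⬝ᵥ m = 1) (a b s : ℝ) {R S : Matrix ι ι ℝ} (hR : Rᵀ = R) (hS : Sᵀ = S) :
    (s • blockRow 1 m - blockRow R (f *ᵥ m) - blockRow S (q *ᵥ m)) *
      ((1 : Matrix ι ι ℝ) ⊗ₖ (a • f + b • q)) *
      (s • blockRow 1 m - blockRow R (f *ᵥ m) - blockRow S (q *ᵥ m))ᵀ =
      -((2 * s) • (a • R + b • S)) := by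
  set G := a • f + b • q with hG
  have hGT : Gᵀ = G := by simp [hG, hf, hq]
  have hγG : γ * G = -(G * γ) := by
    rw [hG, mul_add, add_mul, mul_smul_comm, mul_smul_comm, hγf, hγq, smul_mul_assoc,
      smul_mul_assoc]; module
  have h0 : γ *ᵥ m = (1 : ℝ) • m := by rw [hm, one_smul]
  have h1 : γ *ᵥ (f *ᵥ m) = (-1 : ℝ) • (f *ᵥ m) := by
    rw [Matrix.mulVec_mulVec, hγf, Matrix.neg_mulVec, ← Matrix.mulVec_mulVec, hm, neg_one_smul]
  have h2 : γ *ᵥ (q *ᵥ m) = (-1 : ℝ) • (q *ᵥ m) := by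
    rw [Matrix.mulVec_mulVec, hγq, Matrix.neg_mulVec, ← Matrix.mulVec_mulVec, hm, neg_one_smul]
  have c : ∀ A : Matrix μ μ ℝ, Aᵀ = A → ∀ u w : μ → ℝ, (u ᵥ* A) ⬝ᵥ w = (w ᵥ* A) ⬝ᵥ u := by
    intro A hA u w
    rw [← Matrix.mulVec_transpose, hA, dotProduct_comm, Matrix.dotProduct_mulVec]
  have hfm : ∀ u, (u ᵥ* f) ⬝ᵥ (f *ᵥ m) = u ⬝ᵥ m := fun u => by
    rw [Matrix.dotProduct_mulVec, Matrix.vecMul_vecMul, hff, Matrix.vecMul_one]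
  have hqm : ∀ u, (u ᵥ* q) ⬝ᵥ (q *ᵥ m) = u ⬝ᵥ m := fun u => by
    rw [Matrix.dotProduct_mulVec, Matrix.vecMul_vecMul, hqq, Matrix.vecMul_one]
  have hcr : (m ᵥ* q) ⬝ᵥ (f *ᵥ m) = 0 := by
    have e1 : (m ᵥ* q) ⬝ᵥ (f *ᵥ m) = -((m ᵥ* f) ⬝ᵥ (q *ᵥ m)) := by
      rw [Matrix.dotProduct_mulVec, Matrix.dotProduct_mulVec, Matrix.vecMul_vecMul,
        Matrix.vecMul_vecMul, hfq, Matrix.vecMul_neg, neg_dotProduct, neg_neg]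
    have e2 : (m ᵥ* q) ⬝ᵥ (f *ᵥ m) = (m ᵥ* f) ⬝ᵥ (q *ᵥ m) := by
      rw [← Matrix.mulVec_transpose, hq, ← Matrix.mulVec_transpose, hf, dotProduct_comm]
    linarith
  have hcr' : (m ᵥ* f) ⬝ᵥ (q *ᵥ m) = 0 := by
    rw [← Matrix.mulVec_transpose, hf, dotProduct_comm, ← hq, Matrix.mulVec_transpose]
    exact hcr
  have z00 := vecMul_dot_eq_zero hγ hγG (one_mul 1) h0 h0
  have z11 := vecMul_dot_eq_zero hγ hγG (by norm_num) h1 h1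
  have z12 := vecMul_dot_eq_zero hγ hγG (by norm_num) h1 h2
  have z21 := vecMul_dot_eq_zero hγ hγG (by norm_num) h2 h1
  have z22 := vecMul_dot_eq_zero hγ hγG (by norm_num) h2 h2
  have z01 : (m ᵥ* G) ⬝ᵥ (f *ᵥ m) = a := by
    rw [hG, Matrix.vecMul_add, Matrix.vecMul_smul, Matrix.vecMul_smul, add_dotProduct,
      smul_dotProduct, smul_dotProduct, hfm, hcr, hmm]; simp
  have z02 : (m ᵥ* G) ⬝ᵥ (q *ᵥ m) = b := by
    rw [hG, Matrix.vecMul_add, Matrix.vecMul_smul, Matrix.vecMul_smul, add_dotProduct,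
      smul_dotProduct, smul_dotProduct, hqm, hcr', hmm]; simp
  have z10 : ((f *ᵥ m) ᵥ* G) ⬝ᵥ m = a := by rw [c G hGT, z01]
  have z20 : ((q *ᵥ m) ᵥ* G) ⬝ᵥ m = b := by rw [c G hGT, z02]
  simp only [Matrix.transpose_sub, Matrix.transpose_smul,
    Matrix.smul_mul, Matrix.sub_mul, Matrix.mul_sub, Matrix.mul_smul,
    blockRow_mul_kronecker, blockRow_mul_transpose, z00, z01, z02, z10, z20, z11, z12, z21, z22,
    mul_one, one_mul, hR, hS, Matrix.transpose_one]
  module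

end Parity

section Sweep
variable {ι κ : Type} [Fintype ι] [DecidableEq ι] [Fintype κ] [DecidableEq κ]
  {P : Matrix ι ι ℝ} {D : Matrix κ κ ℝ} {B : Matrix ι κ ℝ}

theorem isUnit_sweep (hP : IsUnit P) (hD : D * D = 1) :
    IsUnit (Matrix.fromBlocks (P + B * D * Bᵀ) B Bᵀ D) := by
  have h : Matrix.fromBlocks (P + B * D * Bᵀ) B Bᵀ D =
      Matrix.fromBlocks 1 (B * D) 0 1 * dsum P D * Matrix.fromBlocks 1 0 (D * Bᵀ) 1 := by
    have h1 : D * (D * Bᵀ) = Bᵀ := by rw [← Matrix.mul_assoc, hD, Matrix.one_mul]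
    have h2 : B * D * D = B := by rw [Matrix.mul_assoc, hD, Matrix.mul_one]
    simp [dsum, Matrix.fromBlocks_multiply, h1, h2, ← Matrix.mul_assoc]
  rw [h]
  refine ((?_ : IsUnit _).mul (isUnit_dsum hP ⟨⟨D, D, hD, hD⟩, rfl⟩)).mul ?_
  · exact (Matrix.isUnit_fromBlocks_zero₂₁).2 ⟨isUnit_one, isUnit_one⟩
  · exact (Matrix.isUnit_fromBlocks_zero₁₂).2 ⟨isUnit_one, isUnit_one⟩

variable {k : ℕ} {e : ℕ → Matrix ι ι ℝ} {e' : ℕ → Matrix κ κ ℝ}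

omit [DecidableEq ι] [DecidableEq κ] in
theorem SA.fromBlocks (hP : SA k e P) (hD : SA k e' D) (he : ∀ i < k, (e i)ᵀ = e i)
    (he' : ∀ i < k, (e' i)ᵀ = e' i) (hB : ∀ i < k, e i * B = -(B * e' i)) :
    SA k (fun i => dsum (e i) (e' i)) (Matrix.fromBlocks P B Bᵀ D) := by
  refine ⟨by rw [Matrix.fromBlocks_transpose, hP.1, hD.1, Matrix.transpose_transpose],
    fun i hi => ?_⟩
  have h := congrArg Matrix.transpose (hB i hi)
  rw [Matrix.transpose_mul, Matrix.transpose_neg, Matrix.transpose_mul, he i hi, he' i hi] at h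
  simp only [dsum, Matrix.fromBlocks_multiply, Matrix.fromBlocks_neg, Matrix.zero_mul,
    Matrix.mul_zero, add_zero, zero_add]
  rw [hP.2 i hi, hD.2 i hi, hB i hi, h, neg_neg]

omit [DecidableEq ι] [DecidableEq κ] in
theorem SA.conj (hD : SA k e' D) (he : ∀ i < k, (e i)ᵀ = e i) (he' : ∀ i < k, (e' i)ᵀ = e' i)
    (hB : ∀ i < k, e i * B = -(B * e' i)) : SA k e (B * D * Bᵀ) := by
  refine ⟨by rw [Matrix.transpose_mul, Matrix.transpose_mul, hD.1, Matrix.transpose_transpose,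
    Matrix.mul_assoc], fun i hi => ?_⟩
  have h := congrArg Matrix.transpose (hB i hi)
  rw [Matrix.transpose_mul, Matrix.transpose_neg, Matrix.transpose_mul, he i hi, he' i hi] at h
  rw [← Matrix.mul_assoc, ← Matrix.mul_assoc, hB i hi, Matrix.mul_assoc (B * D), h, Matrix.neg_mul,
    Matrix.mul_assoc B, hD.2 i hi]
  simp [Matrix.mul_assoc]

end Sweep

/-- The parameter interval of the iterated suspension. -/
abbrev PolarArc : Type := Set.Icc (0 : ℝ) Real.pi

section DegreeReduction
variable {ι κ : Type} [Fintype ι] [DecidableEq ι] [Fintype κ] [DecidableEq κ]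
  {X Z : Type} [TopologicalSpace X] [TopologicalSpace Z]

/-- Invertible, in `SA k e`, and with prescribed values `b` on `S`. -/
structure Good (k : ℕ) (e : ℕ → Matrix ι ι ℝ) (S : Set Z) (b : Z → Matrix ι ι ℝ) (z : Z)
    (M : Matrix ι ι ℝ) : Prop where
  sa : SA k e M
  unit : IsUnit M
  bd : z ∈ S → M = b z

theorem Good.blockSum {k : ℕ} {e : ℕ → Matrix ι ι ℝ} {e' : ℕ → Matrix κ κ ℝ} {S : Set Z}
    {b : Z → Matrix ι ι ℝ} {b' : Z → Matrix κ κ ℝ} {z : Z} {M : Matrix ι ι ℝ} {M' : Matrix κ κ ℝ}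
    (h : Good k e S b z M) (h' : Good k e' S b' z M') :
    Good k (fun i => dsum (e i) (e' i)) S (fun z => dsum (b z) (b' z)) z (dsum M M') :=
  ⟨h.sa.blockSum h'.sa, isUnit_dsum h.unit h'.unit, fun hz => by rw [h.bd hz, h'.bd hz]⟩

/-- The coefficients of a trigonometric family whose non-linear part is supported where `χ ≠ 0`. -/
structure TrigPencil (k : ℕ) (e : ℕ → Matrix ι ι ℝ) (χ : X → ℝ) (A B : ℕ → X → Matrix ι ι ℝ) :
    Prop where
  contA : ∀ j, Continuous (A j)
  contB : ∀ j, Continuous (B j)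
  saA : ∀ j x, SA k e (A j x)
  saB : ∀ j x, SA k e (B j x)
  zero : ∀ x, A 0 x = e k
  cutA : ∀ j x, χ x • A (j + 1) x = A (j + 1) x
  cutB : ∀ j x, χ x • B (j + 1) x = B (j + 1) x

theorem trigSum_fromBlocks (d : ℕ) (A B : ℕ → X → Matrix ι ι ℝ) (O : ℕ → X → Matrix ι κ ℝ)
    (E E' : X → Matrix κ κ ℝ) (θ : ℝ) (x : X) :
    trigSum d (fun j x => dsum (A j x) (if j = 0 then E x else 0))
      (fun j x => Matrix.fromBlocks (B j x) (O j x) (O j x)ᵀ (if j = 0 then E' x else 0)) θ x =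
    Matrix.fromBlocks (trigSum d A B θ x)
      (∑ j ∈ Finset.range (d + 1), Real.sin θ ^ (2 * j) • Real.sin θ • O j x)
      (∑ j ∈ Finset.range (d + 1), Real.sin θ ^ (2 * j) • Real.sin θ • O j x)ᵀ
      (Real.cos θ • E x + Real.sin θ • E' x) := by
  induction d with
  | zero =>
    simp [trigSum, dsum, Matrix.fromBlocks_smul, Matrix.fromBlocks_add]
  | succ d ih =>
    have h : ∀ A B : ℕ → X → Matrix ι ι ℝ, trigSum (d + 1) A B θ x = trigSum d A B θ x +
        Real.sin θ ^ (2 * (d + 1)) • (Real.cos θ • A (d + 1) x + Real.sin θ • B (d + 1) x) :=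
      fun A B => Finset.sum_range_succ _ _
    have h' : ∀ A B : ℕ → X → Matrix (ι ⊕ κ) (ι ⊕ κ) ℝ, trigSum (d + 1) A B θ x = trigSum d A B θ x +
        Real.sin θ ^ (2 * (d + 1)) • (Real.cos θ • A (d + 1) x + Real.sin θ • B (d + 1) x) :=
      fun A B => Finset.sum_range_succ _ _
    rw [h', ih, h, Finset.sum_range_succ _ (d + 1)]
    simp only [Nat.add_eq_zero_iff, one_ne_zero, and_false, if_false, dsum, Matrix.fromBlocks_smul,
      Matrix.fromBlocks_add, smul_zero, zero_add, Matrix.transpose_add, Matrix.transpose_smul,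
      add_zero]

theorem Continuous.blockRow {μ : Type} {f : X → Matrix ι ι ℝ} {v : X → μ → ℝ} (hf : Continuous f)
    (hv : Continuous v) : Continuous fun x => blockRow (f x) (v x) :=
  continuous_matrix fun i p => (hf.matrix_elem i p.1).mul ((continuous_apply p.2).comp hv)

variable {k N p : ℕ} {e : ℕ → Matrix ι ι ℝ} {σ : ℕ → X → ℝ} {χ : X → ℝ}

theorem degree_step (hN : k + 1 + p = N) (he : IsCliff N e) (hσ : ∀ j, Continuous (σ j))
    (hσ1 : ∀ x, ∑ j ∈ Finset.range p, σ j x ^ 2 = 1) (hχ : Continuous χ) {d : ℕ}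
    {A B : ℕ → X → Matrix ι ι ℝ} (h : TrigPencil k e χ A B)
    (hu : ∀ z : PolarArc × X, IsUnit (trigSum (d + 1) A B z.1 z.2)) :
    ∃ (κ : Type) (_ : Fintype κ) (_ : DecidableEq κ) (e' : ℕ → Matrix κ κ ℝ),
      IsCliff N e' ∧ ∃ A' B' : ℕ → X → Matrix (ι ⊕ κ) (ι ⊕ κ) ℝ,
      TrigPencil k (fun i => dsum (e i) (e' i)) χ A' B' ∧
      (∀ x, χ x = 0 → B' 0 x = dsum (B 0 x) (cliffSum e' (k + 1) p fun j => σ j x)) ∧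
      Htpy (Good k (fun i => dsum (e i) (e' i)) {z : PolarArc × X | Real.sin z.1 = 0 ∨ χ z.2 = 0}
        fun z => dsum (Real.cos z.1 • e k + Real.sin z.1 • B 0 z.2)
          (Real.cos z.1 • e' k + Real.sin z.1 • cliffSum e' (k + 1) p fun j => σ j z.2))
      (fun z : PolarArc × X => dsum (trigSum (d + 1) A B z.1 z.2)
          (Real.cos z.1 • e' k + Real.sin z.1 • cliffSum e' (k + 1) p fun j => σ j z.2))
      (fun z => trigSum d A' B' z.1 z.2) := by
  obtain ⟨μ, _, _, g, m, hg, hgm, hmm⟩ := exists_cliff_vec (p + 1)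
  let e' : ℕ → Matrix (ι × μ) (ι × μ) ℝ := fun i =>
    if i < k then -(e i ⊗ₖ g 0) else (1 : Matrix ι ι ℝ) ⊗ₖ g (i - k + 1)
  have he' : IsCliff N e' := by
    have := (he.mono (M := k) (by omega)).tensor hg
    rwa [show k + (p + 1) = N by omega] at this
  let q : X → Matrix μ μ ℝ := fun x => cliffSum g 2 p fun j => σ j x
  have hqc : Continuous q := continuous_cliffSum g 2 p hσ
  have hsum : ∀ x, cliffSum e' (k + 1) p (fun j => σ j x) = (1 : Matrix ι ι ℝ) ⊗ₖ q x := by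
    intro x
    ext ⟨i, a⟩ ⟨j, b⟩
    simp only [cliffSum, q, Matrix.sum_apply, Matrix.kroneckerMap_apply, Finset.mul_sum]
    refine Finset.sum_congr rfl fun l _ => ?_
    have h1 : ¬ (k + 1 + l < k) := by omega
    have h2 : k + 1 + l - k + 1 = 2 + l := by omega
    simp only [e', h1, if_false, h2, Matrix.smul_apply, Matrix.kroneckerMap_apply, smul_eq_mul]
    ring
  have hek : e' k = (1 : Matrix ι ι ℝ) ⊗ₖ g 1 := by simp [e']
  have hqsa : ∀ x, SA 2 g (q x) := fun x => hg.cliffSum_sa (by omega) _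
  have hqq : ∀ x, q x * q x = 1 := fun x => by
    rw [hg.cliffSum_sq (by omega), hσ1, one_smul]
  let D : PolarArc × X → Matrix (ι × μ) (ι × μ) ℝ := fun z =>
    Real.cos z.1 • e' k + Real.sin z.1 • cliffSum e' (k + 1) p fun j => σ j z.2
  have hD : ∀ z, D z = (1 : Matrix ι ι ℝ) ⊗ₖ (Real.cos z.1 • g 1 + Real.sin z.1 • q z.2) := by
    intro z
    ext ⟨i, a⟩ ⟨j, b⟩
    simp only [D, hsum, hek, Matrix.add_apply, Matrix.smul_apply, Matrix.kroneckerMap_apply,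
      smul_eq_mul]
    ring
  have hDsa : ∀ z, SA k e' (D z) := fun z => ((he'.sa (by omega) le_rfl).smul _).add
    (((he'.cliffSum_sa (by omega) _).mono (by omega)).smul _)
  have hDD : ∀ z, D z * D z = 1 := fun z => by
    rw [sq_add_of_anti _ _ _ (he'.sq k (by omega)), Real.cos_sq_add_sin_sq, one_smul]
    · rw [he'.cliffSum_sq (by omega), hσ1, one_smul]
    · exact (he'.cliffSum_sa (by omega) _).2 k (by omega)
  have hDc : Continuous D := by
    have := continuous_cliffSum e' (k + 1) p hσ
    have h2 : Continuous fun z : PolarArc × X => cliffSum e' (k + 1) p fun j => σ j z.2 :=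
      this.comp continuous_snd
    fun_prop
  let O : ℕ → X → Matrix ι (ι × μ) ℝ := fun j x =>
    (if j = 0 then χ x • blockRow 1 m else 0) - (if j = d then
      (1 / 2 : ℝ) • (blockRow (A (d + 1) x) (g 1 *ᵥ m) + blockRow (B (d + 1) x) (q x *ᵥ m)) else 0)
  have hAc := h.contA; have hBc := h.contB
  have hOc : ∀ j, Continuous (O j) := by
    intro j
    have h1 : Continuous fun x => blockRow (A (d + 1) x) (g 1 *ᵥ m) :=
      (hAc _).blockRow continuous_const
    have h2 : Continuous fun x => blockRow (B (d + 1) x) (q x *ᵥ m) :=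
      (hBc _).blockRow (hqc.matrix_mulVec continuous_const)
    simp only [O]
    split_ifs <;> fun_prop
  have hrow : ∀ i < k, ∀ (M : Matrix ι ι ℝ) (v : μ → ℝ) (s : ℝ), g 0 *ᵥ v = s • v →
      e i * M = s • (M * e i) → e i * blockRow M v = -(blockRow M v * e' i) := by
    intro i hi M v s hv hM
    have h1 : v ᵥ* g 0 = s • v := by
      rw [← Matrix.mulVec_transpose, hg.symm 0 (by omega), hv]
    simp only [e', hi, if_true]
    rw [mul_blockRow, Matrix.mul_neg, neg_neg, blockRow_mul_kronecker, h1, hM]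
    ext; simp [blockRow]; ring
  have hg1 : g 0 *ᵥ (g 1 *ᵥ m) = (-1 : ℝ) • (g 1 *ᵥ m) := by
    rw [Matrix.mulVec_mulVec, hg.anti 0 (by omega) 1 (by omega) (by omega), Matrix.neg_mulVec,
      ← Matrix.mulVec_mulVec, hgm, neg_one_smul]
  have hgq : ∀ x, g 0 *ᵥ (q x *ᵥ m) = (-1 : ℝ) • (q x *ᵥ m) := fun x => by
    rw [Matrix.mulVec_mulVec, (hqsa x).2 0 (by omega), Matrix.neg_mulVec,
      ← Matrix.mulVec_mulVec, hgm, neg_one_smul]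
  have hOa : ∀ j x, ∀ i < k, e i * O j x = -(O j x * e' i) := by
    intro j x i hi
    have h0 := hrow i hi 1 m 1 (by rw [hgm, one_smul]) (by simp)
    have h1 := hrow i hi (A (d + 1) x) (g 1 *ᵥ m) (-1) hg1 (by
      rw [(h.saA _ x).2 i hi, neg_one_smul])
    have h2 := hrow i hi (B (d + 1) x) (q x *ᵥ m) (-1) (hgq x) (by
      rw [(h.saB _ x).2 i hi, neg_one_smul])
    simp only [O, Matrix.mul_sub, Matrix.sub_mul]
    split_ifs <;> simp only [Matrix.mul_smul, Matrix.smul_mul, Matrix.mul_add, Matrix.add_mul, h0,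
      h1, h2, Matrix.mul_zero, Matrix.zero_mul] <;> module
  have hOχ : ∀ j x, χ x • O (j + 1) x = O (j + 1) x := by
    intro j x
    simp only [O, Nat.add_eq_zero_iff, one_ne_zero, and_false, if_false]
    split_ifs
    · rw [zero_sub, smul_neg, smul_comm, smul_add, ← blockRow_smul, ← blockRow_smul, h.cutA,
        h.cutB]
    · simp
  have hO0 : ∀ j x, χ x = 0 → O j x = 0 := by
    intro j x hx
    have h1 := h.cutA d x
    have h2 := h.cutB d x
    rw [hx, zero_smul] at h1 h2
    have h3 : ∀ v : μ → ℝ, blockRow (0 : Matrix ι ι ℝ) v = 0 := fun v => by ext; simp [blockRow]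
    simp [O, hx, ← h1, ← h2, h3]
  let Bm : PolarArc × X → Matrix ι (ι × μ) ℝ := fun z =>
    ∑ j ∈ Finset.range (d + 1), Real.sin z.1 ^ (2 * j) • Real.sin z.1 • O j z.2
  have hBm0 : ∀ z : PolarArc × X, (Real.sin z.1 = 0 ∨ χ z.2 = 0) → Bm z = 0 := by
    rintro z (hz | hz)
    · simp [Bm, hz]
    · simp [Bm, hO0 _ _ hz]
  have hBmc : Continuous Bm := by fun_prop
  have hBma : ∀ z, ∀ i < k, e i * Bm z = -(Bm z * e' i) := by
    intro z i hi
    simp only [Bm, Matrix.mul_sum, Matrix.sum_mul, ← Finset.sum_neg_distrib]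
    refine Finset.sum_congr rfl fun j _ => ?_
    rw [Matrix.mul_smul, Matrix.mul_smul, hOa _ _ i hi, Matrix.smul_mul, Matrix.smul_mul, smul_neg,
      smul_neg]
  have hsucc : ∀ θ x, trigSum (d + 1) A B θ x = trigSum d A B θ x +
      Real.sin θ ^ (2 * (d + 1)) • (Real.cos θ • A (d + 1) x + Real.sin θ • B (d + 1) x) :=
    fun θ x => Finset.sum_range_succ _ _
  have hconj : ∀ z : PolarArc × X, Bm z * D z * (Bm z)ᵀ = -(Real.sin z.1 ^ (2 * (d + 1)) •
      (Real.cos z.1 • A (d + 1) z.2 + Real.sin z.1 • B (d + 1) z.2)) := by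
    intro z
    have h1 : Bm z = (χ z.2 * Real.sin z.1) • blockRow 1 m -
        blockRow ((Real.sin z.1 ^ (2 * d + 1) / 2) • A (d + 1) z.2) (g 1 *ᵥ m) -
        blockRow ((Real.sin z.1 ^ (2 * d + 1) / 2) • B (d + 1) z.2) (q z.2 *ᵥ m) := by
      simp only [Bm, O, smul_sub, Finset.sum_sub_distrib, smul_ite, smul_zero]
      rw [Finset.sum_ite_eq', Finset.sum_ite_eq', if_pos (by simp), if_pos (by simp), blockRow_smul,
        blockRow_smul, pow_succ]
      simp only [mul_zero, pow_zero]
      module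
    rw [h1, hD, blockRow_conj (hg.symm 0 (by omega)) (hg.symm 1 (by omega)) (hqsa z.2).1
      (hg.sq 1 (by omega)) (hqq _) (hg.anti 0 (by omega) 1 (by omega) (by omega))
      ((hqsa z.2).2 0 (by omega)) ((hqsa z.2).2 1 (by omega)) hgm hmm _ _ _
      (by rw [Matrix.transpose_smul, (h.saA _ _).1]) (by rw [Matrix.transpose_smul, (h.saB _ _).1])]
    conv_rhs => rw [← h.cutA, ← h.cutB]
    rw [show 2 * (d + 1) = 2 * d + 1 + 1 by ring, pow_succ _ (2 * d + 1)]
    module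
  refine ⟨ι × μ, inferInstance, inferInstance, e', he',
    fun j x => dsum (A j x) (if j = 0 then e' k else 0),
    fun j x => Matrix.fromBlocks (B j x) (O j x) (O j x)ᵀ
      (if j = 0 then cliffSum e' (k + 1) p (fun j => σ j x) else 0), ⟨?_, ?_, ?_, ?_, ?_, ?_, ?_⟩,
    fun x hx => ?_, ?_⟩
  · exact fun j => (hAc j).blockSum continuous_const
  · intro j
    refine (hBc j).matrix_fromBlocks (hOc j) (hOc j).matrix_transpose ?_
    split_ifs
    exacts [continuous_cliffSum e' (k + 1) p hσ, continuous_const]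
  · intro j x
    refine (h.saA j x).blockSum ?_
    split_ifs
    exacts [he'.sa (by omega) le_rfl, SA.zero]
  · intro j x
    refine SA.fromBlocks (h.saB j x) ?_ (fun i hi => he.symm i (by omega))
      (fun i hi => he'.symm i (by omega)) (hOa j x)
    split_ifs
    exacts [(he'.cliffSum_sa (by omega) _).mono (by omega), SA.zero]
  · intro x
    simp [h.zero]
  · intro j x
    simp [dsum_smul, h.cutA]
  · intro j x
    simp [Matrix.fromBlocks_smul, h.cutB, hOχ, ← Matrix.transpose_smul]
  · simp [hO0 _ _ hx, dsum]
  · have hPc : Continuous fun z : PolarArc × X => trigSum (d + 1) A B z.1 z.2 := by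
      unfold trigSum; fun_prop
    have hPsa : ∀ z : PolarArc × X, SA k e (trigSum (d + 1) A B z.1 z.2) := fun z =>
      SA.sum fun j _ => (((h.saA j _).smul _).add ((h.saB j _).smul _)).smul _
    refine ⟨fun r => Matrix.fromBlocks (trigSum (d + 1) A B r.2.1 r.2.2 +
      (r.1 • Bm r.2) * D r.2 * (r.1 • Bm r.2)ᵀ) (r.1 • Bm r.2) (r.1 • Bm r.2)ᵀ (D r.2), ?_, ?_, ?_,
      fun t _ z => ⟨?_, ?_, fun hz => ?_⟩⟩
    · have hb : Continuous fun r : ℝ × PolarArc × X => r.1 • Bm r.2 := by fun_prop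
      refine Continuous.matrix_fromBlocks ((hPc.comp continuous_snd).add
        ((hb.matrix_mul (hDc.comp continuous_snd)).matrix_mul hb.matrix_transpose)) hb
        hb.matrix_transpose (hDc.comp continuous_snd)
    · intro z
      simp [dsum, D]
    · intro z
      have := trigSum_fromBlocks d A B O (fun _ => e' k)
        (fun x => cliffSum e' (k + 1) p fun j => σ j x) z.1 z.2
      refine Eq.trans ?_ this.symm
      simp only [one_smul, hconj, hsucc, add_neg_cancel_right]
      rfl
    · have hb : ∀ i < k, e i * (t • Bm z) = -((t • Bm z) * e' i) := fun i hi => by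
        rw [Matrix.mul_smul, hBma z i hi, Matrix.smul_mul, smul_neg]
      exact SA.fromBlocks ((hPsa z).add (SA.conj (hDsa z) (fun i hi => he.symm i (by omega))
        (fun i hi => he'.symm i (by omega)) hb)) (hDsa z) (fun i hi => he.symm i (by omega))
        (fun i hi => he'.symm i (by omega)) hb
    · exact isUnit_sweep (hu z) (hDD z)
    · have h1 : trigSum (d + 1) A B z.1 z.2 =
          Real.cos z.1 • e k + Real.sin z.1 • B 0 z.2 := by
        rw [trigSum_succ, h.zero]
        convert add_zero _ using 2
        refine Finset.sum_eq_zero fun j _ => ?_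
        rcases hz with hz | hz
        · simp [hz]
        · have h1 := h.cutA j z.2
          have h2 := h.cutB j z.2
          rw [hz, zero_smul] at h1 h2
          simp [← h1, ← h2]
      simp only [hBm0 z hz, smul_zero, Matrix.zero_mul, h1, add_zero, Matrix.transpose_zero]
      rfl

end DegreeReduction

section Reindex
variable {ι κ μ : Type} [Fintype ι] [DecidableEq ι] [Fintype κ] [DecidableEq κ] [Fintype μ]
  [DecidableEq μ] {X Z : Type} [TopologicalSpace X] [TopologicalSpace Z]

/-- Relabelling of matrix indices. -/
def reidx (f : ι ≃ κ) (A : Matrix ι ι ℝ) : Matrix κ κ ℝ := A.submatrix f.symm f.symm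

variable (f : ι ≃ κ) (A B : Matrix ι ι ℝ)

theorem reidx_transpose : (reidx f A)ᵀ = reidx f Aᵀ := rfl

theorem reidx_mul : reidx f (A * B) = reidx f A * reidx f B :=
  (Matrix.submatrix_mul_equiv A B _ _ _).symm

theorem reidx_neg : reidx f (-A) = -reidx f A := rfl

theorem reidx_one : reidx f 1 = 1 := Matrix.submatrix_one_equiv _

theorem reidx_dsum_assoc (A : Matrix ι ι ℝ) (B : Matrix κ κ ℝ) (C : Matrix μ μ ℝ) :
    reidx (Equiv.sumAssoc ι κ μ) (dsum (dsum A B) C) = dsum A (dsum B C) := by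
  ext (i | i | i) (j | j | j) <;> rfl

variable {f A B}

theorem IsUnit.reidx (h : IsUnit A) (f : ι ≃ κ) : IsUnit (reidx f A) :=
  h.map (Matrix.reindexAlgEquiv ℝ ℝ f)

theorem continuous_reidx (f : ι ≃ κ) : Continuous (reidx f) :=
  continuous_id.matrix_submatrix _ _

theorem SA.reidx {k : ℕ} {e : ℕ → Matrix ι ι ℝ} (h : SA k e A) (f : ι ≃ κ) :
    SA k (fun i => reidx f (e i)) (reidx f A) :=
  ⟨by rw [reidx_transpose, h.1], fun i hi => by
    rw [← reidx_mul, h.2 i hi, reidx_neg, reidx_mul]⟩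

theorem IsCliff.reidx {N : ℕ} {e : ℕ → Matrix ι ι ℝ} (h : IsCliff N e) (f : ι ≃ κ) :
    IsCliff N (fun i => reidx f (e i)) :=
  ⟨fun i hi => by rw [reidx_transpose, h.symm i hi],
    fun i hi => by rw [← reidx_mul, h.sq i hi, reidx_one],
    fun i hi j hj hij => by rw [← reidx_mul, h.anti i hi j hj hij, reidx_neg, reidx_mul]⟩

theorem Good.reidx {k : ℕ} {e : ℕ → Matrix ι ι ℝ} {S : Set Z} {b : Z → Matrix ι ι ℝ} {z : Z}
    (h : Good k e S b z A) (f : ι ≃ κ) :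
    Good k (fun i => reidx f (e i)) S (fun z => reidx f (b z)) z (reidx f A) :=
  ⟨h.sa.reidx f, h.unit.reidx f, fun hz => by rw [h.bd hz]⟩

theorem Good.congr {k : ℕ} {e : ℕ → Matrix ι ι ℝ} {S S' : Set Z} {b b' : Z → Matrix ι ι ℝ} {z : Z}
    (h : Good k e S b z A) (hS : z ∈ S' → z ∈ S ∧ b z = b' z) : Good k e S' b' z A :=
  ⟨h.sa, h.unit, fun hz => by rw [h.bd (hS hz).1, (hS hz).2]⟩

end Reindex

/-- The point at angle `θ` on the great circle through `a` and `b`. -/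
noncomputable def arcTo {ι : Type} (a b : Matrix ι ι ℝ) (θ : ℝ) : Matrix ι ι ℝ :=
  Real.cos θ • a + Real.sin θ • b

theorem arcTo_dsum {ι κ : Type} (a b : Matrix ι ι ℝ) (a' b' : Matrix κ κ ℝ) (θ : ℝ) :
    arcTo (dsum a a') (dsum b b') θ = dsum (arcTo a b θ) (arcTo a' b' θ) := by
  simp [arcTo, dsum_smul, dsum_add]

theorem reidx_arcTo {ι κ : Type} (f : ι ≃ κ) (a b : Matrix ι ι ℝ) (θ : ℝ) :
    reidx f (arcTo a b θ) = arcTo (reidx f a) (reidx f b) θ := rfl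

theorem arcTo_of_sin_eq_zero {ι : Type} (a b c : Matrix ι ι ℝ) {θ : ℝ} (h : Real.sin θ = 0) :
    arcTo a b θ = arcTo a c θ := by simp [arcTo, h]

section DegreeReduction
variable {X : Type} [TopologicalSpace X] {k N p : ℕ} {σ : ℕ → X → ℝ} {χ : X → ℝ}

theorem Htpy.blockSum_const {Z ι κ : Type} [TopologicalSpace Z] [Fintype ι] [DecidableEq ι]
    [Fintype κ] [DecidableEq κ] {e : ℕ → Matrix ι ι ℝ} {e' : ℕ → Matrix κ κ ℝ} {S : Set Z}
    {b f g : Z → Matrix ι ι ℝ} {c : Z → Matrix κ κ ℝ} (H : Htpy (Good k e S b) f g)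
    (hc : Continuous c) (hsa : ∀ z, SA k e' (c z)) (hu : ∀ z, IsUnit (c z)) :
    Htpy (Good k (fun i => dsum (e i) (e' i)) S fun z => dsum (b z) (c z))
      (fun z => dsum (f z) (c z)) (fun z => dsum (g z) (c z)) :=
  H.map continuous_id (Φ := fun q => dsum q.2 (c q.1))
    (continuous_snd.blockSum (hc.comp continuous_fst))
    fun z _ h => h.blockSum ⟨hsa z, hu z, fun _ => rfl⟩

theorem Htpy.reidx {Z ι κ : Type} [TopologicalSpace Z] [Fintype ι] [DecidableEq ι]
    [Fintype κ] [DecidableEq κ] {e : ℕ → Matrix ι ι ℝ} {S : Set Z}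
    {b f g : Z → Matrix ι ι ℝ} (H : Htpy (Good k e S b) f g) (w : ι ≃ κ) :
    Htpy (Good k (fun i => _root_.reidx w (e i)) S fun z => _root_.reidx w (b z))
      (fun z => _root_.reidx w (f z)) (fun z => _root_.reidx w (g z)) :=
  H.map continuous_id (Φ := fun q => _root_.reidx w q.2)
    ((continuous_reidx w).comp continuous_snd) fun _ _ h => h.reidx w

theorem IsCliff.arcTo_sq {ι : Type} [Fintype ι] [DecidableEq ι] {e : ℕ → Matrix ι ι ℝ}
    (he : IsCliff N e) (hk : k < N) {η : Matrix ι ι ℝ} (hη : SA (k + 1) e η) (hη1 : η * η = 1)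
    (θ : ℝ) : arcTo (e k) η θ * arcTo (e k) η θ = 1 := by
  rw [arcTo, sq_add_of_anti _ _ (hη.2 k (by omega)) (he.sq k hk) hη1, Real.cos_sq_add_sin_sq,
    one_smul]

theorem IsCliff.sa_arcTo {ι : Type} [Fintype ι] [DecidableEq ι] {e : ℕ → Matrix ι ι ℝ}
    (he : IsCliff N e) (hk : k < N) {η : Matrix ι ι ℝ} (hη : SA k e η) (θ : ℝ) :
    SA k e (arcTo (e k) η θ) := ((he.sa hk le_rfl).smul _).add (hη.smul _)

theorem degree_reduction (hN : k + 1 + p = N) (hσ : ∀ j, Continuous (σ j))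
    (hσ1 : ∀ x, ∑ j ∈ Finset.range p, σ j x ^ 2 = 1) (hχ : Continuous χ) (d : ℕ) :
    ∀ {ι : Type} [Fintype ι] [DecidableEq ι] {e : ℕ → Matrix ι ι ℝ}, IsCliff N e →
    ∀ {A B : ℕ → X → Matrix ι ι ℝ}, TrigPencil k e χ A B →
    (∀ z : PolarArc × X, IsUnit (trigSum d A B z.1 z.2)) →
    ∃ (κ : Type) (_ : Fintype κ) (_ : DecidableEq κ) (e' : ℕ → Matrix κ κ ℝ),
      IsCliff N e' ∧ ∃ C : X → Matrix (ι ⊕ κ) (ι ⊕ κ) ℝ, Continuous C ∧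
      (∀ x, SA k (fun i => dsum (e i) (e' i)) (C x)) ∧
      (∀ x, χ x = 0 → C x = dsum (B 0 x) (cliffSum e' (k + 1) p fun j => σ j x)) ∧
      Htpy (Good k (fun i => dsum (e i) (e' i)) {z : PolarArc × X | Real.sin z.1 = 0 ∨ χ z.2 = 0}
        fun z => dsum (arcTo (e k) (B 0 z.2) z.1)
          (arcTo (e' k) (cliffSum e' (k + 1) p fun j => σ j z.2) z.1))
      (fun z : PolarArc × X => dsum (trigSum d A B z.1 z.2)
          (arcTo (e' k) (cliffSum e' (k + 1) p fun j => σ j z.2) z.1))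
      (fun z => arcTo (dsum (e k) (e' k)) (C z.2) z.1) := by
  induction d with
  | zero =>
    intro ι _ _ e he A B h hu
    refine ⟨Empty, inferInstance, inferInstance, fun _ => 0, ⟨fun _ _ => Subsingleton.elim _ _,
      fun _ _ => Subsingleton.elim _ _, fun _ _ _ _ _ => Subsingleton.elim _ _⟩,
      fun x => dsum (B 0 x) 0, (h.contB 0).blockSum continuous_const,
      fun x => (h.saB 0 x).blockSum SA.zero, fun x _ => ?_, ?_⟩
    · exact congrArg (dsum _) (Subsingleton.elim _ _)
    · have hz : ∀ z : PolarArc × X, trigSum 0 A B z.1 z.2 = arcTo (e k) (B 0 z.2) z.1 :=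
        fun z => by simp [trigSum, arcTo, h.zero]
      have hE : ∀ c : Matrix Empty Empty ℝ, c = 0 := fun c => Subsingleton.elim _ _
      simp only [hz, arcTo_dsum, hE (arcTo _ _ _)]
      have hc := h.contB 0
      refine Htpy.refl ?_ fun z => ⟨?_, isUnit_dsum (hz z ▸ hu z) ⟨1, Subsingleton.elim _ _⟩,
        fun _ => rfl⟩
      · refine Continuous.blockSum ?_ continuous_const
        unfold arcTo; fun_prop
      · exact (he.sa_arcTo (by omega) (h.saB 0 _) _).blockSum SA.zero
  | succ d ih =>
    intro ι _ _ e he A B h hu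
    obtain ⟨κ, _, _, e₁, he₁, A', B', h', hB', H₁⟩ := degree_step hN he hσ hσ1 hχ h hu
    simp only [← arcTo.eq_def] at H₁
    obtain ⟨ν, _, _, e₂, he₂, C, hCc, hCsa, hC0, H₂⟩ := ih (he.blockSum he₁) h'
      fun z => (H₁.right z).unit
    have hs : ∀ (x : X), SA (k + 1) e₂ (cliffSum e₂ (k + 1) p fun j => σ j x) :=
      fun x => he₂.cliffSum_sa (by omega) _
    have hs1 : ∀ (x : X), (cliffSum e₂ (k + 1) p fun j => σ j x) *
        (cliffSum e₂ (k + 1) p fun j => σ j x) = 1 := fun x => by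
      rw [he₂.cliffSum_sq (by omega), hσ1, one_smul]
    have hc₂ : Continuous fun z : PolarArc × X =>
        arcTo (e₂ k) (cliffSum e₂ (k + 1) p fun j => σ j z.2) z.1 := by
      have := (continuous_cliffSum e₂ (k + 1) p hσ).comp (continuous_snd (X := PolarArc))
      unfold arcTo
      simp only [Function.comp_def] at this
      fun_prop
    have K₁ := H₁.blockSum_const hc₂ (fun z => he₂.sa_arcTo (by omega) ((hs _).mono (by omega)) _)
      fun z => ⟨⟨_, _, he₂.arcTo_sq (by omega) (hs _) (hs1 _) _,
        he₂.arcTo_sq (by omega) (hs _) (hs1 _) _⟩, rfl⟩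
    have K := (K₁.trans (H₂.mono fun z M hM => hM.congr fun hz => ⟨hz, ?_⟩)).reidx
      (Equiv.sumAssoc ι κ ν)
    · refine ⟨κ ⊕ ν, inferInstance, inferInstance, fun i => dsum (e₁ i) (e₂ i), he₁.blockSum he₂,
        fun x => reidx (Equiv.sumAssoc ι κ ν) (C x), (continuous_reidx _).comp hCc,
        fun x => ?_, fun x hx => ?_, ?_⟩
      · simpa only [reidx_dsum_assoc] using (hCsa x).reidx (Equiv.sumAssoc ι κ ν)
      · beta_reduce
        rw [hC0 x hx, hB' x hx, reidx_dsum_assoc, cliffSum_dsum]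
      · simp only [reidx_dsum_assoc, reidx_arcTo] at K
        simpa only [cliffSum_dsum, arcTo_dsum] using K
    · congr 1
      rw [← arcTo_dsum]
      rcases hz with hz | hz
      · exact arcTo_of_sin_eq_zero _ _ _ hz
      · rw [hB' _ hz]

end DegreeReduction

theorem exists_ball_isUnit {𝔸 Z : Type} [NormedRing 𝔸] [CompleteSpace 𝔸] [TopologicalSpace Z]
    [CompactSpace Z] {F : Z → 𝔸} (hF : Continuous F) (hu : ∀ z, IsUnit (F z)) :
    ∃ δ > 0, ∀ z B, ‖B - F z‖ < δ → IsUnit B := by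
  obtain ⟨δ, hδ, h⟩ := (isCompact_range hF).exists_thickening_subset_open Units.isOpen
    (Set.range_subset_iff.2 hu)
  exact ⟨δ, hδ, fun z B hB => h (Metric.mem_thickening_iff.2
    ⟨F z, ⟨z, rfl⟩, by rwa [dist_eq_norm]⟩)⟩

theorem trig_cut_isUnit {𝔸 X : Type} [NormedRing 𝔸] [NormedAlgebra ℝ 𝔸] [CompleteSpace 𝔸]
    [TopologicalSpace X] [CompactSpace X] {W : Submodule ℝ 𝔸} {F : PolarArc × X → 𝔸}
    (hF : Continuous F) {e : 𝔸} (h0 : ∀ z, (z.1 : ℝ) = 0 → F z = e)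
    (hπ : ∀ z, (z.1 : ℝ) = Real.pi → F z = -e) (hW : ∀ z, F z ∈ W) (he : e ∈ W)
    (hu : ∀ z, IsUnit (F z)) :
    ∃ (d : ℕ) (A B : ℕ → X → 𝔸) (χ : X → ℝ), (∀ j, Continuous (A j)) ∧ (∀ j, Continuous (B j)) ∧
      Continuous χ ∧ (∀ j x, A j x ∈ W) ∧ (∀ j x, B j x ∈ W) ∧ (∀ x, A 0 x = e) ∧
      (∀ j x, χ x • A (j + 1) x = A (j + 1) x ∧ χ x • B (j + 1) x = B (j + 1) x) ∧
      (∀ x b, (∀ θ : PolarArc, F (θ, x) = Real.cos θ • e + Real.sin θ • b) →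
        χ x = 0 ∧ B 0 x = b) ∧
      ∀ t ∈ Set.Icc (0 : ℝ) 1, ∀ z : PolarArc × X,
        IsUnit ((1 - t) • F z + t • trigSum d A B z.1 z.2) := by
  obtain ⟨δ, hδ, hball⟩ := exists_ball_isUnit hF hu
  let G : ℝ × X → 𝔸 := fun q => F (Set.projIcc 0 Real.pi Real.pi_pos.le q.1, q.2)
  have hG : ∀ (θ : PolarArc) x, G (θ, x) = F (θ, x) := fun θ x => by
    simp [G, Set.projIcc_val]
  obtain ⟨d, A, B, χ, hA, hB, hχ, hAW, hBW, hA0, hcut, hb, happ⟩ := trig_cut (F := G) (W := W)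
    (e := e) (hF.comp (by fun_prop)) (fun x => h0 _ (by simp)) (fun x => hπ _ (by simp))
    (fun t x => hW _) he hδ
  refine ⟨d, A, B, χ, hA, hB, hχ, hAW, hBW, hA0, hcut, fun x b h => ?_, fun t ht z => ?_⟩
  · have h2 : G (Real.pi / 2, x) = b := by
      rw [hG ⟨Real.pi / 2, by constructor <;> linarith [Real.pi_pos]⟩, h]; simp
    have := hb x fun θ hθ => by rw [hG ⟨θ, hθ⟩, h, h2]
    rwa [h2] at this
  · refine hball z _ ?_
    have h1 := happ z.1 z.1.2 z.2
    rw [hG] at h1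
    calc ‖(1 - t) • F z + t • trigSum d A B z.1 z.2 - F z‖
        = ‖t • (trigSum d A B z.1 z.2 - F z)‖ := by congr 1; module
      _ ≤ 1 * ‖trigSum d A B z.1 z.2 - F z‖ := by
        rw [norm_smul, Real.norm_of_nonneg ht.1]; gcongr; exact ht.2
      _ < δ := by rwa [one_mul]

section BottStep
variable {ι : Type} [Fintype ι] [DecidableEq ι] {X : Type} [TopologicalSpace X] {k N p : ℕ}
  {e : ℕ → Matrix ι ι ℝ}

open scoped Matrix.Norms.Operator in
theorem trig_cut_matrix [CompactSpace X] (he : IsCliff (k + 1) e)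
    {F : PolarArc × X → Matrix ι ι ℝ} (hF : Continuous F)
    (hsa : ∀ z, SA k e (F z)) (hu : ∀ z, IsUnit (F z)) (h0 : ∀ z, (z.1 : ℝ) = 0 → F z = e k)
    (hπ : ∀ z, (z.1 : ℝ) = Real.pi → F z = -e k) :
    ∃ (d : ℕ) (A B : ℕ → X → Matrix ι ι ℝ) (χ : X → ℝ), Continuous χ ∧ TrigPencil k e χ A B ∧
      (∀ x b, (∀ θ : PolarArc, F (θ, x) = arcTo (e k) b θ) → χ x = 0 ∧ B 0 x = b) ∧
      ∀ t ∈ Set.Icc (0 : ℝ) 1, ∀ z : PolarArc × X,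
        IsUnit ((1 - t) • F z + t • trigSum d A B z.1 z.2) := by
  obtain ⟨d, A, B, χ, hA, hB, hχ, hAW, hBW, hA0, hcut, hb, happ⟩ := trig_cut_isUnit
    (W := saSubmodule k e) hF h0 hπ hsa (he.sa (by omega) le_rfl) hu
  exact ⟨d, A, B, χ, hχ, ⟨hA, hB, hAW, hBW, hA0, fun j x => (hcut j x).1, fun j x => (hcut j x).2⟩,
    hb, happ⟩

theorem TrigPencil.trigSum_of {χ : X → ℝ} {A B : ℕ → X → Matrix ι ι ℝ} (h : TrigPencil k e χ A B)
    (d : ℕ) {θ : ℝ} {x : X} (hz : Real.sin θ = 0 ∨ χ x = 0) :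
    trigSum d A B θ x = arcTo (e k) (B 0 x) θ := by
  rw [trigSum_succ, h.zero]
  refine (add_eq_left).2 (Finset.sum_eq_zero fun j _ => ?_)
  rcases hz with hz | hz
  · simp [hz]
  · have h1 := h.cutA j x
    have h2 := h.cutB j x
    rw [hz, zero_smul] at h1 h2
    simp [← h1, ← h2]

theorem continuous_arcTo {Z : Type} [TopologicalSpace Z] {a b : Z → Matrix ι ι ℝ} {θ : Z → ℝ}
    (ha : Continuous a) (hb : Continuous b) (hθ : Continuous θ) :
    Continuous fun z => arcTo (a z) (b z) (θ z) := by
  unfold arcTo; fun_prop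

theorem isUnit_of_mul_self_eq_one {A : Matrix ι ι ℝ} (h : A * A = 1) : IsUnit A :=
  ⟨⟨A, A, h, h⟩, rfl⟩

theorem bott_step [CompactSpace X] (hN : k + 1 + p = N) (he : IsCliff N e) {Y : Set X}
    {F : PolarArc × X → Matrix ι ι ℝ} (hF : Continuous F) (hsa : ∀ z, SA k e (F z))
    (hu : ∀ z, IsUnit (F z)) (h0 : ∀ z, (z.1 : ℝ) = 0 → F z = e k)
    (hπ : ∀ z, (z.1 : ℝ) = Real.pi → F z = -e k) {η : X → Matrix ι ι ℝ}
    (hη : ∀ y ∈ Y, SA (k + 1) e (η y) ∧ η y * η y = 1)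
    (hFY : ∀ z, z.2 ∈ Y → F z = arcTo (e k) (η z.2) z.1) {σ : ℕ → X → ℝ}
    (hσ : ∀ j, Continuous (σ j)) (hσ1 : ∀ x, ∑ j ∈ Finset.range p, σ j x ^ 2 = 1) :
    ∃ (κ : Type) (_ : Fintype κ) (_ : DecidableEq κ) (e' : ℕ → Matrix κ κ ℝ),
      IsCliff N e' ∧ ∃ ε : X → Matrix (ι ⊕ κ) (ι ⊕ κ) ℝ, Continuous ε ∧
      (∀ x, SA (k + 1) (fun i => dsum (e i) (e' i)) (ε x)) ∧ (∀ x, IsUnit (ε x)) ∧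
      (∀ x ∈ Y, ε x = dsum (η x) (cliffSum e' (k + 1) p fun j => σ j x)) ∧
      Htpy (Good k (fun i => dsum (e i) (e' i)) {z : PolarArc × X | Real.sin z.1 = 0 ∨ z.2 ∈ Y}
        fun z => dsum (F z) (arcTo (e' k) (cliffSum e' (k + 1) p fun j => σ j z.2) z.1))
      (fun z : PolarArc × X => dsum (F z)
          (arcTo (e' k) (cliffSum e' (k + 1) p fun j => σ j z.2) z.1))
      (fun z => arcTo (dsum (e k) (e' k)) (ε z.2) z.1) := by
  obtain ⟨d, A, B, χ, hχ, hT, hb, happ⟩ := trig_cut_matrix (he.mono (by omega)) hF hsa hu h0 hπ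
  have hY : ∀ x ∈ Y, χ x = 0 ∧ B 0 x = η x := fun x hx => hb x _ fun θ => hFY (θ, x) hx
  have hFS : ∀ z : PolarArc × X, (Real.sin z.1 = 0 ∨ z.2 ∈ Y) → F z = arcTo (e k) (B 0 z.2) z.1 := by
    rintro z (hz | hz)
    · have h1 : (z.1 : ℝ) = 0 ∨ (z.1 : ℝ) = Real.pi := by
        have h2 := z.1.2
        rcases h2.1.eq_or_lt with h | h
        · exact Or.inl h.symm
        · rcases h2.2.eq_or_lt with h' | h'
          · exact Or.inr h'
          · exact absurd hz (Real.sin_pos_of_pos_of_lt_pi h h').ne'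
      rcases h1 with h1 | h1
      · simp [h0 z h1, arcTo, h1]
      · simp [hπ z h1, arcTo, h1]
    · rw [hFY z hz, (hY _ hz).2]
  obtain ⟨κ, _, _, e', he', C, hCc, hCsa, hC0, H⟩ := degree_reduction hN hσ hσ1 hχ d he hT
    fun z => by simpa using happ 1 (by simp) z
  have hs : ∀ (x : X), SA (k + 1) e' (cliffSum e' (k + 1) p fun j => σ j x) :=
    fun x => he'.cliffSum_sa (by omega) _
  have hs1 : ∀ (x : X), (cliffSum e' (k + 1) p fun j => σ j x) *
      (cliffSum e' (k + 1) p fun j => σ j x) = 1 := fun x => by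
    rw [he'.cliffSum_sq (by omega), hσ1, one_smul]
  have hEc : Continuous fun z : PolarArc × X =>
      arcTo (e' k) (cliffSum e' (k + 1) p fun j => σ j z.2) z.1 :=
    continuous_arcTo continuous_const ((continuous_cliffSum e' (k + 1) p hσ).comp continuous_snd)
      (by fun_prop)
  have hTc : Continuous fun z : PolarArc × X => trigSum d A B z.1 z.2 := by
    have := hT.contA; have := hT.contB
    unfold trigSum; fun_prop
  have hTsa : ∀ z : PolarArc × X, SA k e (trigSum d A B z.1 z.2) := fun z =>
    SA.sum fun j _ => (((hT.saA j _).smul _).add ((hT.saB j _).smul _)).smul _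
  have H₁ : Htpy (Good k e {z : PolarArc × X | Real.sin z.1 = 0 ∨ z.2 ∈ Y} F) F
      (fun z => trigSum d A B z.1 z.2) := by
    refine ⟨fun q => (1 - q.1) • F q.2 + q.1 • trigSum d A B q.2.1 q.2.2, ?_, fun z => by simp,
      fun z => by simp, fun t ht z => ⟨((hsa z).smul _).add ((hTsa z).smul _), happ t ht z,
      fun hz => ?_⟩⟩
    · have : Continuous fun q : ℝ × PolarArc × X => trigSum d A B q.2.1 q.2.2 :=
        hTc.comp continuous_snd
      fun_prop
    · have := hT.trigSum_of d (θ := z.1) (x := z.2) (hz.imp_right fun h => (hY _ h).1)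
      beta_reduce
      rw [this, hFS z hz]
      module
  have H₂ := H₁.blockSum_const hEc (e' := e')
    (fun z => he'.sa_arcTo (by omega) ((hs _).mono (by omega)) _)
    fun z => isUnit_of_mul_self_eq_one (he'.arcTo_sq (by omega) (hs _) (hs1 _) _)
  have H₃ := H₂.trans (H.mono fun z M hM => hM.congr fun hz =>
    ⟨hz.imp_right fun h => (hY _ h).1, by rw [hFS z hz]⟩)
  have hbl := he.blockSum he'
  obtain ⟨R, hRc, hR0, hR1, hRsa, hRu, hRY⟩ := linear_pencil (hbl.mono (M := k + 1) (by omega)) hCc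
    hCsa fun x θ hθ => (H.right (⟨θ, hθ⟩, x)).unit
  have hRY' : ∀ x ∈ Y, ∀ t, R (t, x) = dsum (η x) (cliffSum e' (k + 1) p fun j => σ j x) := by
    intro x hx t
    have h1 : C x = dsum (η x) (cliffSum e' (k + 1) p fun j => σ j x) := by
      rw [hC0 x (hY x hx).1, (hY x hx).2]
    rw [hRY x (h1 ▸ (hη x hx).1.blockSum (hs x)) (by
      rw [h1, dsum_mul, (hη x hx).2, hs1, dsum_one]), h1]
  refine ⟨κ, inferInstance, inferInstance, e', he', fun x => R (1, x), by fun_prop, hR1,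
    fun x => by simpa using hRu 1 (by simp) x (Real.pi / 2), fun x hx => hRY' x hx 1, ?_⟩
  refine H₃.trans ⟨fun q => arcTo (dsum (e k) (e' k)) (R (q.1, q.2.2)) q.2.1,
    continuous_arcTo continuous_const (by fun_prop) (by fun_prop),
    fun z => congrArg (fun M => arcTo (dsum (e k) (e' k)) M z.1) (hR0 z.2), fun z => rfl, fun t ht z => ⟨hbl.sa_arcTo (by omega) (hRsa _ _) _, hRu t ht _ _, fun hz => ?_⟩⟩
  rw [hFS z hz, ← arcTo_dsum]
  rcases hz with hz | hz
  · exact arcTo_of_sin_eq_zero _ _ _ hz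
  · rw [(hY _ hz).2]
    exact congrArg (fun M => arcTo (dsum (e k) (e' k)) M z.1) (hRY' _ hz t)

end BottStep

section Involutize
variable {𝔸 : Type} [NormedRing 𝔸] [NormedAlgebra ℝ 𝔸] [CompleteSpace 𝔸]
  {X : Type} [TopologicalSpace X]

theorem exists_involutize {T : X → 𝔸} (hT : Continuous T) (hu : ∀ x, SegUnit (T x * T x)) :
    ∃ R : ℝ × X → 𝔸, Continuous R ∧ (∀ x, R (0, x) = T x) ∧ (∀ x, R (1, x) * R (1, x) = 1) ∧
      (∀ t x, IsUnit (R (t, x))) ∧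
      (∀ t x A, A * T x = -(T x * A) → A * R (t, x) = -(R (t, x) * A)) ∧
      (∀ t x, ∀ φ : 𝔸 →ₗ[ℝ] 𝔸, Continuous φ → φ 1 = 1 → (∀ a b, φ (a * b) = φ b * φ a) →
        φ (T x) = T x → φ (R (t, x)) = R (t, x)) ∧
      (∀ x, T x * T x = 1 → ∀ t, R (t, x) = T x) := by
  have hc : Continuous fun q : ℝ × X => sqrtSeg (T q.2 * T q.2) q.1 :=
    (continuous_sqrtSeg (S := fun x => T x * T x) (by fun_prop) hu).comp
      (f := fun q : ℝ × X => (q.2, q.1)) (by fun_prop)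
  have hi : ∀ t x A, Commute A (T x * T x) →
      Commute A (Ring.inverse (sqrtSeg (T x * T x) t)) := fun t x A h =>
    commute_ringInverse (commute_sqrtSeg (hu x) h t) (isUnit_sqrtSeg _ _)
  have hTi : ∀ t x, Commute (T x) (Ring.inverse (sqrtSeg (T x * T x) t)) := fun t x =>
    hi t x _ ((Commute.refl _).mul_right (Commute.refl _))
  have hTu : ∀ x, IsUnit (T x) := fun x => by
    have := hu x 1 (by simp)
    rw [one_smul, add_sub_cancel] at this
    exact ((Commute.refl (T x)).isUnit_mul_iff.1 this).1
  refine ⟨fun q => T q.2 * Ring.inverse (sqrtSeg (T q.2 * T q.2) q.1), ?_, fun x => ?_, fun x => ?_,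
    fun t x => ?_, fun t x A h => ?_, fun t x φ hφ h1 hmul h => ?_, fun x h t => ?_⟩
  · exact Continuous.mul (by fun_prop) (continuous_ringInverse hc fun q => isUnit_sqrtSeg _ _)
  · simp [sqrtSeg_zero]
  · have h1 := sqrtSeg_sq (hu x) (u := 1) (by simp)
    rw [one_smul, add_sub_cancel] at h1
    have h2 := isUnit_sqrtSeg (T x * T x) 1
    beta_reduce
    rw [mul_assoc, ← mul_assoc _ (T x), ← (hTi 1 x).eq]
    calc _ = T x * T x * (Ring.inverse (sqrtSeg (T x * T x) 1) *
          Ring.inverse (sqrtSeg (T x * T x) 1)) := by simp only [mul_assoc]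
      _ = sqrtSeg (T x * T x) 1 * (sqrtSeg (T x * T x) 1 * Ring.inverse (sqrtSeg (T x * T x) 1)) *
          Ring.inverse (sqrtSeg (T x * T x) 1) := by rw [← h1]; simp only [mul_assoc]; rw [h1]
      _ = 1 := by rw [Ring.mul_inverse_cancel _ h2, mul_one, Ring.mul_inverse_cancel _ h2]
  · exact (hTu x).mul (IsUnit.ringInverse (isUnit_sqrtSeg _ _))
  · have h2 : Commute A (T x * T x) := by
      change _ * _ = _ * _
      rw [← mul_assoc, h, neg_mul, mul_assoc, h, mul_neg, neg_neg, mul_assoc]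
    beta_reduce
    rw [← mul_assoc, h, neg_mul, mul_assoc, (hi t x A h2).eq, mul_assoc]
  · beta_reduce
    have h2 : φ (sqrtSeg (T x * T x) t) = sqrtSeg (T x * T x) t :=
      map_sqrtSeg_anti (hu x) ⟨φ, hφ⟩ h1 hmul (by
        change φ (T x * T x) = _
        rw [hmul, h]) t
    rw [hmul, h]
    have h3 := map_ringInverse_anti ⟨φ, hφ⟩ h1 hmul (isUnit_sqrtSeg (T x * T x) t)
    change φ _ = Ring.inverse (φ _) at h3
    rw [h3, h2, (hTi t x).eq]
  · simp [h, sqrtSeg_one]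

end Involutize

section Normalize
variable {ι : Type} [Fintype ι] [DecidableEq ι] {X : Type} [TopologicalSpace X] {k : ℕ}
  {e : ℕ → Matrix ι ι ℝ}

theorem segUnit_sq_of_symm {A : Matrix ι ι ℝ} (hA : Aᵀ = A) (hu : IsUnit A) :
    ∀ u ∈ Set.Icc (0 : ℝ) 1, IsUnit (1 + u • (A * A - 1)) := by
  intro u hu'
  rcases hu'.2.eq_or_lt with h | h
  · rw [h, one_smul, add_sub_cancel]; exact hu.mul hu
  · have := isUnit_smul_one_add_psd (c := 1 - u) (by linarith)
      ((psd_self_mul_transpose A).smul hu'.1)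
    rw [hA] at this
    convert this using 1
    module

open scoped Matrix.Norms.Operator in
theorem exists_normalize {A : X → Matrix ι ι ℝ} (hA : Continuous A) (hsa : ∀ x, SA k e (A x))
    (hu : ∀ x, IsUnit (A x)) :
    ∃ R : ℝ × X → Matrix ι ι ℝ, Continuous R ∧ (∀ x, R (0, x) = A x) ∧
      (∀ x, R (1, x) * R (1, x) = 1) ∧ (∀ t x, SA k e (R (t, x))) ∧
      (∀ t x, IsUnit (R (t, x))) ∧ ∀ x, A x * A x = 1 → ∀ t, R (t, x) = A x := by
  obtain ⟨R, hR, h0, h1, hRu, hanti, hφ, hconst⟩ := exists_involutize hA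
    fun x => segUnit_sq_of_symm (hsa x).1 (hu x)
  refine ⟨R, hR, h0, h1, fun t x => ⟨?_, fun i hi => hanti t x _ ((hsa x).2 i hi)⟩, hRu, hconst⟩
  exact hφ t x (Matrix.transposeLinearEquiv ι ι ℝ ℝ).toLinearMap
    (by change Continuous fun A : Matrix ι ι ℝ => Aᵀ; fun_prop) (by simp) (by simp) (hsa x).1

theorem IsCliff.isUnit_arcTo (he : IsCliff (k + 1) e) {A : Matrix ι ι ℝ} (hA : SA (k + 1) e A)
    (hu : IsUnit A) (θ : ℝ) : IsUnit (arcTo (e k) A θ) := by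
  have h : arcTo (e k) A θ * arcTo (e k) A θ =
      Real.cos θ ^ 2 • (1 : Matrix ι ι ℝ) + Real.sin θ ^ 2 • (A * A) := by
    simp only [arcTo, add_mul, mul_add, smul_mul_assoc, mul_smul_comm, he.sq k (by omega),
      hA.2 k (by omega)]
    module
  refine ((Commute.refl (arcTo (e k) A θ)).isUnit_mul_iff.1 ?_).1
  rw [h]
  by_cases hc : Real.cos θ = 0
  · have hs : Real.sin θ ^ 2 = 1 := by have := Real.sin_sq_add_cos_sq θ; simpa [hc] using this
    rw [hc, hs]
    simpa using hu.mul hu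
  · refine isUnit_smul_one_add_psd (by positivity) (Matrix.PosSemidef.smul ?_ (by positivity))
    have := psd_self_mul_transpose A
    rwa [hA.1] at this

end Normalize

/-- The product of `X` with an `m`-dimensional cube of polar angles. -/
@[reducible] def Cube (X : Type) : ℕ → Type
  | 0 => X
  | m + 1 => PolarArc × Cube X m

@[reducible] instance Cube.topology (X : Type) [TopologicalSpace X] :
    ∀ m, TopologicalSpace (Cube X m)
  | 0 => inferInstanceAs (TopologicalSpace X)
  | m + 1 =>
    let _ := Cube.topology X m
    inferInstanceAs (TopologicalSpace (PolarArc × Cube X m))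

instance Cube.compact (X : Type) [TopologicalSpace X] [CompactSpace X] :
    ∀ m, CompactSpace (Cube X m)
  | 0 => inferInstanceAs (CompactSpace X)
  | m + 1 =>
    have := Cube.compact X m
    inferInstanceAs (CompactSpace (PolarArc × Cube X m))

/-- Some polar angle is degenerate, or the base point lies in `Y`. -/
def cubeBd {X : Type} (Y : Set X) : ∀ m : ℕ, Set (Cube X m)
  | 0 => Y
  | m + 1 => {z | Real.sin z.1 = 0 ∨ z.2 ∈ cubeBd Y m}

/-- The iterated join of `e k, …, e (k + m - 1)` with `ε`. -/
noncomputable def lin {ι X : Type} (e : ℕ → Matrix ι ι ℝ) :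
    ∀ (k m : ℕ), (X → Matrix ι ι ℝ) → Cube X m → Matrix ι ι ℝ
  | _, 0, ε, x => ε x
  | k, m + 1, ε, z => arcTo (e k) (lin e (k + 1) m ε z.2) z.1

/-- Spherical coordinates on the cube. -/
noncomputable def sph {X : Type} : ∀ (m : ℕ), ℕ → Cube X m → ℝ
  | 0, j, _ => if j = 0 then 1 else 0
  | _ + 1, 0, z => Real.cos z.1
  | m + 1, j + 1, z => Real.sin z.1 * sph m j z.2

section Lin
variable {ι κ X : Type} [TopologicalSpace X]

theorem continuous_sph : ∀ (m j : ℕ), Continuous (sph (X := X) m j)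
  | 0, j => continuous_const
  | m + 1, 0 => (Real.continuous_cos.comp continuous_subtype_val).comp continuous_fst
  | m + 1, j + 1 => ((Real.continuous_sin.comp continuous_subtype_val).comp continuous_fst).mul
      ((continuous_sph m j).comp continuous_snd)

theorem sum_sph_sq : ∀ (m : ℕ) (z : Cube X m), ∑ j ∈ Finset.range (m + 1), sph m j z ^ 2 = 1
  | 0, z => by simp [sph]
  | m + 1, z => by
    rw [Finset.sum_range_succ']
    simp only [sph, mul_pow, ← Finset.mul_sum, sum_sph_sq m z.2, mul_one, Real.sin_sq_add_cos_sq]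

theorem cliffSum_sph (e : ℕ → Matrix ι ι ℝ) : ∀ (m l : ℕ) (z : Cube X m),
    cliffSum e l (m + 1) (fun j => sph m j z) = lin e l m (fun _ => e (l + m)) z
  | 0, l, z => by simp [cliffSum, sph, lin]
  | m + 1, l, z => by
    have := cliffSum_sph e m (l + 1) z.2
    rw [cliffSum, Finset.sum_range_succ', lin, show l + (m + 1) = l + 1 + m by ring, ← this]
    simp only [sph, arcTo, cliffSum, Finset.smul_sum, mul_smul]
    rw [add_comm]
    congr 1
    refine Finset.sum_congr rfl fun j _ => ?_
    rw [show l + (j + 1) = l + 1 + j by ring]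

theorem lin_dsum (e : ℕ → Matrix ι ι ℝ) (e' : ℕ → Matrix κ κ ℝ) (ε : X → Matrix ι ι ℝ)
    (ε' : X → Matrix κ κ ℝ) : ∀ (m k : ℕ) (z : Cube X m),
    lin (fun i => dsum (e i) (e' i)) k m (fun x => dsum (ε x) (ε' x)) z =
      dsum (lin e k m ε z) (lin e' k m ε' z)
  | 0, k, z => rfl
  | m + 1, k, z => by simp only [lin, lin_dsum e e' ε ε' m, arcTo_dsum]

theorem reidx_lin [Fintype ι] [Fintype κ] (f : ι ≃ κ) (e : ℕ → Matrix ι ι ℝ)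
    (ε : X → Matrix ι ι ℝ) : ∀ (m k : ℕ) (z : Cube X m),
    reidx f (lin e k m ε z) = lin (fun i => reidx f (e i)) k m (fun x => reidx f (ε x)) z
  | 0, k, z => rfl
  | m + 1, k, z => by simp only [lin, reidx_arcTo, reidx_lin f e ε m]

variable [Fintype ι] [DecidableEq ι] {e : ℕ → Matrix ι ι ℝ}

theorem continuous_lin (e : ℕ → Matrix ι ι ℝ) {ε : X → Matrix ι ι ℝ} (hε : Continuous ε) :
    ∀ (m k : ℕ), Continuous (lin e k m ε)
  | 0, k => hε
  | m + 1, k => continuous_arcTo continuous_const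
      ((continuous_lin e hε m (k + 1)).comp continuous_snd)
      (continuous_subtype_val.comp continuous_fst)

/-- `ε` is an involution on `Y`, compatible with `e 0, …, e (k - 1)`. -/
def InvOn (k : ℕ) (e : ℕ → Matrix ι ι ℝ) (Y : Set X) (ε : X → Matrix ι ι ℝ) : Prop :=
  ∀ x ∈ Y, SA k e (ε x) ∧ ε x * ε x = 1

theorem IsCliff.invOn_lin {Y : Set X} {ε : X → Matrix ι ι ℝ} :
    ∀ {m k : ℕ}, IsCliff (k + m) e → InvOn (k + m) e Y ε → InvOn k e (cubeBd Y m) (lin e k m ε)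
  | 0, k, _, h => h
  | m + 1, k, he, h => by
    have h2 := IsCliff.invOn_lin (m := m) (k := k + 1)
      (by rwa [show k + 1 + m = k + (m + 1) by ring])
      (by rwa [show k + 1 + m = k + (m + 1) by ring])
    rintro z (hz | hz)
    · have h0 : lin e k (m + 1) ε z = Real.cos z.1 • e k := by simp [lin, arcTo, hz]
      rw [h0]
      refine ⟨(he.sa (by omega) le_rfl).smul _, ?_⟩
      have := Real.sin_sq_add_cos_sq z.1
      rw [hz, zero_pow two_ne_zero, zero_add] at this
      rw [smul_mul_smul_comm, he.sq k (by omega), ← pow_two, show Real.cos z.1 ^ 2 = 1 by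
        simpa using this, one_smul]
    · exact ⟨he.sa_arcTo (by omega) ((h2 _ hz).1.mono (by omega)) _,
        he.arcTo_sq (by omega) (h2 _ hz).1 (h2 _ hz).2 _⟩

end Lin

theorem Htpy.congr_left {X Y : Type} [TopologicalSpace X] [TopologicalSpace Y]
    {P : X → Y → Prop} {f f' g : X → Y} (H : Htpy P f g) (h : ∀ x, f' x = f x) : Htpy P f' g :=
  funext h ▸ H

theorem cubeBd_of_sin {X : Type} {Y : Set X} {m : ℕ} {z : Cube X (m + 1)}
    (h : Real.sin z.1 = 0) : z ∈ cubeBd Y (m + 1) := Or.inl h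

/-- A family of self-adjoint units over a cube, linear on the boundary, is stably homotopic to a
linear one. -/
theorem bott_iterate {X : Type} [TopologicalSpace X] [CompactSpace X] {Y : Set X} {N : ℕ} (m : ℕ) :
    ∀ {k : ℕ}, k + m = N → ∀ {ι : Type} [Fintype ι] [DecidableEq ι] {e : ℕ → Matrix ι ι ℝ},
    IsCliff (N + 1) e → ∀ {F : Cube X m → Matrix ι ι ℝ}, Continuous F → (∀ z, SA k e (F z)) →
    (∀ z, IsUnit (F z)) → ∀ {η : X → Matrix ι ι ℝ}, InvOn N e Y η →
    (∀ z ∈ cubeBd Y m, F z = lin e k m η z) →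
    ∃ (κ : Type) (_ : Fintype κ) (_ : DecidableEq κ) (e' : ℕ → Matrix κ κ ℝ),
      IsCliff (N + 1) e' ∧ ∃ ε : X → Matrix (ι ⊕ κ) (ι ⊕ κ) ℝ, Continuous ε ∧
      InvOn N (fun i => dsum (e i) (e' i)) Set.univ ε ∧
      (∀ x ∈ Y, ε x = dsum (η x) (e' N)) ∧
      Htpy (Good k (fun i => dsum (e i) (e' i)) (cubeBd Y m)
        fun z => dsum (F z) (lin e' k m (fun _ => e' N) z))
      (fun z => dsum (F z) (lin e' k m (fun _ => e' N) z))
      (fun z => lin (fun i => dsum (e i) (e' i)) k m ε z) := by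
  induction m with
  | zero =>
    rintro k rfl ι _ _ e he F hF hsa hu η hη hFb
    obtain ⟨R, hR, h0, h1, hRsa, hRu, hRc⟩ := exists_normalize hF hsa hu
    have hE : ∀ c d : Matrix Empty Empty ℝ, c = d := fun c d => Subsingleton.elim _ _
    refine ⟨Empty, inferInstance, inferInstance, fun _ => 0, ⟨fun _ _ => hE _ _,
      fun _ _ => hE _ _, fun _ _ _ _ _ => hE _ _⟩,
      fun x => dsum (R (1, x)) 0, (hR.comp (by fun_prop)).blockSum continuous_const,
      fun x _ => ⟨(hRsa 1 x).blockSum SA.zero, ?_⟩, fun x hx => ?_, ?_⟩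
    · rw [dsum_mul, h1, ← dsum_one]
      exact congrArg (dsum _) (hE _ _)
    · beta_reduce
      rw [hRc x ?_, hFb x hx, lin]
      rw [hFb x hx]
      exact (hη x hx).2
    · refine ⟨fun q => dsum (R q) 0, hR.blockSum continuous_const, fun x => ?_, fun x => rfl,
        fun t _ x => ⟨(hRsa t x).blockSum SA.zero, isUnit_dsum (hRu t x) ⟨1, hE _ _⟩, fun hx => ?_⟩⟩
      · beta_reduce
        rw [h0]
        rfl
      · beta_reduce
        rw [hRc x ?_]
        · rfl
        rw [hFb x hx]
        exact (hη x hx).2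
  | succ m ih =>
    intro k hk ι _ _ e he F hF hsa hu η hη hFb
    obtain rfl : k + 1 + m = N := by omega
    have h0 : ∀ z : Cube X (m + 1), (z.1 : ℝ) = 0 → F z = e k := fun z hz => by
      rw [hFb z (cubeBd_of_sin (by simp [hz]))]
      simp [lin, arcTo, hz]
    have hπ : ∀ z : Cube X (m + 1), (z.1 : ℝ) = Real.pi → F z = -e k := fun z hz => by
      rw [hFb z (cubeBd_of_sin (by simp [hz]))]
      simp [lin, arcTo, hz]
    obtain ⟨κ, _, _, e₁, he₁, ε₁, hε₁, hsa₁, hu₁, hY₁, H₁⟩ := bott_step (p := m + 1)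
      (N := k + 1 + m + 1) rfl he (Y := cubeBd Y m)
      hF hsa hu h0 hπ (η := lin e (k + 1) m η)
      ((he.mono (by omega)).invOn_lin hη) (fun z hz => hFb z (Or.inr hz)) (σ := sph m)
      (continuous_sph m) (sum_sph_sq m)
    simp only [cliffSum_sph] at hY₁ H₁
    obtain ⟨ν, _, _, e₂, he₂, ε, hε, hinv, hY, H₂⟩ := ih rfl (he.blockSum he₁) hε₁ hsa₁ hu₁
      (η := fun x => dsum (η x) (e₁ (k + 1 + m)))
      (fun x hx => ⟨(hη x hx).1.blockSum (he₁.sa (by omega) le_rfl), by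
        rw [dsum_mul, (hη x hx).2, he₁.sq _ (by omega), dsum_one]⟩)
      (fun z hz => by rw [hY₁ z hz, ← lin_dsum])
    have hl₂ : InvOn k e₂ (cubeBd Set.univ (m + 1)) (lin e₂ k (m + 1) fun _ : X => e₂ (k + 1 + m)) :=
      (he₂.mono (by omega)).invOn_lin fun x _ =>
        ⟨he₂.sa (by omega) (by omega), he₂.sq _ (by omega)⟩
    have huniv : ∀ (m : ℕ) (z : Cube X m), z ∈ cubeBd (Set.univ : Set X) m := by
      intro m
      induction m with
      | zero => exact fun z => trivial
      | succ m ih => exact fun z => Or.inr (ih z.2)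
    have K₁ := H₁.blockSum_const (continuous_lin e₂ (ε := fun _ : X => e₂ (k + 1 + m))
      continuous_const (m + 1) k) (fun z => (hl₂ z (huniv (m + 1) z)).1)
      fun z => isUnit_of_mul_self_eq_one (hl₂ z (huniv (m + 1) z)).2
    have hE := he.blockSum he₁
    have hEE := hE.blockSum he₂
    have K₂ := H₂.map (P' := Good k (fun i => dsum (dsum (e i) (e₁ i)) (e₂ i)) (cubeBd Y (m + 1))
      fun z : Cube X (m + 1) => arcTo (dsum (dsum (e k) (e₁ k)) (e₂ k))
        (dsum (ε₁ z.2) (lin e₂ (k + 1) m (fun _ => e₂ (k + 1 + m)) z.2)) z.1)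
      (w := fun z : Cube X (m + 1) => z.2) continuous_snd
      (Φ := fun q => arcTo (dsum (dsum (e k) (e₁ k)) (e₂ k)) q.2 q.1.1)
      (continuous_arcTo continuous_const continuous_snd
        (continuous_subtype_val.comp (continuous_fst.comp continuous_fst)))
      fun z M hM => ⟨hEE.sa_arcTo (by omega) (hM.sa.mono (by omega)) _,
        (hEE.mono (by omega)).isUnit_arcTo hM.sa hM.unit _, fun hz => by
          rcases hz with hz | hz
          · exact arcTo_of_sin_eq_zero _ _ _ hz
          · rw [hM.bd hz]⟩
    have K := (K₁.trans ((K₂.mono fun z M hM => hM.congr fun hz => ⟨hz, ?_⟩).congr_left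
      fun z => ?_)).reidx (Equiv.sumAssoc ι κ ν)
    · refine ⟨κ ⊕ ν, inferInstance, inferInstance, fun i => dsum (e₁ i) (e₂ i), he₁.blockSum he₂,
        fun x => reidx (Equiv.sumAssoc ι κ ν) (ε x), (continuous_reidx _).comp hε,
        fun x hx => ⟨?_, ?_⟩, fun x hx => ?_, ?_⟩
      · simpa only [reidx_dsum_assoc] using (hinv x hx).1.reidx (Equiv.sumAssoc ι κ ν)
      · rw [← reidx_mul, (hinv x hx).2, reidx_one]
      · beta_reduce
        rw [hY x hx, reidx_dsum_assoc]
      · simp only [reidx_dsum_assoc, reidx_arcTo, reidx_lin] at K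
        simp only [lin_dsum, lin, arcTo_dsum] at K ⊢
        exact K
    · refine (arcTo_dsum _ _ _ _ _).trans (congrArg₂ dsum ?_ rfl)
      rcases hz with hz | hz
      · rw [hFb z (Or.inl hz), lin, ← arcTo_dsum]
        exact arcTo_of_sin_eq_zero _ _ _ hz
      · rw [hFb z (Or.inr hz), lin, hY₁ _ hz, arcTo_dsum]
    · exact (arcTo_dsum _ _ _ _ _).symm

section FunctionalCalculus

variable {ι : Type} [Fintype ι] [DecidableEq ι] {A B : Matrix ι ι ℝ}

theorem isSelfAdjoint_of_symm (hA : Aᵀ = A) : IsSelfAdjoint A := by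
  rw [isSelfAdjoint_iff, Matrix.star_eq_conjTranspose, Matrix.conjTranspose_eq_transpose_of_trivial,
    hA]

theorem continuousOn_matrix_spectrum (A : Matrix ι ι ℝ) (f : ℝ → ℝ) :
    ContinuousOn f (spectrum ℝ A) :=
  (Matrix.finite_real_spectrum (A := A)).continuousOn f

theorem fc_mul (f g : ℝ → ℝ) :
    cfc f A * cfc g A = cfc (fun x => f x * g x) A := by
  rw [cfc_mul f g A (continuousOn_matrix_spectrum A f) (continuousOn_matrix_spectrum A g)]

theorem fc_symm (f : ℝ → ℝ) : (cfc f A)ᵀ = cfc f A := by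
  have := (IsSelfAdjoint.cfc (f := f) (a := A) : IsSelfAdjoint (cfc f A))
  rwa [isSelfAdjoint_iff, Matrix.star_eq_conjTranspose,
    Matrix.conjTranspose_eq_transpose_of_trivial] at this

theorem fc_id (hA : Aᵀ = A) : cfc (fun x : ℝ => x) A = A :=
  cfc_id' ℝ A (isSelfAdjoint_of_symm hA)

theorem fc_one (hA : Aᵀ = A) : cfc (fun _ : ℝ => (1 : ℝ)) A = 1 :=
  cfc_const_one ℝ A (isSelfAdjoint_of_symm hA)

theorem fc_self_mul (hA : Aᵀ = A) (f : ℝ → ℝ) : A * cfc f A = cfc (fun x => x * f x) A := by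
  rw [← fc_mul (fun x => x) f, fc_id hA]

theorem fc_mul_self (hA : Aᵀ = A) (f : ℝ → ℝ) : cfc f A * A = cfc (fun x => f x * x) A := by
  rw [← fc_mul f (fun x => x), fc_id hA]

theorem fc_comm (hA : Aᵀ = A) (h : A * B = B * A) (f : ℝ → ℝ) : cfc f A * B = B * cfc f A := by
  have h1 : Commute A B := h
  have h2 : Commute (star A) B := by rw [(isSelfAdjoint_of_symm hA).star_eq]; exact h1
  exact h1.cfc h2 f

/-- The range projections of nonnegative functions: a nonzero symmetric matrix `Z` has a polar
part whose square is a nonzero projection. -/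
theorem exists_polar_part {Z : Matrix ι ι ℝ} (hZ : Zᵀ = Z) (h0 : Z ≠ 0) :
    ∃ C : Matrix ι ι ℝ, Cᵀ = C ∧ (∀ B, Z * Z * B = B * (Z * Z) → C * B = B * C) ∧
      Z * C = C * Z ∧ (Z * C) * (Z * C) ≠ 0 ∧
      (Z * C) * (Z * C) * ((Z * C) * (Z * C)) = (Z * C) * (Z * C) := by
  have hY : (Z * Z)ᵀ = Z * Z := by rw [Matrix.transpose_mul, hZ]
  set φ : ℝ → ℝ := fun x => (√x)⁻¹ with hφ
  set C := cfc φ (Z * Z) with hC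
  have hZC : Z * C = C * Z := (fc_comm hY (by noncomm_ring) φ).symm
  have hsq : (Z * C) * (Z * C) = cfc (fun x => x * (φ x * φ x)) (Z * Z) := by
    rw [← fc_self_mul hY, ← fc_mul, ← hC]
    calc Z * C * (Z * C) = Z * (C * Z) * C := by noncomm_ring
      _ = _ := by rw [← hZC]; noncomm_ring
  have hpos : ∀ x ∈ spectrum ℝ (Z * Z), 0 ≤ x := by
    have h : (Z * Z).PosSemidef := by simpa [hZ] using psd_self_mul_transpose Z
    intro x hx
    rw [h.isHermitian.spectrum_real_eq_range_eigenvalues] at hx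
    obtain ⟨i, rfl⟩ := hx
    exact h.eigenvalues_nonneg i
  refine ⟨C, fc_symm _, fun B hB => fc_comm hY hB φ, hZC, ?_, ?_⟩
  · rw [hsq]
    intro h
    have h2 : Z * Z = 0 := by
      have := fc_self_mul hY (fun x => x * (φ x * φ x))
      rw [h, mul_zero] at this
      rw [this, ← fc_id hY]
      nth_rw 1 3 [← fc_id hY]
      rw [fc_id hY]
      refine cfc_congr fun x hx => ?_
      have := hpos x hx
      rcases this.eq_or_lt with h | h
      · simp [← h]
      · have h3 := Real.mul_self_sqrt this
        have h4 : √x ≠ 0 := (Real.sqrt_pos.2 h).ne'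
        simp only [hφ]
        field_simp
        nlinarith
    apply h0
    have h3 : Zᵀ * Z = 0 := by rw [hZ, h2]
    rw [← Matrix.conjTranspose_eq_transpose_of_trivial] at h3
    exact Matrix.conjTranspose_mul_self_eq_zero.1 h3
  · rw [hsq, fc_mul]
    refine cfc_congr fun x _ => ?_
    simp only [hφ]
    rcases le_or_gt x 0 with h | h
    · simp [Real.sqrt_eq_zero_of_nonpos h]
    · have h3 := Real.mul_self_sqrt h.le
      have h4 : √x ≠ 0 := (Real.sqrt_pos.2 h).ne'
      have : x * ((√x)⁻¹ * (√x)⁻¹) = 1 := by field_simp; nlinarith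
      rw [this, one_mul]

/-- A symmetric `h` supported on a projection `p` that is not a multiple of `p` has a spectral
projection strictly between `0` and `p`. -/
theorem exists_spectral_split {p h : Matrix ι ι ℝ} (hp : pᵀ = p) (hpp : p * p = p) (h0 : p ≠ 0)
    (hh : hᵀ = h) (hph : p * h = h) (hns : ∀ c : ℝ, h ≠ c • p) :
    ∃ q : Matrix ι ι ℝ, qᵀ = q ∧ q * q = q ∧ p * q = q ∧ q ≠ 0 ∧ q ≠ p ∧
      ∀ B, h * B = B * h → p * B = B * p → q * B = B * q := by
  have hhp : h * p = h := by
    have := congrArg Matrix.transpose hph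
    rwa [Matrix.transpose_mul, hh, hp] at this
  have hcom : h * p = p * h := by rw [hhp, hph]
  set δ : ℝ → ℝ → ℝ := fun c x => if x = c then 1 else 0 with hδ
  have hs : ∃ c : ℝ, cfc (δ c) h * p ≠ 0 := by
    by_contra! H
    set S := (Matrix.finite_real_spectrum (A := h)).toFinset
    have h1 : cfc (∑ c ∈ S, δ c) h = 1 := by
      rw [← fc_one hh]
      refine cfc_congr fun x hx => ?_
      have hx' : x ∈ S := by simpa [S] using hx
      simp [hδ, Finset.sum_ite_eq, hx']
    rw [cfc_sum _ _ _ fun c _ => continuousOn_matrix_spectrum h _] at h1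
    apply h0
    rw [← one_mul p, ← h1, Finset.sum_mul]
    exact Finset.sum_eq_zero fun c _ => H c
  obtain ⟨c, hc⟩ := hs
  have hδp : cfc (δ c) h * p = p * cfc (δ c) h := fc_comm hh hcom _
  have hδδ : cfc (δ c) h * cfc (δ c) h = cfc (δ c) h := by
    rw [fc_mul]; congr 1; ext x; simp [hδ]
  refine ⟨cfc (δ c) h * p, ?_, ?_, ?_, hc, ?_, ?_⟩
  · rw [Matrix.transpose_mul, fc_symm, hp, hδp]
  · calc cfc (δ c) h * p * (cfc (δ c) h * p) = cfc (δ c) h * (p * cfc (δ c) h) * p := by noncomm_ring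
      _ = cfc (δ c) h * cfc (δ c) h * (p * p) := by rw [← hδp]; noncomm_ring
      _ = _ := by rw [hδδ, hpp]
  · rw [← mul_assoc, ← hδp, mul_assoc, hpp]
  · intro H
    apply hns c
    calc h = h * p := hhp.symm
      _ = h * cfc (δ c) h * p := by rw [mul_assoc, H]
      _ = c • p := by
        rw [fc_self_mul hh]
        have : (fun x => x * δ c x) = fun x => c • δ c x := by
          ext x; by_cases hx : x = c <;> simp [hδ, hx]
        rw [this, cfc_smul _ _ _ (continuousOn_matrix_spectrum h _), smul_mul_assoc, H]
  · intro B hB hpB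
    rw [mul_assoc, hpB, ← mul_assoc, fc_comm hh hB, mul_assoc]

end FunctionalCalculus

/-- `m` anticommuting symmetric square roots of the symmetric idempotent `p`, in the corner
of `p`: a Clifford module structure on the range of `p`. -/
structure CornerCliff {ι : Type} [Fintype ι] (p : Matrix ι ι ℝ) (m : ℕ)
    (f : ℕ → Matrix ι ι ℝ) : Prop where
  psymm : pᵀ = p
  idem : p * p = p
  symm : ∀ i < m, (f i)ᵀ = f i
  sq : ∀ i < m, f i * f i = p
  corner : ∀ i < m, p * f i = f i
  anti : ∀ i < m, ∀ j < m, i ≠ j → f i * f j = -(f j * f i)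

/-- The product of the `f i`, `i ∈ A`, `i < k`, in decreasing order. -/
def mon {ι : Type} [Fintype ι] (p : Matrix ι ι ℝ) (f : ℕ → Matrix ι ι ℝ) :
    ℕ → Finset ℕ → Matrix ι ι ℝ
  | 0, _ => p
  | k + 1, A => if k ∈ A then f k * mon p f k A else mon p f k A

/-- The (signed) averaging operator over the monomials in `f 0, …, f (k - 1)`. -/
def cliffAvg {ι : Type} [Fintype ι] (σ : ℝ) (f : ℕ → Matrix ι ι ℝ) :
    ℕ → Matrix ι ι ℝ → Matrix ι ι ℝ
  | 0, z => z
  | k + 1, z => cliffAvg σ f k z + σ • (f k * cliffAvg σ f k z * f k)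

section Corner

variable {ι : Type} [Fintype ι] {p : Matrix ι ι ℝ} {m : ℕ} {f : ℕ → Matrix ι ι ℝ}

theorem subset_range_succ_cases {k : ℕ} {A : Finset ℕ} (hA : A ⊆ Finset.range (k + 1)) :
    A ⊆ Finset.range k ∨ ∃ B ⊆ Finset.range k, A = insert k B := by
  by_cases hk : k ∈ A
  · refine Or.inr ⟨A.erase k, fun i hi => ?_, (Finset.insert_erase hk).symm⟩
    have := Finset.mem_range.1 (hA (Finset.mem_of_mem_erase hi))
    have := Finset.ne_of_mem_erase hi
    rw [Finset.mem_range]; omega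
  · refine Or.inl fun i hi => ?_
    have := Finset.mem_range.1 (hA hi)
    have : i ≠ k := fun h => hk (h ▸ hi)
    rw [Finset.mem_range]; omega

theorem notMem_of_subset_range {k : ℕ} {A : Finset ℕ} (hA : A ⊆ Finset.range k) : k ∉ A :=
  fun h => lt_irrefl k (Finset.mem_range.1 (hA h))

theorem mon_congr {A B : Finset ℕ} : ∀ k : ℕ, (∀ i < k, i ∈ A ↔ i ∈ B) →
    mon p f k A = mon p f k B
  | 0, _ => rfl
  | k + 1, h => by
    have h1 := h k (Nat.lt_succ_self k)
    have h2 := mon_congr k fun i hi => h i (hi.trans (Nat.lt_succ_self k))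
    simp only [mon, h1, h2]

theorem mon_succ_of_subset {k : ℕ} {A : Finset ℕ} (hA : A ⊆ Finset.range k) :
    mon p f (k + 1) A = mon p f k A := by
  simp [mon, notMem_of_subset_range hA]

theorem mon_succ_insert {k : ℕ} {A : Finset ℕ} :
    mon p f (k + 1) (insert k A) = f k * mon p f k A := by
  have : mon p f k (insert k A) = mon p f k A :=
    mon_congr k fun i hi => by simp [hi.ne]
  simp [mon, this]

theorem mon_empty : ∀ k : ℕ, mon p f k ∅ = p
  | 0 => rfl
  | k + 1 => by simp [mon, mon_empty k]

variable (h : CornerCliff p m f)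
include h

theorem CornerCliff.corner' {i : ℕ} (hi : i < m) : f i * p = f i := by
  have := congrArg Matrix.transpose (h.corner i hi)
  rwa [Matrix.transpose_mul, h.symm i hi, h.psymm] at this

theorem CornerCliff.mul_mon (A : Finset ℕ) : ∀ k ≤ m, p * mon p f k A = mon p f k A
  | 0, _ => h.idem
  | k + 1, hk => by
    rw [mon]
    split_ifs
    · rw [← mul_assoc, h.corner k (by omega)]
    · exact CornerCliff.mul_mon A k (by omega)

theorem CornerCliff.mon_mul (A : Finset ℕ) : ∀ k ≤ m, mon p f k A * p = mon p f k A
  | 0, _ => h.idem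
  | k + 1, hk => by
    rw [mon]
    split_ifs
    · rw [mul_assoc, CornerCliff.mon_mul A k (by omega)]
    · exact CornerCliff.mon_mul A k (by omega)

theorem CornerCliff.gen_mul_mon {j : ℕ} (hj : j < m) : ∀ k ≤ m, ∀ A ⊆ Finset.range k,
    f j * mon p f k A = ((-1) ^ A.card * if j ∈ A then -1 else 1 : ℝ) • (mon p f k A * f j)
  | 0, _, A, hA => by
    have : A = ∅ := by simpa using hA
    simp [this, mon, h.corner j hj, h.corner' hj]
  | k + 1, hk, A, hA => by
    rcases subset_range_succ_cases hA with hA' | ⟨B, hB, rfl⟩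
    · rw [mon_succ_of_subset hA']
      exact CornerCliff.gen_mul_mon hj k (by omega) A hA'
    · have hkB := notMem_of_subset_range hB
      rw [mon_succ_insert, Finset.card_insert_of_notMem hkB]
      have ih := CornerCliff.gen_mul_mon hj k (by omega) B hB
      by_cases hjk : j = k
      · subst hjk
        have e : f j * mon p f j B * f j = f j * (mon p f j B * f j) := mul_assoc _ _ _
        have e2 : mon p f j B * f j = ((-1) ^ B.card : ℝ) • (f j * mon p f j B) := by
          rw [ih, smul_smul]
          simp [hkB, ← mul_pow]
        rw [e, e2, mul_smul_comm, smul_smul]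
        simp only [Finset.mem_insert, true_or, if_true]
        have e3 : ((-1) ^ (B.card + 1) * -1 * (-1) ^ B.card : ℝ) = 1 := by
          rw [pow_succ, mul_assoc, mul_assoc, neg_one_mul, neg_one_mul, neg_neg, ← mul_pow]
          simp
        rw [e3, one_smul]
      · rw [← mul_assoc, h.anti j hj k (by omega) hjk, neg_mul, mul_assoc, ih, mul_smul_comm,
          ← neg_smul, mul_assoc]
        congr 1
        simp only [Finset.mem_insert, hjk, false_or]
        ring

theorem CornerCliff.transpose_mon : ∀ k ≤ m, ∀ A ⊆ Finset.range k,
    (mon p f k A)ᵀ = ((-1) ^ (A.card.choose 2) : ℝ) • mon p f k A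
  | 0, _, A, hA => by
    have : A = ∅ := by simpa using hA
    simp [this, mon, h.psymm]
  | k + 1, hk, A, hA => by
    rcases subset_range_succ_cases hA with hA' | ⟨B, hB, rfl⟩
    · rw [mon_succ_of_subset hA']
      exact CornerCliff.transpose_mon k (by omega) A hA'
    · have hkB := notMem_of_subset_range hB
      have ih := h.gen_mul_mon (j := k) (by omega) k (by omega) B hB
      rw [mon_succ_insert, Finset.card_insert_of_notMem hkB, Matrix.transpose_mul,
        h.symm k (by omega), CornerCliff.transpose_mon k (by omega) B hB, ih, smul_smul, smul_mul_assoc]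
      congr 1
      have : (B.card + 1).choose 2 = B.card + B.card.choose 2 := by
        rw [Nat.choose_succ_succ' B.card 1]; simp
      rw [this, pow_add]
      simp only [hkB, if_false, mul_one]
      rw [mul_right_comm, ← mul_pow]
      simp

theorem CornerCliff.transpose_mon_mul : ∀ k ≤ m, ∀ A : Finset ℕ,
    (mon p f k A)ᵀ * mon p f k A = p
  | 0, _, A => by rw [mon, h.psymm, h.idem]
  | k + 1, hk, A => by
    rw [mon]
    split_ifs
    · rw [Matrix.transpose_mul, h.symm k (by omega), mul_assoc, ← mul_assoc (f k),
        h.sq k (by omega), h.mul_mon A k (by omega), CornerCliff.transpose_mon_mul k (by omega)]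
    · exact CornerCliff.transpose_mon_mul k (by omega) A

theorem CornerCliff.mon_mul_self {A : Finset ℕ} {k : ℕ} (hk : k ≤ m) (hA : A ⊆ Finset.range k) :
    mon p f k A * mon p f k A = ((-1) ^ (A.card.choose 2) : ℝ) • p := by
  have h1 := h.transpose_mon_mul k hk A
  rw [h.transpose_mon k hk A hA, smul_mul_assoc] at h1
  have h2 := congrArg (((-1) ^ (A.card.choose 2) : ℝ) • ·) h1
  simpa only [smul_smul, ← mul_pow, neg_one_mul, neg_neg, one_pow, one_smul] using h2

theorem CornerCliff.trace_mon_eq_zero {A : Finset ℕ} (hA : A ⊆ Finset.range m) (hne : A ≠ ∅)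
    (hfull : A = Finset.range m → Even m) : (mon p f m A).trace = 0 := by
  obtain ⟨j, hj, hs⟩ : ∃ j < m, ((-1) ^ A.card * if j ∈ A then -1 else 1 : ℝ) = -1 := by
    rcases Nat.even_or_odd A.card with hc | hc
    · obtain ⟨j, hj⟩ := Finset.nonempty_iff_ne_empty.2 hne
      exact ⟨j, Finset.mem_range.1 (hA hj), by simp [hj, hc.neg_one_pow]⟩
    · have : A ≠ Finset.range m := fun H => by
        rw [H, Finset.card_range] at hc
        exact Nat.not_even_iff_odd.2 hc (hfull H)
      obtain ⟨j, hj, hjA⟩ := Finset.exists_of_ssubset (hA.ssubset_of_ne this)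
      exact ⟨j, Finset.mem_range.1 hj, by simp [hjA, hc.neg_one_pow]⟩
  have h1 := h.gen_mul_mon hj m le_rfl A hA
  rw [hs] at h1
  have h2 : (f j * (mon p f m A * f j)).trace = (mon p f m A).trace := by
    rw [Matrix.trace_mul_comm, mul_assoc, h.sq j hj, h.mon_mul A m le_rfl]
  have h3 : (f j * (mon p f m A * f j)).trace = -(mon p f m A).trace := by
    rw [← mul_assoc, h1, smul_mul_assoc, mul_assoc, h.sq j hj, h.mon_mul A m le_rfl]
    simp
  linarith

theorem CornerCliff.cliffAvg_eq_sum (σ : ℝ) (z : Matrix ι ι ℝ) (hz : p * z * p = z) : ∀ k ≤ m,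
    cliffAvg σ f k z = ∑ A ∈ (Finset.range k).powerset,
      σ ^ A.card • (mon p f k A * z * (mon p f k A)ᵀ)
  | 0, _ => by simp [cliffAvg, mon, h.psymm, hz]
  | k + 1, hk => by
    rw [cliffAvg, Finset.range_add_one, Finset.sum_powerset_insert (by simp),
      CornerCliff.cliffAvg_eq_sum σ z hz k (by omega)]
    congr 1
    · refine Finset.sum_congr rfl fun A hA => ?_
      rw [mon_succ_of_subset (Finset.mem_powerset.1 hA)]
    · rw [Finset.mul_sum, Finset.sum_mul, Finset.smul_sum]
      refine Finset.sum_congr rfl fun A hA => ?_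
      rw [mon_succ_insert, Finset.card_insert_of_notMem
        (notMem_of_subset_range (Finset.mem_powerset.1 hA)), Matrix.transpose_mul,
        h.symm k (by omega), mul_smul_comm, smul_mul_assoc, smul_smul, pow_succ, mul_comm σ]
      simp only [mul_assoc]

theorem CornerCliff.mul_cliffAvg {σ : ℝ} (hσ : σ * σ = 1) {z : Matrix ι ι ℝ} (hz : p * z * p = z) :
    ∀ k ≤ m, (∀ j < k, f j * cliffAvg σ f k z = σ • (cliffAvg σ f k z * f j)) ∧
      p * cliffAvg σ f k z = cliffAvg σ f k z ∧ cliffAvg σ f k z * p = cliffAvg σ f k z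
  | 0, _ => by
    refine ⟨by simp, ?_, ?_⟩ <;> rw [cliffAvg, ← hz]
    · simp only [← mul_assoc, h.idem]
    · simp only [mul_assoc, h.idem]
  | k + 1, hk => by
    obtain ⟨h1, h2, h3⟩ := CornerCliff.mul_cliffAvg hσ hz k (by omega)
    have hk' := h.sq k (by omega)
    rw [cliffAvg]
    set R := cliffAvg σ f k z
    refine ⟨fun j hj => ?_, ?_, ?_⟩
    · rcases (Nat.lt_succ_iff_lt_or_eq.1 hj) with hj | rfl
      · have a := h.anti j (by omega) k (by omega) hj.ne
        have e : f j * (f k * R * f k) = σ • (f k * R * f k * f j) := by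
          calc f j * (f k * R * f k) = (f j * f k) * R * f k := by noncomm_ring
            _ = -(f k * (f j * R) * f k) := by rw [a]; noncomm_ring
            _ = -(σ • (f k * R * (f j * f k))) := by
              rw [h1 j hj, mul_smul_comm, smul_mul_assoc]; simp only [mul_assoc]
            _ = _ := by rw [a, mul_neg, smul_neg, neg_neg]; simp only [mul_assoc]
        rw [mul_add, h1 j hj, mul_smul_comm, e, add_mul, smul_mul_assoc, smul_add]
      · have e1 : f j * (f j * R * f j) = R * f j := by
          rw [← mul_assoc, ← mul_assoc, hk', h2]
        have e2 : f j * R * f j * f j = f j * R := by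
          rw [mul_assoc, hk', mul_assoc, h3]
        rw [mul_add, mul_smul_comm, e1, add_mul, smul_mul_assoc, e2, smul_add, smul_smul, hσ,
          one_smul, add_comm]
    · rw [mul_add, h2, mul_smul_comm, ← mul_assoc, ← mul_assoc, h.corner k (by omega)]
    · rw [add_mul, h3, smul_mul_assoc, mul_assoc, h.corner' (i := k) (by omega)]

theorem CornerCliff.transpose_cliffAvg (σ : ℝ) {z : Matrix ι ι ℝ} (hz : zᵀ = z) :
    ∀ k ≤ m, (cliffAvg σ f k z)ᵀ = cliffAvg σ f k z
  | 0, _ => hz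
  | k + 1, hk => by
    rw [cliffAvg, Matrix.transpose_add, CornerCliff.transpose_cliffAvg σ hz k (by omega),
      Matrix.transpose_smul, Matrix.transpose_mul, Matrix.transpose_mul,
      CornerCliff.transpose_cliffAvg σ hz k (by omega), h.symm k (by omega), mul_assoc]

end Corner

/-- The signed count `∑ σ ^ |A| q(A)` over subsets of an `m`-element set, where `q(A)` is the
sign of the square of a monomial. -/
noncomputable def signCount (σ : ℝ) (m : ℕ) : ℝ :=
  ∑ A ∈ (Finset.range m).powerset, σ ^ A.card * (-1) ^ (A.card.choose 2)

theorem signCount_zero (σ : ℝ) : signCount σ 0 = 1 := by simp [signCount]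

theorem signCount_succ (σ : ℝ) (m : ℕ) :
    signCount σ (m + 1) = signCount σ m + σ * signCount (-σ) m := by
  rw [signCount, Finset.range_add_one, Finset.sum_powerset_insert (by simp), signCount,
    signCount, Finset.mul_sum]
  congr 1
  refine Finset.sum_congr rfl fun A hA => ?_
  rw [Finset.card_insert_of_notMem (notMem_of_subset_range (Finset.mem_powerset.1 hA))]
  have : (A.card + 1).choose 2 = A.card + A.card.choose 2 := by
    rw [Nat.choose_succ_succ' A.card 1]; simp
  rw [this, pow_add, neg_pow]
  ring

theorem signCount_add_four {σ : ℝ} (hσ : σ * σ = 1) (m : ℕ) :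
    signCount σ (m + 4) = -4 * signCount σ m := by
  have h2 : ∀ {σ : ℝ}, σ * σ = 1 → ∀ m, signCount σ (m + 2) = 2 * σ * signCount (-σ) m := by
    intro σ hσ m
    rw [signCount_succ, signCount_succ, signCount_succ (-σ), neg_neg]
    linear_combination (-signCount σ m) * hσ
  rw [h2 hσ (m + 2), h2 (by rw [neg_mul_neg, hσ]) m, neg_neg]
  linear_combination (-4 * signCount σ m) * hσ

theorem signCount_add_mul_eight {σ : ℝ} (hσ : σ * σ = 1) (m j : ℕ) :
    signCount σ (m + 8 * j) = 16 ^ j * signCount σ m := by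
  induction j with
  | zero => simp
  | succ j ih =>
    rw [show m + 8 * (j + 1) = (m + 8 * j) + 4 + 4 by ring, signCount_add_four hσ,
      signCount_add_four hσ, ih]
    ring

section Identity

variable {ι : Type} [Fintype ι] [DecidableEq ι]

/-- The symmetrised matrix unit. -/
def symUnit (i j : ι) : Matrix ι ι ℝ := Matrix.single i j 1 + Matrix.single j i 1

theorem mul_single_mul_apply (a b : Matrix ι ι ℝ) (i j k l : ι) :
    (a * (Matrix.single i j 1 : Matrix ι ι ℝ) * b : Matrix ι ι ℝ) k l = a k i * b j l := by
  rw [Matrix.mul_apply, Finset.sum_eq_single j]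
  · simp
  · intro c _ hc
    rw [Matrix.mul_single_apply_of_ne _ _ _ _ _ hc, zero_mul]
  · simp

/-- Trace of the conjugation operator on symmetric matrices. -/
theorem sum_conj_single (a : Matrix ι ι ℝ) :
    ∑ i, ∑ j, (a * symUnit i j * aᵀ : Matrix ι ι ℝ) i j =
      a.trace ^ 2 + (a * a).trace := by
  simp only [symUnit, mul_add, add_mul, Matrix.add_apply, mul_single_mul_apply, Matrix.transpose_apply,
    Finset.sum_add_distrib]
  congr 1
  · rw [sq, Matrix.trace, Finset.sum_mul_sum]; rfl

variable {p : Matrix ι ι ℝ} {m : ℕ} {f : ℕ → Matrix ι ι ℝ}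

theorem CornerCliff.sum_cliffAvg (h : CornerCliff p m f) (hm : 0 < m) (σ : ℝ) :
    ∑ i, ∑ j, (cliffAvg σ f m (p * symUnit i j * p)) i j =
      p.trace ^ 2 + signCount σ m * p.trace +
        σ ^ m * (mon p f m (Finset.range m)).trace ^ 2 := by
  have hz : ∀ i j, p * (p * symUnit i j * p) * p =
      p * symUnit i j * p := fun i j => by
    simp only [← mul_assoc, h.idem]; rw [mul_assoc, h.idem]
  have hT : ∀ A ⊆ Finset.range m, ∑ i, ∑ j, (mon p f m A *
      (p * symUnit i j * p) * (mon p f m A)ᵀ : Matrix ι ι ℝ) i j =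
      (mon p f m A).trace ^ 2 + (-1) ^ (A.card.choose 2) * p.trace := fun A hA => by
    have e : ∀ i j : ι, mon p f m A * (p * symUnit i j * p) *
        (mon p f m A)ᵀ =
        mon p f m A * symUnit i j * (mon p f m A)ᵀ := fun i j => by
      have h1 := h.mon_mul A m le_rfl
      have h2 := congrArg Matrix.transpose h1
      rw [Matrix.transpose_mul, h.psymm] at h2
      calc _ = (mon p f m A * p) * symUnit i j *
            (p * (mon p f m A)ᵀ) := by simp only [mul_assoc]
        _ = _ := by rw [h1, h2]
    simp only [e]
    rw [sum_conj_single, h.mon_mul_self le_rfl hA, Matrix.trace_smul, smul_eq_mul]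
  have e1 : ∑ i, ∑ j, (cliffAvg σ f m (p * symUnit i j * p)) i j =
      ∑ A ∈ (Finset.range m).powerset, σ ^ A.card *
        ((mon p f m A).trace ^ 2 + (-1) ^ (A.card.choose 2) * p.trace) := by
    simp only [fun i j => h.cliffAvg_eq_sum σ _ (hz i j) m le_rfl, Matrix.sum_apply,
      Matrix.smul_apply, smul_eq_mul]
    have : ∀ i : ι, ∑ j, ∑ A ∈ (Finset.range m).powerset, σ ^ A.card *
        (mon p f m A * (p * symUnit i j * p) *
          (mon p f m A)ᵀ : Matrix ι ι ℝ) i j = ∑ A ∈ (Finset.range m).powerset, σ ^ A.card * ∑ j,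
        (mon p f m A * (p * symUnit i j * p) *
          (mon p f m A)ᵀ : Matrix ι ι ℝ) i j := fun i => by
      rw [Finset.sum_comm]; simp only [Finset.mul_sum]
    simp only [this]
    rw [Finset.sum_comm]
    refine Finset.sum_congr rfl fun A hA => ?_
    rw [← Finset.mul_sum, hT A (Finset.mem_powerset.1 hA)]
  rw [e1]
  simp only [mul_add, Finset.sum_add_distrib]
  have e2 : ∑ A ∈ (Finset.range m).powerset, σ ^ A.card * (mon p f m A).trace ^ 2 =
      p.trace ^ 2 + σ ^ m * (mon p f m (Finset.range m)).trace ^ 2 := by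
    rw [Finset.sum_eq_add (∅ : Finset ℕ) (Finset.range m)]
    · simp [mon_empty]
    · intro H
      have := Finset.mem_range.2 hm
      rw [← H] at this
      simp at this
    · rintro A hA ⟨h1, h2⟩
      rw [h.trace_mon_eq_zero (Finset.mem_powerset.1 hA) h1 fun H => absurd H h2]
      simp
    · simp
    · simp
  rw [e2, signCount, Finset.sum_mul]
  simp only [mul_assoc]
  ring

theorem exists_nat_trace {q : Matrix ι ι ℝ} (hq : q * q = q) : ∃ k : ℕ, q.trace = k := by
  have h : IsIdempotentElem (Matrix.toLin' q) := by
    rw [IsIdempotentElem, Module.End.mul_eq_comp, ← Matrix.toLin'_mul, hq]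
  have := (LinearMap.IsIdempotentElem.isProj_range _ h).trace
  rw [Matrix.trace_toLin'_eq] at this
  exact ⟨_, this⟩

theorem trace_pos_of_idem {q : Matrix ι ι ℝ} (hs : qᵀ = q) (hq : q * q = q) (h0 : q ≠ 0) :
    0 < q.trace := by
  have h : q.trace = (qᵀ * q).trace := by rw [hs, hq]
  have h1 : 0 ≤ q.trace := by
    rw [h, Matrix.trace]
    refine Finset.sum_nonneg fun i _ => ?_
    rw [Matrix.diag_apply, Matrix.mul_apply]
    exact Finset.sum_nonneg fun j _ => mul_self_nonneg _
  refine h1.lt_of_ne fun h2 => h0 ?_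
  rw [h, ← Matrix.conjTranspose_eq_transpose_of_trivial] at h2
  exact Matrix.trace_conjTranspose_mul_self_eq_zero_iff.1 h2.symm

end Identity

/-- `q` is the projection onto a Clifford submodule of the range of `p`. -/
structure Submod {ι : Type} [Fintype ι] (p : Matrix ι ι ℝ) (m : ℕ) (f : ℕ → Matrix ι ι ℝ)
    (q : Matrix ι ι ℝ) : Prop where
  symm : qᵀ = q
  idem : q * q = q
  le : p * q = q
  comm : ∀ i < m, q * f i = f i * q

/-- The Clifford module structure on the range of `q` extends by one more generator. -/
def HasExt {ι : Type} [Fintype ι] (m : ℕ) (f : ℕ → Matrix ι ι ℝ) (q : Matrix ι ι ℝ) : Prop :=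
  ∃ ζ : Matrix ι ι ℝ, ζᵀ = ζ ∧ ζ * ζ = q ∧ q * ζ = ζ ∧ ∀ i < m, ζ * f i = -(f i * ζ)

section Submodules

variable {ι : Type} [Fintype ι] [DecidableEq ι] {p q q' : Matrix ι ι ℝ} {m : ℕ}
  {f : ℕ → Matrix ι ι ℝ}

theorem mul_eq_of_le {q : Matrix ι ι ℝ} (hp : pᵀ = p) (hq : qᵀ = q) (h : p * q = q) :
    q * p = q := by
  have := congrArg Matrix.transpose h
  rwa [Matrix.transpose_mul, hp, hq] at this

theorem Submod.le' (hp : CornerCliff p m f) (h : Submod p m f q) : q * p = q :=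
  mul_eq_of_le hp.psymm h.symm h.le

theorem CornerCliff.self (hp : CornerCliff p m f) : Submod p m f p :=
  ⟨hp.psymm, hp.idem, hp.idem, fun i hi => by rw [hp.corner i hi, hp.corner' hi]⟩

theorem Submod.sub (h : Submod p m f q) (h' : Submod p m f q')
    (hq : q * q' = q') : Submod p m f (q - q') := by
  have h1 := mul_eq_of_le h.symm h'.symm hq
  refine ⟨by rw [Matrix.transpose_sub, h.symm, h'.symm], ?_, by rw [mul_sub, h.le, h'.le],
    fun i hi => by rw [sub_mul, mul_sub, h.comm i hi, h'.comm i hi]⟩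
  rw [mul_sub, sub_mul, sub_mul, h.idem, hq, h1, h'.idem, sub_self, sub_zero]

theorem Submod.cornerCliff (hp : CornerCliff p m f) (h : Submod p m f q) :
    CornerCliff q m fun i => q * f i := by
  refine ⟨h.symm, h.idem, fun i hi => ?_, fun i hi => ?_, fun i hi => ?_, fun i hi j hj hij => ?_⟩
  · rw [Matrix.transpose_mul, hp.symm i hi, h.symm, h.comm i hi]
  · rw [mul_assoc, ← mul_assoc (f i), ← h.comm i hi, mul_assoc, hp.sq i hi, h.le' hp, h.idem]
  · rw [← mul_assoc, h.idem]
  · rw [mul_assoc, ← mul_assoc (f i), ← h.comm i hi, mul_assoc, ← mul_assoc q q, h.idem,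
      hp.anti i hi j hj hij, mul_assoc q (f j), ← mul_assoc (f j), ← h.comm j hj, mul_assoc q,
      ← mul_assoc q q, h.idem, mul_neg]

theorem Submod.mon_corner (hp : CornerCliff p m f) (h : Submod p m f q) (A : Finset ℕ) :
    ∀ k ≤ m, mon q (fun i => q * f i) k A = q * mon p f k A
  | 0, _ => (h.le' hp).symm
  | k + 1, hk => by
    rw [mon, mon]
    split_ifs
    · rw [Submod.mon_corner hp h A k (by omega), mul_assoc, ← mul_assoc (f k),
        ← h.comm k (by omega), mul_assoc q (f k), ← mul_assoc q q, h.idem]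
    · exact Submod.mon_corner hp h A k (by omega)

theorem Submod.trans (h : Submod p m f q)
    (h' : Submod q m (fun i => q * f i) q') : Submod p m f q' := by
  have h1 := mul_eq_of_le h.symm h'.symm h'.le
  refine ⟨h'.symm, h'.idem, ?_, fun i hi => ?_⟩
  · rw [← h'.le, ← mul_assoc, h.le]
  · have := h'.comm i hi
    rw [← mul_assoc, h1, h.comm i hi, mul_assoc, h'.le] at this
    exact this

theorem HasExt.add (h : Submod p m f q) (h' : Submod p m f q')
    (hq : q * q' = q') (h1 : HasExt m f q') (h2 : HasExt m f (q - q')) : HasExt m f q := by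
  obtain ⟨ζ, a1, a2, a3, a4⟩ := h1
  obtain ⟨ξ, b1, b2, b3, b4⟩ := h2
  have hq' := mul_eq_of_le h.symm h'.symm hq
  have a3' := mul_eq_of_le h'.symm a1 a3
  have b3' := mul_eq_of_le (h.sub h' hq).symm b1 b3
  have e1 : q' * (q - q') = 0 := by rw [mul_sub, hq', h'.idem, sub_self]
  have e2 : (q - q') * q' = 0 := by rw [sub_mul, hq, h'.idem, sub_self]
  have c1 : ζ * ξ = 0 := by
    rw [← a3', ← b3, mul_assoc, ← mul_assoc q', e1, zero_mul, mul_zero]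
  have c2 : ξ * ζ = 0 := by
    rw [← a3, ← b3', mul_assoc, ← mul_assoc _ q', e2, zero_mul, mul_zero]
  refine ⟨ζ + ξ, by rw [Matrix.transpose_add, a1, b1], ?_, ?_, fun i hi => ?_⟩
  · rw [mul_add, add_mul, add_mul, c1, c2, a2, b2]; abel
  · have d1 : q * ζ = ζ := by rw [← a3, ← mul_assoc, hq]
    have d2 : q * ξ = ξ := by
      have : q * (q - q') = q - q' := by rw [mul_sub, h.idem, hq]
      rw [← b3, ← mul_assoc, this]
    rw [mul_add, d1, d2]
  · rw [add_mul, mul_add, a4 i hi, b4 i hi]; abel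

theorem HasExt.of_corner (h : Submod p m f q)
    (h' : Submod q m (fun i => q * f i) q') (H : HasExt m (fun i => q * f i) q') :
    HasExt m f q' := by
  obtain ⟨ζ, a1, a2, a3, a4⟩ := H
  have d1 : q * ζ = ζ := by rw [← a3, ← mul_assoc, h'.le]
  have d2 := mul_eq_of_le h.symm a1 d1
  refine ⟨ζ, a1, a2, a3, fun i hi => ?_⟩
  have := a4 i hi
  dsimp only at this
  rwa [← mul_assoc, d2, h.comm i hi, mul_assoc, d1] at this

/-- If the averaging trace is positive, some nonzero submodule extends. -/
theorem CornerCliff.exists_ext_submod (h : CornerCliff p m f) (hm : 0 < m)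
    (hpos : 0 < p.trace ^ 2 + signCount (-1) m * p.trace +
        (-1) ^ m * (mon p f m (Finset.range m)).trace ^ 2) :
    ∃ q, Submod p m f q ∧ q ≠ 0 ∧ HasExt m f q := by
  rw [← h.sum_cliffAvg hm (-1)] at hpos
  obtain ⟨i, -, hi⟩ := Finset.exists_ne_zero_of_sum_ne_zero hpos.ne'
  obtain ⟨j, -, hj⟩ := Finset.exists_ne_zero_of_sum_ne_zero hi
  set z := p * symUnit i j * p with hz
  have hzp : p * z * p = z := by
    rw [hz]; simp only [← mul_assoc, h.idem]; rw [mul_assoc, h.idem]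
  have hzs : zᵀ = z := by
    simp [hz, symUnit, Matrix.transpose_mul, h.psymm, mul_assoc, add_comm]
  have hZs := h.transpose_cliffAvg (-1) hzs m le_rfl
  obtain ⟨hZa, hpZ, -⟩ := h.mul_cliffAvg (σ := -1) (by norm_num) hzp m le_rfl
  have hZ0 : cliffAvg (-1) f m z ≠ 0 := fun H => hj (by rw [H]; rfl)
  clear hj
  generalize cliffAvg (-1) f m z = Z at *
  have hanti : ∀ i < m, f i * Z = -(Z * f i) := fun i hi => by
    rw [hZa i hi, neg_one_smul]
  obtain ⟨C, hCs, hCc, hZC, hne, hid⟩ := exists_polar_part hZs hZ0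
  have hCf : ∀ i < m, C * f i = f i * C := fun i hi => hCc _ (by
    rw [mul_assoc, ← neg_eq_iff_eq_neg.2 (hanti i hi), ← mul_assoc, hanti i hi]
    simp only [neg_mul, ← mul_assoc, neg_neg]
    simp only [mul_assoc, hanti i hi]
    simp)
  have hζf : ∀ i < m, Z * C * f i = -(f i * (Z * C)) := fun i hi => by
    rw [mul_assoc, hCf i hi, ← mul_assoc, ← mul_assoc, hanti i hi, neg_mul, neg_neg]
  have hζs : (Z * C)ᵀ = Z * C := by rw [Matrix.transpose_mul, hZs, hCs, hZC]
  have hpζ : p * (Z * C) = Z * C := by rw [← mul_assoc, hpZ]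
  clear hZC
  generalize Z * C = ζ at *
  have hζ4 : ζ * ζ * ζ = ζ := by
    have : (ζ * ζ * ζ - ζ)ᵀ * (ζ * ζ * ζ - ζ) = 0 := by
      rw [Matrix.transpose_sub, Matrix.transpose_mul, Matrix.transpose_mul, hζs]
      calc (ζ * (ζ * ζ) - ζ) * (ζ * ζ * ζ - ζ) = ζ * ζ * (ζ * ζ) * (ζ * ζ) - ζ * ζ * (ζ * ζ)
            - ζ * ζ * (ζ * ζ) + ζ * ζ := by noncomm_ring
        _ = 0 := by rw [hid, hid]; abel
    rw [← Matrix.conjTranspose_eq_transpose_of_trivial] at this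
    exact sub_eq_zero.1 (Matrix.conjTranspose_mul_self_eq_zero.1 this)
  refine ⟨ζ * ζ, ⟨by rw [Matrix.transpose_mul, hζs], hid, ?_, fun i hi => ?_⟩, hne, ζ, hζs, rfl,
    hζ4, hζf⟩
  · rw [← mul_assoc, hpζ]
  · rw [mul_assoc, hζf i hi, mul_neg, ← mul_assoc, hζf i hi, neg_mul, neg_neg, mul_assoc]

/-- A hereditary condition forcing positivity of the averaging trace forces extendability. -/
theorem CornerCliff.hasExt_of_pos (h : CornerCliff p m f) (hm : 0 < m) (Q : Matrix ι ι ℝ → Prop)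
    (hpos : ∀ q, Submod p m f q → q ≠ 0 → Q q → 0 < q.trace ^ 2 + signCount (-1) m * q.trace +
        (-1) ^ m * (q * mon p f m (Finset.range m)).trace ^ 2)
    (hsub : ∀ q q', Submod p m f q → Submod p m f q' → q * q' = q' → Q q → HasExt m f q' →
      Q (q - q')) : ∀ q, Submod p m f q → Q q → HasExt m f q := by
  suffices H : ∀ k : ℕ, ∀ q, Submod p m f q → Q q → q.trace < k → HasExt m f q by
    intro q hq hQ
    obtain ⟨k, hk⟩ := exists_nat_trace hq.idem
    exact H (k + 1) q hq hQ (by rw [hk]; push_cast; linarith)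
  intro k
  induction k with
  | zero =>
    intro q hq hQ ht
    rcases eq_or_ne q 0 with h0 | h0
    · exact ⟨0, by simp, by simp [h0], by simp, by simp⟩
    · have := trace_pos_of_idem hq.symm hq.idem h0
      norm_num at ht; linarith
  | succ k ih =>
    intro q hq hQ ht
    rcases eq_or_ne q 0 with h0 | h0
    · exact ⟨0, by simp, by simp [h0], by simp, by simp⟩
    have hc := hq.cornerCliff h
    have hp := hpos q hq h0 hQ
    rw [← hq.mon_corner h _ m le_rfl] at hp
    obtain ⟨q', h1, h2, h3⟩ := hc.exists_ext_submod hm hp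
    have h1' := hq.trans h1
    have h3' := h3.of_corner hq h1
    refine HasExt.add hq h1' h1.le h3' (ih _ (hq.sub h1' h1.le)
      (hsub q q' hq h1' h1.le hQ h3') ?_)
    obtain ⟨a, ha⟩ := exists_nat_trace h1.idem
    have hapos := trace_pos_of_idem h1.symm h1.idem h2
    rw [ha] at hapos
    have : (1 : ℝ) ≤ a := by exact_mod_cast (Nat.cast_pos.1 hapos : 0 < a)
    rw [Matrix.trace_sub, ha]
    push_cast at ht
    linarith

/-- Every nonzero Clifford module contains a submodule of the dimension `d` of the irreducible
modules, and its own dimension is a multiple of `d`. -/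
theorem CornerCliff.exists_irreducible (h : CornerCliff p m f) (hm : 0 < m) {d : ℝ}
    (hd : ∀ D τ : ℝ, 0 < D → (m % 4 = 3 ∨ m % 2 = 0 → τ = 0) → (m % 4 = 1 → τ ^ 2 = D ^ 2) →
      D ^ 2 + signCount 1 m * D + τ ^ 2 = 2 ^ (m + 1) → D = d) :
    ∀ q, Submod p m f q → (∃ k : ℕ, q.trace = k * d) ∧ (q ≠ 0 → ∃ q', Submod p m f q' ∧
      q * q' = q' ∧ q'.trace = d ∧
      (m % 4 = 1 → (q' * mon p f m (Finset.range m)).trace ^ 2 = d ^ 2)) := by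
  suffices H : ∀ k : ℕ, ∀ q, Submod p m f q → q.trace < k →
      (∃ k : ℕ, q.trace = k * d) ∧ (q ≠ 0 → ∃ q', Submod p m f q' ∧
      q * q' = q' ∧ q'.trace = d ∧
      (m % 4 = 1 → (q' * mon p f m (Finset.range m)).trace ^ 2 = d ^ 2)) by
    intro q hq
    obtain ⟨k, hk⟩ := exists_nat_trace hq.idem
    exact H (k + 1) q hq (by rw [hk]; push_cast; linarith)
  intro k
  induction k with
  | zero =>
    intro q hq ht
    rcases eq_or_ne q 0 with h0 | h0
    · exact ⟨⟨0, by simp [h0]⟩, fun h => absurd h0 h⟩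
    · have := trace_pos_of_idem hq.symm hq.idem h0
      norm_num at ht; linarith
  | succ k ih =>
    intro q hq ht
    rcases eq_or_ne q 0 with h0 | h0
    · exact ⟨⟨0, by simp [h0]⟩, fun h => absurd h0 h⟩
    have hc := hq.cornerCliff h
    have hD := trace_pos_of_idem hq.symm hq.idem h0
    by_cases hirr : ∀ z : Matrix ι ι ℝ, zᵀ = z → q * z = z →
        (∀ i < m, z * (q * f i) = (q * f i) * z) → ∃ c : ℝ, z = c • q
    · have hid := hc.sum_cliffAvg hm 1
      set ω := mon q (fun i => q * f i) m (Finset.range m) with hω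
      have hz : ∀ i j : ι, q * (q * symUnit i j * q) * q = q * symUnit i j * q := fun i j => by
        simp only [← mul_assoc, hq.idem]; rw [mul_assoc, hq.idem]
      have hzs : ∀ i j : ι, (q * symUnit i j * q)ᵀ = q * symUnit i j * q := fun i j => by
        simp [symUnit, Matrix.transpose_mul, hq.symm, mul_assoc, add_comm]
      have e : ∀ i j : ι, cliffAvg 1 (fun i => q * f i) m (q * symUnit i j * q) =
          (2 ^ (m + 1) * q i j / q.trace) • q := fun i j => by
        obtain ⟨c1, c2, c3⟩ := hc.mul_cliffAvg (σ := 1) (by norm_num) (hz i j) m le_rfl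
        obtain ⟨c, hcq⟩ := hirr _ (hc.transpose_cliffAvg 1 (hzs i j) m le_rfl) c2
          (fun i hi => by rw [c1 i hi, one_smul])
        have ht : (cliffAvg 1 (fun i => q * f i) m (q * symUnit i j * q)).trace =
            2 ^ (m + 1) * q i j := by
          rw [hc.cliffAvg_eq_sum 1 _ (hz i j) m le_rfl, Matrix.trace_sum]
          have : ∀ A ∈ (Finset.range m).powerset, ((1 : ℝ) ^ A.card •
              (mon q (fun i => q * f i) m A * (q * symUnit i j * q) *
                (mon q (fun i => q * f i) m A)ᵀ)).trace = 2 * q i j := fun A _ => by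
            rw [one_pow, one_smul, Matrix.trace_mul_comm, ← mul_assoc,
              hc.transpose_mon_mul m le_rfl A, ← mul_assoc, ← mul_assoc, hq.idem,
              Matrix.trace_mul_comm, ← mul_assoc, hq.idem, symUnit, mul_add, Matrix.trace_add,
              Matrix.trace_mul_single, Matrix.trace_mul_single]
            have := congrFun (congrFun hq.symm i) j
            rw [Matrix.transpose_apply] at this
            simp [this]; ring
          rw [Finset.sum_congr rfl this]
          simp [pow_succ]; ring
        rw [hcq, Matrix.trace_smul, smul_eq_mul] at ht
        rw [hcq, ← ht, mul_div_cancel_right₀ _ hD.ne']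
      simp only [e, Matrix.smul_apply, smul_eq_mul] at hid
      have hsum : ∑ i, ∑ j, 2 ^ (m + 1) * q i j / q.trace * q i j = 2 ^ (m + 1) := by
        have h1 : q.trace = ∑ i, ∑ j, q i j * q i j := by
          have : q.trace = (q * qᵀ).trace := by rw [hq.symm, hq.idem]
          rw [this]; rfl
        have : ∀ i j : ι, 2 ^ (m + 1) * q i j / q.trace * q i j =
            2 ^ (m + 1) / q.trace * (q i j * q i j) := fun i j => by ring
        simp only [this, ← Finset.mul_sum]
        rw [← h1, div_mul_cancel₀ _ hD.ne']
      rw [hsum, one_pow, one_mul] at hid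
      have hτ0 : m % 4 = 3 ∨ m % 2 = 0 → ω.trace = 0 := by
        rintro (h3 | h2)
        · have ht := hc.transpose_mon m le_rfl (Finset.range m) le_rfl
          have hodd : Odd ((Finset.range m).card.choose 2) := by
            rw [Finset.card_range, Nat.choose_two_right]
            obtain ⟨a, rfl⟩ : ∃ a, m = 4 * a + 3 := ⟨m / 4, by omega⟩
            rw [show (4 * a + 3) * (4 * a + 3 - 1) = 2 * ((4 * a + 3) * (2 * a + 1)) by
              rw [show 4 * a + 3 - 1 = 2 * (2 * a + 1) by omega]; ring, Nat.mul_div_cancel_left _ two_pos]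
            exact Odd.mul ⟨2 * a + 1, by ring⟩ ⟨a, by ring⟩
          rw [hodd.neg_one_pow, neg_one_smul, ← hω] at ht
          have := congrArg Matrix.trace ht
          rw [Matrix.trace_transpose, Matrix.trace_neg] at this
          linarith
        · exact hc.trace_mon_eq_zero le_rfl (by simpa using hm.ne') fun _ =>
            Nat.even_iff.2 h2
      have hτ1 : m % 4 = 1 → ω.trace ^ 2 = q.trace ^ 2 := by
        intro h1
        have heven : Even ((Finset.range m).card.choose 2) := by
          rw [Finset.card_range, Nat.choose_two_right]
          obtain ⟨a, rfl⟩ : ∃ a, m = 4 * a + 1 := ⟨m / 4, by omega⟩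
          rw [show (4 * a + 1) * (4 * a + 1 - 1) = 2 * ((4 * a + 1) * (2 * a)) by
              rw [show 4 * a + 1 - 1 = 2 * (2 * a) by omega]; ring, Nat.mul_div_cancel_left _ two_pos]
          exact Even.mul_left ⟨a, by ring⟩ _
        have ht := hc.transpose_mon m le_rfl (Finset.range m) le_rfl
        have hs := hc.mon_mul_self le_rfl (A := Finset.range m) le_rfl
        rw [heven.neg_one_pow, one_smul, ← hω] at ht hs
        obtain ⟨c, hcq⟩ := hirr ω ht (hc.mul_mon _ m le_rfl) (fun i hi => by
          have := hc.gen_mul_mon hi m le_rfl (Finset.range m) le_rfl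
          have ho : Odd m := Nat.odd_iff.2 (by omega)
          rw [Finset.card_range, ho.neg_one_pow, if_pos (Finset.mem_range.2 hi)] at this
          rw [this]; simp [hω])
        rw [hcq, smul_mul_smul_comm, hq.idem] at hs
        have := congrArg Matrix.trace hs
        rw [Matrix.trace_smul, smul_eq_mul] at this
        have hc1 : c * c = 1 := by
          have h3 : (c * c - 1) * q.trace = 0 := by linarith
          rcases mul_eq_zero.1 h3 with h3 | h3
          · linarith
          · exact absurd h3 hD.ne'
        rw [hcq, Matrix.trace_smul, smul_eq_mul]
        nlinarith
      have hDd := hd _ _ hD hτ0 hτ1 hid.symm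
      refine ⟨⟨1, by rw [hDd]; simp⟩, fun _ => ⟨q, hq, hq.idem, hDd, fun h1 => ?_⟩⟩
      rw [← hq.mon_corner h _ m le_rfl, ← hω, hτ1 h1, hDd]
    · push Not at hirr
      obtain ⟨z, hz1, hz2, hz3, hz4⟩ := hirr
      obtain ⟨r, r1, r2, r3, r4, r5, r6⟩ := exists_spectral_split hq.symm hq.idem h0 hz1 hz2 hz4
      have hr : Submod p m f r := hq.trans ⟨r1, r2, r3, fun i hi => r6 _ (hz3 i hi)
        (by rw [hc.corner i hi, hc.corner' hi])⟩
      have hr' := hq.sub hr r3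
      have lt : ∀ {s : Matrix ι ι ℝ}, Submod p m f s → s ≠ 0 → 1 ≤ s.trace := fun {s} hs hs0 => by
        obtain ⟨a, ha⟩ := exists_nat_trace hs.idem
        have hapos := trace_pos_of_idem hs.symm hs.idem hs0
        rw [ha] at hapos ⊢
        exact_mod_cast (Nat.cast_pos.1 hapos : 0 < a)
      have l1 := lt hr r4
      have l2 := lt hr' (sub_ne_zero.2 fun H => r5 H.symm)
      rw [Matrix.trace_sub] at l2
      push_cast at ht
      obtain ⟨⟨a, ha⟩, H1⟩ := ih r hr (by linarith)
      obtain ⟨⟨b, hb⟩, -⟩ := ih (q - r) hr' (by rw [Matrix.trace_sub]; linarith)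
      rw [Matrix.trace_sub] at hb
      refine ⟨⟨a + b, by push_cast; linarith⟩, fun _ => ?_⟩
      obtain ⟨q', s1, s2, s3, s4⟩ := H1 r4
      exact ⟨q', s1, by rw [← s2, ← mul_assoc, r3], s3, s4⟩

end Submodules

/-- A symmetric involution `ε` which may replace the last generator of a Clifford system. -/
structure Adm {ι : Type} [Fintype ι] [DecidableEq ι] (n : ℕ) (e : ℕ → Matrix ι ι ℝ)
    (ε : Matrix ι ι ℝ) : Prop where
  cliff : IsCliff (n + 1) e
  sa : SA n e ε
  sq : ε * ε = 1

/-- `w` is the orthogonal projection onto the kernel of the symmetric matrix `s`. -/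
structure IsKerProj {ι : Type} [Fintype ι] [DecidableEq ι] (s w : Matrix ι ι ℝ) : Prop where
  symm : wᵀ = w
  idem : w * w = w
  mul : s * w = 0
  inv : ∃ y : Matrix ι ι ℝ, y * s = 1 - w ∧ yᵀ = y

/-- The generators with the last one replaced by `ε`. -/
def replLast {ι : Type} (n : ℕ) (e : ℕ → Matrix ι ι ℝ) (ε : Matrix ι ι ℝ) :
    ℕ → Matrix ι ι ℝ := fun i => if i < n then e i else ε

section Kernel

variable {ι : Type} [Fintype ι] [DecidableEq ι] {s w w' : Matrix ι ι ℝ}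

theorem IsKerProj.unique (h : IsKerProj s w) (h' : IsKerProj s w') : w = w' := by
  have key : ∀ {w w' : Matrix ι ι ℝ}, IsKerProj s w → IsKerProj s w' → w * w' = w' := by
    intro w w' h h'
    obtain ⟨y, hy, -⟩ := h.inv
    have : (1 - w) * w' = 0 := by rw [← hy, mul_assoc, h'.mul, mul_zero]
    rw [sub_mul, one_mul, sub_eq_zero] at this
    exact this.symm
  have := congrArg Matrix.transpose (key h' h)
  rw [Matrix.transpose_mul, h.symm, h'.symm] at this
  rw [← this, key h h']

theorem IsKerProj.mul' (hs : sᵀ = s) (h : IsKerProj s w) : w * s = 0 := by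
  have := congrArg Matrix.transpose h.mul
  rwa [Matrix.transpose_mul, hs, h.symm, Matrix.transpose_zero] at this

/-- The kernel projection of a symmetric matrix, by functional calculus. -/
theorem isKerProj_cfc (hs : sᵀ = s) :
    IsKerProj s (cfc (fun x : ℝ => if x = 0 then (1 : ℝ) else 0) (s * s)) := by
  have hY : (s * s)ᵀ = s * s := by rw [Matrix.transpose_mul, hs]
  set δ : ℝ → ℝ := fun x => if x = 0 then 1 else 0 with hδ
  have h0 : s * s * cfc δ (s * s) = 0 := by
    rw [fc_self_mul hY]
    have : (fun x : ℝ => x * δ x) = fun _ => 0 := by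
      ext x; by_cases hx : x = 0 <;> simp [hδ, hx]
    rw [this, cfc_const_zero]
  have hi : cfc δ (s * s) * cfc δ (s * s) = cfc δ (s * s) := by
    rw [fc_mul]; congr 1; ext x; simp [hδ]
  have hss : s * s * s = s * (s * s) := mul_assoc _ _ _
  have hinv : s * cfc (fun x : ℝ => x⁻¹) (s * s) = cfc (fun x : ℝ => x⁻¹) (s * s) * s :=
    (fc_comm hY hss _).symm
  refine ⟨fc_symm _, hi, ?_, cfc (fun x : ℝ => x⁻¹) (s * s) * s, ?_, ?_⟩
  · have : (s * cfc δ (s * s))ᵀ * (s * cfc δ (s * s)) = 0 := by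
      rw [Matrix.transpose_mul, hs, fc_symm]
      calc _ = cfc δ (s * s) * (s * s * cfc δ (s * s)) := by simp only [mul_assoc]
        _ = 0 := by rw [h0, mul_zero]
    rw [← Matrix.conjTranspose_eq_transpose_of_trivial] at this
    exact Matrix.conjTranspose_mul_self_eq_zero.1 this
  · rw [mul_assoc, fc_mul_self hY, ← fc_one hY]
    rw [← cfc_sub _ _ _ (continuousOn_matrix_spectrum _ _) (continuousOn_matrix_spectrum _ _)]
    congr 1; ext x; by_cases hx : x = 0 <;> simp [hδ, hx]
  · rw [Matrix.transpose_mul, hs, fc_symm, hinv]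

theorem IsKerProj.isUnit (hs : sᵀ = s) (h : IsKerProj s w) {c : ℝ} (hc : c ≠ 0) :
    IsUnit (s * s + c • w) := by
  obtain ⟨y, hy, hys⟩ := h.inv
  have hsw := h.mul' hs
  have hy' : s * y = 1 - w := by
    have := congrArg Matrix.transpose hy
    rwa [Matrix.transpose_mul, hs, hys, Matrix.transpose_sub, h.symm, Matrix.transpose_one] at this
  have hsy : s * (1 - w) = s := by rw [mul_sub, h.mul, mul_one, sub_zero]
  refine IsUnit.of_mul_eq_one ((y * y) * (1 - w) + c⁻¹ • w) ?_
  have e1 : s * s * (y * y * (1 - w)) = 1 - w := by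
    calc s * s * (y * y * (1 - w)) = s * (s * y) * y * (1 - w) := by simp only [mul_assoc]
      _ = (1 - w) * (1 - w) := by rw [hy', hsy, hy']
      _ = 1 - w := by rw [mul_sub, sub_mul, sub_mul, h.idem]; simp
  have e2 : w * (y * y * (1 - w)) = 0 := by
    have e3 : y * y * (1 - w) = (1 - w) * (y * y) := by
      rw [← hy, mul_assoc y y, hy]
      have : y * (1 - w) = (1 - w) * y := by
        nth_rewrite 1 [← hy']; rw [← hy, mul_assoc]
      rw [this, ← mul_assoc, this, mul_assoc]
    rw [e3, ← mul_assoc, mul_sub, h.idem]; simp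
  rw [mul_add, add_mul, add_mul, e1, smul_mul_assoc, e2, mul_smul_comm, mul_assoc, h.mul,
    smul_mul_smul_comm, mul_inv_cancel₀ hc, h.idem]
  simp

end Kernel

section Path

variable {ι : Type} [Fintype ι] [DecidableEq ι] {n : ℕ} {e : ℕ → Matrix ι ι ℝ}
  {ε w : Matrix ι ι ℝ}

theorem Adm.cornerCliff (h : Adm n e ε) : CornerCliff 1 (n + 1) (replLast n e ε) := by
  have hc := h.cliff
  refine ⟨Matrix.transpose_one, one_mul 1, fun i hi => ?_, fun i hi => ?_, fun i _ => one_mul _,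
    fun i hi j hj hij => ?_⟩
  · unfold replLast; split_ifs
    exacts [hc.symm i hi, h.sa.1]
  · unfold replLast; split_ifs
    exacts [hc.sq i hi, h.sq]
  · unfold replLast; split_ifs with h1 h2 h2
    · exact hc.anti i hi j hj hij
    · exact h.sa.2 i h1
    · rw [h.sa.2 j h2, neg_neg]
    · omega

theorem Adm.symm_add (h : Adm n e ε) : (ε + e n)ᵀ = ε + e n := by
  rw [Matrix.transpose_add, h.sa.1, h.cliff.symm n (by omega)]

theorem Adm.add_sq (h : Adm n e ε) :
    (ε + e n) * (ε + e n) = (2 : ℝ) • 1 + (ε * e n + e n * ε) := by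
  rw [mul_add, add_mul, add_mul, h.sq, h.cliff.sq n (by omega)]
  module

theorem Adm.comm_add_sq (h : Adm n e ε) {i : ℕ} (hi : i < n + 1) :
    (ε + e n) * (ε + e n) * replLast n e ε i = replLast n e ε i * ((ε + e n) * (ε + e n)) := by
  have hη := h.cliff.sq n (by omega)
  unfold replLast
  split_ifs with h1
  · have a := h.sa.2 i h1
    have b := h.cliff.anti i (by omega) n (by omega) h1.ne
    have c : e i * (ε + e n) = -((ε + e n) * e i) := by rw [mul_add, a, b, add_mul]; abel
    rw [← mul_assoc, c, neg_mul, mul_assoc, mul_assoc, c, mul_neg, neg_neg]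
  · rw [h.add_sq, add_mul, mul_add, add_mul, mul_add, mul_assoc, mul_assoc, h.sq,
      ← mul_assoc, ← mul_assoc, h.sq]
    simp [add_comm, mul_assoc]

theorem Adm.comm_last (h : Adm n e ε) :
    (ε + e n) * (ε + e n) * e n = e n * ((ε + e n) * (ε + e n)) := by
  have hη := h.cliff.sq n (by omega)
  rw [h.add_sq, add_mul, mul_add, add_mul, mul_add, mul_assoc, mul_assoc, hη,
      ← mul_assoc, ← mul_assoc, hη]
  simp [add_comm, mul_assoc]

theorem Adm.exists_kerProj (h : Adm n e ε) : ∃ w : Matrix ι ι ℝ, IsKerProj (ε + e n) w ∧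
    Submod 1 (n + 1) (replLast n e ε) w := by
  have h1 := isKerProj_cfc h.symm_add
  exact ⟨_, h1, h1.symm, h1.idem, one_mul _, fun i hi =>
    fc_comm (by rw [Matrix.transpose_mul, h.symm_add]) (h.comm_add_sq hi) _⟩

theorem Adm.mul_kerProj (hw : IsKerProj (ε + e n) w) :
    e n * w = -(ε * w) := by
  have := hw.mul
  rw [add_mul] at this
  exact eq_neg_of_add_eq_zero_right this

/-- If the kernel of `ε + e n` carries one more generator, `ε` can be deformed to `e n`. -/
theorem Adm.exists_path (h : Adm n e ε) (hw : IsKerProj (ε + e n) w)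
    (hS : Submod 1 (n + 1) (replLast n e ε) w) (hext : HasExt (n + 1) (replLast n e ε) w) :
    ∃ H : ℝ → Matrix ι ι ℝ, Continuous H ∧ H 0 = ε ∧ H 1 = e n ∧
      ∀ t ∈ Set.Icc (0 : ℝ) 1, SA n e (H t) ∧ IsUnit (H t) := by
  obtain ⟨ζ, z1, z2, z3, z4⟩ := hext
  have hη := h.cliff.sq n (by omega)
  have hηs := h.cliff.symm n (by omega)
  have hεs := h.sa.1
  have hcε : w * ε = ε * w := by simpa [replLast] using hS.comm n (by omega)
  have hηw := Adm.mul_kerProj hw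
  have hcη : w * e n = e n * w := by
    have := congrArg Matrix.transpose hηw
    rw [Matrix.transpose_mul, hηs, hw.symm, Matrix.transpose_neg, Matrix.transpose_mul, hεs,
      hw.symm, hcε] at this
    rw [this, hηw]
  have z3' : ζ * w = ζ := mul_eq_of_le hw.symm z1 z3
  have zε : ζ * ε = -(ε * ζ) := by simpa [replLast] using z4 n (by omega)
  have ze : ∀ i < n, ζ * e i = -(e i * ζ) := fun i hi => by
    simpa [replLast, hi] using z4 i (by omega)
  have hce : ∀ i < n, w * e i = e i * w := fun i hi => by
    simpa [replLast, hi] using hS.comm i (by omega)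
  set L : ℝ → Matrix ι ι ℝ := fun t => (1 - t) • ε + t • e n with hL
  have hLs : ∀ t, SA n e (L t) := fun t =>
    (h.sa.smul _).add ((h.cliff.sa (by omega) le_rfl).smul _)
  have hLc : ∀ t, w * L t = L t * w := fun t => by
    simp only [hL, mul_add, add_mul, mul_smul_comm, smul_mul_assoc, hcε, hcη]
  have hLsq : ∀ t, L t * L t = ((1 - 2 * t) ^ 2) • (1 : Matrix ι ι ℝ) +
      (t * (1 - t)) • ((ε + e n) * (ε + e n)) := fun t => by
    rw [h.add_sq]
    simp only [hL, mul_add, add_mul, smul_mul_smul_comm, h.sq, hη]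
    module
  set K : ℝ → Matrix ι ι ℝ := fun t => Real.cos (Real.pi * t) • (w * ε) + Real.sin (Real.pi * t) • ζ with hK
  have hKs : ∀ t, SA n e (K t) := fun t => by
    refine SA.add (SA.smul (k := n) (A := w * ε) ⟨?_, fun i hi => ?_⟩ (Real.cos (Real.pi * t)))
      (SA.smul (k := n) (A := ζ) ⟨z1, fun i hi => ?_⟩ (Real.sin (Real.pi * t)))
    · rw [Matrix.transpose_mul, hεs, hw.symm, hcε]
    · rw [← mul_assoc, ← hce i hi, mul_assoc, h.sa.2 i hi]; simp [mul_assoc]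
    · rw [ze i hi, neg_neg]
  have hKw : ∀ t, w * K t = K t ∧ K t * w = K t := fun t => by
    constructor
    · simp only [hK, mul_add, mul_smul_comm, ← mul_assoc, hw.idem, z3]
    · simp only [hK, add_mul, smul_mul_assoc, z3']
      rw [mul_assoc, ← hcε, ← mul_assoc, hw.idem]
  have hKsq : ∀ t, K t * K t = w := fun t => by
    have e1 : w * ε * (w * ε) = w := by
      rw [mul_assoc, ← mul_assoc ε, ← hcε, mul_assoc w ε, h.sq, mul_one, hw.idem]
    have e2 : w * ε * ζ = -(ζ * (w * ε)) := by
      rw [← mul_assoc ζ, z3', zε, neg_neg, mul_assoc, ← neg_eq_iff_eq_neg.2 zε, mul_neg,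
        ← mul_assoc, z3]
    simp only [hK, mul_add, add_mul, smul_mul_smul_comm, e1, e2, z2]
    have := Real.sin_sq_add_cos_sq (Real.pi * t)
    have e3' : (Real.sin (Real.pi * t) ^ 2 + Real.cos (Real.pi * t) ^ 2) • w = w := by
      rw [this, one_smul]
    refine Eq.trans ?_ e3'
    module
  refine ⟨fun t => (1 - w) * L t + K t, ?_, ?_, ?_, fun t ht => ⟨?_, ?_⟩⟩
  · simp only [hL, hK]
    fun_prop
  · simp only [hL, hK]
    simp [sub_mul]
  · simp only [hL, hK]
    simp [sub_mul, hcη, hηw, hcε]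
  · refine SA.add ⟨?_, fun i hi => ?_⟩ (hKs t)
    · rw [Matrix.transpose_mul, (hLs t).1, Matrix.transpose_sub, hw.symm, Matrix.transpose_one,
        mul_sub, sub_mul, hLc t]; simp
    · have : e i * (1 - w) = (1 - w) * e i := by
        rw [mul_sub, sub_mul, hce i hi]; simp
      rw [← mul_assoc, this, mul_assoc, (hLs t).2 i hi, mul_neg, mul_assoc]
  · have hsq : ((1 - w) * L t + K t) * ((1 - w) * L t + K t) =
        ((1 - 2 * t) ^ 2) • (1 : Matrix ι ι ℝ) +
        (t * (1 - t)) • ((ε + e n) * (ε + e n) + (4 : ℝ) • w) := by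
      have c1 : (1 - w) * K t = 0 := by rw [sub_mul, (hKw t).1]; simp
      have c2 : K t * (1 - w) = 0 := by rw [mul_sub, (hKw t).2]; simp
      have c3 : (1 - w) * L t = L t * (1 - w) := by rw [mul_sub, sub_mul, hLc t]; simp
      have c4 : (1 - w) * (1 - w) = 1 - w := by rw [mul_sub, sub_mul, sub_mul, hw.idem]; simp
      have c5 : (1 - w) * L t * ((1 - w) * L t) = (1 - w) * (L t * L t) := by
        rw [mul_assoc, ← mul_assoc (L t), ← c3, mul_assoc, ← mul_assoc (1 - w), c4]
      have c6 : (1 - w) * L t * K t = 0 := by rw [c3, mul_assoc, c1, mul_zero]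
      have c7 : K t * ((1 - w) * L t) = 0 := by rw [← mul_assoc, c2, zero_mul]
      have c8 : w * ((ε + e n) * (ε + e n)) = 0 := by
        rw [← mul_assoc, hw.mul' h.symm_add, zero_mul]
      have hq := hKsq t
      have hl := hLsq t
      generalize L t = l at *
      generalize K t = x at *
      rw [mul_add, add_mul, add_mul, c5, c6, c7, hq, hl, sub_mul, mul_add w,
        mul_smul_comm, mul_smul_comm, c8]
      simp only [mul_one, one_mul, smul_zero, smul_add, smul_smul]
      module
    have hu : IsUnit (((1 - w) * L t + K t) * ((1 - w) * L t + K t)) := by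
      rw [hsq]
      rcases eq_or_ne (1 - 2 * t) 0 with h0 | h0
      · have : t = 1 / 2 := by linarith
        subst this
        have hU := hw.isUnit h.symm_add (c := 4) (by norm_num)
        obtain ⟨u, hu⟩ := hU
        rw [h0, ← hu]
        exact ⟨(Units.mk0 (1 / 4 : ℝ) (by norm_num)) • u, by simp [Units.smul_def]; norm_num⟩
      · refine isUnit_smul_one_add_psd (by positivity) (Matrix.PosSemidef.smul ?_ ?_)
        · refine Matrix.PosSemidef.add ?_ (Matrix.PosSemidef.smul ?_ (by norm_num))
          · simpa [h.symm_add] using psd_self_mul_transpose (ε + e n)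
          · simpa [hw.symm, hw.idem] using psd_self_mul_transpose w
        · nlinarith [ht.1, ht.2]
    exact isUnit_of_mul_isUnit_left hu

end Path

section SpectralCut

variable {ι : Type} [Fintype ι] [DecidableEq ι] {n : ℕ} {e : ℕ → Matrix ι ι ℝ}
  {ε w s : Matrix ι ι ℝ}

theorem HasExt.cornerCliff {p q : Matrix ι ι ℝ} {m : ℕ} {f : ℕ → Matrix ι ι ℝ}
    (hp : CornerCliff p m f) (h : Submod p m f q) (hext : HasExt m f q) :
    ∃ f', CornerCliff q (m + 1) f' := by
  obtain ⟨ζ, z1, z2, z3, z4⟩ := hext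
  have hc := h.cornerCliff hp
  have z3' := mul_eq_of_le h.symm z1 z3
  have hz : ∀ i < m, ζ * (q * f i) = -(q * f i * ζ) := fun i hi => by
    rw [← mul_assoc, z3', z4 i hi, h.comm i hi, mul_assoc (f i), z3]
  refine ⟨fun i => if i < m then q * f i else ζ, h.symm, h.idem, fun i hi => ?_, fun i hi => ?_,
    fun i hi => ?_, fun i hi j hj hij => ?_⟩
  · split_ifs with h1
    exacts [hc.symm i h1, z1]
  · split_ifs with h1
    exacts [hc.sq i h1, z2]
  · split_ifs with h1
    exacts [hc.corner i h1, z3]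
  · split_ifs with h1 h2 h2
    · exact hc.anti i h1 j h2 hij
    · rw [hz i h1, neg_neg]
    · exact hz j h2
    · omega

theorem cfc_congr_of_nonneg (hs : sᵀ = s) {f g : ℝ → ℝ} (hfg : ∀ x, 0 ≤ x → f x = g x) :
    cfc f (s * s) = cfc g (s * s) := by
  have h : (s * s).PosSemidef := by simpa [hs] using psd_self_mul_transpose s
  refine cfc_congr fun x hx => hfg x ?_
  rw [h.isHermitian.spectrum_real_eq_range_eigenvalues] at hx
  obtain ⟨i, rfl⟩ := hx
  exact h.eigenvalues_nonneg i

/-- The spectral projection of `(ε + e n) ^ 2` for the eigenvalues `< c`. -/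
noncomputable def cutProj (c : ℝ) (s : Matrix ι ι ℝ) : Matrix ι ι ℝ :=
  cfc (fun x : ℝ => if x < c then (1 : ℝ) else 0) (s * s)

theorem cutProj_idem (c : ℝ) : cutProj c s * cutProj c s = cutProj c s := by
  rw [cutProj, fc_mul]; congr 1; ext x; simp

theorem cutProj_sub_kerProj (hs : sᵀ = s) (hw : IsKerProj s w) {c : ℝ} (hc : 0 < c) :
    cutProj c s - w = cfc (fun x : ℝ => if 0 < x ∧ x < c then (1 : ℝ) else 0) (s * s) := by
  rw [hw.unique (isKerProj_cfc hs), cutProj,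
    ← cfc_sub _ _ _ (continuousOn_matrix_spectrum _ _) (continuousOn_matrix_spectrum _ _)]
  refine cfc_congr_of_nonneg hs fun x hx => ?_
  rcases hx.eq_or_lt with h | h
  · simp [← h, hc]
  · simp [h, h.ne']

theorem Adm.cut_sub (h : Adm n e ε) (hw : IsKerProj (ε + e n) w) {c : ℝ} (hc : 0 < c)
    (hc4 : c < 4) : Submod 1 (n + 1) (replLast n e ε) (cutProj c (ε + e n) - w) ∧
      HasExt (n + 1) (replLast n e ε) (cutProj c (ε + e n) - w) := by
  have hη := h.cliff.sq n (by omega)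
  have hηs := h.cliff.symm n (by omega)
  have hεs := h.sa.1
  have hs := h.symm_add
  have hcomm := fun i (hi : i < n + 1) => h.comm_add_sq hi
  have hlast := h.comm_last
  have hy := h.add_sq
  rw [cutProj_sub_kerProj hs hw hc]
  have hYs : ((ε + e n) * (ε + e n))ᵀ = (ε + e n) * (ε + e n) := by rw [Matrix.transpose_mul, hs]
  set y := (ε + e n) * (ε + e n) with hY
  set q := cfc (fun x : ℝ => if 0 < x ∧ x < c then (1 : ℝ) else 0) y with hq
  have hyε : y * ε = ε * y := by simpa [replLast] using hcomm n (by omega)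
  have hqq : q * q = q := by rw [hq, fc_mul]; congr 1; ext x; simp
  refine ⟨⟨fc_symm _, hqq, one_mul _, fun i hi => fc_comm hYs (hcomm i hi) _⟩, ?_⟩
  set g : ℝ → ℝ := fun x => if 0 < x ∧ x < c then (√(x * (4 - x) / 4))⁻¹ else 0 with hg
  set z := (1 / 2 : ℝ) • (e n - ε * e n * ε) with hz
  have hzy : y * z = z * y := by
    have : y * (ε * e n * ε) = ε * e n * ε * y := by
      rw [← mul_assoc, ← mul_assoc, hyε, mul_assoc ε, hlast, mul_assoc, mul_assoc (e n), hyε]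
      simp only [mul_assoc]
    rw [hz, mul_smul_comm, smul_mul_assoc, mul_sub, sub_mul, hlast, this]
  have hzz : z * z = cfc (fun x : ℝ => x * (4 - x) / 4) y := by
    have e1 : z * z = (1 / 4 : ℝ) • (y * ((4 : ℝ) • 1 - y)) := by
      have u1 : e n * (ε * e n * ε) = (e n * ε) * (e n * ε) := by simp only [mul_assoc]
      have u2 : ε * e n * ε * e n = (ε * e n) * (ε * e n) := by simp only [mul_assoc]
      have u3 : ε * e n * ε * (ε * e n * ε) = 1 := by
        calc _ = ε * (e n * (ε * ε) * e n) * ε := by simp only [mul_assoc]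
          _ = 1 := by rw [h.sq, mul_one, hη, mul_one, h.sq]
      have u4 : ε * e n * (e n * ε) = 1 := by
        rw [mul_assoc, ← mul_assoc (e n), hη, one_mul, h.sq]
      have u5 : e n * ε * (ε * e n) = 1 := by
        rw [mul_assoc, ← mul_assoc ε, h.sq, one_mul, hη]
      rw [hz, hy, smul_mul_smul_comm, mul_sub, sub_mul, sub_mul, hη, u1, u2, u3]
      generalize ε * e n = a at *
      generalize e n * ε = b at *
      simp only [mul_sub, mul_add, add_mul, smul_mul_assoc, mul_smul_comm, mul_one,
        one_mul, u4, u5]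
      module
    have e2 : (4 : ℝ) • (1 : Matrix ι ι ℝ) - y = cfc (fun x : ℝ => 4 * 1 - x) y := by
      rw [cfc_sub _ _ _ (continuousOn_matrix_spectrum _ _) (continuousOn_matrix_spectrum _ _),
        cfc_const_mul _ _ _ (continuousOn_matrix_spectrum _ _), fc_one hYs, fc_id hYs]
    rw [e1, e2, fc_self_mul hYs, ← cfc_smul _ _ _ (continuousOn_matrix_spectrum _ _)]
    congr 1; ext x; simp; ring
  have hzg : cfc g y * z = z * cfc g y := fc_comm hYs hzy _
  have hzs : zᵀ = z := by
    simp only [hz, Matrix.transpose_smul, Matrix.transpose_sub, Matrix.transpose_mul, hηs, hεs,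
      mul_assoc]
  refine ⟨z * cfc g y, ?_, ?_, ?_, fun i hi => ?_⟩
  · rw [Matrix.transpose_mul, fc_symm, hzs, hzg]
  · rw [mul_assoc, ← mul_assoc (cfc g y), hzg, mul_assoc, ← mul_assoc, hzz, fc_mul, fc_mul]
    congr 1; ext x
    simp only [hg]
    split_ifs with h1
    · have h3 : 0 < x * (4 - x) / 4 := by nlinarith [h1.1, h1.2]
      have h4 := Real.mul_self_sqrt h3.le
      have h5 := (Real.sqrt_pos.2 h3).ne'
      field_simp
      nlinarith
    · simp
  · rw [← mul_assoc, fc_comm hYs hzy, mul_assoc, fc_mul]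
    congr 2; ext x; simp only [hg]; split_ifs <;> simp
  · have h1 : z * replLast n e ε i = -(replLast n e ε i * z) := by
      unfold replLast
      split_ifs with h2
      · have a := h.sa.2 i h2
        have b := h.cliff.anti i (by omega) n (by omega) h2.ne
        have d : e i * (ε * e n * ε) = -(ε * e n * ε * e i) := by
          rw [← mul_assoc, ← mul_assoc, a, neg_mul, mul_assoc ε, b, mul_neg, neg_neg, mul_assoc,
            mul_assoc, a]
          simp only [mul_neg, mul_assoc]
        rw [hz, mul_smul_comm, smul_mul_assoc, mul_sub, b, d, sub_mul]
        module
      · have a : ε * e n * ε * ε = ε * e n := by rw [mul_assoc, h.sq, mul_one]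
        have b : ε * (ε * e n * ε) = e n * ε := by rw [← mul_assoc, ← mul_assoc, h.sq, one_mul]
        rw [hz, mul_smul_comm, smul_mul_assoc, mul_sub, sub_mul, a, b]
        module
    rw [mul_assoc, fc_comm hYs (hcomm i hi), ← mul_assoc, h1, neg_mul, mul_assoc]

end SpectralCut

section LocalConstancy

variable {ι : Type} [Fintype ι] [DecidableEq ι]

theorem trace_eq_of_isUnit {S S' : Matrix ι ι ℝ} (h : S * S = 1) (h' : S' * S' = 1)
    (hu : IsUnit (1 + S * S')) : S.trace = S'.trace := by
  obtain ⟨u, hu⟩ := hu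
  have h1 : S * u = u * S' := by
    rw [hu, mul_add, ← mul_assoc, h, add_mul, mul_assoc, h', mul_one, one_mul,
      add_comm]
  have h2 : S = u * S' * (↑u⁻¹ : Matrix ι ι ℝ) := by rw [← h1, mul_assoc, Units.mul_inv, mul_one]
  rw [h2, Matrix.trace_mul_comm, ← mul_assoc, Units.inv_mul, one_mul]

/-- Quadratic forms near a positive definite one are positive. -/
theorem eventually_dotProduct_pos {G : ℝ → Matrix ι ι ℝ} (hG : Continuous G) {t₀ : ℝ}
    (h0 : ∀ v : ι → ℝ, v ≠ 0 → 0 < v ⬝ᵥ (G t₀ *ᵥ v)) :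
    ∀ᶠ t in nhds t₀, ∀ v : ι → ℝ, v ≠ 0 → 0 < v ⬝ᵥ (G t *ᵥ v) := by
  have hK : IsCompact (Metric.sphere (0 : ι → ℝ) 1) := isCompact_sphere _ _
  have hc : Continuous fun q : ℝ × (ι → ℝ) => q.2 ⬝ᵥ (G q.1 *ᵥ q.2) := by fun_prop
  have key : ∀ᶠ t in nhds t₀, ∀ v ∈ Metric.sphere (0 : ι → ℝ) 1, 0 < v ⬝ᵥ (G t *ᵥ v) := by
    refine hK.eventually_forall_of_forall_eventually fun v hv => ?_
    exact hc.continuousAt.eventually (lt_mem_nhds (h0 v (by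
      rintro rfl; simp at hv)))
  filter_upwards [key] with t ht v hv
  have hn : 0 < ‖v‖ := norm_pos_iff.2 hv
  have := ht (‖v‖⁻¹ • v) (by simp [norm_smul, hn.ne'])
  rw [Matrix.mulVec_smul, smul_dotProduct, dotProduct_smul, smul_smul, smul_eq_mul] at this
  exact (pos_iff_pos_of_mul_pos this).1 (by positivity)

/-- The trace of the sign of a continuous path of symmetric matrices is locally constant near
invertible ones. -/
theorem eventually_trace_eq {A S : ℝ → Matrix ι ι ℝ} (hA : Continuous A)
    (hSS : ∀ t, S t * S t = 1) (hAS : ∀ t, (A t * S t).PosSemidef)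
    {t₀ : ℝ} (hu : IsUnit (A t₀)) : ∀ᶠ t in nhds t₀, (S t).trace = (S t₀).trace := by
  have hpd : (A t₀ * S t₀).PosDef := by
    rw [(hAS t₀).posDef_iff_isUnit]
    exact hu.mul (isUnit_of_mul_self_eq_one (hSS t₀))
  have h0 : ∀ v : ι → ℝ, v ≠ 0 → 0 < v ⬝ᵥ ((A t₀ * S t₀) *ᵥ v) := fun v hv => by
    simpa using hpd.dotProduct_mulVec_pos hv
  filter_upwards [eventually_dotProduct_pos (G := fun t => A t * S t₀) (by fun_prop) h0] with t ht
  refine trace_eq_of_isUnit (hSS t) (hSS t₀) ?_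
  rw [← Matrix.mulVec_injective_iff_isUnit, ← Matrix.coe_mulVecLin, ← LinearMap.ker_eq_bot,
    LinearMap.ker_eq_bot']
  intro v hv
  by_contra hne
  simp only [Matrix.mulVecLin_apply, Matrix.add_mulVec, Matrix.one_mulVec] at hv
  have hv' : S t₀ *ᵥ v = -(S t *ᵥ v) := by
    have := congrArg (fun x => S t *ᵥ x) hv
    simp only [Matrix.mulVec_add, Matrix.mulVec_mulVec, ← mul_assoc, hSS, one_mul,
      Matrix.mulVec_zero] at this
    exact eq_neg_of_add_eq_zero_right this
  have h1 := ht v hne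
  have h2 : 0 ≤ v ⬝ᵥ ((A t * S t) *ᵥ v) := by simpa using (hAS t).dotProduct_mulVec_nonneg v
  rw [← Matrix.mulVec_mulVec, hv', Matrix.mulVec_neg, dotProduct_neg, Matrix.mulVec_mulVec] at h1
  linarith

end LocalConstancy

/-- A homotopy invariant of Clifford involutions detecting deformability to `e n`. -/
structure BottInv (n : ℕ) (A : Type) [AddCommGroup A]
    (ν : ∀ {ι : Type} [Fintype ι] [DecidableEq ι], (ℕ → Matrix ι ι ℝ) → Matrix ι ι ℝ → A) :
    Prop where
  sum : ∀ {ι κ : Type} [Fintype ι] [DecidableEq ι] [Fintype κ] [DecidableEq κ]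
    {e : ℕ → Matrix ι ι ℝ} {e' : ℕ → Matrix κ κ ℝ} {ε : Matrix ι ι ℝ} {ε' : Matrix κ κ ℝ},
    Adm n e ε → Adm n e' ε' → ν (fun i => dsum (e i) (e' i)) (dsum ε ε') = ν e ε + ν e' ε'
  refl : ∀ {ι : Type} [Fintype ι] [DecidableEq ι] {e : ℕ → Matrix ι ι ℝ},
    IsCliff (n + 1) e → ν e (e n) = 0
  path : ∀ {ι : Type} [Fintype ι] [DecidableEq ι] {e : ℕ → Matrix ι ι ℝ} {H : ℝ → Matrix ι ι ℝ},
    Continuous H → (∀ t, Adm n e (H t)) → ∀ t t', ν e (H t) = ν e (H t')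
  zero : ∀ {ι : Type} [Fintype ι] [DecidableEq ι] {e : ℕ → Matrix ι ι ℝ} {ε : Matrix ι ι ℝ},
    Adm n e ε → ν e ε = 0 → ∃ H : ℝ → Matrix ι ι ℝ, Continuous H ∧ H 0 = ε ∧ H 1 = e n ∧
      ∀ t ∈ Set.Icc (0 : ℝ) 1, SA n e (H t) ∧ IsUnit (H t)
  surj : ∀ a : A, ∃ (ι : Type) (_ : Fintype ι) (_ : DecidableEq ι) (e : ℕ → Matrix ι ι ℝ)
    (ε : Matrix ι ι ℝ), Adm n e ε ∧ ν e ε = a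

section Basic

variable {ι κ : Type} [Fintype ι] [DecidableEq ι] [Fintype κ] [DecidableEq κ] {n : ℕ}
  {e : ℕ → Matrix ι ι ℝ} {e' : ℕ → Matrix κ κ ℝ} {ε : Matrix ι ι ℝ} {ε' : Matrix κ κ ℝ}

theorem Adm.refl (h : IsCliff (n + 1) e) : Adm n e (e n) :=
  ⟨h, h.sa (by omega) le_rfl, h.sq n (by omega)⟩

theorem Adm.blockSum (h : Adm n e ε) (h' : Adm n e' ε') :
    Adm n (fun i => dsum (e i) (e' i)) (dsum ε ε') :=
  ⟨h.cliff.blockSum h'.cliff, h.sa.blockSum h'.sa, by rw [dsum_mul, h.sq, h'.sq, dsum_one]⟩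

/-- The kernel projection of a symmetric matrix. -/
noncomputable def kerProj (s : Matrix ι ι ℝ) : Matrix ι ι ℝ :=
  cfc (fun x : ℝ => if x = 0 then (1 : ℝ) else 0) (s * s)

theorem isKerProj_dsum {s w : Matrix ι ι ℝ} {s' w' : Matrix κ κ ℝ} (h : IsKerProj s w)
    (h' : IsKerProj s' w') : IsKerProj (dsum s s') (dsum w w') := by
  obtain ⟨y, h1, h2⟩ := h.inv
  obtain ⟨y', h1', h2'⟩ := h'.inv
  refine ⟨by rw [dsum_transpose, h.symm, h'.symm], by rw [dsum_mul, h.idem, h'.idem],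
    by rw [dsum_mul, h.mul, h'.mul]; simp [dsum], dsum y y', ?_, by rw [dsum_transpose, h2, h2']⟩
  rw [dsum_mul, h1, h1', ← dsum_sub, dsum_one]

theorem Adm.isKerProj (h : Adm n e ε) : IsKerProj (ε + e n) (kerProj (ε + e n)) :=
  isKerProj_cfc h.symm_add

theorem Adm.kerProj_eq {w : Matrix ι ι ℝ} (h : Adm n e ε) (hw : IsKerProj (ε + e n) w) :
    kerProj (ε + e n) = w := h.isKerProj.unique hw

theorem Adm.submod (h : Adm n e ε) :
    Submod 1 (n + 1) (replLast n e ε) (kerProj (ε + e n)) := by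
  obtain ⟨w, h1, h2⟩ := h.exists_kerProj
  rwa [h.kerProj_eq h1]

theorem Adm.kerProj_blockSum (h : Adm n e ε) (h' : Adm n e' ε') :
    kerProj (dsum ε ε' + dsum (e n) (e' n)) =
      dsum (kerProj (ε + e n)) (kerProj (ε' + e' n)) := by
  refine (h.blockSum h').kerProj_eq ?_
  rw [dsum_add]
  exact isKerProj_dsum h.isKerProj h'.isKerProj

theorem dsum_trace (a : Matrix ι ι ℝ) (b : Matrix κ κ ℝ) : (dsum a b).trace = a.trace + b.trace := by
  simp [dsum, Matrix.trace]

theorem kerProj_refl (h : IsCliff (n + 1) e) : kerProj (e n + e n) = 0 := by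
  refine (Adm.refl h).kerProj_eq ⟨by simp, by simp, by simp, (1 / 2 : ℝ) • e n, ?_, ?_⟩
  · rw [smul_mul_assoc, mul_add, h.sq n (by omega)]; module
  · rw [Matrix.transpose_smul, h.symm n (by omega)]

/-- Reflecting `e n` in a Clifford submodule. -/
theorem IsCliff.adm_reflect (h : IsCliff (n + 1) e) {q : Matrix ι ι ℝ} (hq : qᵀ = q)
    (hqq : q * q = q) (hc : ∀ i < n + 1, q * e i = e i * q) :
    Adm n e (e n * (1 - (2 : ℝ) • q)) ∧ kerProj (e n * (1 - (2 : ℝ) • q) + e n) = q := by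
  have hn := hc n (by omega)
  have hs := h.sq n (by omega)
  have hen := h.symm n (by omega)
  have hcom : (1 - (2 : ℝ) • q) * e n = e n * (1 - (2 : ℝ) • q) := by
    simp only [mul_sub, sub_mul, smul_mul_assoc, mul_smul_comm, hn, one_mul, mul_one]
  have hadm : Adm n e (e n * (1 - (2 : ℝ) • q)) := by
    refine ⟨h, ⟨?_, fun i hi => ?_⟩, ?_⟩
    · rw [Matrix.transpose_mul, hen, Matrix.transpose_sub, Matrix.transpose_smul, hq,
        Matrix.transpose_one, hcom]
    · have hi' : (1 - (2 : ℝ) • q) * e i = e i * (1 - (2 : ℝ) • q) := by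
        simp only [mul_sub, sub_mul, smul_mul_assoc, mul_smul_comm, hc i (by omega), one_mul,
          mul_one]
      rw [mul_assoc, hi', ← mul_assoc, h.anti i (by omega) n (by omega) hi.ne, neg_mul, mul_assoc]
    · rw [mul_assoc, ← mul_assoc _ (e n), hcom, mul_assoc, ← mul_assoc (e n), hs, one_mul]
      simp only [mul_sub, sub_mul, hqq, one_mul, mul_one, smul_mul_assoc, mul_smul_comm]
      module
  refine ⟨hadm, hadm.kerProj_eq ⟨hq, hqq, ?_, (1 / 2 : ℝ) • (e n * (1 - q)), ?_, ?_⟩⟩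
  · simp only [mul_sub, sub_mul, add_mul, mul_assoc, smul_mul_assoc, mul_smul_comm, hqq,
      mul_one]
    module
  · have h1 : e n * (1 - (2 : ℝ) • q) + e n = (2 : ℝ) • (e n * (1 - q)) := by
      simp only [mul_sub, mul_smul_comm, mul_one]; module
    have h2 : (1 - q) * e n = e n * (1 - q) := by simp only [mul_sub, sub_mul, hn, one_mul, mul_one]
    rw [h1, smul_mul_smul_comm, mul_assoc, ← mul_assoc (1 - q), h2, mul_assoc, ← mul_assoc (e n),
      hs, one_mul, mul_sub, sub_mul, sub_mul, hqq]
    norm_num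
  · rw [Matrix.transpose_smul, Matrix.transpose_mul, hen, Matrix.transpose_sub,
      Matrix.transpose_one, hq, sub_mul, mul_sub, hn, one_mul, mul_one]

end Basic

section CutConstancy

variable {ι : Type} [Fintype ι] [DecidableEq ι] {n : ℕ} {e : ℕ → Matrix ι ι ℝ}

theorem eventually_cut_trace {s : ℝ → Matrix ι ι ℝ} (hs : Continuous s) (hst : ∀ t, (s t)ᵀ = s t)
    (t₀ : ℝ) : ∃ c : ℝ, 0 < c ∧ c < 4 ∧
      ∀ᶠ t in nhds t₀, (cutProj c (s t)).trace = (cutProj c (s t₀)).trace := by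
  have hY : ∀ t, (s t * s t)ᵀ = s t * s t := fun t => by rw [Matrix.transpose_mul, hst]
  obtain ⟨c, hc, hcs⟩ := ((Set.Ioo_infinite (show (0 : ℝ) < 4 by norm_num)).sdiff
    (Matrix.finite_real_spectrum (A := s t₀ * s t₀))).nonempty
  refine ⟨c, hc.1, hc.2, ?_⟩
  have hu : IsUnit (s t₀ * s t₀ - c • 1) := by
    have := (spectrum.notMem_iff.1 hcs).neg
    rwa [neg_sub, Algebra.algebraMap_eq_smul_one] at this
  have h2 : ∀ t, 1 - (2 : ℝ) • cutProj c (s t) =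
      cfc (fun x : ℝ => 1 - 2 * if x < c then (1 : ℝ) else 0) (s t * s t) := fun t => by
    rw [cfc_sub _ _ _ (continuousOn_matrix_spectrum _ _) (continuousOn_matrix_spectrum _ _),
      cfc_const_mul _ _ _ (continuousOn_matrix_spectrum _ _), fc_one (hY t), cutProj]
  have h3 : ∀ t, s t * s t - c • 1 = cfc (fun x : ℝ => x - c * 1) (s t * s t) := fun t => by
    rw [cfc_sub _ _ _ (continuousOn_matrix_spectrum _ _) (continuousOn_matrix_spectrum _ _),
      cfc_const_mul _ _ _ (continuousOn_matrix_spectrum _ _), fc_one (hY t), fc_id (hY t)]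
  have key := eventually_trace_eq (A := fun t => s t * s t - c • 1)
    (S := fun t => 1 - (2 : ℝ) • cutProj c (s t)) (by fun_prop) (fun t => ?_) (fun t => ?_) hu
  · filter_upwards [key] with t ht
    simp only [Matrix.trace_sub, Matrix.trace_smul, smul_eq_mul] at ht
    linarith
  · simp only [mul_sub, sub_mul, smul_mul_smul_comm, cutProj_idem, one_mul, mul_one]
    module
  · rw [h2, h3, fc_mul]
    have : (fun x : ℝ => (x - c * 1) * (1 - 2 * if x < c then (1 : ℝ) else 0)) =
        fun x => √|x - c| * √|x - c| := by
      ext x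
      rw [Real.mul_self_sqrt (abs_nonneg _)]
      split_ifs with h
      · rw [abs_of_neg (by linarith)]; ring
      · rw [abs_of_nonneg (by linarith)]; ring
    rw [this, ← fc_mul]
    have := psd_self_mul_transpose (cfc (fun x : ℝ => √|x - c|) (s t * s t))
    rwa [fc_symm] at this

theorem const_of_eventually {A : Type} {g : ℝ → A} (h : ∀ t₀, ∀ᶠ t in nhds t₀, g t = g t₀) :
    ∀ t t', g t = g t' := by
  have : IsLocallyConstant g := (IsLocallyConstant.iff_eventually_eq g).2 h
  exact fun t t' => this.apply_eq_of_preconnectedSpace t t'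

end CutConstancy

section FullMonomial

variable {ι κ : Type} [Fintype ι] [DecidableEq ι] [Fintype κ] [DecidableEq κ] {n m : ℕ}
  {p q : Matrix ι ι ℝ} {f : ℕ → Matrix ι ι ℝ} {e : ℕ → Matrix ι ι ℝ} {ε : Matrix ι ι ℝ}

theorem mon_congr_gen {f' : ℕ → Matrix ι ι ℝ} {A : Finset ℕ} : ∀ k : ℕ, (∀ i < k, f i = f' i) →
    mon p f k A = mon p f' k A
  | 0, _ => rfl
  | k + 1, h => by
    rw [mon, mon, h k (Nat.lt_succ_self k),
      mon_congr_gen k fun i hi => h i (hi.trans (Nat.lt_succ_self k))]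

theorem mon_dsum {e' : ℕ → Matrix κ κ ℝ} {A : Finset ℕ} : ∀ k : ℕ,
    mon 1 (fun i => dsum (e i) (e' i)) k A = dsum (mon 1 e k A) (mon 1 e' k A)
  | 0 => by simp only [mon, dsum_one]
  | k + 1 => by
    simp only [mon]
    split_ifs
    · rw [mon_dsum k, dsum_mul]
    · rw [mon_dsum k]

theorem odd_choose_two (h : m % 4 = 3) : Odd (m.choose 2) := by
  rw [Nat.choose_two_right]
  obtain ⟨a, rfl⟩ : ∃ a, m = 4 * a + 3 := ⟨m / 4, by omega⟩
  rw [show (4 * a + 3) * (4 * a + 3 - 1) = 2 * ((4 * a + 3) * (2 * a + 1)) by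
    rw [show 4 * a + 3 - 1 = 2 * (2 * a + 1) by omega]; ring, Nat.mul_div_cancel_left _ two_pos]
  exact Odd.mul ⟨2 * a + 1, by ring⟩ ⟨a, by ring⟩

theorem even_choose_two (h : m % 4 = 1) : Even (m.choose 2) := by
  rw [Nat.choose_two_right]
  obtain ⟨a, rfl⟩ : ∃ a, m = 4 * a + 1 := ⟨m / 4, by omega⟩
  rw [show (4 * a + 1) * (4 * a + 1 - 1) = 2 * (2 * ((4 * a + 1) * a)) by
    rw [show 4 * a + 1 - 1 = 2 * (2 * a) by omega]; ring, Nat.mul_div_cancel_left _ two_pos]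
  exact even_two_mul _

theorem CornerCliff.trace_full_eq_zero (h : CornerCliff p m f) (hm : 0 < m)
    (hm4 : m % 4 = 3 ∨ m % 2 = 0) : (mon p f m (Finset.range m)).trace = 0 := by
  rcases hm4 with h3 | h2
  · have ht := h.transpose_mon m le_rfl (Finset.range m) le_rfl
    rw [Finset.card_range, (odd_choose_two h3).neg_one_pow, neg_one_smul] at ht
    have := congrArg Matrix.trace ht
    rw [Matrix.trace_transpose, Matrix.trace_neg] at this
    linarith
  · exact h.trace_mon_eq_zero le_rfl (by simpa using hm.ne') fun _ => Nat.even_iff.2 h2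

theorem CornerCliff.trace_corner_full_eq_zero (h : CornerCliff p m f) (hq : Submod p m f q)
    (hm : 0 < m) (hm4 : m % 4 = 3 ∨ m % 2 = 0) :
    (q * mon p f m (Finset.range m)).trace = 0 := by
  rw [← hq.mon_corner h _ m le_rfl]
  exact (hq.cornerCliff h).trace_full_eq_zero hm hm4

theorem CornerCliff.trace_corner_full_of_hasExt (h : CornerCliff p m f) (hq : Submod p m f q)
    (hm : m % 2 = 1) (hext : HasExt m f q) : (q * mon p f m (Finset.range m)).trace = 0 := by
  obtain ⟨ζ, z1, z2, z3, z4⟩ := hext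
  have key : ∀ k ≤ m, ζ * mon p f k (Finset.range k) =
      ((-1) ^ k : ℝ) • (mon p f k (Finset.range k) * ζ) := by
    intro k
    induction k with
    | zero =>
      intro _
      have h1 : p * ζ = ζ := by rw [← z3, ← mul_assoc, hq.le]
      simp [mon, h1, mul_eq_of_le h.psymm z1 h1]
    | succ k ih =>
      intro hk
      rw [Finset.range_add_one, mon_succ_insert, ← mul_assoc, z4 k (by omega), neg_mul, mul_assoc,
        ih (by omega), mul_smul_comm, pow_succ, mul_assoc]
      module
  have h1 := key m le_rfl
  rw [(Nat.odd_iff.2 hm).neg_one_pow, neg_one_smul] at h1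
  have h2 : (q * mon p f m (Finset.range m)).trace = -(q * mon p f m (Finset.range m)).trace := by
    nth_rewrite 1 [← z2]
    rw [mul_assoc, h1, mul_neg, Matrix.trace_neg, Matrix.trace_mul_comm, mul_assoc, z2,
      Matrix.trace_mul_comm]
  linarith

end FullMonomial

section Trivial

variable {n : ℕ}

theorem bottInv_trivial_of (h : ∀ {ι : Type} [Fintype ι] [DecidableEq ι] {p q : Matrix ι ι ℝ}
    {f : ℕ → Matrix ι ι ℝ}, CornerCliff p (n + 1) f → Submod p (n + 1) f q → HasExt (n + 1) f q) :
    BottInv n PUnit fun _ _ => 0 where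
  sum _ _ := rfl
  refl _ := rfl
  path _ _ _ _ := rfl
  zero hA _ := hA.exists_path hA.isKerProj hA.submod (h hA.cornerCliff hA.submod)
  surj _ := by
    obtain ⟨μ, _, _, g, -, hg⟩ := exists_cliff (n + 1)
    exact ⟨μ, _, _, g, _, Adm.refl hg, rfl⟩

theorem signCount_values {σ : ℝ} : signCount σ 1 = 1 + σ ∧ signCount σ 2 = 1 + σ + σ * (1 - σ) := by
  have h1 : signCount σ 1 = 1 + σ := by simp [signCount_succ, signCount_zero]
  have h1' : signCount (-σ) 1 = 1 - σ := by
    rw [signCount_succ, signCount_zero, signCount_zero]; ring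
  refine ⟨h1, ?_⟩
  rw [show (2 : ℕ) = 1 + 1 from rfl, signCount_succ, h1, h1']

theorem signCount_table (j : ℕ) :
    signCount 1 (1 + 8 * j) = 16 ^ j * 2 ∧ signCount (-1) (1 + 8 * j) = 0 ∧
    signCount 1 (2 + 8 * j) = 16 ^ j * 2 ∧ signCount (-1) (2 + 8 * j) = 16 ^ j * -2 ∧
    signCount 1 (3 + 8 * j) = 0 ∧ signCount (-1) (3 + 8 * j) = 16 ^ j * -4 ∧
    signCount 1 (4 + 8 * j) = 16 ^ j * -4 ∧
    signCount 1 (5 + 8 * j) = 16 ^ j * -8 ∧ signCount (-1) (5 + 8 * j) = 0 ∧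
    signCount (-1) (6 + 8 * j) = 16 ^ j * 8 ∧ signCount (-1) (7 + 8 * j) = 16 ^ j * 16 ∧
    signCount (-1) (8 + 8 * j) = 16 ^ j * 16 := by
  have p1 : (1 : ℝ) * 1 = 1 := by norm_num
  have m1 : (-1 : ℝ) * -1 = 1 := by norm_num
  have a0 := signCount_zero 1
  have b0 := signCount_zero (-1)
  have a1 : signCount 1 1 = 2 := by rw [signCount_values.1]; norm_num
  have b1 : signCount (-1) 1 = 0 := by rw [signCount_values.1]; norm_num
  have a2 : signCount 1 2 = 2 := by rw [signCount_values.2]; norm_num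
  have b2 : signCount (-1) 2 = -2 := by rw [signCount_values.2]; norm_num
  have a3 : signCount 1 3 = 0 := by
    have := signCount_succ 1 2; norm_num [a2, b2] at this ⊢; exact this
  have b3 : signCount (-1) 3 = -4 := by
    have := signCount_succ (-1) 2; norm_num [a2, b2] at this ⊢; exact this
  have f := signCount_add_four p1
  have g := signCount_add_four m1
  have a4 := f 0
  have a5 := f 1
  have b4 := g 0
  have b5 := g 1
  have b6 := g 2
  have b7 := g 3
  have b8 := g 4
  rw [a0, zero_add] at a4
  rw [b0, zero_add] at b4
  rw [a1] at a5
  rw [b1] at b5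
  rw [b2] at b6
  rw [b3] at b7
  rw [b4] at b8
  norm_num at a4 a5 b4 b5 b6 b7 b8
  simp only [signCount_add_mul_eight p1, signCount_add_mul_eight m1, a1, b1, a2, b2, a3, b3, a4, a5,
    b5, b6, b7, b8]
  norm_num

theorem bottInv_trivial (hn : n % 8 = 3 ∨ n % 8 = 5 ∨ n % 8 = 6 ∨ n % 8 = 7) :
    BottInv n PUnit fun _ _ => 0 := by
  refine bottInv_trivial_of fun {ι} _ _ {p q f} hc hq => ?_
  by_cases h4 : n % 4 = 3
  · set w := mon p f n (Finset.range n) with hw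
    have hsub : Finset.range n ⊆ Finset.range n := le_rfl
    have w1 : wᵀ = -w := by
      have := hc.transpose_mon n (by omega) _ hsub
      rwa [Finset.card_range, (odd_choose_two h4).neg_one_pow, neg_one_smul] at this
    have w2 : w * w = -p := by
      have := hc.mon_mul_self (by omega) hsub
      rwa [Finset.card_range, (odd_choose_two h4).neg_one_pow, neg_one_smul] at this
    have hodd : Odd n := Nat.odd_iff.2 (by omega)
    have w3 : ∀ i < n, f i * w = w * f i := fun i hi => by
      have := hc.gen_mul_mon (j := i) (by omega) n (by omega) _ hsub
      simpa [hi, hodd.neg_one_pow] using this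
    have w4 : f n * w = -(w * f n) := by
      have := hc.gen_mul_mon (j := n) (by omega) n (by omega) _ hsub
      simpa [hodd.neg_one_pow] using this
    have w5 : q * w = w * q := by
      have h1 : ∀ k ≤ n + 1, q * mon p f k (Finset.range n) = mon p f k (Finset.range n) * q := by
        intro k
        induction k with
        | zero => intro _; rw [mon, hq.le' hc, hq.le]
        | succ k ih =>
          intro hk
          rw [mon]
          split_ifs
          · rw [← mul_assoc, hq.comm k (by omega), mul_assoc, ih (by omega), mul_assoc]
          · exact ih (by omega)
      exact h1 n (by omega)
    have hn' := hq.comm n (by omega)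
    have w6 : w * p = w := hc.mon_mul _ n (by omega)
    have hpq := hq.le
    refine ⟨q * (w * f n), ?_, ?_, by rw [← mul_assoc, hq.idem], fun i hi => ?_⟩
    · rw [Matrix.transpose_mul, Matrix.transpose_mul, w1, hc.symm n (by omega), hq.symm, mul_neg, w4,
        neg_neg, mul_assoc, ← hn', ← mul_assoc, ← w5, mul_assoc]
    · have e1 : q * (w * f n) = w * f n * q := by rw [← mul_assoc, w5, mul_assoc, hn', mul_assoc]
      have e2 : w * f n * (w * f n) = p := by
        rw [mul_assoc, ← mul_assoc (f n), w4, neg_mul, mul_assoc w, hc.sq n (by omega), w6, mul_neg,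
          w2, neg_neg]
      calc q * (w * f n) * (q * (w * f n)) = q * (w * f n) * (w * f n * q) := by rw [← e1]
        _ = q * (w * f n * (w * f n)) * q := by simp only [mul_assoc]
        _ = q := by rw [e2, mul_assoc, hpq, hq.idem]
    · rcases Nat.lt_succ_iff_lt_or_eq.1 hi with h1 | rfl
      · rw [mul_assoc, mul_assoc w, hc.anti n (by omega) i hi h1.ne', mul_neg, ← mul_assoc w,
          ← w3 i h1, mul_neg, mul_assoc, ← mul_assoc q, hq.comm i hi, mul_assoc]
      · rw [mul_assoc q, ← mul_assoc (f i), ← hn', mul_assoc q (f i), ← mul_assoc (f i) w, w4, neg_mul,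
          mul_neg, neg_neg, mul_assoc]
  · obtain ⟨-, -, -, -, -, -, -, -, -, t6, t7, t8⟩ := signCount_table (n / 8)
    have hpos : (0 : ℝ) < 16 ^ (n / 8) := by positivity
    have hα : 0 < signCount (-1) (n + 1) := by
      rcases hn with h | h | h | h
      · omega
      · rw [show n + 1 = 6 + 8 * (n / 8) by omega, t6]; positivity
      · rw [show n + 1 = 7 + 8 * (n / 8) by omega, t7]; positivity
      · rw [show n + 1 = 8 + 8 * (n / 8) by omega, t8]; positivity
    refine hc.hasExt_of_pos (by omega) (fun _ => True) (fun q hq h0 _ => ?_)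
      (fun _ _ _ _ _ _ _ => trivial) q hq trivial
    have hD := trace_pos_of_idem hq.symm hq.idem h0
    rw [hc.trace_corner_full_eq_zero hq (by omega) (by omega)]
    nlinarith [mul_pos hα hD, sq_nonneg q.trace]

end Trivial

section Counting

/-- The numerical equation forced on the trace `D` of an irreducible Clifford module. -/
def IrrDim (m : ℕ) (d : ℝ) : Prop :=
  ∀ D τ : ℝ, 0 < D → (m % 4 = 3 ∨ m % 2 = 0 → τ = 0) → (m % 4 = 1 → τ ^ 2 = D ^ 2) →
    D ^ 2 + signCount 1 m * D + τ ^ 2 = 2 ^ (m + 1) → D = d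

theorem CornerCliff.exists_trace {ι : Type} [Fintype ι] [DecidableEq ι] {p : Matrix ι ι ℝ} {m : ℕ}
    {f : ℕ → Matrix ι ι ℝ} (h : CornerCliff p m f) (hm : 0 < m) {d : ℝ} (hd : IrrDim m d) :
    ∃ k : ℕ, p.trace = k * d :=
  (h.exists_irreducible hm hd p h.self).1

/-- The rank of the kernel projection of `ε + e n` in units of `d`, as an integer. -/
noncomputable def kerCount {ι : Type} [Fintype ι] [DecidableEq ι] (n : ℕ) (d : ℝ)
    (e : ℕ → Matrix ι ι ℝ) (ε : Matrix ι ι ℝ) : ℤ := ⌊(kerProj (ε + e n)).trace / d⌋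

variable {ι κ : Type} [Fintype ι] [DecidableEq ι] [Fintype κ] [DecidableEq κ] {n : ℕ}
  {e : ℕ → Matrix ι ι ℝ} {ε : Matrix ι ι ℝ} {d : ℝ}

theorem kerCount_eq (hd0 : 0 < d) {k : ℤ} (h : (kerProj (ε + e n)).trace = k * d) :
    kerCount n d e ε = k := by
  rw [kerCount, h, mul_div_cancel_right₀ _ hd0.ne', Int.floor_intCast]

theorem Adm.kerCount_mul (hd0 : 0 < d) (hd : IrrDim (n + 1) d) (h : Adm n e ε) :
    (kerProj (ε + e n)).trace = kerCount n d e ε * d := by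
  obtain ⟨k, hk⟩ := (h.cornerCliff.exists_irreducible (by omega) hd _ h.submod).1
  have : (kerProj (ε + e n)).trace = (k : ℤ) * d := by rw [hk]; push_cast; rfl
  rw [kerCount_eq hd0 this, this]

theorem Adm.kerCount_cut (hd' : IrrDim (n + 1 + 1) (2 * d)) (h : Adm n e ε) {c : ℝ}
    (hc : 0 < c) (hc4 : c < 4) :
    ∃ j : ℤ, (kerProj (ε + e n)).trace = (cutProj c (ε + e n)).trace - j * (2 * d) := by
  obtain ⟨h1, h2⟩ := h.cut_sub h.isKerProj hc hc4
  obtain ⟨f', hf⟩ := h2.cornerCliff h.cornerCliff h1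
  obtain ⟨j, hj⟩ := hf.exists_trace (by omega) hd'
  refine ⟨j, ?_⟩
  rw [Matrix.trace_sub] at hj
  push_cast
  linarith

theorem Adm.hasExt_of_even (hd0 : 0 < d) (hd' : IrrDim (n + 1 + 1) (2 * d))
    (hm : (n + 1) % 4 = 3 ∨ (n + 1) % 2 = 0) (hα : signCount (-1) (n + 1) = -d) (h : Adm n e ε)
    {k : ℤ} (hk : (kerProj (ε + e n)).trace = k * (2 * d)) :
    HasExt (n + 1) (replLast n e ε) (kerProj (ε + e n)) := by
  have hc := h.cornerCliff
  refine hc.hasExt_of_pos (by omega) (fun q => ∃ k : ℤ, q.trace = k * (2 * d))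
    (fun q hq h0 ⟨k, hk⟩ => ?_) (fun q q' hq hq' hqq ⟨k, hk⟩ hext => ?_) _ h.submod ⟨k, hk⟩
  · have hD := trace_pos_of_idem hq.symm hq.idem h0
    rw [hc.trace_corner_full_eq_zero hq (by omega) hm, hα]
    have hk0 : (0 : ℝ) < k := by
      by_contra hcon
      rw [hk] at hD
      nlinarith
    have hk1 : (1 : ℝ) ≤ k := by exact_mod_cast hk0
    rw [hk]
    nlinarith [mul_pos hd0 hd0, mul_nonneg (sub_nonneg.2 hk1) hk0.le, mul_pos (mul_pos hd0 hd0) hk0,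
      mul_nonneg (mul_pos hd0 hd0).le (mul_nonneg (sub_nonneg.2 hk1) hk0.le)]
  · obtain ⟨f', hf⟩ := hext.cornerCliff hc hq'
    obtain ⟨j, hj⟩ := hf.exists_trace (by omega) hd'
    exact ⟨k - j, by rw [Matrix.trace_sub, hk, hj]; push_cast; ring⟩

theorem replLast_self {i : ℕ} (hi : i < n + 1) : replLast n e (e n) i = e i := by
  unfold replLast
  split_ifs with h
  · rfl
  · rw [show i = n by omega]

theorem exists_irreducible_clifford (hd : IrrDim (n + 1) d) :
    ∃ (μ : Type) (_ : Fintype μ) (_ : DecidableEq μ) (g : ℕ → Matrix μ μ ℝ), IsCliff (n + 1) g ∧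
      CornerCliff 1 (n + 1) g ∧ ∃ q, Submod 1 (n + 1) g q ∧ q.trace = d ∧
      ((n + 1) % 4 = 1 → (q * mon 1 g (n + 1) (Finset.range (n + 1))).trace ^ 2 = d ^ 2) := by
  obtain ⟨μ, _, _, g, hμ, hg⟩ := exists_cliff (n + 1)
  have hc : CornerCliff 1 (n + 1) g := by
    have := (Adm.refl hg).cornerCliff
    exact ⟨this.psymm, this.idem, fun i hi => by
        simpa only [replLast_self hi] using this.symm i hi, fun i hi => by
        simpa only [replLast_self hi] using this.sq i hi, fun i hi => by
        simpa only [replLast_self hi] using this.corner i hi, fun i hi j hj => by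
        simpa only [replLast_self hi, replLast_self hj] using this.anti i hi j hj⟩
  obtain ⟨q, h1, -, h3, h4⟩ := (hc.exists_irreducible (by omega) hd 1 hc.self).2 one_ne_zero
  exact ⟨μ, _, _, g, hg, hc, q, h1, h3, h4⟩

theorem bottInv_two_of (hd0 : 0 < d) (hd : IrrDim (n + 1) d) (hd' : IrrDim (n + 1 + 1) (2 * d))
    (hm : (n + 1) % 4 = 3 ∨ (n + 1) % 2 = 0) (hα : signCount (-1) (n + 1) = -d) :
    BottInv n (ZMod 2) fun e ε => (kerCount n d e ε : ZMod 2) where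
  sum h h' := by
    rw [← Int.cast_add]
    refine congrArg _ (kerCount_eq hd0 ?_)
    rw [h.kerProj_blockSum h', dsum_trace, h.kerCount_mul hd0 hd, h'.kerCount_mul hd0 hd]
    push_cast; ring
  refl h := by
    rw [kerCount_eq (k := 0) hd0 (by rw [kerProj_refl h]; simp), Int.cast_zero]
  path {ι _ _ e H} hH hA := by
    refine const_of_eventually fun t₀ => ?_
    obtain ⟨c, hc0, hc4, hc⟩ := eventually_cut_trace (s := fun t => H t + e n) (by fun_prop)
      (fun t => (hA t).symm_add) t₀
    filter_upwards [hc] with t ht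
    obtain ⟨j, hj⟩ := (hA t).kerCount_cut hd' hc0 hc4
    obtain ⟨j', hj'⟩ := (hA t₀).kerCount_cut hd' hc0 hc4
    have e1 := (hA t).kerCount_mul hd0 hd
    have e2 := (hA t₀).kerCount_mul hd0 hd
    have : (kerCount n d e (H t) : ℝ) = kerCount n d e (H t₀) + 2 * (j' - j) := by
      have : (kerCount n d e (H t) : ℝ) * d = (kerCount n d e (H t₀) + 2 * (j' - j)) * d := by
        rw [← e1, hj, ht, add_mul, ← e2, hj']; ring
      exact mul_right_cancel₀ hd0.ne' this
    have : kerCount n d e (H t) = kerCount n d e (H t₀) + 2 * (j' - j) := by exact_mod_cast this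
    rw [this]
    push_cast
    rw [show (2 : ZMod 2) = 0 from rfl]; ring
  zero {ι _ _ e ε} h h0 := by
    obtain ⟨k, hk⟩ := (ZMod.intCast_zmod_eq_zero_iff_dvd _ 2).1 h0
    refine h.exists_path h.isKerProj h.submod (h.hasExt_of_even hd0 hd' hm hα (k := k) ?_)
    rw [h.kerCount_mul hd0 hd, hk]; push_cast; ring
  surj a := by
    obtain ⟨μ, _, _, g, hg, hc, q, hq, ht, -⟩ := exists_irreducible_clifford hd
    obtain ⟨h1, h2⟩ := hg.adm_reflect hq.symm hq.idem hq.comm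
    have ha : a = 0 ∨ a = 1 := by revert a; decide
    rcases ha with rfl | rfl
    · refine ⟨μ, _, _, g, g n, Adm.refl hg, ?_⟩
      rw [kerCount_eq (k := 0) hd0 (by rw [kerProj_refl hg]; simp), Int.cast_zero]
    · refine ⟨μ, _, _, g, _, h1, ?_⟩
      rw [kerCount_eq (k := 1) hd0 (by rw [h2, ht]; simp), Int.cast_one]

theorem two_pow_add (k m : ℕ) : (2 : ℝ) ^ (k + 8 * m) = 2 ^ k * (16 ^ m * 16 ^ m) := by
  rw [pow_add, pow_mul, ← mul_pow]; norm_num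

theorem bottInv_two (hn : n % 8 = 1 ∨ n % 8 = 2) :
    ∃ d : ℝ, BottInv n (ZMod 2) fun e ε => (kerCount n d e ε : ZMod 2) := by
  obtain ⟨-, -, t3, t4, t5, t6, t7, -⟩ := signCount_table (n / 8)
  have hpos : (0 : ℝ) < 16 ^ (n / 8) := by positivity
  rcases hn with h | h
  · refine ⟨2 * 16 ^ (n / 8), bottInv_two_of (by positivity) ?_ ?_ (by omega) ?_⟩
    · intro D τ hD h0 _ he
      rw [h0 (by omega), show n + 1 = 2 + 8 * (n / 8) by omega, t3,
        show 2 + 8 * (n / 8) + 1 = 3 + 8 * (n / 8) by omega, two_pow_add] at he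
      have : (D - 2 * 16 ^ (n / 8)) * (D + 4 * 16 ^ (n / 8)) = 0 := by linear_combination he
      rcases mul_eq_zero.1 this with h | h <;> linarith
    · intro D τ hD h0 _ he
      rw [h0 (by omega), show n + 1 + 1 = 3 + 8 * (n / 8) by omega, t5,
        show 3 + 8 * (n / 8) + 1 = 4 + 8 * (n / 8) by omega, two_pow_add] at he
      have : (D - 2 * (2 * 16 ^ (n / 8))) * (D + 4 * 16 ^ (n / 8)) = 0 := by linear_combination he
      rcases mul_eq_zero.1 this with h | h <;> linarith
    · rw [show n + 1 = 2 + 8 * (n / 8) by omega, t4]; ring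
  · refine ⟨4 * 16 ^ (n / 8), bottInv_two_of (by positivity) ?_ ?_ (by omega) ?_⟩
    · intro D τ hD h0 _ he
      rw [h0 (by omega), show n + 1 = 3 + 8 * (n / 8) by omega, t5,
        show 3 + 8 * (n / 8) + 1 = 4 + 8 * (n / 8) by omega, two_pow_add] at he
      have : (D - 4 * 16 ^ (n / 8)) * (D + 4 * 16 ^ (n / 8)) = 0 := by linear_combination he
      rcases mul_eq_zero.1 this with h | h <;> linarith
    · intro D τ hD h0 _ he
      rw [h0 (by omega), show n + 1 + 1 = 4 + 8 * (n / 8) by omega, t7,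
        show 4 + 8 * (n / 8) + 1 = 5 + 8 * (n / 8) by omega, two_pow_add] at he
      have : (D - 2 * (4 * 16 ^ (n / 8))) * (D + 4 * 16 ^ (n / 8)) = 0 := by linear_combination he
      rcases mul_eq_zero.1 this with h | h <;> linarith
    · rw [show n + 1 = 3 + 8 * (n / 8) by omega, t6]; ring

end Counting

section Signature

variable {ι κ : Type} [Fintype ι] [DecidableEq ι] [Fintype κ] [DecidableEq κ] {n m : ℕ}
  {p q : Matrix ι ι ℝ} {f : ℕ → Matrix ι ι ℝ}
  {e : ℕ → Matrix ι ι ℝ} {ε : Matrix ι ι ℝ} {e' : ℕ → Matrix κ κ ℝ} {ε' : Matrix κ κ ℝ} {d : ℝ}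

theorem Submod.comm_mon (hc : CornerCliff p m f) (hq : Submod p m f q) {A : Finset ℕ} :
    ∀ k ≤ m, q * mon p f k A = mon p f k A * q
  | 0, _ => by rw [mon, hq.le' hc, hq.le]
  | k + 1, hk => by
    rw [mon]
    split_ifs
    · rw [← mul_assoc, hq.comm k (by omega), mul_assoc, Submod.comm_mon hc hq k (by omega),
        mul_assoc]
    · exact Submod.comm_mon hc hq k (by omega)

/-- The product of the first `n` generators. -/
noncomputable abbrev volumeMon (n : ℕ) (e : ℕ → Matrix ι ι ℝ) : Matrix ι ι ℝ :=
  mon 1 e n (Finset.range n)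

theorem volumeMon_replLast : volumeMon n (replLast n e ε) = volumeMon n e :=
  mon_congr_gen n fun i hi => by simp [replLast, hi]

theorem volumeMon_succ : volumeMon (n + 1) e = e n * volumeMon n e := by
  rw [volumeMon, Finset.range_add_one, mon_succ_insert]

theorem volumeMon_succ_replLast :
    volumeMon (n + 1) (replLast n e ε) = ε * volumeMon n e := by
  rw [volumeMon_succ, volumeMon_replLast]; simp [replLast]

theorem Adm.comm_volumeMon (hn : n % 4 = 0) (h : Adm n e ε) :
    ε * volumeMon n e = volumeMon n e * ε := by
  have := h.cornerCliff.gen_mul_mon (j := n) (by omega) n (by omega) (Finset.range n) le_rfl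
  rw [show mon 1 (replLast n e ε) n (Finset.range n) = volumeMon n e from volumeMon_replLast] at this
  have hev : Even n := Nat.even_iff.2 (by omega)
  simpa [replLast, hev.neg_one_pow] using this

theorem Adm.trace_volume (hn : n % 4 = 0) (h : Adm n e ε) :
    (ε * volumeMon n e).trace - (e n * volumeMon n e).trace =
      2 * (kerProj (ε + e n) * volumeMon (n + 1) (replLast n e ε)).trace := by
  have hw := h.isKerProj
  rw [volumeMon_succ_replLast]
  set w := kerProj (ε + e n)
  set M := volumeMon n e with hM
  obtain ⟨y, y1, y2⟩ := hw.inv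
  have c1 := h.comm_volumeMon hn
  have c2 := (Adm.refl h.cliff).comm_volumeMon hn
  have hη := h.cliff.sq n (by omega)
  have hηs := h.cliff.symm n (by omega)
  have y3 : (ε + e n) * y = 1 - w := by
    have := congrArg Matrix.transpose y1
    rwa [Matrix.transpose_mul, y2, h.symm_add, Matrix.transpose_sub, Matrix.transpose_one,
      hw.symm] at this
  have s1 : (ε + e n) * ε = e n * (ε + e n) := by rw [add_mul, mul_add, h.sq, hη, add_comm]
  have s2 : (ε + e n) * M = M * (ε + e n) := by rw [add_mul, mul_add, c1, c2]
  have k1 : ((1 - w) * (ε * M)).trace = ((1 - w) * (e n * M)).trace := by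
    rw [← y1, mul_assoc, ← mul_assoc _ ε, s1, mul_assoc, s2, ← mul_assoc, ← mul_assoc,
      Matrix.trace_mul_comm, ← mul_assoc, ← mul_assoc, y3, mul_assoc, y1]
  have k2 : w * e n = -(w * ε) := by
    have := congrArg Matrix.transpose (Adm.mul_kerProj hw)
    rwa [Matrix.transpose_neg, Matrix.transpose_mul, Matrix.transpose_mul, hw.symm, h.sa.1,
      hηs] at this
  have k3 : (w * (e n * M)).trace = -(w * (ε * M)).trace := by
    rw [← mul_assoc, k2, neg_mul, Matrix.trace_neg, mul_assoc]
  rw [sub_mul, sub_mul, Matrix.trace_sub, Matrix.trace_sub, one_mul, one_mul] at k1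
  linarith

theorem CornerCliff.volume_symm (hm : m % 4 = 1) (hc : CornerCliff 1 m f) :
    (volumeMon m f)ᵀ = volumeMon m f := by
  have := hc.transpose_mon m le_rfl (Finset.range m) le_rfl
  rwa [Finset.card_range, (even_choose_two hm).neg_one_pow, one_smul] at this

theorem CornerCliff.volume_sq (hm : m % 4 = 1) (hc : CornerCliff 1 m f) :
    volumeMon m f * volumeMon m f = 1 := by
  have := hc.mon_mul_self le_rfl (A := Finset.range m) le_rfl
  rwa [Finset.card_range, (even_choose_two hm).neg_one_pow, one_smul] at this

theorem CornerCliff.volume_comm (hm : m % 4 = 1) (hc : CornerCliff 1 m f) {i : ℕ} (hi : i < m) :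
    volumeMon m f * f i = f i * volumeMon m f := by
  have := hc.gen_mul_mon hi m le_rfl (Finset.range m) le_rfl
  rw [Finset.card_range, (Nat.odd_iff.2 (by omega : m % 2 = 1)).neg_one_pow,
    if_pos (Finset.mem_range.2 hi)] at this
  simpa using this.symm

theorem CornerCliff.submod_chiral (hm : m % 4 = 1) (hc : CornerCliff 1 m f)
    (hq : Submod 1 m f q) {σ : ℝ} (hσ : σ * σ = 1) :
    Submod 1 m f ((1 / 2 : ℝ) • (q + σ • (q * volumeMon m f))) := by
  have hcomm : q * volumeMon m f = volumeMon m f * q := hq.comm_mon hc m le_rfl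
  have hsq := hc.volume_sq hm
  have hsy := hc.volume_symm hm
  have hco := fun i (hi : i < m) => hc.volume_comm hm hi
  generalize volumeMon m f = v at *
  have e1 : q * v * (q * v) = q := by
    rw [mul_assoc, ← mul_assoc v, ← hcomm, mul_assoc q v, hsq, mul_one, hq.idem]
  have e2 : q * (q * v) = q * v := by rw [← mul_assoc, hq.idem]
  have e3 : q * v * q = q * v := by rw [mul_assoc, ← hcomm, e2]
  refine ⟨?_, ?_, by rw [one_mul], fun i hi => ?_⟩
  · rw [Matrix.transpose_smul, Matrix.transpose_add, Matrix.transpose_smul, Matrix.transpose_mul,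
      hsy, hq.symm, ← hcomm]
  · simp only [smul_mul_assoc, mul_smul_comm, add_mul, mul_add, e1, e2, e3, hq.idem, smul_add,
      smul_smul]
    rcases mul_self_eq_one_iff.1 hσ with rfl | rfl <;> module
  · simp only [smul_mul_assoc, mul_smul_comm, add_mul, mul_add, mul_assoc, hco i hi,
      hq.comm i hi]
    rw [← mul_assoc q, hq.comm i hi, mul_assoc]

theorem CornerCliff.exists_trace_volume (hm : m % 4 = 1) (hd : IrrDim m d)
    (hc : CornerCliff 1 m f) (hq : Submod 1 m f q) :
    ∃ k : ℤ, (q * volumeMon m f).trace = k * d := by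
  obtain ⟨k, hk⟩ := (hc.exists_irreducible (by omega) hd _
    (hc.submod_chiral hm hq (σ := 1) (by norm_num))).1
  obtain ⟨l, hl⟩ := (hc.exists_irreducible (by omega) hd _
    (hc.submod_chiral hm hq (σ := -1) (by norm_num))).1
  refine ⟨k - l, ?_⟩
  simp only [Matrix.trace_smul, Matrix.trace_add, smul_eq_mul] at hk hl
  push_cast
  linarith

/-- The difference of the oriented volumes of `ε` and `e n` in units of `2 * d`. -/
noncomputable def volCount (n : ℕ) (d : ℝ) (e : ℕ → Matrix ι ι ℝ) (ε : Matrix ι ι ℝ) : ℤ :=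
  ⌊((ε * volumeMon n e).trace - (e n * volumeMon n e).trace) / (2 * d)⌋

theorem volCount_eq (hd0 : 0 < d) {k : ℤ}
    (h : (ε * volumeMon n e).trace - (e n * volumeMon n e).trace = k * (2 * d)) :
    volCount n d e ε = k := by
  rw [volCount, h, mul_div_cancel_right₀ _ (by positivity), Int.floor_intCast]

theorem Adm.volCount_mul (hd0 : 0 < d) (hn : n % 4 = 0) (hd : IrrDim (n + 1) d) (h : Adm n e ε) :
    (ε * volumeMon n e).trace - (e n * volumeMon n e).trace = volCount n d e ε * (2 * d) := by
  obtain ⟨k, hk⟩ := h.cornerCliff.exists_trace_volume (by omega) hd h.submod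
  have : (ε * volumeMon n e).trace - (e n * volumeMon n e).trace = k * (2 * d) := by
    rw [h.trace_volume hn, hk]; ring
  rw [volCount_eq hd0 this, this]

theorem Adm.hasExt_of_trace_volume (hn : n % 4 = 0) (hα : signCount (-1) (n + 1) = 0)
    (h : Adm n e ε)
    (hk : (kerProj (ε + e n) * volumeMon (n + 1) (replLast n e ε)).trace = 0) :
    HasExt (n + 1) (replLast n e ε) (kerProj (ε + e n)) := by
  have hc := h.cornerCliff
  refine hc.hasExt_of_pos (by omega)
    (fun q => (q * volumeMon (n + 1) (replLast n e ε)).trace = 0)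
    (fun q hq h0 hQ => ?_) (fun q q' hq hq' hqq hQ hext => ?_) _ h.submod hk
  · have hD := trace_pos_of_idem hq.symm hq.idem h0
    rw [hQ, hα]
    nlinarith
  · rw [sub_mul, Matrix.trace_sub, hQ,
      hc.trace_corner_full_of_hasExt hq' (by omega) hext, sub_zero]

theorem Adm.swap (h : Adm n e ε) : Adm n (replLast n e ε) (e n) := by
  have hr : ∀ i < n, replLast n e ε i = e i := fun i hi => by simp [replLast, hi]
  have hc := h.cornerCliff
  refine ⟨⟨fun i hi => hc.symm i hi, fun i hi => hc.sq i hi, fun i hi j hj hij =>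
    hc.anti i hi j hj hij⟩, ⟨h.cliff.symm n (by omega), fun i hi => ?_⟩, h.cliff.sq n (by omega)⟩
  rw [hr i hi, h.cliff.anti i (by omega) n (by omega) hi.ne]

theorem volCount_blockSum (hd0 : 0 < d) (hn : n % 4 = 0) (hd : IrrDim (n + 1) d) (h : Adm n e ε)
    (h' : Adm n e' ε') :
    volCount n d (fun i => dsum (e i) (e' i)) (dsum ε ε') =
      volCount n d e ε + volCount n d e' ε' := by
  refine volCount_eq hd0 ?_
  rw [volumeMon, mon_dsum, dsum_mul, dsum_mul, dsum_trace, dsum_trace]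
  have h1 := h.volCount_mul hd0 hn hd
  have h2 := h'.volCount_mul hd0 hn hd
  push_cast
  linarith

theorem volCount_surj (hd0 : 0 < d) (hn : n % 4 = 0) (hd : IrrDim (n + 1) d) (a : ℤ) :
    ∃ (ι : Type) (_ : Fintype ι) (_ : DecidableEq ι) (e : ℕ → Matrix ι ι ℝ)
      (ε : Matrix ι ι ℝ), Adm n e ε ∧ volCount n d e ε = a := by
  set P : ℤ → Prop := fun a => ∃ (ι : Type) (_ : Fintype ι) (_ : DecidableEq ι)
    (e : ℕ → Matrix ι ι ℝ) (ε : Matrix ι ι ℝ), Adm n e ε ∧ volCount n d e ε = a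
  have hneg : ∀ a, P a → P (-a) := fun a ⟨ι, _, _, e, ε, h, ha⟩ => by
    refine ⟨ι, _, _, _, _, h.swap, volCount_eq hd0 ?_⟩
    have := h.volCount_mul hd0 hn hd
    rw [volumeMon_replLast, show replLast n e ε n = ε by simp [replLast], ← ha]
    push_cast
    linarith
  have hadd : ∀ a b, P a → P b → P (a + b) :=
    fun a b ⟨ι, _, _, e, ε, h, ha⟩ ⟨κ, _, _, e', ε', h', hb⟩ =>
      ⟨ι ⊕ κ, inferInstance, inferInstance, _, _, h.blockSum h', by
        rw [volCount_blockSum hd0 hn hd h h', ha, hb]⟩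
  obtain ⟨μ, _, _, g, hg, hc, q, hq, ht, hτ⟩ := exists_irreducible_clifford hd
  obtain ⟨h1, h2⟩ := hg.adm_reflect hq.symm hq.idem hq.comm
  have hφ : (g n * (1 - (2 : ℝ) • q) * volumeMon n g).trace - (g n * volumeMon n g).trace =
      -2 * (q * volumeMon (n + 1) g).trace := by
    rw [volumeMon_succ, ← mul_assoc q, hq.comm n (by omega)]
    simp only [mul_sub, sub_mul, mul_one, mul_smul_comm, smul_mul_assoc, Matrix.trace_sub,
      Matrix.trace_smul, smul_eq_mul]
    ring
  have h0 : P 0 := ⟨μ, _, _, g, g n, Adm.refl hg, volCount_eq hd0 (by simp)⟩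
  have hone : P 1 := by
    rcases sq_eq_sq_iff_eq_or_eq_neg.1 (hτ (by omega)) with h | h
    · have := hneg _ ⟨μ, _, _, g, _, h1, volCount_eq hd0 (k := -1) (by
        rw [hφ]; erw [h]; push_cast; ring)⟩
      simpa using this
    · exact ⟨μ, _, _, g, _, h1, volCount_eq hd0 (k := 1) (by
        rw [hφ]; erw [h]; push_cast; ring)⟩
  induction a using Int.induction_on with
  | zero => exact h0
  | succ i ih => exact hadd _ _ ih hone
  | pred i ih => exact hadd _ _ ih (hneg _ hone)

theorem bottInv_int_of (hd0 : 0 < d) (hn : n % 4 = 0) (hd : IrrDim (n + 1) d)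
    (hα : signCount (-1) (n + 1) = 0) : BottInv n ℤ fun e ε => volCount n d e ε where
  sum h h' := volCount_blockSum hd0 hn hd h h'
  refl _ := volCount_eq hd0 (by simp)
  path {ι _ _ e H} hH hA := by
    refine const_of_eventually fun t₀ => ?_
    have hcont : Continuous fun t => (H t * volumeMon n e).trace := by fun_prop
    filter_upwards [hcont.continuousAt.eventually (Metric.ball_mem_nhds _ hd0)] with t ht
    rw [Real.dist_eq] at ht
    have e1 := (hA t).volCount_mul hd0 hn hd
    have e2 := (hA t₀).volCount_mul hd0 hn hd
    have e3 : (H t * volumeMon n e).trace - (H t₀ * volumeMon n e).trace =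
        (volCount n d e (H t) - volCount n d e (H t₀) : ℤ) * (2 * d) := by push_cast; linarith
    rw [e3, abs_mul, abs_of_pos (by positivity : 0 < 2 * d)] at ht
    have h4 : |((volCount n d e (H t) - volCount n d e (H t₀) : ℤ) : ℝ)| < 1 := by
      by_contra hcon
      nlinarith
    have h5 : |volCount n d e (H t) - volCount n d e (H t₀)| < 1 := by exact_mod_cast h4
    exact sub_eq_zero.1 (Int.abs_lt_one_iff.1 h5)
  zero {ι _ _ e ε} h h0 := by
    refine h.exists_path h.isKerProj h.submod (h.hasExt_of_trace_volume hn hα ?_)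
    have e1 := h.volCount_mul hd0 hn hd
    have e2 := h.trace_volume hn
    rw [e1, h0] at e2
    push_cast at e2
    linarith
  surj a := volCount_surj hd0 hn hd a

theorem bottInv_int (hn : n % 8 = 0 ∨ n % 8 = 4) :
    ∃ d : ℝ, BottInv n ℤ fun e ε => volCount n d e ε := by
  obtain ⟨t1, t2, -, -, -, -, -, t8, t9, -⟩ := signCount_table (n / 8)
  have hpos : (0 : ℝ) < 16 ^ (n / 8) := by positivity
  rcases hn with h | h
  · refine ⟨16 ^ (n / 8), bottInv_int_of hpos (by omega) (fun D τ hD _ h0 he => ?_) ?_⟩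
    · rw [h0 (by omega), show n + 1 = 1 + 8 * (n / 8) by omega, t1,
        show 1 + 8 * (n / 8) + 1 = 2 + 8 * (n / 8) by omega, two_pow_add] at he
      have : (D - 16 ^ (n / 8)) * (D + 2 * 16 ^ (n / 8)) = 0 := by linear_combination he / 2
      rcases mul_eq_zero.1 this with h | h <;> linarith
    · rw [show n + 1 = 1 + 8 * (n / 8) by omega, t2]
  · refine ⟨8 * 16 ^ (n / 8), bottInv_int_of (by positivity) (by omega)
      (fun D τ hD _ h0 he => ?_) ?_⟩
    · rw [h0 (by omega), show n + 1 = 5 + 8 * (n / 8) by omega, t8,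
        show 5 + 8 * (n / 8) + 1 = 6 + 8 * (n / 8) by omega, two_pow_add] at he
      have : (D - 8 * 16 ^ (n / 8)) * (D + 4 * 16 ^ (n / 8)) = 0 := by linear_combination he / 2
      rcases mul_eq_zero.1 this with h | h <;> linarith
    · rw [show n + 1 = 5 + 8 * (n / 8) by omega, t9]

end Signature

section SphereCoordinates

variable {n : ℕ} {X : Type} [TopologicalSpace X]

/-- The coordinates of a point of the sphere, extended by zero. -/
noncomputable def crd (v : ↥(Sph n)) (j : ℕ) : ℝ := if h : j < n + 1 then v.1 ⟨j, h⟩ else 0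

theorem continuous_crd (j : ℕ) : Continuous fun v : ↥(Sph n) => crd v j := by
  unfold crd
  split_ifs with h
  · exact (PiLp.continuous_apply 2 _ _).comp continuous_subtype_val
  · exact continuous_const

theorem norm_sq_toLp (s : ℕ → ℝ) :
    ‖WithLp.toLp 2 (fun i : Fin (n + 1) => s i)‖ ^ 2 = ∑ j ∈ Finset.range (n + 1), s j ^ 2 := by
  rw [EuclideanSpace.norm_sq_eq, Finset.sum_range]
  simp

theorem toLp_crd (v : ↥(Sph n)) : WithLp.toLp 2 (fun i : Fin (n + 1) => crd v i) = v.1 := by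
  ext i
  simp [crd, Nat.lt_succ_iff.1 i.2]

theorem sum_crd_sq (v : ↥(Sph n)) : ∑ j ∈ Finset.range (n + 1), crd v j ^ 2 = 1 := by
  rw [← norm_sq_toLp, toLp_crd, mem_sphere_zero_iff_norm.1 v.2, one_pow]

theorem sum_crd_sq' (v : ↥(Sph n)) :
    ∑ j ∈ Finset.range n, crd v j ^ 2 = 1 - crd v n ^ 2 := by
  rw [← sum_crd_sq v, Finset.sum_range_succ, add_sub_cancel_right]

theorem abs_crd_le (v : ↥(Sph n)) : -1 ≤ crd v n ∧ crd v n ≤ 1 := by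
  have := sum_crd_sq' v
  have h0 : 0 ≤ ∑ j ∈ Finset.range n, crd v j ^ 2 := Finset.sum_nonneg fun _ _ => sq_nonneg _
  constructor <;> nlinarith

theorem crd_ext {v w : ↥(Sph n)} (h : ∀ j < n + 1, crd v j = crd w j) : v = w := by
  apply Subtype.ext
  rw [← toLp_crd v, ← toLp_crd w]
  congr 1
  exact funext fun i => h i i.2

/-- The point of the sphere in the direction of a nonzero vector. -/
noncomputable def mkSph (n : ℕ) (s : ℕ → ℝ) : ↥(Sph n) :=
  if h : ∑ j ∈ Finset.range (n + 1), s j ^ 2 ≠ 0 then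
    ⟨(√(∑ j ∈ Finset.range (n + 1), s j ^ 2))⁻¹ • WithLp.toLp 2 (fun i : Fin (n + 1) => s i), by
      have := Finset.sum_nonneg (s := Finset.range (n + 1)) fun j _ => sq_nonneg (s j)
      rw [mem_sphere_zero_iff_norm, norm_smul, ← Real.sqrt_sq (norm_nonneg (WithLp.toLp 2 _)),
        norm_sq_toLp, norm_inv, Real.norm_of_nonneg (Real.sqrt_nonneg _)]
      exact inv_mul_cancel₀ ((Real.sqrt_ne_zero this).2 h)⟩
  else ⟨EuclideanSpace.single 0 1, by simp⟩

theorem crd_mkSph {s : ℕ → ℝ} (h : ∑ j ∈ Finset.range (n + 1), s j ^ 2 ≠ 0) {j : ℕ}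
    (hj : j < n + 1) :
    crd (mkSph n s) j = (√(∑ j ∈ Finset.range (n + 1), s j ^ 2))⁻¹ * s j := by
  rw [mkSph, dif_pos h, crd, dif_pos hj]
  simp

theorem crd_mkSph_one {s : ℕ → ℝ} (h : ∑ j ∈ Finset.range (n + 1), s j ^ 2 = 1) {j : ℕ}
    (hj : j < n + 1) : crd (mkSph n s) j = s j := by
  rw [crd_mkSph (by rw [h]; exact one_ne_zero) hj, h]; simp

theorem continuous_mkSph {s : X → ℕ → ℝ} (hs : ∀ j, Continuous fun x => s x j)
    (h : ∀ x, ∑ j ∈ Finset.range (n + 1), s x j ^ 2 ≠ 0) : Continuous fun x => mkSph n (s x) := by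
  rw [continuous_induced_rng]
  have : (Subtype.val ∘ fun x => mkSph n (s x)) = fun x =>
      (√(∑ j ∈ Finset.range (n + 1), s x j ^ 2))⁻¹ •
        (WithLp.toLp 2 (fun i : Fin (n + 1) => s x i) : EuclideanSpace ℝ (Fin (n + 1))) := by
    funext x; simp [mkSph, h x]
  rw [this]
  have hsum : Continuous fun x => ∑ j ∈ Finset.range (n + 1), s x j ^ 2 := by fun_prop
  refine (hsum.sqrt.inv₀ fun x => ?_).smul
    ((PiLp.continuous_toLp 2 _).comp (continuous_pi fun i => hs i))
  exact (Real.sqrt_ne_zero (Finset.sum_nonneg fun j _ => sq_nonneg _)).2 (h x)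

/-- Spherical coordinates on the upper hemisphere. -/
noncomputable def sphPt (z : Cube X n) : ↥(Sph n) := mkSph n fun j => sph n j z

theorem crd_sphPt (z : Cube X n) {j : ℕ} (hj : j < n + 1) : crd (sphPt z) j = sph n j z :=
  crd_mkSph_one (sum_sph_sq n z) hj

theorem continuous_sphPt : Continuous (sphPt : Cube X n → ↥(Sph n)) :=
  continuous_mkSph (fun j => continuous_sph n j) fun z => by rw [sum_sph_sq]; exact one_ne_zero

/-- The base point of a point of the cube. -/
def cubeFst {X : Type} : ∀ m, Cube X m → X
  | 0, x => x
  | m + 1, z => cubeFst m z.2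

theorem continuous_cubeFst : ∀ m, Continuous (cubeFst (X := X) m)
  | 0 => continuous_id
  | m + 1 => (continuous_cubeFst m).comp continuous_snd

theorem sph_last_nonneg : ∀ (m : ℕ) (z : Cube X m), 0 ≤ sph m m z
  | 0, z => by simp [sph]
  | m + 1, z => mul_nonneg (Real.sin_nonneg_of_mem_Icc z.1.2) (sph_last_nonneg m z.2)

theorem mem_cubeBd {Y : Set X} : ∀ (m : ℕ) (z : Cube X m),
    z ∈ cubeBd Y m ↔ sph m m z = 0 ∨ cubeFst m z ∈ Y
  | 0, z => by simp [sph, cubeBd, cubeFst]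
  | m + 1, z => by
    have := mem_cubeBd (Y := Y) m z.2
    change Real.sin z.1 = 0 ∨ z.2 ∈ cubeBd Y m ↔ Real.sin z.1 * sph m m z.2 = 0 ∨ cubeFst m z.2 ∈ Y
    rw [this, mul_eq_zero, or_assoc]

theorem lin_eq {ι : Type} (e : ℕ → Matrix ι ι ℝ) (ε : X → Matrix ι ι ℝ) : ∀ (m l : ℕ) (z : Cube X m),
    lin e l m ε z = cliffSum e l m (fun j => sph m j z) + sph m m z • ε (cubeFst m z)
  | 0, l, z => by simp [cliffSum, sph, lin, cubeFst]
  | m + 1, l, z => by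
    rw [lin, lin_eq e ε m, cliffSum.eq_def e l, Finset.sum_range_succ']
    simp only [sph, arcTo, cliffSum, Finset.smul_sum, mul_smul, smul_add, cubeFst]
    rw [← add_assoc, add_comm _ (Real.cos z.1 • _)]
    congr 2
    refine Finset.sum_congr rfl fun j _ => ?_
    rw [show l + (j + 1) = l + 1 + j by ring]

theorem exists_sph (x : X) : ∀ (m : ℕ) (s : ℕ → ℝ), ∑ j ∈ Finset.range (m + 1), s j ^ 2 = 1 →
    0 ≤ s m → ∃ z : Cube X m, cubeFst m z = x ∧ ∀ j < m + 1, sph m j z = s j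
  | 0, s, hs, h0 => ⟨x, rfl, fun j hj => by
    obtain rfl : j = 0 := by omega
    simp only [zero_add, Finset.range_one, Finset.sum_singleton] at hs
    simp only [sph, if_true]
    nlinarith⟩
  | m + 1, s, hs, h0 => by
    rw [Finset.sum_range_succ'] at hs
    have hn := Finset.sum_nonneg (s := Finset.range (m + 1)) fun j _ => sq_nonneg (s (j + 1))
    set r := √(∑ j ∈ Finset.range (m + 1), s (j + 1) ^ 2) with hr
    have hr2 : r ^ 2 = ∑ j ∈ Finset.range (m + 1), s (j + 1) ^ 2 := Real.sq_sqrt hn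
    obtain ⟨z, hzx, hz⟩ : ∃ z : Cube X m, cubeFst m z = x ∧
        ∀ j < m + 1, r * sph m j z = s (j + 1) := by
      by_cases h : r = 0
      · obtain ⟨z, hzx, -⟩ := exists_sph x m (fun j => if j = m then 1 else 0)
          (by simp) (by simp)
        refine ⟨z, hzx, fun j hj => ?_⟩
        rw [h, zero_pow two_ne_zero, eq_comm,
          Finset.sum_eq_zero_iff_of_nonneg fun j _ => sq_nonneg _] at hr2
        rw [h, zero_mul, pow_eq_zero_iff two_ne_zero |>.1 (hr2 j (Finset.mem_range.2 hj))]
      · obtain ⟨z, hzx, hz⟩ := exists_sph x m (fun j => r⁻¹ * s (j + 1))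
          (by simp only [mul_pow, ← Finset.mul_sum, ← hr2]; field_simp)
          (mul_nonneg (inv_nonneg.2 (Real.sqrt_nonneg _)) h0)
        exact ⟨z, hzx, fun j hj => by rw [hz j hj]; field_simp⟩
    refine ⟨(⟨Real.arccos (s 0), Real.arccos_nonneg _, Real.arccos_le_pi _⟩, z), hzx,
      fun j hj => ?_⟩
    cases j with
    | zero => exact Real.cos_arccos (by nlinarith) (by nlinarith)
    | succ j =>
      change Real.sin (Real.arccos (s 0)) * sph m j z = _
      rw [Real.sin_arccos, show 1 - s 0 ^ 2 = ∑ j ∈ Finset.range (m + 1), s (j + 1) ^ 2 by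
        linarith, ← hr, hz j (by omega)]

theorem sph_injective : ∀ (m : ℕ) (z z' : Cube X m), 0 < sph m m z →
    (∀ j < m + 1, sph m j z = sph m j z') → cubeFst m z = cubeFst m z' → z = z'
  | 0, z, z', _, _, h => h
  | m + 1, z, z', h0, h, hx => by
    have hc : Real.cos z.1 = Real.cos z'.1 := h 0 (by omega)
    have h1 : z.1 = z'.1 := Subtype.ext (Real.injOn_cos z.1.2 z'.1.2 hc)
    have h0' : 0 < Real.sin z.1 * sph m m z.2 := h0
    have hs : Real.sin z.1 ≠ 0 := fun h => by simp [h] at h0'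
    refine Prod.ext h1 (sph_injective m z.2 z'.2 ?_ (fun j hj => ?_) hx)
    · exact pos_of_mul_pos_right h0' (Real.sin_nonneg_of_mem_Icc z.1.2)
    · have h2 : Real.sin z.1 * sph m j z.2 = Real.sin z'.1 * sph m j z'.2 := h (j + 1) (by omega)
      rw [← h1] at h2
      exact mul_left_cancel₀ hs h2

theorem exists_sphPt (x : X) {v : ↥(Sph n)} (hv : 0 ≤ crd v n) :
    ∃ z : Cube X n, cubeFst n z = x ∧ sphPt z = v := by
  obtain ⟨z, hx, hz⟩ := exists_sph x n _ (sum_crd_sq v) hv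
  exact ⟨z, hx, crd_ext fun j hj => by rw [crd_sphPt z hj, hz j hj]⟩

end SphereCoordinates

section SphereMaps

variable {n : ℕ} {X : Type} [TopologicalSpace X] {ι κ : Type} [Fintype ι] [DecidableEq ι]
  [Fintype κ] [DecidableEq κ] {e : ℕ → Matrix ι ι ℝ} {e' : ℕ → Matrix κ κ ℝ}

/-- Symmetric and invertible. -/
def SymU (_ : X) (M : Matrix ι ι ℝ) : Prop := Mᵀ = M ∧ IsUnit M

theorem Htpy.symU_blockSum {f g : X → Matrix ι ι ℝ} {f' g' : X → Matrix κ κ ℝ}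
    (H : Htpy SymU f g) (H' : Htpy SymU f' g') :
    Htpy SymU (fun x => dsum (f x) (f' x)) fun x => dsum (g x) (g' x) := by
  obtain ⟨H, hc, h0, h1, hH⟩ := H
  obtain ⟨H', hc', h0', h1', hH'⟩ := H'
  refine ⟨fun q => dsum (H q) (H' q), hc.blockSum hc', fun x => by simp only [h0, h0'],
    fun x => by simp only [h1, h1'], fun t ht x => ⟨?_, isUnit_dsum (hH t ht x).2 (hH' t ht x).2⟩⟩
  rw [dsum_transpose, (hH t ht x).1, (hH' t ht x).1]

/-- The linear combination of the generators by all but the last coordinate. -/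
noncomputable def vecSum (e : ℕ → Matrix ι ι ℝ) (v : ↥(Sph n)) : Matrix ι ι ℝ :=
  cliffSum e 0 n (crd v)

@[fun_prop]
theorem Continuous.vecSum {e : ℕ → Matrix ι ι ℝ} {w : X → ↥(Sph n)} (hw : Continuous w) :
    Continuous fun x => vecSum e (w x) :=
  (continuous_cliffSum e 0 n continuous_crd).comp hw

@[fun_prop]
theorem Continuous.crd {w : X → ↥(Sph n)} (hw : Continuous w) (j : ℕ) :
    Continuous fun x => crd (w x) j := (continuous_crd j).comp hw

theorem vecSum_dsum (v : ↥(Sph n)) :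
    vecSum (fun i => dsum (e i) (e' i)) v = dsum (vecSum e v) (vecSum e' v) :=
  cliffSum_dsum e e' 0 n _

theorem SA.vecSum_mul {M : Matrix ι ι ℝ} (hM : SA n e M) (v : ↥(Sph n)) :
    _root_.vecSum e v * M = -(M * _root_.vecSum e v) := by
  simp only [_root_.vecSum, cliffSum, Finset.sum_mul, Finset.mul_sum, ← Finset.sum_neg_distrib]
  refine Finset.sum_congr rfl fun j hj => ?_
  rw [smul_mul_assoc, mul_smul_comm, zero_add, hM.2 j (Finset.mem_range.1 hj), smul_neg]

theorem symU_vec (he : IsCliff (n + 1) e) (v : ↥(Sph n)) {x : ℝ} {M : Matrix ι ι ℝ}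
    (h : (x = 0 ∧ Mᵀ = M ∧ IsUnit M) ∨ SA n e M ∧ (x ≠ 0 ∧ crd v n ^ 2 ≠ 1 ∨ IsUnit M)) (z : X) :
    SymU z (x • vecSum e v + M) := by
  rcases h with ⟨rfl, h⟩ | ⟨hM, h⟩
  · simpa [SymU] using h
  · have hs := (he.cliffSum_sa (l := 0) (p := n) (by omega) (crd v)).1
    have hsq := he.cliffSum_sq (l := 0) (p := n) (by omega) (crd v)
    rw [sum_crd_sq'] at hsq
    have ha := hM.vecSum_mul v
    refine ⟨by rw [Matrix.transpose_add, Matrix.transpose_smul, hM.1, vecSum, hs], ?_⟩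
    have h2 : (x • vecSum e v + M) * (x • vecSum e v + M) =
        (x ^ 2 * (1 - crd v n ^ 2)) • (1 : Matrix ι ι ℝ) + M * M := by
      simp only [add_mul, mul_add, smul_mul_assoc, mul_smul_comm, ha]
      rw [vecSum, hsq]
      module
    have hp : (M * M).PosSemidef := by simpa [hM.1] using psd_self_mul_transpose M
    have hb : 0 ≤ 1 - crd v n ^ 2 := by nlinarith [abs_crd_le v]
    refine isUnit_of_mul_isUnit_left (y := x • vecSum e v + M) ?_
    rw [h2]
    rcases eq_or_lt_of_le (mul_nonneg (sq_nonneg x) hb) with h0 | h0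
    · rw [← h0, zero_smul, zero_add]
      rcases h with h | h
      · rcases mul_eq_zero.1 h0.symm with h1 | h1
        · exact absurd (pow_eq_zero_iff two_ne_zero |>.1 h1) h.1
        · exact absurd (by linarith) h.2
      · exact h.mul h
    · exact isUnit_smul_one_add_psd h0 hp

/-- The map on the sphere which is the join of the generators with `ε` on the upper hemisphere,
and with the last generator on the lower one. -/
noncomputable def bottMap (n : ℕ) (e : ℕ → Matrix ι ι ℝ) (ε : Matrix ι ι ℝ) (v : ↥(Sph n)) :
    Matrix ι ι ℝ :=
  vecSum e v + (max (crd v n) 0 • ε + max (-crd v n) 0 • e n)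

theorem continuous_bottMap {ε : Matrix ι ι ℝ} : Continuous (bottMap n e ε) := by
  unfold bottMap
  fun_prop

theorem bottMap_dsum {ε : Matrix ι ι ℝ} {ε' : Matrix κ κ ℝ} (v : ↥(Sph n)) :
    bottMap n (fun i => dsum (e i) (e' i)) (dsum ε ε') v =
      dsum (bottMap n e ε v) (bottMap n e' ε' v) := by
  simp only [bottMap, vecSum_dsum, dsum_smul, dsum_add]

theorem bottMap_of_nonpos {ε : Matrix ι ι ℝ} {v : ↥(Sph n)} (h : crd v n ≤ 0) :
    bottMap n e ε v = bottMap n e (e n) v := by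
  simp [bottMap, max_eq_right h]

theorem bottMap_sphPt {ε : X → Matrix ι ι ℝ} (z : Cube X n) :
    bottMap n e (ε (cubeFst n z)) (sphPt z) = lin e 0 n ε z := by
  rw [lin_eq, bottMap, crd_sphPt z (by omega), max_eq_left (sph_last_nonneg n z),
    max_eq_right (by linarith [sph_last_nonneg n z]), zero_smul, add_zero, vecSum]
  congr 1
  exact Finset.sum_congr rfl fun j hj => by
    rw [crd_sphPt z (by have := Finset.mem_range.1 hj; omega)]

theorem symU_bottMap (he : IsCliff (n + 1) e) {ε : Matrix ι ι ℝ} (hs : SA n e ε) (hu : IsUnit ε)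
    (v : ↥(Sph n)) (z : X) : SymU z (bottMap n e ε v) := by
  have hn : SA n e (e n) := he.sa (by omega) le_rfl
  rw [bottMap, ← one_smul ℝ (vecSum e v)]
  refine symU_vec he v (Or.inr ⟨(hs.smul _).add (hn.smul _), ?_⟩) z
  by_cases h : crd v n ^ 2 = 1
  · right
    rcases eq_or_eq_neg_of_sq_eq_sq _ 1 (h.trans (one_pow 2).symm) with h | h
    · simpa [h] using hu
    · simpa [h] using isUnit_of_mul_self_eq_one (he.sq n (by omega))
  · exact Or.inl ⟨one_ne_zero, h⟩

theorem bottMap_sq (he : IsCliff (n + 1) e) {ε : Matrix ι ι ℝ} (h : Adm n e ε) (v : ↥(Sph n)) :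
    bottMap n e ε v * bottMap n e ε v = 1 := by
  have hb : (max (crd v n) 0 • ε + max (-crd v n) 0 • e n) *
      (max (crd v n) 0 • ε + max (-crd v n) 0 • e n) = crd v n ^ 2 • (1 : Matrix ι ι ℝ) := by
    rcases le_total (crd v n) 0 with h0 | h0
    · rw [max_eq_right h0, max_eq_left (by linarith), zero_smul, zero_add, smul_mul_smul_comm,
        he.sq n (by omega), neg_mul_neg, pow_two]
    · rw [max_eq_left h0, max_eq_right (by linarith), zero_smul, add_zero, smul_mul_smul_comm,
        h.sq, pow_two]
  have hsa : SA n e (max (crd v n) 0 • ε + max (-crd v n) 0 • e n) :=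
    (h.sa.smul _).add ((he.sa (by omega) le_rfl).smul _)
  have hsq := he.cliffSum_sq (l := 0) (p := n) (by omega) (crd v)
  rw [bottMap]
  generalize max (crd v n) 0 • ε + max (-crd v n) 0 • e n = M at *
  have ha := hsa.vecSum_mul v
  simp only [add_mul, mul_add, ha, hb]
  rw [vecSum, hsq, sum_crd_sq']
  module

/-- A homotopy on the upper hemisphere, parametrised by the cube, extends to the sphere if it is
constant on the equator. -/
theorem htpy_sphere {L f g : ↥(Sph n) → Matrix ι ι ℝ} (hL : Continuous L) (hLs : ∀ v, SymU v (L v))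
    (hf : ∀ v, crd v n ≤ 0 → f v = L v) (hg : ∀ v, crd v n ≤ 0 → g v = L v)
    (H : Htpy (Good 0 e (cubeBd (∅ : Set Unit) n) fun z => L (sphPt z)) (fun z => f (sphPt z))
      fun z => g (sphPt z)) : Htpy SymU f g := by
  classical
  obtain ⟨K, hK, K0, K1, hP⟩ := H
  set c : ℝ → Set.Icc (0 : ℝ) 1 := Set.projIcc 0 1 zero_le_one with hc
  have hcc : Continuous c := continuous_projIcc
  set G : ℝ × ↥(Sph n) → Matrix ι ι ℝ := fun q =>
    if h : 0 < crd q.2 n then K (c q.1, (exists_sphPt () h.le).choose) else L q.2 with hG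
  have hlow : ∀ t v, crd v n ≤ 0 → G (t, v) = L v := fun t v h => dif_neg (not_lt.2 h)
  have hup : ∀ t z, G (t, sphPt z) = K (c t, z) := by
    intro t z
    by_cases h : 0 < crd (sphPt z) n
    · have key : ∀ z' : Cube Unit n, sphPt z' = sphPt z → z' = z := fun z' hz =>
        sph_injective n _ _ (by rw [← crd_sphPt _ (by omega), hz]; exact h)
          (fun j hj => by rw [← crd_sphPt _ hj, ← crd_sphPt _ hj, hz]) rfl
      exact (dif_pos h).trans
        (congrArg (fun z' => K (c t, z')) (key _ (exists_sphPt () h.le).choose_spec.2))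
    · rw [hlow t _ (not_lt.1 h)]
      refine ((hP _ (c t).2 z).bd ((mem_cubeBd n z).2 (Or.inl ?_))).symm
      rw [crd_sphPt z (by omega)] at h
      exact le_antisymm (not_lt.1 h) (sph_last_nonneg n z)
  have hcases : ∀ v : ↥(Sph n), crd v n ≤ 0 ∨ ∃ z : Cube Unit n, sphPt z = v := fun v =>
    (le_total (crd v n) 0).imp id fun h => ⟨_, (exists_sphPt () h).choose_spec.2⟩
  refine ⟨G, ?_, fun v => ?_, fun v => ?_, fun t ht v => ?_⟩
  · refine continuous_iff_isClosed.2 fun C hC => ?_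
    have hcl : IsClosedMap (Prod.map id sphPt : ℝ × Cube Unit n → ℝ × ↥(Sph n)) :=
      (isProperMap_id.prodMap continuous_sphPt.isProperMap).isClosedMap
    have : G ⁻¹' C = Prod.map id sphPt '' ((fun q : ℝ × Cube Unit n => K (c q.1, q.2)) ⁻¹' C) ∪
        {q | crd q.2 n ≤ 0} ∩ (fun q => L q.2) ⁻¹' C := by
      ext ⟨t, v⟩
      constructor
      · intro h
        rcases hcases v with hv | ⟨z, rfl⟩
        · exact Or.inr ⟨hv, by simpa [hlow t v hv] using h⟩
        · exact Or.inl ⟨(t, z), by simpa [hup] using h, rfl⟩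
      · rintro (⟨⟨t, z⟩, h, h'⟩ | ⟨hv, h⟩)
        · obtain ⟨rfl, rfl⟩ := Prod.mk.inj h'
          simpa [hup] using h
        · simpa [hlow t v hv] using h
    rw [this]
    exact (hcl _ (hC.preimage (by fun_prop))).union
      ((isClosed_le (by fun_prop) continuous_const).inter (hC.preimage (by fun_prop)))
  · rcases hcases v with hv | ⟨z, rfl⟩
    · rw [hlow 0 v hv, hf v hv]
    · rw [hup, ← show K (0, z) = f (sphPt z) from K0 z]; simp [hc]
  · rcases hcases v with hv | ⟨z, rfl⟩
    · rw [hlow 1 v hv, hg v hv]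
    · rw [hup, ← show K (1, z) = g (sphPt z) from K1 z]; simp [hc]
  · rcases hcases v with hv | ⟨z, rfl⟩
    · rw [hlow t v hv]; exact hLs v
    · rw [hup]; exact ⟨(hP _ (c t).2 z).sa.1, (hP _ (c t).2 z).unit⟩

end SphereMaps

section Collapse

variable {n : ℕ} {X : Type} [TopologicalSpace X] {ι κ : Type} [Fintype ι] [DecidableEq ι]
  [Fintype κ] [DecidableEq κ] {e : ℕ → Matrix ι ι ℝ} {e' : ℕ → Matrix κ κ ℝ}

theorem IsUnit.real_smul {M : Matrix ι ι ℝ} (h : IsUnit M) {x : ℝ} (hx : x ≠ 0) : IsUnit (x • M) :=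
  h.smul (Units.mk0 x hx)

theorem sum_ite_last (x y : ℝ) (v : ↥(Sph n)) :
    ∑ j ∈ Finset.range (n + 1), (if j < n then x * crd v j else y) ^ 2 =
      x ^ 2 * (1 - crd v n ^ 2) + y ^ 2 := by
  rw [Finset.sum_range_succ, if_neg (lt_irrefl n), ← sum_crd_sq', Finset.mul_sum]
  congr 1
  exact Finset.sum_congr rfl fun j hj => by rw [if_pos (Finset.mem_range.1 hj), mul_pow]

/-- A point of the sphere all of whose coordinates but the last vanish, the last being `-1`. -/
def IsSouth (v : ↥(Sph n)) : Prop := (∀ j < n, crd v j = 0) ∧ crd v n = -1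

/-- The south pole. -/
noncomputable def south (n : ℕ) : ↥(Sph n) := mkSph n fun j => if j < n then 0 else -1

theorem isSouth_south : IsSouth (south n) := by
  have h : ∑ j ∈ Finset.range (n + 1), (if j < n then (0 : ℝ) else -1) ^ 2 = 1 := by
    rw [Finset.sum_range_succ, if_neg (lt_irrefl n), Finset.sum_eq_zero fun j hj => by
      rw [if_pos (Finset.mem_range.1 hj), zero_pow two_ne_zero]]
    norm_num
  exact ⟨fun j hj => by rw [south, crd_mkSph_one h (by omega), if_pos hj],
    by rw [south, crd_mkSph_one h (by omega), if_neg (lt_irrefl n)]⟩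

theorem IsSouth.eq {v : ↥(Sph n)} (h : IsSouth v) : v = south n := crd_ext fun j hj => by
  rcases Nat.lt_succ_iff_lt_or_eq.1 hj with hj | rfl
  · rw [h.1 j hj, isSouth_south.1 j hj]
  · rw [h.2, isSouth_south.2]

theorem bottMap_south (ε : Matrix ι ι ℝ) : bottMap n e ε (south n) = e n := by
  have : vecSum e (south n) = 0 := by
    unfold vecSum cliffSum
    exact Finset.sum_eq_zero fun j hj => by
      rw [isSouth_south.1 j (Finset.mem_range.1 hj), zero_smul]
  rw [bottMap, isSouth_south.2, this]
  norm_num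

/-- The horizontal and vertical scales of the collapse. -/
noncomputable def colX (t b : ℝ) : ℝ := (1 - t) * max 0 (2 * b - 1) + t

/-- See `colX`. -/
noncomputable def colY (t b : ℝ) : ℝ := (1 - t) * (4 * b - 3) + t * b

/-- Deformation of the identity of the sphere to a map collapsing a neighbourhood of the lower
hemisphere. -/
noncomputable def collapse (q : ℝ × ↥(Sph n)) : ↥(Sph n) :=
  mkSph n fun j => if j < n then colX (max 0 (min 1 q.1)) (crd q.2 n) * crd q.2 j
    else colY (max 0 (min 1 q.1)) (crd q.2 n)

theorem collapse_ne {t : ℝ} (h0 : 0 ≤ t) (h1 : t ≤ 1) (v : ↥(Sph n)) :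
    0 < colX t (crd v n) ^ 2 * (1 - crd v n ^ 2) + colY t (crd v n) ^ 2 := by
  obtain ⟨hb, hb'⟩ := abs_crd_le v
  generalize crd v n = b at *
  have hb2 : 0 ≤ 1 - b ^ 2 := by nlinarith
  by_contra h
  have hx : colX t b ^ 2 * (1 - b ^ 2) = 0 := le_antisymm
    (by nlinarith [sq_nonneg (colY t b)]) (mul_nonneg (sq_nonneg _) hb2)
  have hy : colY t b = 0 := by nlinarith [sq_nonneg (colY t b)]
  rcases mul_eq_zero.1 hx with hx | hx
  · have hx := (pow_eq_zero_iff two_ne_zero).1 hx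
    unfold colX at hx
    unfold colY at hy
    have hm := le_max_left 0 (2 * b - 1)
    have hm' := le_max_right 0 (2 * b - 1)
    have ht : t = 0 := by nlinarith [mul_nonneg (sub_nonneg.2 h1) hm]
    subst ht
    linarith
  · rcases eq_or_eq_neg_of_sq_eq_sq b 1 (by linarith) with rfl | rfl <;>
    · unfold colY at hy
      linarith

theorem continuous_collapse : Continuous (collapse (n := n)) := by
  refine continuous_mkSph (fun j => ?_) fun q => ?_
  · unfold colX colY
    split_ifs <;> fun_prop
  · rw [sum_ite_last]
    exact (collapse_ne (le_max_left _ _) (max_le zero_le_one (min_le_left _ _)) _).ne'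

theorem crd_collapse {t : ℝ} (h0 : 0 ≤ t) (h1 : t ≤ 1) (v : ↥(Sph n)) :
    ∃ r > 0, r ^ 2 * (colX t (crd v n) ^ 2 * (1 - crd v n ^ 2) + colY t (crd v n) ^ 2) = 1 ∧
      (∀ j < n, crd (collapse (t, v)) j = r * colX t (crd v n) * crd v j) ∧
      crd (collapse (t, v)) n = r * colY t (crd v n) := by
  have ht : max 0 (min 1 t) = t := by rw [min_eq_right h1, max_eq_right h0]
  have hp := collapse_ne h0 h1 v
  have hs := sum_ite_last (colX t (crd v n)) (colY t (crd v n)) v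
  refine ⟨(√(colX t (crd v n) ^ 2 * (1 - crd v n ^ 2) + colY t (crd v n) ^ 2))⁻¹,
    inv_pos.2 (Real.sqrt_pos.2 hp), ?_, fun j hj => ?_, ?_⟩
  · rw [inv_pow, Real.sq_sqrt hp.le, inv_mul_cancel₀ hp.ne']
  · simp only [collapse, ht]
    rw [crd_mkSph (by rw [hs]; exact hp.ne') (by omega), hs, if_pos hj, mul_assoc]
  · simp only [collapse, ht]
    rw [crd_mkSph (by rw [hs]; exact hp.ne') (by omega), hs, if_neg (lt_irrefl n)]

theorem collapse_one (v : ↥(Sph n)) : collapse (1, v) = v := by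
  have hX : ∀ b, colX 1 b = 1 := fun b => by simp [colX]
  have hY : ∀ b, colY 1 b = b := fun b => by simp [colY]
  obtain ⟨r, hr, h, h1, h2⟩ := crd_collapse zero_le_one le_rfl v
  rw [hX, hY] at h
  have hr1 : r = 1 := by nlinarith
  refine crd_ext fun j hj => ?_
  rcases Nat.lt_succ_iff_lt_or_eq.1 hj with hj | rfl
  · rw [h1 j hj, hX, hr1]; ring
  · rw [h2, hY, hr1, one_mul]

theorem collapse_zero_of_le {v : ↥(Sph n)} (hv : crd v n ≤ 1 / 2) : collapse (0, v) = south n := by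
  obtain ⟨r, hr, h, h1, h2⟩ := crd_collapse le_rfl zero_le_one v
  have hX : colX 0 (crd v n) = 0 := by simp [colX]; linarith
  have hY : colY 0 (crd v n) < 0 := by simp only [colY]; linarith
  refine IsSouth.eq ⟨fun j hj => by rw [h1 j hj, hX]; ring, ?_⟩
  rw [h2]
  rw [hX, zero_pow two_ne_zero, zero_mul, zero_add, ← mul_pow] at h
  rcases eq_or_eq_neg_of_sq_eq_sq _ 1 (h.trans (one_pow 2).symm) with h | h
  · nlinarith
  · exact h

theorem vecSum_collapse (v : ↥(Sph n)) : ∃ a : ℝ, 0 ≤ a ∧ ∀ (ι : Type) (e : ℕ → Matrix ι ι ℝ) [Fintype ι]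
    [DecidableEq ι], vecSum e (collapse (0, v)) = a • vecSum e v := by
  obtain ⟨r, hr, -, h1, -⟩ := crd_collapse le_rfl zero_le_one v
  refine ⟨r * colX 0 (crd v n), mul_nonneg hr.le (by simp [colX]), fun ι e _ _ => ?_⟩
  simp only [vecSum, cliffSum, Finset.smul_sum]
  exact Finset.sum_congr rfl fun j hj => by rw [h1 j (Finset.mem_range.1 hj), mul_smul]

theorem crd_collapse_of_sq {v : ↥(Sph n)} (hv : crd v n ^ 2 = 1) :
    crd (collapse (0, v)) n = crd v n := by
  obtain ⟨r, hr, h, -, h2⟩ := crd_collapse le_rfl zero_le_one v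
  rw [hv, sub_self, mul_zero, zero_add] at h
  rw [h2]
  rcases eq_or_eq_neg_of_sq_eq_sq _ 1 (hv.trans (one_pow 2).symm) with hb | hb <;>
  · rw [hb] at h ⊢
    norm_num [colY] at h ⊢
    first | (rcases h with h | h <;> linarith) | nlinarith

/-- Graft a map of the sphere onto the upper hemisphere of the standard lower hemisphere. -/
noncomputable def graft (n : ℕ) (e : ℕ → Matrix ι ι ℝ) (c : ↥(Sph n) → Matrix ι ι ℝ) (v : ↥(Sph n)) :
    Matrix ι ι ℝ :=
  min 1 (max 0 (1 - 2 * crd v n)) • vecSum e v + |crd v n| • c (collapse (0, v))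

theorem graft_dsum {c : ↥(Sph n) → Matrix ι ι ℝ} {c' : ↥(Sph n) → Matrix κ κ ℝ} (v : ↥(Sph n)) :
    graft n (fun i => dsum (e i) (e' i)) (fun v => dsum (c v) (c' v)) v =
      dsum (graft n e c v) (graft n e' c' v) := by
  simp only [graft, vecSum_dsum, dsum_smul, dsum_add]

/-- Symmetric, invertible, and standard on the lower hemisphere. -/
def HemiGood (e : ℕ → Matrix ι ι ℝ) (v : ↥(Sph n)) (M : Matrix ι ι ℝ) : Prop :=
  SymU v M ∧ (crd v n ≤ 0 → M = bottMap n e (e n) v)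

theorem graft_hemiGood (he : IsCliff (n + 1) e) {c : ↥(Sph n) → Matrix ι ι ℝ}
    (hc : ∀ v, SymU v (c v)) (hs : c (south n) = e n) (v : ↥(Sph n)) :
    HemiGood e v (graft n e c v) := by
  have hn : SA n e (e n) := he.sa (by omega) le_rfl
  have hu := isUnit_of_mul_self_eq_one (he.sq n (by omega))
  refine ⟨symU_vec he v ?_ v, fun hv => ?_⟩
  · by_cases hb : crd v n ≤ 1 / 2
    · rw [collapse_zero_of_le hb, hs]
      refine Or.inr ⟨hn.smul _, ?_⟩
      by_cases h0 : crd v n = 0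
      · left; simp [h0]
      · exact Or.inr (hu.real_smul (abs_ne_zero.2 h0))
    · refine Or.inl ⟨?_, ?_, (hc _).2.real_smul (abs_ne_zero.2 fun h => hb (by rw [h]; norm_num))⟩
      · rw [max_eq_left (by linarith), min_eq_right zero_le_one]
      · rw [Matrix.transpose_smul, (hc _).1]
  · rw [graft, collapse_zero_of_le (by linarith), hs, min_eq_left (le_max_of_le_right (by linarith)),
      bottMap, max_eq_right hv, max_eq_left (by linarith), abs_of_nonpos hv]
    module

theorem continuous_graft {H : X → ↥(Sph n) → Matrix ι ι ℝ} (hH : Continuous fun q : X × _ => H q.1 q.2) :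
    Continuous fun q : X × ↥(Sph n) => graft n e (H q.1) q.2 := by
  unfold graft
  have h1 : Continuous fun q : X × ↥(Sph n) => collapse (0, q.2) :=
    continuous_collapse.comp (by fun_prop)
  have h2 : Continuous fun q : X × ↥(Sph n) => H q.1 (collapse (0, q.2)) :=
    hH.comp (continuous_fst.prodMk h1)
  fun_prop

theorem continuous_graft_of {c : ↥(Sph n) → Matrix ι ι ℝ} (hc : Continuous c) :
    Continuous (graft n e c) := by
  unfold graft
  have h1 : Continuous fun v : ↥(Sph n) => collapse (0, v) :=
    continuous_collapse.comp (Continuous.prodMk_right 0)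
  have h2 := hc.comp h1
  exact (by fun_prop : Continuous fun v : ↥(Sph n) => min 1 (max 0 (1 - 2 * crd v n)) • vecSum e v).add
    ((by fun_prop : Continuous fun v : ↥(Sph n) => |crd v n|).smul h2)

theorem htpy_graft (he : IsCliff (n + 1) e) {c : ↥(Sph n) → Matrix ι ι ℝ} (hcc : Continuous c)
    (hc : ∀ v, SymU v (c v)) (hs : c (south n) = e n) : Htpy SymU (graft n e c) c := by
  have hn : SA n e (e n) := he.sa (by omega) le_rfl
  have hu := isUnit_of_mul_self_eq_one (he.sq n (by omega))
  have hw := continuous_collapse (n := n)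
  have H2 : Htpy SymU (fun v => c (collapse (0, v))) c :=
    ⟨fun q => c (collapse q), hcc.comp hw, fun _ => rfl, fun v => congrArg c (collapse_one v),
      fun _ _ _ => hc _⟩
  refine Htpy.trans ?_ H2
  refine ⟨fun q => ((1 - q.1) * min 1 (max 0 (1 - 2 * crd q.2 n))) • vecSum e q.2 +
    ((1 - q.1) * |crd q.2 n| + q.1) • c (collapse (0, q.2)), ?_, fun v => ?_, fun v => ?_,
    fun t ht v => symU_vec he v ?_ v⟩
  · have : Continuous fun q : ℝ × ↥(Sph n) => c (collapse (0, q.2)) :=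
      hcc.comp (hw.comp (by fun_prop))
    fun_prop
  · simp [graft]
  · simp
  · dsimp only
    have ha := abs_nonneg (crd v n)
    by_cases hb : crd v n ≤ 1 / 2
    · rw [collapse_zero_of_le hb, hs]
      refine Or.inr ⟨hn.smul _, ?_⟩
      by_cases h0 : (1 - t) * |crd v n| + t = 0
      · have h1 : t = 0 := by nlinarith [ht.1, ht.2, mul_nonneg (sub_nonneg.2 ht.2) ha]
        left
        rw [h1, sub_zero, one_mul, add_zero, abs_eq_zero] at h0
        simp [h0, h1]
      · exact Or.inr (hu.real_smul h0)
    · have h0 : 0 < (1 - t) * |crd v n| + t := by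
        rw [abs_of_pos (by linarith)]; nlinarith [ht.1, ht.2]
      refine Or.inl ⟨?_, ?_, (hc _).2.real_smul h0.ne'⟩
      · rw [max_eq_left (by linarith), min_eq_right zero_le_one, mul_zero]
      · rw [Matrix.transpose_smul, (hc _).1]

theorem htpy_graft_bottMap (he : IsCliff (n + 1) e) {ε : Matrix ι ι ℝ} (h : Adm n e ε) :
    Htpy (HemiGood e) (graft n e (bottMap n e ε)) (bottMap n e ε) := by
  have hu := isUnit_of_mul_self_eq_one h.sq
  have hU := fun v => symU_bottMap he h.sa hu v v
  have hS := bottMap_south (e := e) (n := n) ε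
  have hG := graft_hemiGood he hU hS
  have hc : Continuous (bottMap n e ε) := continuous_bottMap
  have hg := continuous_graft_of (e := e) hc
  have hn : SA n e (e n) := he.sa (by omega) le_rfl
  refine ⟨fun q => (1 - q.1) • graft n e (bottMap n e ε) q.2 + q.1 • bottMap n e ε q.2,
    ((continuous_const.sub continuous_fst).smul (hg.comp continuous_snd)).add
      (continuous_fst.smul (hc.comp continuous_snd)), fun v => by simp, fun v => by simp, fun t ht v => ⟨?_, fun hv => ?_⟩⟩
  · rcases ht.1.eq_or_lt with rfl | h0
    · simpa using (hG v).1
    · obtain ⟨a, ha, hva⟩ := vecSum_collapse v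
      have hsa : ∀ b : ℝ, SA n e (max b 0 • ε + max (-b) 0 • e n) := fun b =>
        (h.sa.smul _).add (hn.smul _)
      have key : (1 - t) • graft n e (bottMap n e ε) v + t • bottMap n e ε v =
          ((1 - t) * (min 1 (max 0 (1 - 2 * crd v n)) + |crd v n| * a) + t) • vecSum e v +
          (((1 - t) * |crd v n|) • (max (crd (collapse (0, v)) n) 0 • ε +
            max (-crd (collapse (0, v)) n) 0 • e n) +
            t • (max (crd v n) 0 • ε + max (-crd v n) 0 • e n)) := by
        rw [graft, bottMap, bottMap, hva]
        module
      dsimp only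
      rw [key]
      have hM := ((hsa (crd (collapse (0, v)) n)).smul ((1 - t) * |crd v n|)).add ((hsa (crd v n)).smul t)
      refine symU_vec he v (Or.inr ⟨hM, ?_⟩) v
      by_cases hb : crd v n ^ 2 = 1
      · right
        rw [crd_collapse_of_sq hb]
        rcases eq_or_eq_neg_of_sq_eq_sq _ 1 (hb.trans (one_pow 2).symm) with hb | hb
        · simpa [hb, ← add_smul] using hu
        · simpa [hb, ← add_smul] using isUnit_of_mul_self_eq_one (he.sq n (by omega))
      · refine Or.inl ⟨ne_of_gt ?_, hb⟩
        have h1 : 0 ≤ min 1 (max 0 (1 - 2 * crd v n)) :=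
          le_min zero_le_one (le_max_left _ _)
        have h2 := mul_nonneg (abs_nonneg (crd v n)) ha
        have := mul_nonneg (sub_nonneg.2 ht.2) (add_nonneg h1 h2)
        linarith
  · dsimp only
    rw [(hG v).2 hv, bottMap_of_nonpos (ε := ε) hv]
    module

theorem htpy_graft_const (he : IsCliff (n + 1) e) :
    Htpy (HemiGood e) (graft n e fun _ => e n) (bottMap n e (e n)) := by
  have hn : SA n e (e n) := he.sa (by omega) le_rfl
  have hu := isUnit_of_mul_self_eq_one (he.sq n (by omega))
  have hb : ∀ v : ↥(Sph n), bottMap n e (e n) v = vecSum e v + |crd v n| • e n := fun v => by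
    rw [bottMap, ← add_smul, max_comm (crd v n), max_comm (-crd v n)]
    rcases le_total 0 (crd v n) with h | h
    · rw [max_eq_right h, max_eq_left (by linarith), abs_of_nonneg h, add_zero]
    · rw [max_eq_left h, max_eq_right (by linarith), abs_of_nonpos h, zero_add]
  refine ⟨fun q => ((1 - q.1) * min 1 (max 0 (1 - 2 * crd q.2 n)) + q.1) • vecSum e q.2 +
    |crd q.2 n| • e n, by fun_prop, fun v => by simp [graft], fun v => by simp [hb],
    fun t ht v => ⟨symU_vec he v (Or.inr ⟨hn.smul _, ?_⟩) v, fun hv => ?_⟩⟩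
  · by_cases h0 : crd v n = 0
    · left; simp [h0]
    · exact Or.inr (hu.real_smul (abs_ne_zero.2 h0))
  · dsimp only
    rw [hb, min_eq_left (le_max_of_le_right (by linarith))]
    module

end Collapse

section Represent

variable {n : ℕ} {ι κ : Type} [Fintype ι] [DecidableEq ι]
  [Fintype κ] [DecidableEq κ] {e : ℕ → Matrix ι ι ℝ}

/-- Any symmetric involution is stably the last generator of a Clifford system. -/
theorem exists_cliff_last {s : Matrix ι ι ℝ} (hs : sᵀ = s) (hss : s * s = 1) (n : ℕ) :
    ∃ (κ : Type) (_ : Fintype κ) (_ : DecidableEq κ) (r : Matrix κ κ ℝ)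
      (e : ℕ → Matrix (ι ⊕ κ) (ι ⊕ κ) ℝ), rᵀ = r ∧ r * r = 1 ∧ IsCliff (n + 1) e ∧ e n = dsum s r := by
  induction n with
  | zero =>
    refine ⟨Empty, inferInstance, inferInstance, 0, fun _ => dsum s 0, Subsingleton.elim _ _,
      Subsingleton.elim _ _, ⟨fun _ _ => ?_, fun _ _ => ?_, fun i hi j hj h => by omega⟩, rfl⟩
    · rw [dsum_transpose, hs, Matrix.transpose_zero]
    · rw [dsum_mul, hss, Subsingleton.elim (0 * 0 : Matrix Empty Empty ℝ) 1, dsum_one]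
  | succ n ih =>
    obtain ⟨κ, _, _, r, e, hr, hrr, he, hen⟩ := ih
    have hn := he.symm n (by omega)
    have hn2 := he.sq n (by omega)
    have hE : IsCliff (n + 2) fun i => match i with
        | 0 => Matrix.fromBlocks 0 1 1 0
        | i + 1 => dsum (e i) (-(e i)) := by
      refine ⟨fun i hi => ?_, fun i hi => ?_, fun i hi j hj hij => ?_⟩
      · rcases i with _ | i
        · simp [Matrix.fromBlocks_transpose]
        · simp [dsum_transpose, he.symm i (by omega)]
      · rcases i with _ | i
        · simp [Matrix.fromBlocks_multiply]
        · simp [dsum_mul, he.sq i (by omega), dsum_one]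
      · rcases i with _ | i <;> rcases j with _ | j
        · omega
        · simp [dsum, Matrix.fromBlocks_multiply, Matrix.fromBlocks_neg]
        · simp [dsum, Matrix.fromBlocks_multiply, Matrix.fromBlocks_neg]
        · simp [dsum_mul, he.anti i (by omega) j (by omega) (by omega), dsum_neg]
    refine ⟨κ ⊕ (ι ⊕ κ), inferInstance, inferInstance, dsum r (-(e n)), _, ?_, ?_,
      hE.reidx (Equiv.sumAssoc ι κ (ι ⊕ κ)), ?_⟩
    · rw [dsum_transpose, hr, Matrix.transpose_neg, hn]
    · rw [dsum_mul, hrr, neg_mul_neg, hn2, dsum_one]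
    · dsimp only
      rw [← reidx_dsum_assoc, ← hen]

theorem htpy_bottMap_const (he : IsCliff (n + 1) e) :
    Htpy SymU (bottMap n e (e n)) fun _ => e n :=
  ((htpy_graft_const he).mono fun _ _ h => h.1).symm.trans (htpy_graft he continuous_const
    (fun _ => ⟨he.symm n (by omega), isUnit_of_mul_self_eq_one (he.sq n (by omega))⟩) rfl)

theorem lin_const_eq_of_mem (e : ℕ → Matrix ι ι ℝ) {z : Cube Unit n} (hz : z ∈ cubeBd (∅ : Set Unit) n)
    (η : Unit → Matrix ι ι ℝ) :
    crd (sphPt z) n ≤ 0 ∧ lin e 0 n η z = bottMap n e (e n) (sphPt z) := by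
  have h0 : sph n n z = 0 := ((mem_cubeBd n z).1 hz).resolve_right (Set.notMem_empty _)
  refine ⟨by rw [crd_sphPt z (by omega), h0], ?_⟩
  rw [bottMap_sphPt (ε := fun _ => e n) z, lin_eq, lin_eq, h0, zero_smul, zero_smul]

/-- A symmetric invertible family over the sphere is stably a Bott map. -/
theorem exists_htpy_bottMap (he : IsCliff (n + 1) e) {c : ↥(Sph n) → Matrix ι ι ℝ} (hcc : Continuous c)
    (hc : ∀ v, SymU v (c v)) (hs : c (south n) = e n) :
    ∃ (κ : Type) (_ : Fintype κ) (_ : DecidableEq κ) (e' : ℕ → Matrix κ κ ℝ), IsCliff (n + 1) e' ∧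
      ∃ ε, Adm n (fun i => dsum (e i) (e' i)) ε ∧ Htpy SymU (fun v => dsum (c v) (e' n))
        (bottMap n (fun i => dsum (e i) (e' i)) ε) := by
  have hG := graft_hemiGood he hc hs
  obtain ⟨κ, _, _, e', he', ε, hε, hεi, -, H⟩ := bott_iterate (X := Unit) (Y := (∅ : Set Unit)) n
    (zero_add n) he (F := fun z => graft n e c (sphPt z))
    ((continuous_graft_of hcc).comp continuous_sphPt)
    (fun z => ⟨(hG _).1.1, fun i hi => absurd hi (Nat.not_lt_zero i)⟩) (fun z => (hG _).1.2)
    (η := fun _ => 0) (fun x hx => absurd hx (Set.notMem_empty x)) (fun z hz => by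
      obtain ⟨h1, h2⟩ := lin_const_eq_of_mem e hz fun _ => 0
      rw [h2, (hG _).2 h1])
  have hA : Adm n (fun i => dsum (e i) (e' i)) (ε ()) :=
    ⟨he.blockSum he', (hεi () trivial).1, (hεi () trivial).2⟩
  have hn := he.blockSum he'
  refine ⟨κ, inferInstance, inferInstance, e', he', ε (), hA, ?_⟩
  have h1 := (htpy_graft he hcc hc hs).symU_blockSum (htpy_bottMap_const he')
  refine h1.symm.trans (htpy_sphere (e := fun i => dsum (e i) (e' i)) (L := bottMap n (fun i => dsum (e i) (e' i)) (dsum (e n) (e' n)))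
    continuous_bottMap
    (fun v => symU_bottMap hn (hn.sa (i := n) (by omega) le_rfl)
      (isUnit_of_mul_self_eq_one (hn.sq n (by omega))) v v)
    (fun v hv => by rw [bottMap_dsum, (hG v).2 hv]) (fun v hv => bottMap_of_nonpos hv) ?_)
  have h2 : ∀ z : Cube Unit n, lin e' 0 n (fun _ => e' n) z = bottMap n e' (e' n) (sphPt z) :=
    fun z => (bottMap_sphPt (ε := fun _ => e' n) z).symm
  have h3 : ∀ z : Cube Unit n, lin (fun i => dsum (e i) (e' i)) 0 n ε z =
      bottMap n (fun i => dsum (e i) (e' i)) (ε ()) (sphPt z) :=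
    fun z => (bottMap_sphPt (ε := ε) z).symm
  simp only [h2, h3] at H
  refine H.mono fun z M hM => hM.congr fun hz => ⟨hz, ?_⟩
  rw [bottMap_dsum, (hG _).2 (lin_const_eq_of_mem e hz fun _ => 0).1]

end Represent

section MurrayVonNeumann

variable {X : Type} [TopologicalSpace X] {ι κ μ ν : Type} [Fintype ι] [DecidableEq ι]
  [Fintype κ] [DecidableEq κ] [Fintype μ] [DecidableEq μ] [Fintype ν] [DecidableEq ν]
  {p : X → Matrix ι ι ℝ} {q : X → Matrix κ κ ℝ} {r : X → Matrix μ μ ℝ} {s : X → Matrix ν ν ℝ}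

/-- Continuous Murray-von Neumann equivalence of families of matrices. -/
def MvN (p : X → Matrix ι ι ℝ) (q : X → Matrix κ κ ℝ) : Prop :=
  ∃ (u : X → Matrix ι κ ℝ) (v : X → Matrix κ ι ℝ), Continuous u ∧ Continuous v ∧
    (∀ x, u x * v x = p x) ∧ ∀ x, v x * u x = q x

theorem MvN.symm : MvN p q → MvN q p := fun ⟨u, v, hu, hv, h1, h2⟩ => ⟨v, u, hv, hu, h2, h1⟩

theorem MvN.trans (hp : ∀ x, p x * p x = p x) (hr : ∀ x, r x * r x = r x) :
    MvN p q → MvN q r → MvN p r := by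
  rintro ⟨u, v, hu, hv, h1, h2⟩ ⟨u', v', hu', hv', h1', h2'⟩
  refine ⟨fun x => u x * u' x, fun x => v' x * v x, hu.matrix_mul hu', hv'.matrix_mul hv,
    fun x => ?_, fun x => ?_⟩
  · calc u x * u' x * (v' x * v x) = u x * (u' x * v' x) * v x := by simp only [Matrix.mul_assoc]
      _ = (u x * v x) * (u x * v x) := by rw [h1', ← h2]; simp only [Matrix.mul_assoc]
      _ = p x := by rw [h1, hp]
  · calc v' x * v x * (u x * u' x) = v' x * (v x * u x) * u' x := by simp only [Matrix.mul_assoc]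
      _ = (v' x * u' x) * (v' x * u' x) := by rw [h2, ← h1']; simp only [Matrix.mul_assoc]
      _ = r x := by rw [h2', hr]

theorem MvN.blockSum : MvN p q → MvN r s →
    MvN (fun x => dsum (p x) (r x)) fun x => dsum (q x) (s x) := by
  rintro ⟨u, v, hu, hv, h1, h2⟩ ⟨u', v', hu', hv', h1', h2'⟩
  refine ⟨fun x => Matrix.fromBlocks (u x) 0 0 (u' x), fun x => Matrix.fromBlocks (v x) 0 0 (v' x),
    hu.matrix_fromBlocks continuous_const continuous_const hu',
    hv.matrix_fromBlocks continuous_const continuous_const hv', fun x => ?_, fun x => ?_⟩ <;>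
  simp [Matrix.fromBlocks_multiply, dsum, *]

theorem mvN_reidx (hp : Continuous p) (hpp : ∀ x, p x * p x = p x) (f : ι ≃ κ) :
    MvN p fun x => reidx f (p x) :=
  ⟨fun x => (p x).submatrix id f.symm, fun x => (p x).submatrix f.symm id,
    hp.matrix_submatrix _ _, hp.matrix_submatrix _ _,
    fun x => by rw [Matrix.submatrix_mul_equiv, hpp, Matrix.submatrix_id_id],
    fun x => by
      rw [← Matrix.submatrix_mul _ _ _ _ _ Function.bijective_id, hpp]
      rfl⟩

theorem mvN_of_conj {p q : X → Matrix ι ι ℝ} (hp : Continuous p) (hpp : ∀ x, p x * p x = p x)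
    {g g' : X → Matrix ι ι ℝ} (hg : Continuous g) (hg' : Continuous g') (h1 : ∀ x, g x * g' x = 1)
    (h2 : ∀ x, g' x * g x = 1) (h : ∀ x, g x * p x = q x * g x) : MvN p q := by
  refine ⟨fun x => p x * g' x, fun x => g x * p x, hp.matrix_mul hg', hg.matrix_mul hp,
    fun x => ?_, fun x => ?_⟩
  · rw [mul_assoc, ← mul_assoc (g' x), h2, one_mul, hpp]
  · rw [mul_assoc, ← mul_assoc (p x), hpp, ← mul_assoc, h, mul_assoc, h1, mul_one]

theorem MvN.conj {p q : X → Matrix ι ι ℝ} (hp : Continuous p) (hq : Continuous q)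
    (hpp : ∀ x, p x * p x = p x) (hqq : ∀ x, q x * q x = q x) (h : MvN p q) :
    ∃ g g' : X → Matrix (ι ⊕ ι) (ι ⊕ ι) ℝ, Continuous g ∧ Continuous g' ∧ (∀ x, g x * g' x = 1) ∧
      (∀ x, g' x * g x = 1) ∧ ∀ x, g x * dsum (p x) 0 = dsum (q x) 0 * g x := by
  obtain ⟨u, v, hu, hv, h1, h2⟩ := h
  have hpu : ∀ x, p x * u x = u x * q x := fun x => by rw [← h1, ← h2, mul_assoc]
  have hqv : ∀ x, q x * v x = v x * p x := fun x => by rw [← h1, ← h2, mul_assoc]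
  have e1 : ∀ x, p x * u x * (q x * v x) = p x := fun x => by
    rw [hqv, ← mul_assoc, mul_assoc (p x), h1, hpp, hpp]
  have e2 : ∀ x, q x * v x * (p x * u x) = q x := fun x => by
    rw [hpu, ← mul_assoc, mul_assoc (q x), h2, hqq, hqq]
  have a1 : ∀ x, p x * (p x * u x) = p x * u x := fun x => by rw [← mul_assoc, hpp]
  have a2 : ∀ x, q x * (q x * v x) = q x * v x := fun x => by rw [← mul_assoc, hqq]
  have a3 : ∀ x, p x * u x * q x = p x * u x := fun x => by rw [hpu, mul_assoc, hqq]
  have a4 : ∀ x, q x * v x * p x = q x * v x := fun x => by rw [hqv, mul_assoc, hpp]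
  refine ⟨fun x => Matrix.fromBlocks (q x * v x) (1 - q x) (1 - p x) (p x * u x),
    fun x => Matrix.fromBlocks (p x * u x) (1 - p x) (1 - q x) (q x * v x),
    (hq.matrix_mul hv).matrix_fromBlocks (continuous_const.sub hq) (continuous_const.sub hp)
      (hp.matrix_mul hu),
    (hp.matrix_mul hu).matrix_fromBlocks (continuous_const.sub hp) (continuous_const.sub hq)
      (hq.matrix_mul hv), fun x => ?_, fun x => ?_, fun x => ?_⟩
  · simp [Matrix.fromBlocks_multiply, mul_sub, sub_mul, hpp, hqq, e1, e2, a1, a2, a3, a4]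
  · simp [Matrix.fromBlocks_multiply, mul_sub, sub_mul, hpp, hqq, e1, e2, a1, a2, a3, a4]
  · simp [Matrix.fromBlocks_multiply, dsum, sub_mul, mul_sub, hpp, hqq, a2, a4]

theorem mvN_compl (hp : Continuous p) (hpp : ∀ x, p x * p x = p x) :
    MvN (fun x => dsum (p x) (1 - p x)) fun _ => (1 : Matrix ι ι ℝ) := by
  have h1 : Continuous fun x => 1 - p x := continuous_const.sub hp
  refine ⟨fun x => Matrix.fromRows (p x) (1 - p x), fun x => Matrix.fromCols (p x) (1 - p x),
    continuous_matrix ?_, continuous_matrix ?_, fun x => ?_, fun x => ?_⟩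
  · rintro (i | i) j
    exacts [hp.matrix_elem i j, h1.matrix_elem i j]
  · rintro i (j | j)
    exacts [hp.matrix_elem i j, h1.matrix_elem i j]
  · simp [dsum, mul_sub, sub_mul, hpp]
  · simp [Matrix.fromCols_mul_fromRows, mul_sub, sub_mul, hpp]

theorem mvN_const {q : Matrix ι ι ℝ} (h : q * q = q) :
    ∃ k : ℕ, MvN (fun _ : X => q) fun _ => (1 : Matrix (Fin k) (Fin k) ℝ) := by
  let V := LinearMap.range q.toLin'
  let b := Module.finBasis ℝ V
  have hq : ∀ w : V, q.toLin' w = w := by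
    rintro ⟨_, w, rfl⟩
    rw [← Matrix.toLin'_mul_apply, h]
  refine ⟨_, fun _ => LinearMap.toMatrix' (V.subtype ∘ₗ b.equivFun.symm.toLinearMap),
    fun _ => LinearMap.toMatrix' (b.equivFun.toLinearMap ∘ₗ q.toLin'.rangeRestrict),
    continuous_const, continuous_const, fun _ => ?_, fun _ => ?_⟩
  · rw [← LinearMap.toMatrix'_comp]
    refine Eq.trans (congrArg _ (LinearMap.ext fun w => ?_)) (LinearMap.toMatrix'_toLin' q)
    simp only [LinearMap.comp_apply, LinearEquiv.coe_coe, LinearEquiv.symm_apply_apply]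
    rfl
  · rw [← LinearMap.toMatrix'_comp, ← LinearMap.toMatrix'_id]
    congr 1
    refine LinearMap.ext fun w => ?_
    have : q.toLin'.rangeRestrict ((b.equivFun.symm w : V) : ι → ℝ) = b.equivFun.symm w :=
      Subtype.ext (hq _)
    simp only [LinearMap.comp_apply, LinearEquiv.coe_coe, Submodule.subtype_apply, this,
      LinearEquiv.apply_symm_apply, LinearMap.id_apply]

end MurrayVonNeumann

section Homotopy

variable {X : Type} [TopologicalSpace X] {ι κ : Type} [Fintype ι] [DecidableEq ι]
  [Fintype κ] [DecidableEq κ]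

/-- The idempotent attached to an involution. -/
noncomputable def half (M : Matrix ι ι ℝ) : Matrix ι ι ℝ := (1 / 2 : ℝ) • (1 + M)

theorem half_idem {M : Matrix ι ι ℝ} (h : M * M = 1) : half M * half M = half M := by
  rw [half, smul_mul_smul_comm, mul_add, add_mul, add_mul, h, one_mul, one_mul, mul_one]
  module

theorem half_dsum (A : Matrix ι ι ℝ) (B : Matrix κ κ ℝ) : half (dsum A B) = dsum (half A) (half B) := by
  rw [half, half, half, ← dsum_one, dsum_add, dsum_smul]

theorem half_reflection (p : Matrix ι ι ℝ) : half ((2 : ℝ) • p - 1) = p := by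
  rw [half]; module

theorem reflection_sq {p : Matrix ι ι ℝ} (h : p * p = p) :
    ((2 : ℝ) • p - 1) * ((2 : ℝ) • p - 1) = 1 := by
  simp only [mul_sub, sub_mul, smul_mul_smul_comm, h, one_mul, mul_one]
  module

theorem continuous_half {f : X → Matrix ι ι ℝ} (h : Continuous f) : Continuous fun x => half (f x) := by
  unfold half; fun_prop

open scoped Matrix.Norms.Operator in
theorem mvN_of_path [CompactSpace X] {J : ℝ × X → Matrix ι ι ℝ} (hJ : Continuous J)
    (hJJ : ∀ q, J q * J q = 1) (t t' : ℝ) :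
    MvN (fun x => half (J (t, x))) fun x => half (J (t', x)) := by
  have hid := fun t x => half_idem (hJJ (t, x))
  have hc : ∀ t, Continuous fun x => J (t, x) := fun t => hJ.comp (Continuous.prodMk_right t)
  have loc : ∀ t₀, ∀ᶠ t in nhds t₀, MvN (fun x => half (J (t₀, x))) fun x => half (J (t, x)) := by
    intro t₀
    have h1 : ∀ᶠ t in nhds t₀, ∀ x ∈ (Set.univ : Set X), IsUnit (1 + J (t, x) * J (t₀, x)) := by
      refine isCompact_univ.eventually_forall_of_forall_eventually fun x _ => ?_
      have h2 : Continuous fun q : ℝ × X => 1 + J q * J (t₀, q.2) :=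
        continuous_const.add (hJ.mul ((hc t₀).comp continuous_snd))
      refine h2.continuousAt.eventually (Units.isOpen.mem_nhds ?_)
      change IsUnit (1 + J (t₀, x) * J (t₀, x))
      rw [hJJ, ← two_smul ℝ (1 : Matrix ι ι ℝ)]
      exact isUnit_one.real_smul two_ne_zero
    filter_upwards [h1] with t ht
    have hz : Continuous fun x => 1 + J (t, x) * J (t₀, x) := continuous_const.add ((hc t).mul (hc t₀))
    refine mvN_of_conj (continuous_half (hc t₀)) (hid t₀) hz (continuous_ringInverse hz fun x => ht x trivial)
      (fun x => Ring.mul_inverse_cancel _ (ht x trivial))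
      (fun x => Ring.inverse_mul_cancel _ (ht x trivial)) fun x => ?_
    simp only [half, mul_smul_comm, smul_mul_assoc, mul_add, add_mul, mul_one, one_mul]
    rw [mul_assoc (J (t, x)) (J (t₀, x)), hJJ, ← mul_assoc (J (t, x)) (J (t, x)), hJJ]
    simp only [mul_one, one_mul]
    module
  have hS : IsClopen {t' | MvN (fun x => half (J (t, x))) fun x => half (J (t', x))} := by
    constructor
    · rw [← isOpen_compl_iff, isOpen_iff_eventually]
      exact fun s hs => (loc s).mono fun s' h h' => hs (h'.trans (hid t) (hid s) h.symm)
    · rw [isOpen_iff_eventually]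
      exact fun s hs => (loc s).mono fun s' h => MvN.trans (hid t) (hid s') hs h
  rcases isClopen_iff.1 hS with h | h
  · have : t ∈ (∅ : Set ℝ) := h ▸ (loc t).self_of_nhds
    exact absurd this (Set.notMem_empty t)
  · exact (h.symm ▸ Set.mem_univ t' : t' ∈ {t' | MvN (fun x => half (J (t, x))) _})

theorem mvN_of_htpy [CompactSpace X] {A B : X → Matrix ι ι ℝ} (H : Htpy SymU A B)
    (hA : ∀ x, A x * A x = 1) (hB : ∀ x, B x * B x = 1) :
    MvN (fun x => half (A x)) fun x => half (B x) := by
  obtain ⟨H, hH, h0, h1, hP⟩ := H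
  have hP' := fun q : ℝ × X => hP _ (Set.projIcc (0 : ℝ) 1 zero_le_one q.1).2 q.2
  obtain ⟨R, hR, -, hRR, -, -, hc⟩ := exists_normalize (k := 0) (e := fun _ => 0)
    (A := fun q : ℝ × X => H (Set.projIcc (0 : ℝ) 1 zero_le_one q.1, q.2))
    (hH.comp ((continuous_subtype_val.comp (continuous_projIcc.comp continuous_fst)).prodMk
      continuous_snd))
    (fun q => ⟨(hP' q).1, fun i hi => absurd hi (Nat.not_lt_zero i)⟩) fun q => (hP' q).2
  have e0 : ∀ x, R (1, (0, x)) = A x := fun x => by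
    rw [hc _ (by simp [h0, hA]) 1]; simp [h0]
  have e1 : ∀ x, R (1, (1, x)) = B x := fun x => by
    rw [hc _ (by simp [h1, hB]) 1]; simp [h1]
  have := mvN_of_path (J := fun q => R (1, q)) (hR.comp (Continuous.prodMk_right 1)) hRR 0 1
  simpa only [e0, e1] using this

open scoped Matrix.Norms.Operator in
theorem isUnit_symmetrize {c : Matrix ι ι ℝ} (h : c * c = 1) {t : ℝ} (ht : t ∈ Set.Icc (0 : ℝ) 1) :
    SegUnit (((1 - t) • c + t • cᵀ) * ((1 - t) • c + t • cᵀ)) := by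
  intro u hu
  have h' : cᵀ * cᵀ = 1 := by rw [← Matrix.transpose_mul, h, Matrix.transpose_one]
  have hp : (c * cᵀ + cᵀ * c).PosSemidef := (psd_self_mul_transpose c).add (by
    simpa using psd_self_mul_transpose cᵀ)
  have h0 : 0 ≤ u * (t * (1 - t)) := mul_nonneg hu.1 (mul_nonneg ht.1 (sub_nonneg.2 ht.2))
  have e : 1 + u • (((1 - t) • c + t • cᵀ) * ((1 - t) • c + t • cᵀ) - 1) =
      ((1 - u) + u * ((1 - t) ^ 2 + t ^ 2)) • 1 + (u * (t * (1 - t))) • (c * cᵀ + cᵀ * c) := by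
    simp only [mul_add, add_mul, smul_mul_smul_comm, h, h']
    module
  rw [e]
  refine isUnit_smul_one_add_psd ?_ (hp.smul h0)
  nlinarith [hu.1, hu.2, sq_nonneg (1 - 2 * t)]

open scoped Matrix.Norms.Operator in
theorem exists_symm [CompactSpace X] {c : X → Matrix ι ι ℝ} (hc : Continuous c)
    (h : ∀ x, c x * c x = 1) : ∃ s : X → Matrix ι ι ℝ, Continuous s ∧ (∀ x, (s x)ᵀ = s x) ∧
      (∀ x, s x * s x = 1) ∧ MvN (fun x => half (c x)) fun x => half (s x) := by
  let τ : ℝ → ℝ := fun t => Set.projIcc (0 : ℝ) 1 zero_le_one t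
  have hτ : Continuous τ := continuous_subtype_val.comp continuous_projIcc
  obtain ⟨R, hR, -, hRR, -, -, hφ, hcst⟩ := exists_involutize
    (T := fun q : ℝ × X => (1 - τ q.1) • c q.2 + τ q.1 • (c q.2)ᵀ)
    (((continuous_const.sub (hτ.comp continuous_fst)).smul (hc.comp continuous_snd)).add
      ((hτ.comp continuous_fst).smul (hc.comp continuous_snd).matrix_transpose))
    fun q => isUnit_symmetrize (h q.2) (Set.projIcc (0 : ℝ) 1 zero_le_one q.1).2
  have hτ0 : τ 0 = 0 := by simp [τ]
  have hτ2 : τ (1 / 2) = 1 / 2 := by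
    simp only [τ]; rw [Set.projIcc_of_mem _ (by norm_num)]
  refine ⟨fun x => R (1, (1 / 2, x)), by fun_prop, fun x => ?_, fun x => hRR _, ?_⟩
  · refine hφ 1 (1 / 2, x) (Matrix.transposeLinearEquiv ι ι ℝ ℝ).toLinearMap
      (continuous_id.matrix_transpose) (by simp) (fun a b => by simp) ?_
    change ((1 - τ (1 / 2)) • c x + τ (1 / 2) • (c x)ᵀ)ᵀ = (1 - τ (1 / 2)) • c x + τ (1 / 2) • (c x)ᵀ
    rw [hτ2, Matrix.transpose_add, Matrix.transpose_smul, Matrix.transpose_smul,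
      Matrix.transpose_transpose]
    module
  · have := mvN_of_path (J := fun q => R (1, q)) (hR.comp (Continuous.prodMk_right 1)) hRR 0 (1 / 2)
    have e0 : ∀ x, R (1, (0, x)) = c x := fun x => by
      rw [hcst _ (by simp [hτ0, h]) 1]; simp [hτ0]
    simpa only [e0] using this

end Homotopy

/-- A continuous family of idempotent real matrices over `X`. -/
structure Idem (X : Type) [TopologicalSpace X] : Type 1 where
  J : Type
  [fin : Fintype J]
  [dec : DecidableEq J]
  p : X → Matrix J J ℝ
  cont : Continuous p
  idem : ∀ x, p x * p x = p x

attribute [instance] Idem.fin Idem.dec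

namespace Idem

variable {X : Type} [TopologicalSpace X]

instance setoid (X : Type) [TopologicalSpace X] : Setoid (Idem X) where
  r P Q := MvN P.p Q.p
  iseqv := ⟨fun P => ⟨P.p, P.p, P.cont, P.cont, P.idem, P.idem⟩, MvN.symm,
    fun {P _ R} => MvN.trans P.idem R.idem⟩

/-- The direct sum of two families of idempotents. -/
def add (P Q : Idem X) : Idem X where
  J := P.J ⊕ Q.J
  p x := dsum (P.p x) (Q.p x)
  cont := P.cont.blockSum Q.cont
  idem x := by rw [dsum_mul, P.idem, Q.idem]

/-- A constant family of idempotents. -/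
def const {ι : Type} [Fintype ι] [DecidableEq ι] (q : Matrix ι ι ℝ) (h : q * q = q) : Idem X :=
  ⟨ι, fun _ => q, continuous_const, fun _ => h⟩

/-- The complementary family. -/
def compl (P : Idem X) : Idem X where
  J := P.J
  p x := 1 - P.p x
  cont := continuous_const.sub P.cont
  idem x := by simp [mul_sub, sub_mul, P.idem]

/-- The family of idempotents attached to a family of involutions. -/
noncomputable def ofInv {ι : Type} [Fintype ι] [DecidableEq ι] (c : X → Matrix ι ι ℝ)
    (hc : Continuous c) (h : ∀ x, c x * c x = 1) : Idem X :=
  ⟨ι, fun x => half (c x), continuous_half hc, fun x => half_idem (h x)⟩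

end Idem

/-- The monoid of Murray-von Neumann classes of continuous families of idempotents. -/
def IdemClass (X : Type) [TopologicalSpace X] : Type 1 := Quotient (Idem.setoid X)

namespace IdemClass

variable {X : Type} [TopologicalSpace X]

/-- The class of a family of idempotents. -/
def mk (P : Idem X) : IdemClass X := Quotient.mk _ P

theorem mk_eq {P Q : Idem X} : mk P = mk Q ↔ MvN P.p Q.p := Quotient.eq

instance : Add (IdemClass X) :=
  ⟨Quotient.map₂ Idem.add fun _ _ h _ _ h' => MvN.blockSum h h'⟩

instance : Zero (IdemClass X) := ⟨mk (Idem.const (0 : Matrix Empty Empty ℝ) (zero_mul _))⟩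

theorem mk_reidx {P Q : Idem X} (f : P.J ≃ Q.J) (h : ∀ x, reidx f (P.p x) = Q.p x) :
    mk P = mk Q :=
  mk_eq.2 (by simpa only [h] using mvN_reidx P.cont P.idem f)

theorem add_comm' (x y : IdemClass X) : x + y = y + x := by
  induction x using Quotient.inductionOn with | _ P
  induction y using Quotient.inductionOn with | _ Q
  exact mk_reidx (P := P.add Q) (Q := Q.add P) (Equiv.sumComm _ _) fun x => by
    ext (i | i) (j | j) <;> rfl

theorem add_zero' (x : IdemClass X) : x + 0 = x := by
  induction x using Quotient.inductionOn with | _ P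
  exact mk_reidx (P := P.add (Idem.const _ _)) (Q := P) (Equiv.sumEmpty P.J Empty) fun x => by
    ext i j; rfl

instance : AddCommMonoid (IdemClass X) where
  add_assoc x y z := by
    induction x using Quotient.inductionOn with | _ P
    induction y using Quotient.inductionOn with | _ Q
    induction z using Quotient.inductionOn with | _ R
    exact mk_reidx (P := (P.add Q).add R) (Q := P.add (Q.add R)) (Equiv.sumAssoc _ _ _)
      fun x => reidx_dsum_assoc _ _ _
  zero_add x := (add_comm' 0 x).trans (add_zero' x)
  add_zero := add_zero'
  add_comm := add_comm'
  nsmul := nsmulRec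

/-- The class of the trivial family of rank `k`. -/
def triv (k : ℕ) : IdemClass X := mk (Idem.const (1 : Matrix (Fin k) (Fin k) ℝ) (one_mul _))

/-- The rank at a point. -/
noncomputable def rank (x : X) : IdemClass X →+ ℝ where
  toFun := Quotient.lift (fun P : Idem X => (P.p x).trace) fun P Q ⟨u, v, _, _, h1, h2⟩ => by
    rw [← h1, ← h2, Matrix.trace_mul_comm]
  map_zero' := Matrix.trace_zero _ _
  map_add' y z := by
    induction y using Quotient.inductionOn with | _ P
    induction z using Quotient.inductionOn with | _ Q
    exact dsum_trace _ _

theorem rank_mk (x : X) (P : Idem X) : rank x (mk P) = (P.p x).trace := rfl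

theorem rank_triv (x : X) (k : ℕ) : rank x (triv k) = k := by
  exact Matrix.trace_one.trans (congrArg _ (Fintype.card_fin k))

theorem exists_mk_const {ι : Type} [Fintype ι] [DecidableEq ι] (q : Matrix ι ι ℝ) (h : q * q = q) :
    ∃ k, mk (Idem.const q h) = (triv k : IdemClass X) := by
  obtain ⟨k, hk⟩ := mvN_const (X := X) h
  exact ⟨k, mk_eq.2 hk⟩

theorem triv_add [Nonempty X] (k l : ℕ) : triv k + triv l = (triv (k + l) : IdemClass X) := by
  obtain ⟨m, hm⟩ := exists_mk_const (X := X) _ (((Idem.const (1 : Matrix (Fin k) (Fin k) ℝ)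
    (one_mul _)).add (Idem.const (1 : Matrix (Fin l) (Fin l) ℝ) (one_mul _))).idem
      (Classical.arbitrary X))
  have h : triv k + triv l = (triv m : IdemClass X) := hm
  have hr := congrArg (rank (Classical.arbitrary X)) h
  rw [map_add, rank_triv, rank_triv, rank_triv] at hr
  rw [h, show m = k + l by exact_mod_cast hr.symm]

theorem mk_add_compl (P : Idem X) : ∃ k, mk P + mk P.compl = triv k := by
  obtain ⟨k, hk⟩ := exists_mk_const (X := X) (1 : Matrix P.J P.J ℝ) (one_mul _)
  exact ⟨k, (mk_eq.2 (mvN_compl P.cont P.idem)).trans hk⟩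

/-- The class attached to a family of involutions. -/
noncomputable def inv {ι : Type} [Fintype ι] [DecidableEq ι] (c : X → Matrix ι ι ℝ)
    (hc : Continuous c) (h : ∀ x, c x * c x = 1) : IdemClass X := mk (Idem.ofInv c hc h)

variable {ι κ : Type} [Fintype ι] [DecidableEq ι] [Fintype κ] [DecidableEq κ]

theorem exists_inv_const {s : Matrix ι ι ℝ} (h : s * s = 1) :
    ∃ k, inv (fun _ : X => s) continuous_const (fun _ => h) = triv k :=
  exists_mk_const (half s) (half_idem h)

theorem inv_dsum {c : X → Matrix ι ι ℝ} {d : X → Matrix κ κ ℝ} (hc hd h h') (hcd h'') :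
    inv (fun x => dsum (c x) (d x)) hcd h'' = inv c hc h + inv d hd h' := by
  refine congrArg mk ?_
  simp only [Idem.ofInv, Idem.add, half_dsum]
  rfl

end IdemClass

section Whitehead

variable {X : Type} [TopologicalSpace X] {ι κ : Type} [Fintype ι] [DecidableEq ι]
  [Fintype κ] [DecidableEq κ]

/-- The rotation of angle `θ` between two copies of the same space. -/
noncomputable def rotBlock (ι : Type) [Fintype ι] [DecidableEq ι] (θ : ℝ) : Matrix (ι ⊕ ι) (ι ⊕ ι) ℝ :=
  Matrix.fromBlocks (Real.cos θ • 1) (-(Real.sin θ • 1)) (Real.sin θ • 1) (Real.cos θ • 1)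

theorem rotBlock_mul_neg (θ : ℝ) : rotBlock ι θ * rotBlock ι (-θ) = 1 := by
  have h := Real.cos_sq_add_sin_sq θ
  rw [rotBlock, rotBlock, Matrix.fromBlocks_multiply, ← dsum_one, dsum, Real.cos_neg, Real.sin_neg]
  simp only [neg_smul, neg_neg, smul_mul_smul_comm, neg_mul, mul_neg, one_mul]
  have h' := congrArg (fun r : ℝ => r • (1 : Matrix ι ι ℝ)) h
  simp only [add_smul, one_smul, sq] at h'
  congr 1
  · rw [← h']; module
  · module
  · refine Eq.trans ?_ h'; module

theorem rotBlock_dsum (A : Matrix ι ι ℝ) (θ : ℝ) :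
    rotBlock ι θ * dsum A A = dsum A A * rotBlock ι θ := by
  simp [rotBlock, dsum, Matrix.fromBlocks_multiply]

theorem continuous_rotBlock : Continuous (rotBlock ι) := by
  unfold rotBlock
  exact (by fun_prop : Continuous fun θ => Real.cos θ • (1 : Matrix ι ι ℝ)).matrix_fromBlocks
    (by fun_prop) (by fun_prop) (by fun_prop)

/-- Being an involution, with a prescribed value where `Y` holds. -/
def BasedInv (Y : X → Prop) (B : X → Matrix ι ι ℝ) (x : X) (M : Matrix ι ι ℝ) : Prop :=
  M * M = 1 ∧ (Y x → M = B x)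

theorem whitehead {C a a' : X → Matrix ι ι ℝ} {D : Matrix ι ι ℝ} {Y : X → Prop} (hC : Continuous C)
    (hCC : ∀ x, C x * C x = 1) (hD : D * D = 1) (ha : Continuous a) (ha' : Continuous a')
    (h1 : ∀ x, a x * a' x = 1) (h2 : ∀ x, a' x * a x = 1) (haD : ∀ x, a x * D = D * a x)
    (hY : ∀ x, Y x → a x = 1 ∨ C x = D) :
    Htpy (BasedInv Y fun x => dsum (C x) D) (fun x => dsum (C x) D)
      fun x => dsum (a x * C x * a' x) D := by
  have hR' : ∀ θ, rotBlock ι (-θ) * rotBlock ι θ = 1 := fun θ => by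
    simpa using rotBlock_mul_neg (ι := ι) (-θ)
  have haD' : ∀ x, a' x * D * a x = D := fun x => by rw [mul_assoc, ← haD, ← mul_assoc, h2, one_mul]
  have hA : ∀ x, dsum (a x) (1 : Matrix ι ι ℝ) * dsum (a' x) 1 = 1 := fun x => by
    rw [dsum_mul, h1, one_mul, dsum_one]
  have hA' : ∀ x, dsum (a' x) (1 : Matrix ι ι ℝ) * dsum (a x) 1 = 1 := fun x => by
    rw [dsum_mul, h2, one_mul, dsum_one]
  have hW : ∀ θ x, (rotBlock ι θ * dsum (a x) 1 * rotBlock ι (-θ) * dsum (a' x) 1) *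
      (dsum (a x) 1 * rotBlock ι θ * dsum (a' x) 1 * rotBlock ι (-θ)) = 1 := fun θ x => by
    simp only [mul_assoc]
    rw [← mul_assoc (dsum (a' x) 1) (dsum (a x) 1), hA', one_mul, ← mul_assoc (rotBlock ι (-θ)), hR',
      one_mul, ← mul_assoc (dsum (a x) 1), hA, one_mul, rotBlock_mul_neg]
  have hM : ∀ x, dsum (C x) D * dsum (C x) D = 1 := fun x => by rw [dsum_mul, hCC, hD, dsum_one]
  have hac : Continuous fun q : ℝ × X => dsum (a q.2) (1 : Matrix ι ι ℝ) :=
    (ha.comp continuous_snd).blockSum continuous_const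
  have hac' : Continuous fun q : ℝ × X => dsum (a' q.2) (1 : Matrix ι ι ℝ) :=
    (ha'.comp continuous_snd).blockSum continuous_const
  have hcc : Continuous fun q : ℝ × X => dsum (C q.2) D :=
    (hC.comp continuous_snd).blockSum continuous_const
  have hr : Continuous fun q : ℝ × X => rotBlock ι (Real.pi / 2 * q.1) :=
    continuous_rotBlock.comp (by fun_prop)
  have hr' : Continuous fun q : ℝ × X => rotBlock ι (-(Real.pi / 2 * q.1)) :=
    continuous_rotBlock.comp (by fun_prop)
  refine ⟨fun q => (dsum (a q.2) 1 * rotBlock ι (Real.pi / 2 * q.1) * dsum (a' q.2) 1 *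
    rotBlock ι (-(Real.pi / 2 * q.1))) * dsum (C q.2) D * (rotBlock ι (Real.pi / 2 * q.1) *
    dsum (a q.2) 1 * rotBlock ι (-(Real.pi / 2 * q.1)) * dsum (a' q.2) 1), by fun_prop,
    fun x => ?_, fun x => ?_, fun t _ x => ⟨?_, fun hx => ?_⟩⟩
  · have h0 : rotBlock ι 0 = 1 := by simp [rotBlock, ← Matrix.fromBlocks_one]
    simp only [mul_zero, neg_zero, h0, mul_one, one_mul, hA]
  · simp only [mul_one]
    simp [rotBlock, dsum, Matrix.fromBlocks_multiply, haD']
  · dsimp only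
    generalize Real.pi / 2 * t = θ
    have hw := hW θ x
    generalize dsum (a x) 1 * rotBlock ι θ * dsum (a' x) 1 * rotBlock ι (-θ) = W at *
    generalize rotBlock ι θ * dsum (a x) 1 * rotBlock ι (-θ) * dsum (a' x) 1 = W' at *
    calc W * dsum (C x) D * W' * (W * dsum (C x) D * W')
        = W * dsum (C x) D * (W' * W) * dsum (C x) D * W' := by noncomm_ring
      _ = W * (dsum (C x) D * dsum (C x) D) * W' := by rw [hw]; noncomm_ring
      _ = 1 := by rw [hM, mul_one, mul_eq_one_comm, hw]
  · dsimp only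
    generalize Real.pi / 2 * t = θ
    have hw := hW θ x
    rcases hY x hx with h | h
    · have h' : a' x = 1 := by simpa [h] using h1 x
      simp only [h, h', dsum_one, one_mul, mul_one, rotBlock_mul_neg]
    · rw [h]
      have e1 : dsum (a' x) 1 * dsum D D = dsum D D * dsum (a' x) 1 := by
        have : a' x * D = D * a' x := by
          rw [← mul_one (a' x * D), ← h1 x, ← mul_assoc, haD']
        rw [dsum_mul, dsum_mul, this, one_mul, mul_one]
      have e2 : dsum (a x) 1 * dsum D D = dsum D D * dsum (a x) 1 := by
        rw [dsum_mul, dsum_mul, haD, one_mul, mul_one]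
      have hc : Commute (dsum (a x) 1 * rotBlock ι θ * dsum (a' x) 1 * rotBlock ι (-θ)) (dsum D D) :=
        (((show Commute _ _ from e2).mul_left (rotBlock_dsum D θ)).mul_left e1).mul_left
          (rotBlock_dsum D (-θ))
      rw [hc.eq, mul_assoc, mul_eq_one_comm.1 hw, mul_one]

theorem isUnit_half_add_transpose {M : Matrix ι ι ℝ} (h : M * M = 1) :
    IsUnit ((1 / 2 : ℝ) • (M + Mᵀ)) := by
  have := isUnit_symmetrize h (t := 1 / 2) (by norm_num) 1 (by norm_num)
  rw [one_smul, add_sub_cancel, ← sq, isUnit_pow_iff two_ne_zero] at this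
  convert this using 1
  module

/-- Conjugate families of symmetric involutions are stably homotopic relative to a point. -/
theorem htpy_of_conj {C₁ C₂ g g' : X → Matrix ι ι ℝ} {D : Matrix ι ι ℝ} {x₀ : X}
    (hC₁ : Continuous C₁) (hs₁ : ∀ x, (C₁ x)ᵀ = C₁ x) (hs₂ : ∀ x, (C₂ x)ᵀ = C₂ x)
    (hi₁ : ∀ x, C₁ x * C₁ x = 1) (h0₁ : C₁ x₀ = D) (h0₂ : C₂ x₀ = D) (hg : Continuous g)
    (hg' : Continuous g') (h1 : ∀ x, g x * g' x = 1) (h2 : ∀ x, g' x * g x = 1)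
    (h : ∀ x, g x * C₁ x = C₂ x * g x) :
    Htpy (fun x M => SymU x M ∧ (x = x₀ → M = dsum (dsum D D) (1 : Matrix (ι ⊕ ι) (ι ⊕ ι) ℝ)))
      (fun x => dsum (dsum (C₁ x) D) 1) fun x => dsum (dsum (C₂ x) D) 1 := by
  have hD : D * D = 1 := by rw [← h0₁, hi₁]
  have hDs : Dᵀ = D := by rw [← h0₁, hs₁]
  have hk : g x₀ * D = D * g x₀ := by rw [← h0₁, h, h0₁, h0₂]
  have hkD : g x₀ * D * g' x₀ = D := by rw [hk, mul_assoc, h1, mul_one]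
  have hone : (1 : Matrix (ι ⊕ ι) (ι ⊕ ι) ℝ) * 1 = 1 := one_mul 1
  have W1 := whitehead (Y := fun x => x = x₀) hC₁ hi₁ hD (a := fun _ => g x₀) (a' := fun _ => g' x₀)
    continuous_const continuous_const (fun _ => h1 _) (fun _ => h2 _) (fun _ => hk)
    fun x hx => Or.inr (hx ▸ h0₁)
  have hm : Continuous fun x => dsum (g x₀ * C₁ x * g' x₀) D := by
    refine Continuous.blockSum ?_ continuous_const
    fun_prop
  have W2 := whitehead (Y := fun x => x = x₀) hm (fun x => by
      rw [dsum_mul, hD, ← dsum_one]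
      congr 1
      calc _ = g x₀ * C₁ x * (g' x₀ * g x₀) * C₁ x * g' x₀ := by noncomm_ring
        _ = 1 := by rw [h2, mul_one, mul_assoc (g x₀), hi₁, mul_one, h1]) hone
    (a := fun x => dsum (g x * g' x₀) 1) (a' := fun x => dsum (g x₀ * g' x) 1)
    ((hg.mul continuous_const).blockSum continuous_const)
    ((continuous_const.mul hg').blockSum continuous_const)
    (fun x => by
      rw [dsum_mul, mul_assoc, ← mul_assoc (g' x₀), h2, one_mul, h1, one_mul, dsum_one])
    (fun x => by
      rw [dsum_mul, mul_assoc, ← mul_assoc (g' x), h2, one_mul, h1, one_mul, dsum_one])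
    (fun x => by rw [mul_one, one_mul]) fun x hx => Or.inl (by rw [hx, h1, dsum_one])
  have e : ∀ x, dsum (g x * g' x₀) 1 * dsum (g x₀ * C₁ x * g' x₀) D * dsum (g x₀ * g' x) 1 =
      dsum (C₂ x) D := fun x => by
    rw [dsum_mul, dsum_mul, one_mul, mul_one]
    congr 1
    calc _ = g x * (g' x₀ * g x₀) * C₁ x * (g' x₀ * g x₀) * g' x := by noncomm_ring
      _ = _ := by rw [h2, mul_one, mul_one, h, mul_assoc, h1, mul_one]
  simp only [e] at W2
  have W1' := W1.map (w := id) continuous_id (Φ := fun q => dsum q.2 (1 : Matrix (ι ⊕ ι) (ι ⊕ ι) ℝ))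
    (continuous_snd.blockSum continuous_const)
    (P' := BasedInv (fun x => x = x₀) fun _ => dsum (dsum D D) 1) fun x M hM =>
      ⟨by rw [dsum_mul, hM.1, one_mul, dsum_one], fun hx => by
        have hx' : x = x₀ := hx
        simp only [hM.2 hx, id, hx', h0₁]⟩
  have W := W1'.trans (W2.mono fun x M hM => ⟨hM.1, fun hx => by
    have hx' : x = x₀ := hx
    simp only [hM.2 hx, hx', h0₁, hkD]⟩)
  have hsym : ∀ {A : Matrix ι ι ℝ}, Aᵀ = A → (1 / 2 : ℝ) • (dsum (dsum A D) (1 : Matrix (ι ⊕ ι) _ ℝ) +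
      (dsum (dsum A D) (1 : Matrix (ι ⊕ ι) _ ℝ))ᵀ) = dsum (dsum A D) 1 := fun hA => by
    rw [dsum_transpose, dsum_transpose, hA, hDs, Matrix.transpose_one]
    module
  have := W.map (w := id) continuous_id (Φ := fun q => (1 / 2 : ℝ) • (q.2 + q.2ᵀ)) (by fun_prop)
    (P' := fun x M => SymU x M ∧ (x = x₀ → M = dsum (dsum D D) 1)) fun x M hM =>
      ⟨⟨by simp [add_comm], isUnit_half_add_transpose hM.1⟩, fun hx => by rw [hM.2 hx, hsym hDs]⟩
  simpa only [id, hsym (hs₁ _), hsym (hs₂ _)] using this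

end Whitehead

section BottUnique

variable {n : ℕ} {ι κ : Type} [Fintype ι] [DecidableEq ι]
  [Fintype κ] [DecidableEq κ] {e : ℕ → Matrix ι ι ℝ} {e' : ℕ → Matrix κ κ ℝ}

theorem Htpy.hemiGood_blockSum {f g : ↥(Sph n) → Matrix ι ι ℝ} {f' g' : ↥(Sph n) → Matrix κ κ ℝ}
    (H : Htpy (HemiGood e) f g) (H' : Htpy (HemiGood e') f' g') :
    Htpy (HemiGood fun i => dsum (e i) (e' i)) (fun x => dsum (f x) (f' x))
      fun x => dsum (g x) (g' x) := by
  obtain ⟨H, hc, h0, h1, hH⟩ := H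
  obtain ⟨H', hc', h0', h1', hH'⟩ := H'
  refine ⟨fun q => dsum (H q) (H' q), hc.blockSum hc', fun x => by simp only [h0, h0'],
    fun x => by simp only [h1, h1'], fun t ht x => ⟨⟨?_, isUnit_dsum (hH t ht x).1.2 (hH' t ht x).1.2⟩,
    fun hx => ?_⟩⟩
  · rw [dsum_transpose, (hH t ht x).1.1, (hH' t ht x).1.1]
  · dsimp only
    rw [bottMap_dsum, (hH t ht x).2 hx, (hH' t ht x).2 hx]

theorem htpy_graft_bottMap_dsum (he : IsCliff (n + 1) e) (he' : IsCliff (n + 1) e')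
    {ε : Matrix ι ι ℝ} (h : Adm n e ε) :
    Htpy (HemiGood fun i => dsum (e i) (e' i))
      (graft n (fun i => dsum (e i) (e' i)) fun v => dsum (bottMap n e ε v) (e' n))
      (bottMap n (fun i => dsum (e i) (e' i)) (dsum ε (e' n))) := by
  rw [funext fun v => graft_dsum (c := bottMap n e ε) (c' := fun _ => e' n) (e := e) (e' := e') v,
    funext fun v => bottMap_dsum (e := e) (e' := e') (ε := ε) (ε' := e' n) v]
  exact (htpy_graft_bottMap he h).hemiGood_blockSum (htpy_graft_const he')

/-- Homotopic Bott maps have equal invariants, if the homotopy is standard on the lower hemisphere. -/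
theorem BottInv.eq_of_hemiGood {A : Type} [AddCommGroup A]
    {ν : ∀ {ι : Type} [Fintype ι] [DecidableEq ι], (ℕ → Matrix ι ι ℝ) → Matrix ι ι ℝ → A}
    (B : BottInv n A ν) (he : IsCliff (n + 1) e) {ε₁ ε₂ : Matrix ι ι ℝ} (h1 : Adm n e ε₁)
    (h2 : Adm n e ε₂) (L : Htpy (HemiGood e) (bottMap n e ε₁) (bottMap n e ε₂)) :
    ν e ε₁ = ν e ε₂ := by
  obtain ⟨L, Lc, L0, L1, LH⟩ := L
  have hL : ∀ z : Cube (Set.Icc (0 : ℝ) 1) n, HemiGood e (sphPt z) (L ((cubeFst n z).1, sphPt z)) :=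
    fun z => LH _ (cubeFst n z).2 _
  obtain ⟨κ, _, _, e', he', ε, hε, hεi, hεY, -⟩ := bott_iterate (X := Set.Icc (0 : ℝ) 1)
    (Y := {x | x.1 = 0 ∨ x.1 = 1}) n (zero_add n) he
    (F := fun z => L ((cubeFst n z).1, sphPt z))
    (Lc.comp ((continuous_subtype_val.comp (continuous_cubeFst n)).prodMk continuous_sphPt))
    (fun z => ⟨(hL z).1.1, fun i hi => absurd hi (Nat.not_lt_zero i)⟩) (fun z => (hL z).1.2)
    (η := fun x => (1 - x.1) • ε₁ + x.1 • ε₂) (fun x hx => by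
      rcases hx with hx | hx
      · simp only [hx, sub_zero, one_smul, zero_smul, add_zero]; exact ⟨h1.sa, h1.sq⟩
      · simp only [hx, sub_self, one_smul, zero_smul, zero_add]; exact ⟨h2.sa, h2.sq⟩)
    (fun z hz => by
      rw [← bottMap_sphPt (ε := fun x : Set.Icc (0 : ℝ) 1 => (1 - x.1) • ε₁ + x.1 • ε₂) z]
      rcases (mem_cubeBd n z).1 hz with h | h
      · have hc : crd (sphPt z) n ≤ 0 := by rw [crd_sphPt z (by omega), h]
        rw [(hL z).2 hc, bottMap_of_nonpos (ε := _ + _) hc]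
      · rcases h with h | h
        · simp only [h, L0, sub_zero, one_smul, zero_smul, add_zero]
        · simp only [h, L1, sub_self, one_smul, zero_smul, zero_add])
  have hA : ∀ t, Adm n (fun i => dsum (e i) (e' i)) (ε (Set.projIcc 0 1 zero_le_one t)) := fun t =>
    ⟨he.blockSum he', (hεi _ trivial).1, (hεi _ trivial).2⟩
  have h := B.path (H := fun t => ε (Set.projIcc 0 1 zero_le_one t)) (hε.comp continuous_projIcc)
    hA 0 1
  rw [Set.projIcc_left, Set.projIcc_right, hεY _ (Or.inl rfl), hεY _ (Or.inr rfl)] at h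
  simp only [sub_zero, one_smul, zero_smul, add_zero, sub_self, zero_add] at h
  rw [B.sum h1 (Adm.refl he'), B.sum h2 (Adm.refl he'), B.refl he', add_zero, add_zero] at h
  exact h

theorem BottInv.eq_of_htpy {A : Type} [AddCommGroup A]
    {ν : ∀ {ι : Type} [Fintype ι] [DecidableEq ι], (ℕ → Matrix ι ι ℝ) → Matrix ι ι ℝ → A}
    (B : BottInv n A ν) (he : IsCliff (n + 1) e) (he' : IsCliff (n + 1) e') {ε₁ ε₂ : Matrix ι ι ℝ}
    (h1 : Adm n e ε₁) (h2 : Adm n e ε₂)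
    (H : Htpy (fun v M => SymU v M ∧ (v = south n → M = dsum (e n) (e' n)))
      (fun v => dsum (bottMap n e ε₁ v) (e' n)) fun v => dsum (bottMap n e ε₂ v) (e' n)) :
    ν e ε₁ = ν e ε₂ := by
  have hE := he.blockSum he'
  have G : Htpy (HemiGood fun i => dsum (e i) (e' i))
      (graft n (fun i => dsum (e i) (e' i)) fun v => dsum (bottMap n e ε₁ v) (e' n))
      (graft n (fun i => dsum (e i) (e' i)) fun v => dsum (bottMap n e ε₂ v) (e' n)) := by
    obtain ⟨H, hc, h0, h1, hH⟩ := H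
    refine ⟨fun q => graft n (fun i => dsum (e i) (e' i)) (fun v => H (q.1, v)) q.2,
      continuous_graft (H := fun t v => H (t, v)) hc, fun x => by simp only [h0],
      fun x => by simp only [h1], fun t ht x =>
        graft_hemiGood hE (fun v => (hH t ht v).1) ((hH t ht _).2 rfl) x⟩
  have h := B.eq_of_hemiGood hE (h1.blockSum (Adm.refl he')) (h2.blockSum (Adm.refl he'))
    (((htpy_graft_bottMap_dsum he he' h1).symm.trans G).trans (htpy_graft_bottMap_dsum he he' h2))
  rwa [B.sum h1 (Adm.refl he'), B.sum h2 (Adm.refl he'), B.refl he', add_zero, add_zero] at h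

end BottUnique

section Based

variable {X ι κ μ : Type} [TopologicalSpace X] [Fintype ι] [DecidableEq ι] [Fintype κ] [DecidableEq κ]
  [Fintype μ] [DecidableEq μ]

/-- Symmetric and invertible, with prescribed value `B` at the point `x₀`. -/
def BasedSym (x₀ : X) (B : Matrix ι ι ℝ) (x : X) (M : Matrix ι ι ℝ) : Prop :=
  SymU x M ∧ (x = x₀ → M = B)

variable {f g : X → Matrix ι ι ℝ} {P : Matrix ι ι ℝ} {A : Matrix κ κ ℝ} {B : Matrix μ μ ℝ} {x₀ : X}

theorem Htpy.based_assoc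
    (H : Htpy (BasedSym x₀ (dsum (dsum P A) B)) (fun v => dsum (dsum (f v) A) B)
      fun v => dsum (dsum (g v) A) B) :
    Htpy (BasedSym x₀ (dsum P (dsum A B))) (fun v => dsum (f v) (dsum A B))
      fun v => dsum (g v) (dsum A B) := by
  have := H.map (w := id) continuous_id (Φ := fun q => _root_.reidx (Equiv.sumAssoc ι κ μ) q.2)
    ((continuous_reidx _).comp continuous_snd) (P' := BasedSym x₀ (dsum P (dsum A B)))
    fun x M hM => ⟨⟨by rw [reidx_transpose, hM.1.1], hM.1.2.reidx _⟩, fun hx => by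
      rw [hM.2 hx, reidx_dsum_assoc]⟩
  simpa only [id, reidx_dsum_assoc] using this

theorem Htpy.based_dsum (H : Htpy (BasedSym x₀ P) f g) (hs : Bᵀ = B) (hB : B * B = 1) :
    Htpy (BasedSym x₀ (dsum P B)) (fun v => dsum (f v) B) fun v => dsum (g v) B :=
  H.map (w := id) continuous_id (Φ := fun q => dsum q.2 B)
    (continuous_snd.blockSum continuous_const)
    fun x M hM => ⟨⟨by rw [dsum_transpose, hM.1.1, hs],
      isUnit_dsum hM.1.2 (isUnit_of_mul_self_eq_one hB)⟩, fun hx => by rw [hM.2 hx]⟩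

theorem Htpy.exists_based {μ₁ μ₂ μ₃ : Type} [Fintype μ₁] [DecidableEq μ₁] [Fintype μ₂] [DecidableEq μ₂]
    [Fintype μ₃] [DecidableEq μ₃] {C : Matrix μ₁ μ₁ ℝ} {D : Matrix μ₂ μ₂ ℝ} {E : Matrix μ₃ μ₃ ℝ}
    (H : Htpy (BasedSym x₀ (dsum (dsum (dsum (dsum P B) C) D) E))
      (fun x => dsum (dsum (dsum (dsum (f x) B) C) D) E)
      fun x => dsum (dsum (dsum (dsum (g x) B) C) D) E)
    (hB : Bᵀ = B ∧ B * B = 1) (hC : Cᵀ = C ∧ C * C = 1) (hD : Dᵀ = D ∧ D * D = 1)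
    (hE : Eᵀ = E ∧ E * E = 1) :
    ∃ (κ : Type) (_ : Fintype κ) (_ : DecidableEq κ) (s : Matrix κ κ ℝ), sᵀ = s ∧ s * s = 1 ∧
      Htpy (BasedSym x₀ (dsum P s)) (fun x => dsum (f x) s) fun x => dsum (g x) s := by
  refine ⟨_, inferInstance, inferInstance, _, ?_, ?_, H.based_assoc.based_assoc.based_assoc⟩
  · simp only [dsum_transpose, hB, hC, hD, hE]
  · simp only [dsum_mul, hB, hC, hD, hE, dsum_one]

theorem half_one : half (1 : Matrix ι ι ℝ) = 1 := by
  rw [half]; module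

theorem reflection_half_dsum (M : Matrix ι ι ℝ) :
    (2 : ℝ) • dsum (half M) (0 : Matrix κ κ ℝ) - 1 = dsum M (-1) := by
  rw [← dsum_one, dsum_smul, dsum_sub, half]
  congr 1 <;> module

/-- Two families of symmetric involutions with the same value at a point and the same stable class
are stably homotopic relative to this point. -/
theorem exists_based_htpy (hf : Continuous f) (hg : Continuous g) (hfs : ∀ x, (f x)ᵀ = f x)
    (hgs : ∀ x, (g x)ᵀ = g x) (hff : ∀ x, f x * f x = 1) (hgg : ∀ x, g x * g x = 1)
    (hf₀ : f x₀ = P) (hg₀ : g x₀ = P) {a b : ℕ}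
    (h : IdemClass.inv f hf hff + IdemClass.triv a = IdemClass.inv g hg hgg + IdemClass.triv b) :
    ∃ (κ : Type) (_ : Fintype κ) (_ : DecidableEq κ) (s : Matrix κ κ ℝ), sᵀ = s ∧ s * s = 1 ∧
      Htpy (BasedSym x₀ (dsum P s)) (fun x => dsum (f x) s) fun x => dsum (g x) s := by
  have hab : a = b := by
    have := congrArg (IdemClass.rank x₀) h
    rw [map_add, map_add, IdemClass.rank_triv, IdemClass.rank_triv, IdemClass.inv, IdemClass.inv,
      IdemClass.rank_mk, IdemClass.rank_mk] at this
    simp only [Idem.ofInv, hf₀, hg₀] at this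
    exact_mod_cast add_left_cancel this
  subst hab
  have h1' : ∀ {M : Matrix ι ι ℝ}, M * M = 1 → dsum M (1 : Matrix (Fin a) (Fin a) ℝ) * dsum M 1 = 1 :=
    fun hM => by rw [dsum_mul, hM, one_mul, dsum_one]
  have key : ∀ (f : X → Matrix ι ι ℝ) (hf : Continuous f) (hff : ∀ x, f x * f x = 1),
      IdemClass.inv f hf hff + IdemClass.triv a =
        IdemClass.mk (Idem.ofInv (fun x => dsum (f x) (1 : Matrix (Fin a) (Fin a) ℝ))
        (hf.blockSum continuous_const) fun x => h1' (hff x)) :=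
    fun f hf hff => by
      refine congrArg IdemClass.mk ?_
      simp only [Idem.ofInv, Idem.add, Idem.const, half_dsum, half_one]
      rfl
  rw [key, key, IdemClass.mk_eq] at h
  obtain ⟨u, u', hu, hu', h1, h2, hc⟩ := MvN.conj
    (continuous_half (hf.blockSum continuous_const)) (continuous_half (hg.blockSum continuous_const))
    (fun x => half_idem (h1' (hff x))) (fun x => half_idem (h1' (hgg x))) h
  have hc' : ∀ x, u x * dsum (dsum (f x) (1 : Matrix (Fin a) (Fin a) ℝ)) (-1 : Matrix (ι ⊕ Fin a) _ ℝ) =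
      dsum (dsum (g x) (1 : Matrix (Fin a) (Fin a) ℝ)) (-1 : Matrix (ι ⊕ Fin a) _ ℝ) * u x := fun x => by
    rw [← reflection_half_dsum, ← reflection_half_dsum, mul_sub, sub_mul, mul_one, one_mul,
      mul_smul_comm, smul_mul_assoc]
    exact congrArg (fun M => (2 : ℝ) • M - u x) (hc x)
  have hS : ∀ (M : Matrix ι ι ℝ), Mᵀ = M →
      (dsum (dsum M (1 : Matrix (Fin a) (Fin a) ℝ)) (-1 : Matrix (ι ⊕ Fin a) _ ℝ))ᵀ = dsum (dsum M 1) (-1) :=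
    fun M hM => by
      rw [dsum_transpose, dsum_transpose, hM, Matrix.transpose_neg, Matrix.transpose_one,
        Matrix.transpose_one]
  have hI : ∀ (M : Matrix ι ι ℝ), M * M = 1 →
      dsum (dsum M (1 : Matrix (Fin a) (Fin a) ℝ)) (-1 : Matrix (ι ⊕ Fin a) _ ℝ) *
        dsum (dsum M 1) (-1) = 1 := fun M hM => by
    rw [dsum_mul, dsum_mul, hM, neg_mul_neg, one_mul, one_mul, dsum_one, dsum_one]
  have H := htpy_of_conj (D := dsum (dsum P 1) (-1)) (x₀ := x₀)
    ((hf.blockSum continuous_const).blockSum continuous_const) (fun x => hS _ (hfs x))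
    (fun x => hS _ (hgs x)) (fun x => hI _ (hff x)) (by rw [hf₀]) (by rw [hg₀]) hu hu' h1 h2 hc'
  have hPs : Pᵀ = P := by rw [← hf₀, hfs]
  have hPP : P * P = 1 := by rw [← hf₀, hff]
  exact Htpy.exists_based H ⟨Matrix.transpose_one, one_mul _⟩
    ⟨by rw [Matrix.transpose_neg, Matrix.transpose_one], by rw [neg_mul_neg, one_mul]⟩
    ⟨hS _ hPs, hI _ hPP⟩ ⟨Matrix.transpose_one, one_mul _⟩

end Based

section BottClass

variable {n : ℕ} {ι κ : Type} [Fintype ι] [DecidableEq ι]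
  [Fintype κ] [DecidableEq κ] {e : ℕ → Matrix ι ι ℝ} {e' : ℕ → Matrix κ κ ℝ} {ε : Matrix ι ι ℝ}

instance : Nonempty ↥(Sph n) := ⟨south n⟩

/-- The class of the Bott map. -/
noncomputable def bottClass (he : IsCliff (n + 1) e) (h : Adm n e ε) : IdemClass ↥(Sph n) :=
  IdemClass.inv (bottMap n e ε) continuous_bottMap fun v => bottMap_sq he h v

theorem bottClass_dsum (he : IsCliff (n + 1) e) (h : Adm n e ε) (he' : IsCliff (n + 1) e')
    {ε' : Matrix κ κ ℝ} (h' : Adm n e' ε') :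
    bottClass (he.blockSum he') (h.blockSum h') = bottClass he h + bottClass he' h' := by
  unfold bottClass
  rw [← IdemClass.inv_dsum continuous_bottMap continuous_bottMap _ _
    (continuous_bottMap.blockSum continuous_bottMap)
    fun v => by rw [dsum_mul, bottMap_sq he h, bottMap_sq he' h', dsum_one]]
  congr 1
  exact funext bottMap_dsum

theorem bottClass_refl (he : IsCliff (n + 1) e) : ∃ k, bottClass he (Adm.refl he) = IdemClass.triv k := by
  obtain ⟨k, hk⟩ := IdemClass.exists_inv_const (X := ↥(Sph n)) (he.sq n (by omega))
  refine ⟨k, Eq.trans ?_ hk⟩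
  exact IdemClass.mk_eq.2 (mvN_of_htpy (htpy_bottMap_const he) (bottMap_sq he (Adm.refl he))
    fun _ => he.sq n (by omega))

variable {A : Type} [AddCommGroup A]
    {ν : ∀ {ι : Type} [Fintype ι] [DecidableEq ι], (ℕ → Matrix ι ι ℝ) → Matrix ι ι ℝ → A}

theorem BottInv.eq_of_bottClass (B : BottInv n A ν) (he : IsCliff (n + 1) e) {ε₁ ε₂ : Matrix ι ι ℝ}
    (h1 : Adm n e ε₁) (h2 : Adm n e ε₂) {a b : ℕ}
    (h : bottClass he h1 + IdemClass.triv a = bottClass he h2 + IdemClass.triv b) :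
    ν e ε₁ = ν e ε₂ := by
  have hn := he.sa (i := n) (by omega) le_rfl
  have hs : ∀ {ε : Matrix ι ι ℝ}, Adm n e ε → ∀ v, (bottMap n e ε v)ᵀ = bottMap n e ε v := fun h v =>
    (symU_bottMap he h.sa (isUnit_of_mul_self_eq_one h.sq) v v).1
  obtain ⟨κ, _, _, s, hss, hs2, H⟩ := exists_based_htpy continuous_bottMap continuous_bottMap (hs h1) (hs h2)
    (bottMap_sq he h1) (bottMap_sq he h2) (bottMap_south _) (bottMap_south _) h
  obtain ⟨μ, _, _, r, E, hr, hrr, hE, hEn⟩ := exists_cliff_last hss hs2 n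
  have H' := (H.based_dsum hr hrr).based_assoc
  rw [← hEn] at H'
  exact B.eq_of_htpy he hE h1 h2 H'

theorem BottInv.eq_of_bottClass' (B : BottInv n A ν) (he : IsCliff (n + 1) e) (he' : IsCliff (n + 1) e')
    {ε' : Matrix κ κ ℝ} (h : Adm n e ε) (h' : Adm n e' ε') {a b : ℕ}
    (hab : bottClass he h + IdemClass.triv a = bottClass he' h' + IdemClass.triv b) :
    ν e ε = ν e' ε' := by
  obtain ⟨k, hk⟩ := bottClass_refl he
  obtain ⟨l, hl⟩ := bottClass_refl he'
  have := B.eq_of_bottClass (he.blockSum he') (h.blockSum (Adm.refl he'))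
    ((Adm.refl he).blockSum h') (a := a + k) (b := b + l) (by
      rw [bottClass_dsum he h he' (Adm.refl he'), bottClass_dsum he (Adm.refl he) he' h', hk, hl, ← IdemClass.triv_add,
        ← IdemClass.triv_add]
      calc _ = (bottClass he h + IdemClass.triv a) + (IdemClass.triv l + IdemClass.triv k) := by abel
        _ = _ := by rw [hab]; abel)
  rwa [B.sum h (Adm.refl he'), B.sum (Adm.refl he) h', B.refl he, B.refl he', add_zero, zero_add] at this

end BottClass

section IsVal

variable {n : ℕ} {A : Type} [AddCommGroup A]
    {ν : ∀ {ι : Type} [Fintype ι] [DecidableEq ι], (ℕ → Matrix ι ι ℝ) → Matrix ι ι ℝ → A}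

/-- The stable class `x` is represented by a Bott map with invariant `a`. -/
def IsVal (n : ℕ) (ν : ∀ {ι : Type} [Fintype ι] [DecidableEq ι], (ℕ → Matrix ι ι ℝ) → Matrix ι ι ℝ → A)
    (x : IdemClass ↥(Sph n)) (a : A) : Prop :=
  ∃ (ι : Type) (_ : Fintype ι) (_ : DecidableEq ι) (e : ℕ → Matrix ι ι ℝ) (ε : Matrix ι ι ℝ)
    (he : IsCliff (n + 1) e) (h : Adm n e ε) (r s : ℕ),
    x + IdemClass.triv r = bottClass he h + IdemClass.triv s ∧ ν e ε = a

variable {x y : IdemClass ↥(Sph n)} {a b : A}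

theorem IsVal.unique (B : BottInv n A ν) (hx : IsVal n ν x a) (hy : IsVal n ν x b) : a = b := by
  obtain ⟨ι, _, _, e, ε, he, h, r, s, hx, rfl⟩ := hx
  obtain ⟨κ, _, _, e', ε', he', h', r', s', hy, rfl⟩ := hy
  refine B.eq_of_bottClass' he he' h h' (a := s + r') (b := s' + r) ?_
  rw [← IdemClass.triv_add, ← IdemClass.triv_add, ← add_assoc, ← add_assoc, ← hx, ← hy]
  abel

theorem IsVal.add (B : BottInv n A ν) (hx : IsVal n ν x a) (hy : IsVal n ν y b) :
    IsVal n ν (x + y) (a + b) := by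
  obtain ⟨ι, _, _, e, ε, he, h, r, s, hx, rfl⟩ := hx
  obtain ⟨κ, _, _, e', ε', he', h', r', s', hy, rfl⟩ := hy
  refine ⟨_, inferInstance, inferInstance, _, _, he.blockSum he', h.blockSum h', r + r', s + s', ?_,
    B.sum h h'⟩
  rw [bottClass_dsum he h he' h', ← IdemClass.triv_add, ← IdemClass.triv_add, add_add_add_comm, hx, hy,
    add_add_add_comm]

theorem isVal_triv (B : BottInv n A ν) (k : ℕ) : IsVal n ν (IdemClass.triv k) 0 := by
  obtain ⟨ι, _, _, e, -, he⟩ := exists_cliff (n + 1)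
  obtain ⟨l, hl⟩ := bottClass_refl he
  exact ⟨ι, inferInstance, inferInstance, e, e n, he, Adm.refl he, l, k, by
    rw [hl]; exact add_comm _ _, B.refl he⟩

theorem exists_isVal_of (B : BottInv n A ν) (a : A) : ∃ (ι : Type) (_ : Fintype ι) (_ : DecidableEq ι)
    (e : ℕ → Matrix ι ι ℝ) (ε : Matrix ι ι ℝ) (he : IsCliff (n + 1) e) (h : Adm n e ε),
    IsVal n ν (bottClass he h) a := by
  obtain ⟨ι, _, _, e, ε, h, hν⟩ := B.surj a
  exact ⟨ι, inferInstance, inferInstance, e, ε, h.cliff, h, ι, inferInstance, inferInstance, e, ε,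
    h.cliff, h, 0, 0, rfl, hν⟩

theorem IsVal.eq_triv (B : BottInv n A ν) (hx : IsVal n ν x 0) :
    ∃ r s : ℕ, x + IdemClass.triv r = IdemClass.triv s := by
  obtain ⟨ι, _, _, e, ε, he, h, r, s, hx, h0⟩ := hx
  obtain ⟨H, hH, H0, H1, hP⟩ := B.zero h h0
  have hc : Htpy SymU (bottMap n e ε) (bottMap n e (e n)) := by
    refine ⟨fun q => bottMap n e (H q.1) q.2, ?_, fun v => by simp only [H0], fun v => by simp only [H1],
      fun t ht v => symU_bottMap he (hP t ht).1 (hP t ht).2 v v⟩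
    have h1 : Continuous fun q : ℝ × ↥(Sph n) => bottMap n e 0 q.2 := continuous_bottMap.comp continuous_snd
    unfold bottMap at h1 ⊢
    fun_prop
  obtain ⟨k, hk⟩ := bottClass_refl he
  refine ⟨r, k + s, ?_⟩
  rw [hx, ← IdemClass.triv_add, ← hk]
  congr 1
  exact IdemClass.mk_eq.2 (mvN_of_htpy hc (bottMap_sq he h) (bottMap_sq he (Adm.refl he)))

theorem exists_isVal (x : IdemClass ↥(Sph n)) : ∃ a, IsVal n ν x a := by
  induction x using Quotient.inductionOn with | _ P
  obtain ⟨J, p, hp, hpp⟩ := P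
  obtain ⟨c, hc, hcs, hcc, hm⟩ := exists_symm (c := fun v => (2 : ℝ) • p v - 1) (by fun_prop)
    fun v => reflection_sq (hpp v)
  simp only [half_reflection] at hm
  obtain ⟨κ, _, _, r, e, hr, hrr, he, hen⟩ := exists_cliff_last (hcs (south n)) (hcc (south n)) n
  have hdd : ∀ v, dsum (c v) r * dsum (c v) r = 1 := fun v => by rw [dsum_mul, hcc, hrr, dsum_one]
  obtain ⟨μ, _, _, e', he', ε, hε, H⟩ := exists_htpy_bottMap he (c := fun v => dsum (c v) r)
    (hc.blockSum continuous_const) (fun v => ⟨by rw [dsum_transpose, hcs, hr],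
      isUnit_of_mul_self_eq_one (hdd v)⟩) hen.symm
  have hE := he.blockSum he'
  have hn := he'.sq n (by omega)
  obtain ⟨k, hk⟩ := IdemClass.exists_inv_const (X := ↥(Sph n)) hrr
  obtain ⟨l, hl⟩ := IdemClass.exists_inv_const (X := ↥(Sph n)) hn
  refine ⟨_, _, inferInstance, inferInstance, _, ε, hE, hε, k + l, 0, ?_, rfl⟩
  have h1 : bottClass hE hε = IdemClass.inv c hc hcc + IdemClass.triv k + IdemClass.triv l := by
    rw [← hk, ← hl, ← IdemClass.inv_dsum hc continuous_const hcc _ (hc.blockSum continuous_const) hdd,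
      ← IdemClass.inv_dsum _ continuous_const _ _ ((hc.blockSum continuous_const).blockSum continuous_const)
      fun v => by rw [dsum_mul, hdd, hn, dsum_one]]
    exact IdemClass.mk_eq.2 (mvN_of_htpy H (fun v => by rw [dsum_mul, hdd, hn, dsum_one])
      (bottMap_sq hE hε)).symm
  have h2 : (Quotient.mk _ ⟨J, p, hp, hpp⟩ : IdemClass ↥(Sph n)) = IdemClass.inv c hc hcc :=
    IdemClass.mk_eq.2 hm
  rw [h1, h2, add_assoc (IdemClass.inv c hc hcc), IdemClass.triv_add, add_assoc (IdemClass.inv c hc hcc),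
    IdemClass.triv_add]
  rfl

end IsVal

theorem isLinearMap_of_eq {M N : Type} [AddCommGroup M] [Module ℝ M] [AddCommGroup N] [Module ℝ N]
    (L : M →ₗ[ℝ] N) {f : M → N} (h : ∀ t, f t = L t) : IsLinearMap ℝ f :=
  (funext h : f = L) ▸ L.isLinear

namespace VB

/-- The fibre of a vector bundle. -/
abbrev Fib {X : Type} [TopologicalSpace X] (V : VB ℝ X) (x : X) : Type := {t : V.T // V.π t = x}

/-- A presentation of a vector bundle as the image of a family of idempotent matrices. -/
structure Pres {X : Type} [TopologicalSpace X] (V : VB ℝ X) {ι : Type} [Fintype ι]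
    (p : X → Matrix ι ι ℝ) where
  a : ∀ x, V.Fib x →ₗ[ℝ] (ι → ℝ)
  b : ∀ x, (ι → ℝ) →ₗ[ℝ] V.Fib x
  cont_a : Continuous fun t : V.T => a (V.π t) ⟨t, rfl⟩
  cont_b : Continuous fun q : X × (ι → ℝ) => (b q.1 q.2).1
  ba : ∀ x v, b x (a x v) = v
  ab : ∀ x w, a x (b x w) = p x *ᵥ w

namespace Pres

variable {X : Type} [TopologicalSpace X] {V W S : VB ℝ X} {ι κ : Type} [Fintype ι] [Fintype κ]
    {p : X → Matrix ι ι ℝ} {q : X → Matrix κ κ ℝ}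

theorem a_mk (A : Pres V p) {x : X} (v : V.Fib x) : A.a (V.π v.1) ⟨v.1, rfl⟩ = A.a x v := by
  obtain ⟨t, rfl⟩ := v; rfl

theorem continuous_a (A : Pres V p) {Y : Type} [TopologicalSpace Y] {f : Y → X} {v : ∀ y, V.Fib (f y)}
    (hv : Continuous fun y => (v y).1) : Continuous fun y => A.a (f y) (v y) := by
  simpa only [Function.comp_def, a_mk] using A.cont_a.comp hv

theorem continuous_b (A : Pres V p) {Y : Type} [TopologicalSpace Y] {f : Y → X} {w : Y → ι → ℝ}
    (hf : Continuous f) (hw : Continuous w) : Continuous fun y => (A.b (f y) (w y)).1 :=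
  A.cont_b.comp (hf.prodMk hw)

theorem apply_a (A : Pres V p) (x : X) (v : V.Fib x) : p x *ᵥ A.a x v = A.a x v := by
  rw [← A.ab, A.ba]

theorem mvN [DecidableEq ι] [DecidableEq κ] (A : Pres V p) (B : Pres V q) : MvN p q := by
  refine ⟨fun x => LinearMap.toMatrix' (A.a x ∘ₗ B.b x), fun x => LinearMap.toMatrix' (B.a x ∘ₗ A.b x),
    ?_, ?_, fun x => ?_, fun x => ?_⟩
  · exact continuous_matrix fun i j => (continuous_apply i).comp
      (A.continuous_a (B.continuous_b continuous_id continuous_const))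
  · exact continuous_matrix fun i j => (continuous_apply i).comp
      (B.continuous_a (A.continuous_b continuous_id continuous_const))
  · rw [← LinearMap.toMatrix'_comp]
    exact (congrArg LinearMap.toMatrix' (LinearMap.ext fun w => by simp [A.ab, B.ba])).trans
      (LinearMap.toMatrix'_toLin' (p x))
  · rw [← LinearMap.toMatrix'_comp]
    exact (congrArg LinearMap.toMatrix' (LinearMap.ext fun w => by simp [B.ab, A.ba])).trans
      (LinearMap.toMatrix'_toLin' (q x))

/-- Presentations transport along fibrewise linear maps. -/
def congr (A : Pres V p) (F : ∀ x, W.Fib x ≃ₗ[ℝ] V.Fib x)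
    (h : Continuous fun t : W.T => (F (W.π t) ⟨t, rfl⟩).1)
    (h' : Continuous fun t : V.T => ((F (V.π t)).symm ⟨t, rfl⟩).1) : Pres W p where
  a x := A.a x ∘ₗ (F x).toLinearMap
  b x := (F x).symm.toLinearMap ∘ₗ A.b x
  cont_a := A.continuous_a (v := fun t => F (W.π t) ⟨t, rfl⟩) h
  cont_b := by
    refine (h'.comp A.cont_b).congr fun q => ?_
    have : ∀ {x : X} (v : V.Fib x), ((F (V.π v.1)).symm ⟨v.1, rfl⟩).1 = ((F x).symm v).1 := by
      rintro x ⟨t, rfl⟩; rfl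
    exact this _
  ba x v := by simp [A.ba]
  ab x w := by simp [A.ab]

theorem of_iso (A : Pres V p) (h : Iso W V) : Nonempty (Pres W p) := by
  obtain ⟨φ, hπ, hl⟩ := h
  have hs : ∀ t, W.π (φ.symm t) = V.π t := fun t => by rw [← hπ, φ.apply_symm_apply]
  let F : ∀ x, W.Fib x ≃ₗ[ℝ] V.Fib x := fun x =>
    { (hl x).mk' _ with
      invFun := fun v => ⟨φ.symm v.1, (hs _).trans v.2⟩
      left_inv := fun v => Subtype.ext (φ.symm_apply_apply _)
      right_inv := fun v => Subtype.ext (φ.apply_symm_apply _) }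
  exact ⟨A.congr F φ.continuous φ.symm.continuous⟩

theorem iso (A : Pres V p) (B : Pres W q) (h : MvN p q) : Iso V W := by
  obtain ⟨u, v, hu, hv, h1, h2⟩ := h
  have cu : Continuous fun t : W.T => (A.b (W.π t) (u (W.π t) *ᵥ B.a (W.π t) ⟨t, rfl⟩)).1 :=
    A.continuous_b W.contπ ((hu.comp W.contπ).matrix_mulVec B.cont_a)
  have cv : Continuous fun t : V.T => (B.b (V.π t) (v (V.π t) *ᵥ A.a (V.π t) ⟨t, rfl⟩)).1 :=
    B.continuous_b V.contπ ((hv.comp V.contπ).matrix_mulVec A.cont_a)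
  have e1 : ∀ (x : X) (t : V.Fib x), A.b x (u x *ᵥ B.a x (B.b x (v x *ᵥ A.a x t))) = t := fun x t => by
    rw [B.ab, Matrix.mulVec_mulVec, Matrix.mulVec_mulVec, ← h2, ← Matrix.mul_assoc,
      Matrix.mul_assoc (u x * v x), h1, ← Matrix.mulVec_mulVec, A.apply_a, A.apply_a, A.ba]
  have e2 : ∀ (x : X) (t : W.Fib x), B.b x (v x *ᵥ A.a x (A.b x (u x *ᵥ B.a x t))) = t := fun x t => by
    rw [A.ab, Matrix.mulVec_mulVec, Matrix.mulVec_mulVec, ← h1, ← Matrix.mul_assoc,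
      Matrix.mul_assoc (v x * u x), h2, ← Matrix.mulVec_mulVec, B.apply_a, B.apply_a, B.ba]
  have k1 : ∀ {x : X} (t : W.Fib x), (A.b (W.π t.1) (u (W.π t.1) *ᵥ B.a (W.π t.1) ⟨t.1, rfl⟩)).1 =
      (A.b x (u x *ᵥ B.a x t)).1 := by rintro x ⟨t, rfl⟩; rfl
  have k2 : ∀ {x : X} (t : V.Fib x), (B.b (V.π t.1) (v (V.π t.1) *ᵥ A.a (V.π t.1) ⟨t.1, rfl⟩)).1 =
      (B.b x (v x *ᵥ A.a x t)).1 := by rintro x ⟨t, rfl⟩; rfl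
  refine ⟨⟨⟨_, _, fun t => (k1 _).trans (congrArg Subtype.val (e1 _ ⟨t, rfl⟩)),
    fun t => (k2 _).trans (congrArg Subtype.val (e2 _ ⟨t, rfl⟩))⟩, cv, cu⟩,
    fun t => (B.b (V.π t) (v (V.π t) *ᵥ A.a (V.π t) ⟨t, rfl⟩)).2, ?_⟩
  intro x
  exact isLinearMap_of_eq (B.b x ∘ₗ (v x).mulVecLin ∘ₗ A.a x) fun t => Subtype.ext (k2 t)

theorem of_isSum (A : Pres V p) (B : Pres W q) (h : IsSumOf S V W) :
    Nonempty (Pres S fun x => dsum (p x) (q x)) := by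
  obtain ⟨φ, hπ, hl⟩ := h
  let L : ∀ x, S.Fib x →ₗ[ℝ] V.Fib x × W.Fib x := fun x => (hl x).mk' _
  have hs : ∀ t, S.π (φ.symm t) = V.π t.1.1 := fun t => by rw [← hπ, φ.apply_symm_apply]
  let F : ∀ x, S.Fib x ≃ₗ[ℝ] V.Fib x × W.Fib x := fun x =>
    { L x with
      invFun := fun v => ⟨φ.symm ⟨(v.1.1, v.2.1), v.1.2.trans v.2.2.symm⟩, (hs _).trans v.1.2⟩
      left_inv := fun v => Subtype.ext (φ.symm_apply_apply _)
      right_inv := fun v => by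
        refine Prod.ext (Subtype.ext ?_) (Subtype.ext ?_)
        · exact congrArg (fun t => t.1.1) (φ.apply_symm_apply _)
        · exact congrArg (fun t => t.1.2) (φ.apply_symm_apply _) }
  refine ⟨⟨fun x => (LinearEquiv.sumArrowLequivProdArrow ι κ ℝ ℝ).symm.toLinearMap ∘ₗ
      ((A.a x).prodMap (B.a x)) ∘ₗ (F x).toLinearMap,
    fun x => (F x).symm.toLinearMap ∘ₗ ((A.b x).prodMap (B.b x)) ∘ₗ
      (LinearEquiv.sumArrowLequivProdArrow ι κ ℝ ℝ).toLinearMap, ?_, ?_, fun x v => ?_, fun x w => ?_⟩⟩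
  · refine continuous_pi fun i => ?_
    have h1 : Continuous fun t : S.T => ((F (S.π t) ⟨t, rfl⟩).1).1 :=
      (continuous_fst.comp continuous_subtype_val).comp φ.continuous
    have h2 : Continuous fun t : S.T => ((F (S.π t) ⟨t, rfl⟩).2).1 :=
      (continuous_snd.comp continuous_subtype_val).comp φ.continuous
    rcases i with i | i
    · exact (continuous_apply i).comp (A.continuous_a h1)
    · exact (continuous_apply i).comp (B.continuous_a h2)
  · refine φ.symm.continuous.comp (Continuous.subtype_mk (Continuous.prodMk ?_ ?_) _)
    · exact A.continuous_b (w := fun q : X × (ι ⊕ κ → ℝ) => fun i => q.2 (Sum.inl i)) continuous_fst (by fun_prop)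
    · exact B.continuous_b (w := fun q : X × (ι ⊕ κ → ℝ) => fun i => q.2 (Sum.inr i)) continuous_fst (by fun_prop)
  · simp [A.ba, B.ba]
  · ext i
    rcases i with i | i <;> simp [A.ab, B.ab, dsum, Matrix.fromBlocks_mulVec] <;> rfl

end Pres

end VB

namespace VB

namespace Pres

variable {X : Type} [TopologicalSpace X] {V W S : VB ℝ X} {ι κ : Type} [Fintype ι] [Fintype κ]
    {p : X → Matrix ι ι ℝ} {q : X → Matrix κ κ ℝ}

theorem isSum (A : Pres V p) (B : Pres W q) (C : Pres S fun x => dsum (p x) (q x)) : IsSumOf S V W := by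
  let f : ∀ x, S.Fib x →ₗ[ℝ] V.Fib x × W.Fib x := fun x =>
    ((A.b x).prodMap (B.b x)) ∘ₗ (LinearEquiv.sumArrowLequivProdArrow ι κ ℝ ℝ).toLinearMap ∘ₗ C.a x
  let g : ∀ x, V.Fib x → W.Fib x → S.Fib x := fun x v w => C.b x (Sum.elim (A.a x v) (B.a x w))
  have fg : ∀ x v w, f x (g x v w) = (v, w) := fun x v w => by
    have h : C.a x (g x v w) = Sum.elim (A.a x v) (B.a x w) := by
      simp [g, C.ab, dsum, Matrix.fromBlocks_mulVec, A.apply_a, B.apply_a]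
    simp only [f, LinearMap.comp_apply, h]
    exact Prod.ext (A.ba x v) (B.ba x w)
  have gf : ∀ x s, g x (f x s).1 (f x s).2 = s := fun x s => by
    have h : Sum.elim (A.a x (f x s).1) (B.a x (f x s).2) = C.a x s := by
      rw [← C.apply_a]
      have h1 : A.a x (f x s).1 = p x *ᵥ (C.a x s ∘ Sum.inl) := A.ab x _
      have h2 : B.a x (f x s).2 = q x *ᵥ (C.a x s ∘ Sum.inr) := B.ab x _
      simp [h1, h2, dsum, Matrix.fromBlocks_mulVec]
    exact (congrArg (C.b x) h).trans (C.ba x s)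
  have k1 : ∀ {x : X} (s : S.Fib x), (f (S.π s.1) ⟨s.1, rfl⟩).1.1 = (f x s).1.1 ∧
      (f (S.π s.1) ⟨s.1, rfl⟩).2.1 = (f x s).2.1 := by rintro x ⟨t, rfl⟩; exact ⟨rfl, rfl⟩
  have k2 : ∀ {x : X} (v : V.Fib x) (w : W.Fib x) (h : W.π w.1 = V.π v.1),
      (g (V.π v.1) ⟨v.1, rfl⟩ ⟨w.1, h⟩).1 = (g x v w).1 := by rintro x ⟨t, rfl⟩ w h; rfl
  refine ⟨⟨⟨fun s => ⟨((f (S.π s) ⟨s, rfl⟩).1.1, (f (S.π s) ⟨s, rfl⟩).2.1),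
      (f (S.π s) ⟨s, rfl⟩).1.2.trans (f (S.π s) ⟨s, rfl⟩).2.2.symm⟩,
    fun t => (g (V.π t.1.1) ⟨t.1.1, rfl⟩ ⟨t.1.2, t.2.symm⟩).1, fun s => ?_, fun t => ?_⟩, ?_, ?_⟩,
    fun s => (f (S.π s) ⟨s, rfl⟩).1.2, fun x => ?_⟩
  · exact (k2 _ _ _).trans (congrArg Subtype.val (gf (S.π s) ⟨s, rfl⟩))
  · have h := fg (V.π t.1.1) ⟨t.1.1, rfl⟩ ⟨t.1.2, t.2.symm⟩
    refine Subtype.ext (Prod.ext ((k1 _).1.trans ?_) ((k1 _).2.trans ?_)) <;> rw [h]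
  · refine Continuous.subtype_mk (Continuous.prodMk ?_ ?_) _
    · exact A.continuous_b (w := fun s i => C.a (S.π s) ⟨s, rfl⟩ (Sum.inl i)) S.contπ
        (continuous_pi fun i => (continuous_apply _).comp C.cont_a)
    · exact B.continuous_b (w := fun s i => C.a (S.π s) ⟨s, rfl⟩ (Sum.inr i)) S.contπ
        (continuous_pi fun i => (continuous_apply _).comp C.cont_a)
  · refine C.continuous_b (V.contπ.comp (continuous_fst.comp continuous_subtype_val))
      (continuous_pi fun i => ?_)
    rcases i with i | i
    · exact (continuous_apply i).comp (A.continuous_a (continuous_fst.comp continuous_subtype_val))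
    · exact (continuous_apply i).comp (B.continuous_a (continuous_snd.comp continuous_subtype_val))
  · exact isLinearMap_of_eq (f x) fun s => Prod.ext (Subtype.ext (k1 s).1) (Subtype.ext (k1 s).2)

theorem isPullback (A : Pres V p) (x : X) {W : VB ℝ PUnit} (B : Pres W fun _ => p x) :
    IsPullbackAlong (fun _ => x) W V := by
  refine ⟨⟨⟨fun t => ⟨(W.π t, (A.b x (B.a (W.π t) ⟨t, rfl⟩)).1), (A.b x _).2⟩,
    fun t => (B.b t.1.1 (A.a x ⟨t.1.2, t.2⟩)).1, fun t => ?_, fun t => ?_⟩, ?_, ?_⟩, fun _ => rfl,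
    fun y => ?_⟩
  · change (B.b (W.π t) (A.a x (A.b x (B.a (W.π t) ⟨t, rfl⟩)))).1 = t
    rw [A.ab, B.apply_a, B.ba]
  · refine Subtype.ext (Prod.ext rfl ?_)
    dsimp only
    rw [B.a_mk, B.ab, A.apply_a, A.ba]
  · exact Continuous.subtype_mk (W.contπ.prodMk (A.continuous_b continuous_const B.cont_a)) _
  · exact B.continuous_b (continuous_fst.comp continuous_subtype_val)
      (A.continuous_a (continuous_snd.comp continuous_subtype_val))
  · exact isLinearMap_of_eq (A.b x ∘ₗ B.a y) fun t => Subtype.ext (by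
      obtain ⟨t, rfl⟩ := t; rfl)

end Pres

section OfIdem

variable {X : Type} [TopologicalSpace X] {ι : Type} [Fintype ι] [DecidableEq ι] {p : X → Matrix ι ι ℝ}

/-- The fibre of the bundle attached to a family of idempotents. -/
def fibEquiv (p : X → Matrix ι ι ℝ) (x : X) :
    {t : {q : X × (ι → ℝ) // p q.1 *ᵥ q.2 = q.2} // t.1.1 = x} ≃
      LinearMap.ker ((p x - 1).mulVecLin) where
  toFun t := ⟨t.1.1.2, by
    obtain ⟨⟨⟨y, w⟩, h⟩, rfl⟩ := t
    simpa [Matrix.sub_mulVec, sub_eq_zero] using h⟩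
  invFun w := ⟨⟨(x, w.1), by simpa [Matrix.sub_mulVec, sub_eq_zero] using w.2⟩, rfl⟩
  left_inv := by rintro ⟨⟨⟨y, w⟩, h⟩, rfl⟩; rfl
  right_inv _ := rfl

theorem exists_frame (hp : Continuous p) (hpp : ∀ x, p x * p x = p x) (x₀ : X) :
    ∃ (U : Set X) (_ : IsOpen U) (_ : x₀ ∈ U) (m : ℕ) (r : ↥U → Matrix (Fin m) ι ℝ)
      (s : ↥U → Matrix ι (Fin m) ℝ), Continuous r ∧ Continuous s ∧ (∀ x, r x * s x = 1) ∧
      ∀ x, s x * r x = p x := by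
  obtain ⟨m, u, v, -, -, h1, h2⟩ := mvN_const (X := PUnit) (hpp x₀)
  have hg : Continuous fun x => p x * p x₀ + (1 - p x) * (1 - p x₀) := by fun_prop
  generalize hgx : (fun x => p x * p x₀ + (1 - p x) * (1 - p x₀)) = g at hg
  have h0 : g x₀ = 1 := by
    rw [← hgx]; dsimp only
    rw [hpp, sub_mul, mul_sub, mul_sub, hpp]; simp
  have hgp : ∀ x, g x * p x₀ = p x * g x := fun x => by
    rw [← hgx]; dsimp only
    simp only [add_mul, mul_add, sub_mul, mul_sub, mul_assoc, hpp, one_mul, mul_one]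
    simp only [← mul_assoc, hpp]; abel
  have hd : ∀ x : ↥{x | (g x).det ≠ 0}, IsUnit (g x).det := fun x => x.2.isUnit
  refine ⟨{x | (g x).det ≠ 0}, isOpen_ne.preimage hg.matrix_det, by simp [h0], m,
    fun x => v ⟨⟩ * (g x)⁻¹, fun x => g x * u ⟨⟩, ?_, by fun_prop, fun x => ?_, fun x => ?_⟩
  · simp only [Matrix.inv_def, Ring.inverse_eq_inv']
    have hg' : Continuous fun x : ↥{x | (g x).det ≠ 0} => g x := hg.comp continuous_subtype_val
    exact continuous_const.matrix_mul ((hg'.matrix_det.inv₀ fun x => x.2).smul hg'.matrix_adjugate)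
  · rw [Matrix.mul_assoc, Matrix.nonsing_inv_mul_cancel_left _ _ (hd x), h2]
  · rw [← Matrix.mul_assoc, Matrix.mul_assoc (g x), h1, hgp, Matrix.mul_nonsing_inv_cancel_right _ _ (hd x)]

/-- The image bundle of a continuous family of idempotents. -/
def ofIdem (hp : Continuous p) (hpp : ∀ x, p x * p x = p x) : VB ℝ X :=
  letI (x : X) : AddCommGroup {t : {q : X × (ι → ℝ) // p q.1 *ᵥ q.2 = q.2} // t.1.1 = x} :=
    (fibEquiv p x).addCommGroup
  letI (x : X) : Module ℝ {t : {q : X × (ι → ℝ) // p q.1 *ᵥ q.2 = q.2} // t.1.1 = x} :=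
    (fibEquiv p x).module ℝ
  { T := {q : X × (ι → ℝ) // p q.1 *ᵥ q.2 = q.2}
    π := fun t => t.1.1
    contπ := continuous_fst.comp continuous_subtype_val
    locTriv := fun x₀ => by
      obtain ⟨U, hU, hx, m, r, s, hr, hs, h1, h2⟩ := exists_frame hp hpp x₀
      have hc : Continuous fun t : {t : {q : X × (ι → ℝ) // p q.1 *ᵥ q.2 = q.2} // t.1.1 ∈ U} =>
          (⟨t.1.1.1, t.2⟩ : ↥U) := by fun_prop
      refine ⟨U, hU, hx, m, ⟨⟨fun t => (⟨t.1.1.1, t.2⟩, r ⟨t.1.1.1, t.2⟩ *ᵥ t.1.1.2),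
        fun q => ⟨⟨(q.1.1, s q.1 *ᵥ q.2), ?_⟩, q.1.2⟩, fun t => ?_, fun q => ?_⟩, ?_, ?_⟩,
        fun t => rfl, fun y hy => ?_⟩
      · dsimp only
        rw [← h2, Matrix.mulVec_mulVec, Matrix.mul_assoc, h1, Matrix.mul_one]
      · refine Subtype.ext (Subtype.ext (Prod.ext rfl ?_))
        dsimp only
        rw [Matrix.mulVec_mulVec, h2, t.1.2]
      · refine Prod.ext rfl ?_
        dsimp only
        rw [Matrix.mulVec_mulVec, h1, Matrix.one_mulVec]
      · exact hc.prodMk ((hr.comp hc).matrix_mulVec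
          (continuous_snd.comp (continuous_subtype_val.comp continuous_subtype_val)))
      · exact (((continuous_subtype_val.comp continuous_fst).prodMk
          ((hs.comp continuous_fst).matrix_mulVec continuous_snd)).subtype_mk _).subtype_mk _
      · refine isLinearMap_of_eq ((r ⟨y, hy⟩).mulVecLin ∘ₗ (Submodule.subtype _) ∘ₗ
          ((fibEquiv p y).linearEquiv ℝ).toLinearMap) ?_
        rintro ⟨⟨⟨z, w⟩, h⟩, rfl⟩
        rfl }

/-- The linear structure on the fibres of the image bundle. -/
def fibLin (hp : Continuous p) (hpp : ∀ x, p x * p x = p x) (x : X) :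
    (ofIdem hp hpp).Fib x ≃ₗ[ℝ] LinearMap.ker ((p x - 1).mulVecLin) :=
  letI : AddCommGroup {t : {q : X × (ι → ℝ) // p q.1 *ᵥ q.2 = q.2} // t.1.1 = x} :=
    (fibEquiv p x).addCommGroup
  letI : Module ℝ {t : {q : X × (ι → ℝ) // p q.1 *ᵥ q.2 = q.2} // t.1.1 = x} :=
    (fibEquiv p x).module ℝ
  (fibEquiv p x).linearEquiv ℝ

theorem nonempty_pres_ofIdem (hp : Continuous p) (hpp : ∀ x, p x * p x = p x) :
    Nonempty (Pres (ofIdem hp hpp) p) := by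
  refine ⟨⟨fun x => (Submodule.subtype _) ∘ₗ (fibLin hp hpp x).toLinearMap, fun x =>
    (fibLin hp hpp x).symm.toLinearMap ∘ₗ
      (p x).mulVecLin.codRestrict (LinearMap.ker ((p x - 1).mulVecLin)) fun w => ?_, ?_, ?_, ?_, ?_⟩⟩
  · simp [hpp]
  · exact continuous_snd.comp continuous_subtype_val
  · exact (continuous_fst.prodMk ((hp.comp continuous_fst).matrix_mulVec continuous_snd)).subtype_mk _
  · rintro _ ⟨⟨⟨z, w⟩, h⟩, rfl⟩
    exact Subtype.ext (Subtype.ext (Prod.ext rfl h))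
  · intro x w
    rfl

end OfIdem

end VB

theorem continuous_of_eq_zero_off {Y E : Type} [TopologicalSpace Y] [TopologicalSpace E] [Zero E]
    {f : Y → E} {C U : Set Y} (hC : IsClosed C) (hU : IsOpen U) (h : C ⊆ U)
    (hf : Continuous fun y : ↥U => f y) (h0 : ∀ y, y ∉ C → f y = 0) : Continuous f := by
  refine continuous_iff_continuousAt.2 fun y => ?_
  by_cases hy : y ∈ C
  · exact (continuousOn_iff_continuous_domRestrict.2 hf).continuousAt (hU.mem_nhds (h hy))
  · refine (continuousAt_const (y := (0 : E))).congr ?_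
    filter_upwards [hC.isOpen_compl.mem_nhds hy] with z hz using (h0 z hz).symm

namespace VB

variable {X : Type} [TopologicalSpace X] {V : VB ℝ X}

theorem Pres.idem {ι : Type} [Fintype ι] [DecidableEq ι] {p : X → Matrix ι ι ℝ} (A : Pres V p) (x : X) :
    p x * p x = p x :=
  Matrix.toLin'.injective (LinearMap.ext fun w => by
    rw [Matrix.toLin'_mul, LinearMap.comp_apply, Matrix.toLin'_apply, Matrix.toLin'_apply, ← A.ab x w, A.apply_a])

theorem Pres.continuous {ι : Type} [Fintype ι] [DecidableEq ι] {p : X → Matrix ι ι ℝ} (A : Pres V p) :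
    Continuous p := by
  obtain ⟨u, v, hu, hv, h, -⟩ := A.mvN A
  exact (hu.matrix_mul hv).congr h

/-- A trivialization of a vector bundle over a set. -/
structure Chart (V : VB ℝ X) (U : Set X) where
  m : ℕ
  L : ∀ y ∈ U, V.Fib y ≃ₗ[ℝ] (Fin m → ℝ)
  cont : Continuous fun t : {t : V.T // V.π t ∈ U} => L (V.π t) t.2 ⟨t, rfl⟩
  cont_symm : Continuous fun q : ↥U × (Fin m → ℝ) => ((L q.1 q.1.2).symm q.2).1

theorem exists_chart (V : VB ℝ X) (x : X) :
    ∃ U : Set X, IsOpen U ∧ x ∈ U ∧ Nonempty (Chart V U) := by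
  obtain ⟨U, hU, hx, m, φ, hφ, hl⟩ := V.locTriv x
  have hs : ∀ q, V.π (φ.symm q).1 = q.1 := fun q => by rw [← hφ, φ.apply_symm_apply]
  refine ⟨U, hU, hx, ⟨⟨m, fun y hy =>
    { (hl y hy).mk' _ with
      invFun := fun z => ⟨(φ.symm (⟨y, hy⟩, z)).1, hs _⟩
      left_inv := fun v => Subtype.ext ?_
      right_inv := fun z => ?_ }, ?_, ?_⟩⟩⟩
  · obtain ⟨t, rfl⟩ := v
    refine (congrArg (fun s => (φ.symm s).1) (?_ : _ = φ ⟨t, hy⟩)).trans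
      (congrArg Subtype.val (φ.symm_apply_apply _))
    exact Prod.ext (Subtype.ext (hφ ⟨t, hy⟩).symm) rfl
  · exact congrArg Prod.snd (φ.apply_symm_apply _)
  · exact continuous_snd.comp φ.continuous
  · exact continuous_subtype_val.comp φ.symm.continuous

theorem Chart.continuous_L {U : Set X} (c : Chart V U) {Y : Type} [TopologicalSpace Y] {f : Y → X}
    (hf : ∀ y, f y ∈ U) {v : ∀ y, V.Fib (f y)} (hv : Continuous fun y => (v y).1) :
    Continuous fun y => c.L (f y) (hf y) (v y) := by
  have h : ∀ {x : X} (hx : x ∈ U) (v : V.Fib x),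
      c.L (V.π v.1) (v.2.symm ▸ hx) ⟨v.1, rfl⟩ = c.L x hx v := by rintro x hx ⟨t, rfl⟩; rfl
  exact (c.cont.comp (hv.subtype_mk fun y => by rw [(v y).2]; exact hf y)).congr fun y => h (hf y) (v y)

open Classical in
theorem exists_pres_of_charts {I : Type} [Fintype I] {U : I → Set X} (hU : ∀ i, IsOpen (U i))
    (c : ∀ i, Chart V (U i)) {r : I → X → ℝ} (hr : ∀ i, Continuous (r i))
    (hs : ∀ i, tsupport (r i) ⊆ U i) (h1 : ∀ x, ∑ i, r i x * r i x = 1) :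
    ∃ p : X → Matrix ((i : I) × Fin (c i).m) ((i : I) × Fin (c i).m) ℝ, Nonempty (Pres V p) := by
  have h0 : ∀ i x, x ∉ tsupport (r i) → r i x = 0 := fun i x => image_eq_zero_of_notMem_tsupport
  let a : ∀ i x, V.Fib x →ₗ[ℝ] (Fin (c i).m → ℝ) := fun i x =>
    if h : x ∈ U i then r i x • ((c i).L x h).toLinearMap else 0
  let b : ∀ i x, (Fin (c i).m → ℝ) →ₗ[ℝ] V.Fib x := fun i x =>
    if h : x ∈ U i then r i x • ((c i).L x h).symm.toLinearMap else 0
  let A : ∀ x, V.Fib x →ₗ[ℝ] ((i : I) × Fin (c i).m → ℝ) := fun x =>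
    LinearMap.pi fun k => LinearMap.proj k.2 ∘ₗ a k.1 x
  let B : ∀ x, ((i : I) × Fin (c i).m → ℝ) →ₗ[ℝ] V.Fib x := fun x =>
    ∑ i, b i x ∘ₗ LinearMap.funLeft ℝ ℝ fun k => (⟨i, k⟩ : (i : I) × Fin (c i).m)
  have hb : ∀ i x, x ∉ tsupport (r i) → b i x = 0 := fun i x hx => by
    simp only [b, h0 i x hx, zero_smul, dite_eq_ite, ite_self]
  have ha : ∀ i x, x ∉ tsupport (r i) → a i x = 0 := fun i x hx => by
    simp only [a, h0 i x hx, zero_smul, dite_eq_ite, ite_self]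
  have ha' : ∀ i x (h : x ∈ U i) v, a i x v = r i x • (c i).L x h v := fun i x h v => by
    simp only [a, dif_pos h]; rfl
  have hb' : ∀ i x (h : x ∈ U i) v, b i x v = r i x • ((c i).L x h).symm v := fun i x h v => by
    simp only [b, dif_pos h]; rfl
  refine ⟨fun x => LinearMap.toMatrix' (A x ∘ₗ B x), ⟨⟨A, B, ?_, ?_, fun x v => ?_, fun x w => ?_⟩⟩⟩
  · refine continuous_pi fun k => (continuous_apply k.2).comp
      (continuous_of_eq_zero_off ((isClosed_tsupport (r k.1)).preimage V.contπ)
        ((hU k.1).preimage V.contπ) (Set.preimage_mono (hs k.1)) ?_ fun t ht => ?_)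
    · refine (((hr k.1).comp (V.contπ.comp continuous_subtype_val)).smul (c k.1).cont).congr fun t => ?_
      exact (ha' k.1 _ t.2 ⟨t.1, rfl⟩).symm
    · exact congrArg (fun f : V.Fib (V.π t) →ₗ[ℝ] _ => f ⟨t, rfl⟩) (ha k.1 _ ht)
  · refine continuous_iff_continuousAt.2 fun q₀ => ?_
    obtain ⟨j, -, hj⟩ := Finset.exists_ne_zero_of_sum_ne_zero
      (show ∑ i, r i q₀.1 * r i q₀.1 ≠ 0 by rw [h1]; exact one_ne_zero)
    have hj : q₀.1 ∈ U j := by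
      by_contra h
      exact hj (by rw [h0 j _ fun h' => h (hs j h'), zero_mul])
    refine ContinuousOn.continuousAt (s := Prod.fst ⁻¹' U j) (continuousOn_iff_continuous_domRestrict.2 ?_)
      (((hU j).preimage continuous_fst).mem_nhds hj)
    have key : Continuous fun q : ↥(Prod.fst ⁻¹' U j : Set (X × ((i : I) × Fin (c i).m → ℝ))) =>
        (c j).L q.1.1 q.2 (B q.1.1 q.1.2) := by
      simp only [B, LinearMap.sum_apply, map_sum]
      refine continuous_finsetSum _ fun i _ => ?_
      have hf := continuous_fst.comp (continuous_subtype_val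
        (p := fun q : X × ((i : I) × Fin (c i).m → ℝ) => q ∈ Prod.fst ⁻¹' U j))
      refine continuous_of_eq_zero_off ((isClosed_tsupport (r i)).preimage hf) ((hU i).preimage hf)
        (Set.preimage_mono (hs i)) ?_ fun q hq => ?_
      · have hL := (c j).continuous_L (f := fun q : ↥((fun q : ↥(Prod.fst ⁻¹' U j :
            Set (X × ((i : I) × Fin (c i).m → ℝ))) => q.1.1) ⁻¹' U i) => q.1.1.1) (fun q => q.1.2)
          (v := fun q => ((c i).L q.1.1.1 q.2).symm fun k => q.1.1.2 ⟨i, k⟩)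
          ((c i).cont_symm.comp (Continuous.prodMk
            ((hf.comp continuous_subtype_val).subtype_mk fun q => q.2) (by fun_prop)))
        refine (((hr i).comp (hf.comp continuous_subtype_val)).smul hL).congr fun q => ?_
        refine ((map_smul _ _ _).symm).trans (congrArg ((c j).L q.1.1.1 q.1.2) ?_)
        exact (hb' i _ q.2 fun k => q.1.1.2 ⟨i, k⟩).symm
      · rw [hb i q.1.1 hq]; simp
    refine ((c j).cont_symm.comp (Continuous.prodMk ((continuous_fst.comp
      continuous_subtype_val).subtype_mk fun q => q.2) key)).congr fun q => ?_
    exact congrArg Subtype.val (((c j).L q.1.1 q.2).symm_apply_apply _)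
  · have h : ∀ i, b i x (a i x v) = (r i x * r i x) • v := fun i => by
      by_cases h : x ∈ U i
      · rw [ha' i x h, map_smul, hb' i x h, LinearEquiv.symm_apply_apply, mul_smul]
      · simp [b, h, h0 i x fun h' => h (hs i h')]
    simp only [B, LinearMap.sum_apply, LinearMap.comp_apply]
    refine (Finset.sum_congr rfl fun i _ => h i).trans ?_
    rw [← Finset.sum_smul, h1, one_smul]
  · rw [← Matrix.toLin'_apply, Matrix.toLin'_toMatrix']; rfl

theorem exists_pres [CompactSpace X] [T2Space X] (V : VB ℝ X) :
    ∃ P : Idem X, Nonempty (Pres V P.p) := by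
  classical
  choose U hU hx c using exists_chart V
  obtain ⟨t, ht⟩ := CompactSpace.elim_nhds_subcover U fun x => (hU x).mem_nhds (hx x)
  obtain ⟨f, hf⟩ := PartitionOfUnity.exists_isSubordinate (isClosed_univ (X := X))
    (fun i : ↥t => U i) (fun i => hU i) fun x _ => by
      have h : x ∈ ⋃ y ∈ t, U y := ht ▸ Set.mem_univ x
      simpa using h
  have hs : ∀ i, tsupport (fun x => √(f i x)) ⊆ U i := fun i =>
    (closure_mono (Function.support_subset_iff'.2 fun x hx => by
      rw [Function.notMem_support.1 hx, Real.sqrt_zero])).trans (hf i)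
  have h1 : ∀ x, ∑ i, √(f i x) * √(f i x) = 1 := fun x => by
    rw [← f.sum_eq_one (Set.mem_univ x), finsum_eq_sum_of_fintype]
    exact Finset.sum_congr rfl fun i _ => Real.mul_self_sqrt (f.nonneg i x)
  obtain ⟨p, ⟨A⟩⟩ := exists_pres_of_charts (fun i : ↥t => hU i) (fun i => (c i).some)
    (r := fun i x => √(f i x)) (fun i => (f i).continuous.sqrt) hs h1
  exact ⟨⟨_, p, A.continuous, A.idem⟩, ⟨A⟩⟩

end VB

namespace IsKTheory

variable {X : Type} [TopologicalSpace X] {K : Type 1} [AddCommGroup K] {cls : VB ℝ X → K}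

theorem exists_hom (hK : IsKTheory ℝ X K cls) : ∃ k : IdemClass X →+ K,
    ∀ (V : VB ℝ X) (P : Idem X), V.Pres P.p → k (IdemClass.mk P) = cls V := by
  have hP : ∀ P : Idem X, Nonempty ((VB.ofIdem P.cont P.idem).Pres P.p) :=
    fun P => VB.nonempty_pres_ofIdem P.cont P.idem
  let k : IdemClass X → K := Quotient.lift (fun P : Idem X => cls (VB.ofIdem P.cont P.idem))
    fun P Q h => hK.1 _ _ ((hP P).some.iso (hP Q).some h)
  have hk : ∀ x y, k (x + y) = k x + k y := fun x y => by
    induction x using Quotient.inductionOn with | _ P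
    induction y using Quotient.inductionOn with | _ Q
    exact hK.2.1 _ _ _ ((hP P).some.isSum (hP Q).some (hP (P.add Q)).some)
  exact ⟨⟨⟨k, by simpa using hk 0 0⟩, hk⟩, fun V P A => hK.1 _ _ ((hP P).some.iso A
    (IdemClass.mk_eq.1 rfl))⟩

variable [CompactSpace X] [T2Space X]

theorem exists_lift (hK : IsKTheory ℝ X K cls) {k : IdemClass X →+ K}
    (hk : ∀ (V : VB ℝ X) (P : Idem X), V.Pres P.p → k (IdemClass.mk P) = cls V)
    {H : Type 1} [AddCommGroup H] (f : IdemClass X →+ H) : ∃ φ : K →+ H, ∀ y, φ (k y) = f y := by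
  choose P A using VB.exists_pres (X := X)
  have hF : ∀ V (Q : Idem X), V.Pres Q.p → f (IdemClass.mk (P V)) = f (IdemClass.mk Q) := fun V Q B =>
    congrArg f (IdemClass.mk_eq.2 ((A V).some.mvN B))
  obtain ⟨φ, hφ, -⟩ := hK.2.2 H (fun V => f (IdemClass.mk (P V)))
    (fun V W h => hF _ _ ((A W).some.of_iso h).some)
    (fun S V W h => (hF _ ((P V).add (P W)) ((A V).some.of_isSum (A W).some h).some).trans (f.map_add (IdemClass.mk (P V)) (IdemClass.mk (P W))))
  refine ⟨φ, fun y => ?_⟩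
  induction y using Quotient.inductionOn with | _ Q
  obtain ⟨B⟩ := VB.nonempty_pres_ofIdem Q.cont Q.idem
  exact (congrArg φ (hk _ Q B)).trans ((hφ _).trans (hF _ _ B))

theorem exists_sub_triv [Nonempty X] (hK : IsKTheory ℝ X K cls) {k : IdemClass X →+ K}
    (hk : ∀ (V : VB ℝ X) (P : Idem X), V.Pres P.p → k (IdemClass.mk P) = cls V) (x : K) :
    ∃ y b, x = k y - k (IdemClass.triv b) := by
  let N : AddSubgroup K :=
    { carrier := {x | ∃ y b, x = k y - k (IdemClass.triv b)}
      zero_mem' := ⟨IdemClass.triv 0, 0, (sub_self _).symm⟩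
      add_mem' := by
        rintro _ _ ⟨y, b, rfl⟩ ⟨z, c, rfl⟩
        exact ⟨y + z, b + c, by rw [← IdemClass.triv_add, map_add, map_add]; abel⟩
      neg_mem' := by
        rintro _ ⟨y, b, rfl⟩
        induction y using Quotient.inductionOn with | _ P
        obtain ⟨c, hc⟩ := IdemClass.mk_add_compl P
        refine ⟨IdemClass.triv b + IdemClass.mk P.compl, c, ?_⟩
        rw [← hc, map_add, map_add]
        change -(k (IdemClass.mk P) - _) = _
        abel }
  have hN : ∀ V, cls V ∈ N := fun V => by
    obtain ⟨P, ⟨A⟩⟩ := VB.exists_pres V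
    exact ⟨IdemClass.mk P + IdemClass.triv 0, 0, by rw [map_add, hk V P A, add_sub_cancel_right]⟩
  obtain ⟨φ, -, hu⟩ := hK.2.2 (K ⧸ N) (fun _ => 0) (fun _ _ _ => rfl) fun _ _ _ _ => (add_zero 0).symm
  have h : QuotientAddGroup.mk' N = 0 := (hu _ fun V => (QuotientAddGroup.eq_zero_iff _).2 (hN V)).trans
    (hu 0 fun _ => rfl).symm
  exact (QuotientAddGroup.eq_zero_iff x).1 (DFunLike.congr_fun h x)

end IsKTheory

section ReducedGroup

variable {n : ℕ} {A : Type} [AddCommGroup A]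
    {ν : ∀ {ι : Type} [Fintype ι] [DecidableEq ι], (ℕ → Matrix ι ι ℝ) → Matrix ι ι ℝ → A}

theorem BottInv.exists_hom (B : BottInv n A ν) :
    ∃ g : IdemClass ↥(Sph n) →+ A, ∀ x, IsVal n ν x (g x) := by
  choose g hg using exists_isVal (n := n) (ν := ν)
  have h : ∀ x y, g (x + y) = g x + g y := fun x y => (hg _).unique B ((hg x).add B (hg y))
  exact ⟨⟨⟨g, by simpa using h 0 0⟩, h⟩, hg⟩

theorem BottInv.nonempty_ker_equiv (B : BottInv n A ν) (x₀ : ↥(Sph n))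
    {K : Type 1} [AddCommGroup K] {cls : VB ℝ ↥(Sph n) → K} (hK : IsKTheory ℝ ↥(Sph n) K cls)
    {Kpt : Type 1} [AddCommGroup Kpt] {clspt : VB ℝ PUnit → Kpt} (hKpt : IsKTheory ℝ PUnit Kpt clspt)
    (res : K →+ Kpt) (hres : ∀ (V : VB ℝ ↥(Sph n)) (W : VB ℝ PUnit),
      VB.IsPullbackAlong (fun _ : PUnit => x₀) W V → res (cls V) = clspt W) :
    Nonempty (↥res.ker ≃+ A) := by
  obtain ⟨k, hk⟩ := hK.exists_hom
  obtain ⟨kpt, hkpt⟩ := hKpt.exists_hom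
  obtain ⟨g, hg⟩ := B.exists_hom
  have hg0 : ∀ b, g (IdemClass.triv b) = 0 := fun b => (hg _).unique B (isVal_triv B b)
  obtain ⟨φ, hφ⟩ := hK.exists_lift hk (AddEquiv.ulift.{0, 1}.symm.toAddMonoidHom.comp g)
  obtain ⟨ρ, hρ⟩ := hKpt.exists_lift hkpt
    (AddEquiv.ulift.{0, 1}.symm.toAddMonoidHom.comp (IdemClass.rank PUnit.unit))
  have hr : ∀ P : Idem ↥(Sph n), res (k (IdemClass.mk P)) =
      kpt (IdemClass.mk (Idem.const (P.p x₀) (P.idem x₀))) := fun P => by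
    obtain ⟨A⟩ := VB.nonempty_pres_ofIdem P.cont P.idem
    obtain ⟨C⟩ := VB.nonempty_pres_ofIdem (X := PUnit) (p := fun _ => P.p x₀) continuous_const
      fun _ => P.idem x₀
    exact (congrArg res (hk _ P A)).trans ((hres _ _ (A.isPullback x₀ C)).trans
      (hkpt _ (Idem.const (P.p x₀) (P.idem x₀)) C).symm)
  have hrt : ∀ b : ℕ, ρ (res (k (IdemClass.triv b))) = ULift.up (b : ℝ) := fun b =>
    (congrArg ρ (hr _)).trans ((hρ _).trans (congrArg ULift.up (IdemClass.rank_triv _ b)))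
  let F : ↥res.ker →+ A := (AddEquiv.ulift.toAddMonoidHom.comp φ).comp res.ker.subtype
  have hFk : ∀ y, (φ (k y)).down = g y := fun y => congrArg ULift.down (hφ y)
  refine ⟨AddEquiv.ofBijective F ⟨(injective_iff_map_eq_zero F).2 ?_, fun a => ?_⟩⟩
  · rintro ⟨x, hx⟩ h
    obtain ⟨y, b, rfl⟩ := hK.exists_sub_triv hk x
    have h1 : g y = 0 := by
      have h2 : (φ (k y - k (IdemClass.triv b))).down = 0 := h
      rwa [map_sub, ULift.sub_down, hFk, hFk, hg0, sub_zero] at h2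
    obtain ⟨r, s, hrs⟩ := IsVal.eq_triv B (h1 ▸ hg y)
    have h3 : k y - k (IdemClass.triv b) = k (IdemClass.triv s) - k (IdemClass.triv (r + b)) := by
      rw [← hrs, ← IdemClass.triv_add, map_add, map_add]; abel
    refine Subtype.ext (h3.trans ?_)
    have h4 : res (k (IdemClass.triv s) - k (IdemClass.triv (r + b))) = 0 := h3 ▸ hx
    have h5 := congrArg (fun z => (ρ z).down) h4
    simp only [map_sub, ULift.sub_down, hrt, map_zero, ULift.zero_down, sub_eq_zero, Nat.cast_inj] at h5
    rw [h5]
    exact sub_self _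
  · obtain ⟨ι, _, _, e, ε, he, h, hv⟩ := exists_isVal_of B a
    have hP : ∃ P : Idem ↥(Sph n), bottClass he h = IdemClass.mk P := ⟨_, rfl⟩
    obtain ⟨P, hP⟩ := hP
    refine ⟨⟨k (IdemClass.mk P) - k (IdemClass.mk (Idem.const (P.p x₀) (P.idem x₀))), ?_⟩, ?_⟩
    · rw [AddMonoidHom.mem_ker, map_sub, hr, hr]
      exact sub_self _
    · obtain ⟨b, hb⟩ := IdemClass.exists_mk_const (X := ↥(Sph n)) (P.p x₀) (P.idem x₀)
      change (φ (_ - _)).down = a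
      rw [map_sub, ULift.sub_down, hFk, hFk, hb, hg0, sub_zero, ← hP]
      exact (hg _).unique B hv

end ReducedGroup

/-- In reduced real K-theory of spheres (`n ≥ 1`): `K̃O⁰(Sⁿ) ≅ ℤ` for
`n ≡ 0, 4 mod 8`, `K̃O⁰(Sⁿ) ≅ ℤ/2` for `n ≡ 1, 2 mod 8`, and `K̃O⁰(Sⁿ) = 0`
otherwise.  Here `KO⁰` is any model of the Grothendieck group of real vector bundles,
and the reduced group `K̃O⁰(Sⁿ)` is the kernel of the restriction map
`KO⁰(Sⁿ) → KO⁰(pt)` induced by the inclusion of a (base)point `x₀ ∈ Sⁿ`. -/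
theorem stmt_6 (n : ℕ) (hn : 1 ≤ n) (x₀ : ↥(Sph n))
    (K : Type 1) [AddCommGroup K] (cls : VB ℝ ↥(Sph n) → K)
    (hK : IsKTheory ℝ ↥(Sph n) K cls)
    (Kpt : Type 1) [AddCommGroup Kpt] (clspt : VB ℝ PUnit → Kpt)
    (hKpt : IsKTheory ℝ PUnit Kpt clspt)
    (res : K →+ Kpt)
    (hres : ∀ (V : VB ℝ ↥(Sph n)) (W : VB ℝ PUnit),
      VB.IsPullbackAlong (fun _ : PUnit => x₀) W V → res (cls V) = clspt W) :
    ((n % 8 = 0 ∨ n % 8 = 4) → Nonempty (↥res.ker ≃+ ℤ)) ∧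
    ((n % 8 = 1 ∨ n % 8 = 2) → Nonempty (↥res.ker ≃+ ZMod 2)) ∧
    ((n % 8 = 3 ∨ n % 8 = 5 ∨ n % 8 = 6 ∨ n % 8 = 7) → ∀ k ∈ res.ker, k = 0) := by
  refine ⟨fun h => ?_, fun h => ?_, fun h x hx => ?_⟩
  · obtain ⟨d, B⟩ := bottInv_int h
    exact B.nonempty_ker_equiv x₀ hK hKpt res hres
  · obtain ⟨d, B⟩ := bottInv_two h
    exact B.nonempty_ker_equiv x₀ hK hKpt res hres
  · obtain ⟨E⟩ := (bottInv_trivial h).nonempty_ker_equiv x₀ hK hKpt res hres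
    exact congrArg Subtype.val (E.injective (Subsingleton.elim (E ⟨x, hx⟩) (E 0)))
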